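/- Let ω ∈ 𝒲 with associated functions φ and τ, and let g ∈ L²_ω. Assume the Hankel operator H_g extends to a bounded operator from A²_ω to L²_ω. Then for each p ∈ (0,1) the following are equivalent: (1) H_g belongs to the Schatten class S^p of operators from A²_ω to L²_ω; (2) there exists δ ∈ (0, m_τ) such that for every τ-covering {D(δτ(z_j))} of 𝔻 one has ∑_j F_δ(z_j)^p < ∞; (3) there exist δ ∈ (0, m_τ) and a decomposition g = g₁ + g₂ with g₂ ∈ C¹(𝔻) such that for every τ-covering {D(δτ(z_j))} of 𝔻 both ∑_j ( (1/|D(δτ(z_j))|) ∫_{D(δτ(z_j))} |g₁|² dA )^{p/2} < ∞ and the same sum with ∂̄g₂/(Δφ)^{1/2} in place of g₁ is finite. -/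

import Mathlib

open MeasureTheory Filter Set
open scoped ENNReal ComplexOrder

noncomputable section

/-- The open unit disc in `ℂ`. -/
def unitDisc : Set ℂ := Metric.ball (0 : ℂ) 1

/-- Normalized area Lebesgue measure `dA = dx dy / π` on `ℂ`. -/
def dA : Measure ℂ := (ENNReal.ofReal Real.pi)⁻¹ • (volume : Measure ℂ)

/-- The weighted measure `ω dA` on the unit disc. -/
def muW (ω : ℂ → ℝ) : Measure ℂ :=
  (dA.restrict unitDisc).withDensity fun z => ENNReal.ofReal (ω z)

/-- The radial extension to `𝔻` of a function of `r ∈ [0,1)`. -/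
def radialize (τ : ℝ → ℝ) : ℂ → ℝ := fun z => τ ‖z‖

/-- The class `𝓛`, with constants `c₁, c₂`. -/
structure IsClassL (τC : ℂ → ℝ) (c₁ c₂ : ℝ) : Prop where
  c₁_pos : 0 < c₁
  c₂_pos : 0 < c₂
  pos : ∀ z ∈ unitDisc, 0 < τC z
  upper : ∀ z ∈ unitDisc, τC z ≤ c₁ * (1 - ‖z‖)
  lip : ∀ z ∈ unitDisc, ∀ ζ ∈ unitDisc, |τC z - τC ζ| ≤ c₂ * ‖z - ζ‖

/-- `m_τ = min(1, c₁⁻¹, c₂⁻¹)/4`. -/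
def mTau (c₁ c₂ : ℝ) : ℝ := min 1 (min c₁⁻¹ c₂⁻¹) / 4

/-- The Laplacian `Δφ = φ_xx + φ_yy` of a function `φ : ℂ → ℝ`. -/
def laplacian (φ : ℂ → ℝ) (z : ℂ) : ℝ :=
  fderiv ℝ (fun w => fderiv ℝ φ w 1) z 1 +
    fderiv ℝ (fun w => fderiv ℝ φ w Complex.I) z Complex.I

/-- The Wirtinger derivative `∂̄g = (g_x + i g_y)/2` of `g : ℂ → ℂ`. -/
def dbar (g : ℂ → ℂ) (z : ℂ) : ℂ :=
  (fderiv ℝ g z 1 + Complex.I * fderiv ℝ g z Complex.I) / 2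

/-- The class `𝒲` of weights `ω = e^{-2φ}` with associated radial profile `τ`. -/
structure IsClassW (ω φ : ℂ → ℝ) (τ : ℝ → ℝ) : Prop where
  pos : ∀ z ∈ unitDisc, 0 < ω z
  omega_eq : ∀ z ∈ unitDisc, ω z = Real.exp (-(2 * φ z))
  integrable : ∫⁻ z in unitDisc, ENNReal.ofReal (ω z) ∂dA < ⊤
  radial : ∀ z ∈ unitDisc, ∀ ζ ∈ unitDisc, ‖z‖ = ‖ζ‖ → φ z = φ ζ
  smooth : ContDiffOn ℝ 2 φ unitDisc
  lap_pos : ∀ z ∈ unitDisc, 0 < laplacian φ z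
  tau_pos : ∀ r ∈ Set.Ico (0 : ℝ) 1, 0 < τ r
  tau_anti : AntitoneOn τ (Set.Ico 0 1)
  tau_lim : Tendsto τ (nhdsWithin 1 (Set.Iio 1)) (nhds 0)
  tau_diff : ∀ r ∈ Set.Ico (0 : ℝ) 1, DifferentiableAt ℝ τ r
  tau_deriv_lim : Tendsto (deriv τ) (nhdsWithin 1 (Set.Iio 1)) (nhds 0)
  comp : ∃ C : ℝ, 1 ≤ C ∧ ∀ z ∈ unitDisc,
    τ ‖z‖ / C ≤ (laplacian φ z) ^ (-(1 / 2 : ℝ)) ∧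
      (laplacian φ z) ^ (-(1 / 2 : ℝ)) ≤ C * τ ‖z‖
  extra : (∃ C > (0 : ℝ), ∃ r₀ ∈ Set.Ico (0 : ℝ) 1,
      MonotoneOn (fun r => τ r * (1 - r) ^ C) (Set.Ico r₀ 1)) ∨
    Tendsto (fun r => deriv τ r * Real.log (1 / τ r)) (nhdsWithin 1 (Set.Iio 1)) (nhds 0)

/-- A `(δ,τ)`-lattice of the unit disc. -/
structure IsLattice (τC : ℂ → ℝ) (δ : ℝ) (z : ℕ → ℂ) : Prop where
  mem : ∀ j, z j ∈ unitDisc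
  sep : ∀ j k, j ≠ k → z j ∉ Metric.ball (z k) (δ * τC (z k))
  covers : ∀ w ∈ unitDisc, ∃ j, w ∈ Metric.ball (z j) (δ * τC (z j))
  mult : ∃ N : ℕ, ∀ w ∈ unitDisc,
    ({j : ℕ | w ∈ Metric.ball (z j) (3 * (δ * τC (z j)))}).ncard ≤ N

/-- The distance `d_τ(z,ζ) = |z-ζ| / min(τ(z),τ(ζ))`. -/
def dTau (τC : ℂ → ℝ) (z ζ : ℂ) : ℝ := ‖z - ζ‖ / min (τC z) (τC ζ)

/-- `(1/|D(δτ(z))|) ∫_{D(δτ(z))} |u|² dA`, valued in `ℝ≥0∞`. -/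
def localMeanE (τC : ℂ → ℝ) (δ : ℝ) (u : ℂ → ℂ) (z : ℂ) : ℝ≥0∞ :=
  (ENNReal.ofReal ((δ * τC z) ^ 2))⁻¹ *
    ∫⁻ w in Metric.ball z (δ * τC z), ENNReal.ofReal (‖u w‖ ^ 2) ∂dA

/-- `F_δ(z)² = inf over h analytic in D(δτ(z)) of the mean square of g - h`. -/
def FdeltaSqE (τC : ℂ → ℝ) (δ : ℝ) (g : ℂ → ℂ) (z : ℂ) : ℝ≥0∞ :=
  ⨅ (h : ℂ → ℂ) (_ : DifferentiableOn ℂ h (Metric.ball z (δ * τC z))),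
    localMeanE τC δ (fun w => g w - h w) z

/-- The submodule of `L²_ω` of elements with a representative analytic on `𝔻`. -/
def bergmanSubmodule (ω : ℂ → ℝ) : Submodule ℂ (Lp ℂ 2 (muW ω)) where
  carrier := {f | ∃ F : ℂ → ℂ, DifferentiableOn ℂ F unitDisc ∧ (f : ℂ → ℂ) =ᵐ[muW ω] F}
  zero_mem' := ⟨0, differentiableOn_const 0, Lp.coeFn_zero ℂ 2 (muW ω)⟩
  add_mem' := by
    rintro a b ⟨F, hF, ha⟩ ⟨G, hG, hb⟩
    refine ⟨F + G, hF.add hG, ?_⟩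
    filter_upwards [Lp.coeFn_add a b, ha, hb] with w h1 h2 h3
    rw [h1]; simp only [Pi.add_apply, h2, h3]
  smul_mem' := by
    rintro c a ⟨F, hF, ha⟩
    refine ⟨c • F, hF.const_smul c, ?_⟩
    filter_upwards [Lp.coeFn_smul c a, ha] with w h1 h2
    rw [h1]; simp only [Pi.smul_apply, h2]

/-- The Bergman space `A²_ω`, a closed subspace of `L²_ω`. -/
def bergmanH (ω : ℂ → ℝ) : Submodule ℂ (Lp ℂ 2 (muW ω)) :=
  (bergmanSubmodule ω).topologicalClosure

instance (ω : ℂ → ℝ) : CompleteSpace (bergmanH ω) :=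
  IsClosed.completeSpace_coe (hs := Submodule.isClosed_topologicalClosure _)

/-- The orthogonal (Bergman) projection of `L²_ω` onto `A²_ω`, valued in `A²_ω`. -/
def bergmanProjA (ω : ℂ → ℝ) : Lp ℂ 2 (muW ω) →L[ℂ] bergmanH ω :=
  Submodule.orthogonalProjectionOnto (bergmanH ω)

/-- The Bergman projection `P`, viewed as an operator of `L²_ω`. -/
def bergmanProj (ω : ℂ → ℝ) : Lp ℂ 2 (muW ω) →L[ℂ] Lp ℂ 2 (muW ω) :=
  (bergmanH ω).subtypeL.comp (bergmanProjA ω)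

/-- `T` is a bounded extension of the Hankel operator `H_g : f ↦ g f - P(g f)`,
defined on the bounded analytic functions `f ∈ H^∞`. -/
def IsHankelExtension (ω : ℂ → ℝ) (g : ℂ → ℂ)
    (T : bergmanH ω →L[ℂ] Lp ℂ 2 (muW ω)) : Prop :=
  ∀ (f : bergmanH ω) (F : ℂ → ℂ) (M : ℝ),
    DifferentiableOn ℂ F unitDisc →
    (∀ z ∈ unitDisc, ‖F z‖ ≤ M) →
    ((f : Lp ℂ 2 (muW ω)) : ℂ → ℂ) =ᵐ[muW ω] F →
    ∀ gF : Lp ℂ 2 (muW ω), ((gF : ℂ → ℂ) =ᵐ[muW ω] fun z => g z * F z) →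
    T f = gF - bergmanProj ω gF

/-- The `ν`-th singular number `s_ν(T) = inf{‖T - K‖ : rank K ≤ ν}`, `ν = 0, 1, 2, …`. -/
def singularNumber {E F : Type*} [NormedAddCommGroup E] [NormedSpace ℂ E]
    [NormedAddCommGroup F] [NormedSpace ℂ F] (T : E →L[ℂ] F) (ν : ℕ) : ℝ :=
  sInf {c : ℝ | ∃ K : E →L[ℂ] F,
    Module.rank ℂ (LinearMap.range (K : E →ₗ[ℂ] F)) ≤ (ν : Cardinal) ∧ c = ‖T - K‖}

/-- `‖T‖_{S^p}^p = ∑_ν s_ν(T)^p`. -/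
def schattenSum (p : ℝ) {E F : Type*} [NormedAddCommGroup E] [NormedSpace ℂ E]
    [NormedAddCommGroup F] [NormedSpace ℂ F] (T : E →L[ℂ] F) : ℝ :=
  ∑' ν : ℕ, singularNumber T ν ^ p

/-- Membership in the Schatten class `S^p`: `∑_ν s_ν(T)^p < ∞`. -/
def MemSchatten (p : ℝ) {E F : Type*} [NormedAddCommGroup E] [NormedSpace ℂ E]
    [NormedAddCommGroup F] [NormedSpace ℂ F] (T : E →L[ℂ] F) : Prop :=
  Summable fun ν : ℕ => singularNumber T ν ^ p

/-- A bounded operator has finite rank. -/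
def FiniteRank {E F : Type*} [NormedAddCommGroup E] [NormedSpace ℂ E]
    [NormedAddCommGroup F] [NormedSpace ℂ F] (T : E →L[ℂ] F) : Prop :=
  Module.rank ℂ (LinearMap.range (T : E →ₗ[ℂ] F)) < Cardinal.aleph0

/-- The decay estimate `|F(z)| ω(z)^{1/2} ≲ min(1, min(τ(α),τ(z))/|z-α|)^{3n}` on `𝔻`. -/
def TestDecay (τC ω : ℂ → ℝ) (C₀ : ℝ) (n : ℕ) (α : ℂ) (F : ℂ → ℂ) : Prop :=
  (∀ z ∈ unitDisc, ‖F z‖ * Real.sqrt (ω z) ≤ C₀) ∧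
    ∀ z ∈ unitDisc, z ≠ α → ‖F z‖ * Real.sqrt (ω z) ≤
      C₀ * (min (τC α) (τC z) / ‖z - α‖) ^ (3 * n)

/-- Multiplication of an `L²_ω` element by the indicator of a measurable set `D`. -/
def indLp (ω : ℂ → ℝ) (D : Set ℂ) (hD : MeasurableSet D) (f : Lp ℂ 2 (muW ω)) :
    Lp ℂ 2 (muW ω) :=
  MemLp.toLp (D.indicator f) ((Lp.memLp f).indicator hD)

/-- The subspace of `L²_ω` of elements vanishing a.e. off `D` with a representative
analytic on `D`;  its closure realizes `A²_ω(D)` inside `L²_ω`. -/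
def localBergmanSub (ω : ℂ → ℝ) (D : Set ℂ) : Submodule ℂ (Lp ℂ 2 (muW ω)) where
  carrier := {f | ((f : ℂ → ℂ) =ᵐ[(muW ω).restrict Dᶜ] 0) ∧
    ∃ h : ℂ → ℂ, DifferentiableOn ℂ h D ∧ (f : ℂ → ℂ) =ᵐ[(muW ω).restrict D] h}
  zero_mem' := by
    refine ⟨ae_restrict_of_ae (Lp.coeFn_zero ℂ 2 (muW ω)), 0, differentiableOn_const 0,
      ae_restrict_of_ae (Lp.coeFn_zero ℂ 2 (muW ω))⟩
  add_mem' := by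
    rintro a b ⟨ha0, F, hF, ha⟩ ⟨hb0, G, hG, hb⟩
    refine ⟨?_, F + G, hF.add hG, ?_⟩
    · filter_upwards [ae_restrict_of_ae (Lp.coeFn_add a b), ha0, hb0] with w h1 h2 h3
      rw [h1]; simp only [Pi.add_apply, h2, h3, Pi.zero_apply, add_zero]
    · filter_upwards [ae_restrict_of_ae (Lp.coeFn_add a b), ha, hb] with w h1 h2 h3
      rw [h1]; simp only [Pi.add_apply, h2, h3]
  smul_mem' := by
    rintro c a ⟨ha0, F, hF, ha⟩
    refine ⟨?_, c • F, hF.const_smul c, ?_⟩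
    · filter_upwards [ae_restrict_of_ae (Lp.coeFn_smul c a), ha0] with w h1 h2
      rw [h1]; simp only [Pi.smul_apply, h2, Pi.zero_apply, smul_zero]
    · filter_upwards [ae_restrict_of_ae (Lp.coeFn_smul c a), ha] with w h1 h2
      rw [h1]; simp only [Pi.smul_apply, h2]

instance (ω : ℂ → ℝ) (D : Set ℂ) :
    CompleteSpace ((localBergmanSub ω D).topologicalClosure) :=
  IsClosed.completeSpace_coe (hs := Submodule.isClosed_topologicalClosure _)

/-- The local projection `P_{α,δ}` (for `D = D(δτ(α))`), extended by zero off `D`,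
viewed as an operator of `L²_ω`. -/
def localProj (ω : ℂ → ℝ) (D : Set ℂ) : Lp ℂ 2 (muW ω) →L[ℂ] Lp ℂ 2 (muW ω) :=
  ((localBergmanSub ω D).topologicalClosure).subtypeL.comp
    (Submodule.orthogonalProjectionOnto ((localBergmanSub ω D).topologicalClosure))

-- STATEMENT 1 condition (2)
def SchattenCondTwo (τC : ℂ → ℝ) (c₁ c₂ : ℝ) (g : ℂ → ℂ) (p : ℝ) : Prop :=
  ∃ δ ∈ Set.Ioo 0 (mTau c₁ c₂), ∀ z : ℕ → ℂ, IsLattice τC δ z →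
    ∑' j : ℕ, (FdeltaSqE τC δ g (z j)) ^ (p / 2) < ⊤

-- condition (3) of the main theorem
def SchattenCondThree (τC : ℂ → ℝ) (φ : ℂ → ℝ) (c₁ c₂ : ℝ) (g : ℂ → ℂ) (p : ℝ) : Prop :=
  ∃ δ ∈ Set.Ioo 0 (mTau c₁ c₂), ∃ g₁ g₂ : ℂ → ℂ,
    (∀ z ∈ unitDisc, g z = g₁ z + g₂ z) ∧ ContDiffOn ℝ 1 g₂ unitDisc ∧
    ∀ z : ℕ → ℂ, IsLattice τC δ z →
      (∑' j : ℕ, (localMeanE τC δ g₁ (z j)) ^ (p / 2) < ⊤) ∧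
      (∑' j : ℕ, (localMeanE τC δ
        (fun w => dbar g₂ w / (Real.sqrt (laplacian φ w) : ℂ)) (z j)) ^ (p / 2) < ⊤)

noncomputable section

theorem circ_avg {h : ℂ → ℂ} {z w : ℂ} {R : ℝ} (hw : ‖w‖ < R)
    (hh : DifferentiableOn ℂ h (Metric.ball z R)) :
    ∫ θ in (0 : ℝ)..2 * Real.pi, h (z + Complex.exp (θ * Complex.I) * w) = 2 * Real.pi * h z := by
  have hd : DiffContOnCl ℂ (fun ζ => h (z + ζ * w)) (Metric.ball 0 |1|) := by
    apply DifferentiableOn.diffContOnCl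
    rw [abs_one, closure_ball _ one_ne_zero]
    refine hh.comp (by fun_prop) ?_
    intro ζ hζ
    simp only [Metric.mem_closedBall, dist_zero_right] at hζ
    simp only [Metric.mem_ball, dist_eq_norm, add_sub_cancel_left, norm_mul]
    nlinarith [norm_nonneg w]
  have := hd.circleAverage
  simp only [Real.circleAverage, circleMap, zero_mul, add_zero, zero_add, Complex.ofReal_one, one_mul] at this
  have hpi : (2 * Real.pi : ℂ) ≠ 0 := by exact_mod_cast (by positivity : (2 * Real.pi) ≠ 0)
  rw [← this, Complex.real_smul]
  push_cast
  rw [← mul_assoc, mul_inv_cancel₀ hpi, one_mul]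

theorem mv_radial {h : ℂ → ℂ} {z : ℂ} {R ρ : ℝ} (hR : ρ < R)
    (hh : DifferentiableOn ℂ h (Metric.ball z R)) (k : ℂ → ℝ) (hk : Continuous k)
    (hrad : ∀ w u : ℂ, ‖u‖ = 1 → k (u * w) = k w) (hsupp : ∀ w, ρ ≤ ‖w‖ → k w = 0) :
    ∫ w, (k w : ℂ) * h (z + w) = (∫ w, (k w : ℂ)) * h z := by
  have hpi : (2 * Real.pi : ℂ) ≠ 0 := by exact_mod_cast (by positivity : (2 * Real.pi) ≠ 0)
  set F : ℝ → ℂ → ℂ := fun θ w => (k w : ℂ) * h (z + Complex.exp (θ * Complex.I) * w) with hF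
  have hFc : Continuous (Function.uncurry F) := by
    rw [continuous_iff_continuousAt]
    rintro ⟨θ, w⟩
    by_cases hw : ‖w‖ < R
    · have h1 : ContinuousAt h (z + Complex.exp (θ * Complex.I) * w) := by
        apply hh.continuousOn.continuousAt
        apply Metric.isOpen_ball.mem_nhds
        simpa [Metric.mem_ball, dist_eq_norm, Complex.norm_exp_ofReal_mul_I] using hw
      have h2 : ContinuousAt (fun p : ℝ × ℂ => z + Complex.exp (p.1 * Complex.I) * p.2) (θ, w) := by
        fun_prop
      have h3 := ContinuousAt.comp (f := fun p : ℝ × ℂ => z + Complex.exp (p.1 * Complex.I) * p.2)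
        (x := (θ, w)) (g := h) h1 h2
      have h4 : ContinuousAt (fun p : ℝ × ℂ => (k p.2 : ℂ)) (θ, w) := by fun_prop
      exact h4.mul h3
    · have : (Function.uncurry F) =ᶠ[nhds (θ, w)] fun _ => 0 := by
        have ho : IsOpen {p : ℝ × ℂ | ρ < ‖p.2‖} := isOpen_lt continuous_const (by fun_prop)
        filter_upwards [ho.mem_nhds (show (θ, w) ∈ {p : ℝ × ℂ | ρ < ‖p.2‖} from by
          show ρ < ‖w‖; linarith [not_lt.1 hw])] with p hp
        simp [Function.uncurry, hF, hsupp _ (le_of_lt hp)]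
      exact continuousAt_const.congr this.symm
  have hint : Integrable (Function.uncurry F) ((volume.restrict (Ioc 0 (2 * Real.pi))).prod volume) := by
    have h1 : IntegrableOn (Function.uncurry F) (Icc 0 (2 * Real.pi) ×ˢ Metric.closedBall 0 ρ)
        (volume.prod volume) :=
      hFc.continuousOn.integrableOn_compact (isCompact_Icc.prod (isCompact_closedBall _ _))
    have h2 : IntegrableOn (Function.uncurry F) (Ioc 0 (2 * Real.pi) ×ˢ univ)
        (volume.prod volume) := by
      have h3 : IntegrableOn (Function.uncurry F) (Ioc 0 (2 * Real.pi) ×ˢ Metric.closedBall 0 ρ)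
        (volume.prod volume) := h1.mono_set (prod_mono Ioc_subset_Icc_self subset_rfl)
      refine h3.of_forall_sdiff_eq_zero (measurableSet_Ioc.prod MeasurableSet.univ) ?_
      rintro ⟨θ, w⟩ ⟨h5, h6⟩
      simp only [mem_prod, mem_univ, and_true, Metric.mem_closedBall, dist_zero_right, not_and, not_le] at h5 h6
      simp [Function.uncurry, hF, hsupp _ (h6 h5).le]
    rw [IntegrableOn, ← Measure.prod_restrict, Measure.restrict_univ] at h2
    exact h2
  have hsw := integral_integral_swap hint
  have hrot : ∀ θ : ℝ, ∫ w, F θ w = ∫ w, (k w : ℂ) * h (z + w) := by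
    intro θ
    have hu : ‖Complex.exp (θ * Complex.I)‖ = 1 := Complex.norm_exp_ofReal_mul_I θ
    let e := rotation (Circle.exp θ)
    have hmp : MeasurePreserving e volume volume := e.measurePreserving
    have := hmp.integral_comp (e.toHomeomorph.measurableEmbedding) (fun w => (k w : ℂ) * h (z + w))
    rw [← this]
    congr 1
    ext w
    simp only [hF, e, rotation_apply, Circle.coe_exp]
    rw [hrad w _ hu]
  simp only [hrot] at hsw
  have hin : ∀ w, ∫ θ in Ioc 0 (2 * Real.pi), F θ w = (k w : ℂ) * (2 * Real.pi * h z) := by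
    intro w
    by_cases hw : ‖w‖ < R
    · rw [← circ_avg hw hh, intervalIntegral.integral_of_le (by positivity)]
      simp only [hF]
      rw [integral_const_mul]
    · simp [hF, hsupp w (by linarith [not_lt.1 hw])]
  simp only [hin] at hsw
  rw [integral_mul_const, integral_const] at hsw
  simp only [MeasurableSet.univ, measureReal_restrict_apply, univ_inter, Real.volume_real_Ioc, sub_zero] at hsw
  rw [max_eq_left (by positivity), Complex.real_smul] at hsw
  push_cast at hsw
  have : (2 * Real.pi : ℂ) * (∫ w, (k w : ℂ) * h (z + w)) = 2 * Real.pi * ((∫ w, (k w : ℂ)) * h z) := by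
    rw [hsw]; ring
  exact mul_left_cancel₀ hpi this

/-- The radial bump. -/
def eta (w : ℂ) : ℝ := Real.smoothTransition (1 - ‖w‖ ^ 2)

theorem eta_contDiff {n : ℕ∞} : ContDiff ℝ n eta := by
  unfold eta
  exact Real.smoothTransition.contDiff.comp (contDiff_const.sub (contDiff_norm_sq (E := ℂ) ℝ))

theorem eta_nonneg (w : ℂ) : 0 ≤ eta w := Real.smoothTransition.nonneg _
theorem eta_le_one (w : ℂ) : eta w ≤ 1 := Real.smoothTransition.le_one _
theorem eta_rad (w u : ℂ) (hu : ‖u‖ = 1) : eta (u * w) = eta w := by simp [eta, hu]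
theorem eta_zero {w : ℂ} (hw : 1 ≤ ‖w‖) : eta w = 0 := by
  unfold eta
  apply Real.smoothTransition.zero_of_nonpos
  nlinarith
theorem eta_pos {w : ℂ} (hw : ‖w‖ < 1) : 0 < eta w := by
  unfold eta
  apply Real.smoothTransition.pos_of_pos
  nlinarith [norm_nonneg w]
theorem eta_continuous : Continuous eta := (eta_contDiff (n := 0)).continuous
theorem eta_compact : HasCompactSupport eta := by
  refine HasCompactSupport.of_support_subset_isCompact (isCompact_closedBall (0 : ℂ) 1) ?_
  intro w hw
  by_contra h
  simp only [Metric.mem_closedBall, dist_zero_right, not_le] at h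
  exact hw (eta_zero h.le)
theorem eta_integrable : Integrable eta := eta_continuous.integrable_of_hasCompactSupport eta_compact

/-- The total mass of the bump. -/
def etaI : ℝ := ∫ w, eta w

theorem etaI_pos : 0 < etaI := by
  unfold etaI
  rw [integral_pos_iff_support_of_nonneg eta_nonneg eta_integrable]
  have : Metric.ball (0 : ℂ) 1 ⊆ Function.support eta := by
    intro w hw
    exact (eta_pos (by simpa using hw)).ne'
  exact lt_of_lt_of_le (Metric.measure_ball_pos _ _ one_pos) (measure_mono this)

theorem eta_lip : ∃ L : NNReal, LipschitzWith L eta :=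
  ContDiff.lipschitzWith_of_hasCompactSupport eta_compact (eta_contDiff (n := 1)) (by simp)

/-- Scaled bump of radius `ε`, mass one. -/
def etaS (ε : ℝ) (w : ℂ) : ℝ := (etaI * ε ^ 2)⁻¹ * eta ((ε⁻¹ : ℝ) • w)

theorem etaS_continuous (ε : ℝ) : Continuous (etaS ε) := by
  unfold etaS
  exact continuous_const.mul (eta_continuous.comp (by fun_prop))
theorem etaS_rad (ε : ℝ) (w u : ℂ) (hu : ‖u‖ = 1) : etaS ε (u * w) = etaS ε w := by
  unfold etaS
  rw [← eta_rad ((ε⁻¹ : ℝ) • w) u hu, mul_smul_comm]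
theorem etaS_zero {ε : ℝ} (hε : 0 < ε) {w : ℂ} (hw : ε ≤ ‖w‖) : etaS ε w = 0 := by
  unfold etaS
  rw [eta_zero, mul_zero]
  rw [norm_smul, norm_inv, Real.norm_of_nonneg hε.le]
  rw [inv_mul_eq_div, le_div_iff₀ hε]; linarith
theorem etaS_nonneg {ε : ℝ} (w : ℂ) : 0 ≤ etaS ε w := by
  unfold etaS
  have := etaI_pos
  exact mul_nonneg (by positivity) (eta_nonneg _)
theorem etaS_le {ε : ℝ} (w : ℂ) : etaS ε w ≤ (etaI * ε ^ 2)⁻¹ := by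
  unfold etaS
  have := etaI_pos
  exact mul_le_of_le_one_right (by positivity) (eta_le_one _)
theorem etaS_integral {ε : ℝ} (hε : 0 < ε) : ∫ w, etaS ε w = 1 := by
  unfold etaS
  rw [integral_const_mul, Measure.integral_comp_smul]
  have := etaI_pos
  simp only [Complex.finrank_real_complex, inv_pow, inv_inv, smul_eq_mul]
  rw [abs_of_pos (by positivity)]
  change (etaI * ε ^ 2)⁻¹ * (ε ^ 2 * etaI) = 1
  field_simp
theorem etaS_contDiff {n : ℕ∞} (ε : ℝ) : ContDiff ℝ n (etaS ε) := by
  unfold etaS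
  exact contDiff_const.mul (eta_contDiff.comp (by fun_prop))
theorem etaS_compact {ε : ℝ} (hε : 0 < ε) : HasCompactSupport (etaS ε) := by
  refine HasCompactSupport.of_support_subset_isCompact (isCompact_closedBall (0 : ℂ) ε) ?_
  intro w hw
  by_contra h
  simp only [Metric.mem_closedBall, dist_zero_right, not_le] at h
  exact hw (etaS_zero hε h.le)

theorem mv_etaS {h : ℂ → ℂ} {z : ℂ} {R ε : ℝ} (hε : 0 < ε) (hR : ε < R)
    (hh : DifferentiableOn ℂ h (Metric.ball z R)) :
    ∫ w, (etaS ε w : ℂ) * h (z + w) = h z := by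
  rw [mv_radial hR hh _ (etaS_continuous ε) (etaS_rad ε) (fun w hw => etaS_zero hε hw)]
  rw [integral_complex_ofReal, etaS_integral hε]; simp

end

noncomputable section

/-- real kernel convolved with a complex function -/
def cv (κ : ℂ → ℝ) (f : ℂ → ℂ) : ℂ → ℂ :=
  convolution κ f (ContinuousLinearMap.lsmul ℝ ℝ) volume

theorem cv_apply (κ : ℂ → ℝ) (f : ℂ → ℂ) (x : ℂ) : cv κ f x = ∫ t, (κ t : ℂ) * f (x - t) := by
  simp [cv, convolution_def]

theorem cv_apply' (κ : ℂ → ℝ) (f : ℂ → ℂ) (x : ℂ) : cv κ f x = ∫ t, f t * (κ (x - t) : ℂ) := by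
  rw [cv, ← convolution_flip, convolution_def]
  simp [mul_comm]

theorem cv_fderiv {κ : ℂ → ℝ} {f : ℂ → ℂ} (hf : LocallyIntegrable f) (hκ : ContDiff ℝ 1 κ)
    (hc : HasCompactSupport κ) (x : ℂ) : DifferentiableAt ℝ (cv κ f) x ∧
    ∀ v, fderiv ℝ (cv κ f) x v = ∫ t, f t * ((fderiv ℝ κ (x - t) v : ℝ) : ℂ) := by
  have h := hc.hasFDerivAt_convolution_right (ContinuousLinearMap.lsmul ℝ ℝ : ℝ →L[ℝ] ℂ →L[ℝ] ℂ).flip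
    hf hκ x
  have e : convolution f κ (ContinuousLinearMap.lsmul ℝ ℝ : ℝ →L[ℝ] ℂ →L[ℝ] ℂ).flip volume = cv κ f := by
    rw [cv, convolution_flip]
  rw [e] at h
  refine ⟨h.differentiableAt, fun v => ?_⟩
  rw [h.fderiv, convolution_precompR_apply _ hf (hc.fderiv ℝ) (hκ.continuous_fderiv one_ne_zero), convolution_def]
  simp [mul_comm]

theorem cv_hol {κ : ℂ → ℝ} {f : ℂ → ℂ} {z0 : ℂ} {R ε : ℝ} (hf : LocallyIntegrable f)
    (hκ : ContDiff ℝ (⊤ : ℕ∞) κ)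
    (hc : HasCompactSupport κ) (hs : ∀ w, ε ≤ ‖w‖ → κ w = 0)
    (hw : ∀ χ : ℂ → ℂ, ContDiff ℝ (⊤ : ℕ∞) χ → HasCompactSupport χ → tsupport χ ⊆ Metric.ball z0 R →
      ∫ t, f t * dbar χ t = 0) {x : ℂ} (hx : x ∈ Metric.ball z0 (R - ε)) :
    DifferentiableAt ℂ (cv κ f) x := by
  have hκ1 : ContDiff ℝ 1 κ := hκ.of_le (by exact_mod_cast le_top)
  obtain ⟨h1, h2⟩ := cv_fderiv hf hκ1 hc x
  rw [differentiableAt_complex_iff_differentiableAt_real]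
  refine ⟨h1, ?_⟩
  set χ : ℂ → ℂ := fun t => (κ (x - t) : ℂ) with hχ
  have hχs : tsupport χ ⊆ Metric.closedBall x ε := by
    apply closure_minimal _ Metric.isClosed_closedBall
    intro t ht
    by_contra h
    apply ht
    simp only [Metric.mem_closedBall, not_le, dist_eq_norm] at h
    simp [hχ, hs (x - t) (by rw [norm_sub_rev]; exact h.le)]
  have hχb : tsupport χ ⊆ Metric.ball z0 R := by
    refine hχs.trans (Metric.closedBall_subset_ball' ?_)
    have := Metric.mem_ball.1 hx
    linarith
  have hχc : HasCompactSupport χ :=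
    HasCompactSupport.of_support_subset_isCompact (isCompact_closedBall x ε) (subset_closure.trans hχs)
  have hχd : ContDiff ℝ (⊤ : ℕ∞) χ :=
    Complex.ofRealCLM.contDiff.comp (hκ.comp (contDiff_const.sub contDiff_id))
  have h3 := hw χ hχd hχc hχb
  have h4 : ∀ t v, fderiv ℝ χ t v = -((fderiv ℝ κ (x - t) v : ℝ) : ℂ) := by
    intro t v
    have hk : HasFDerivAt κ (fderiv ℝ κ (x - t)) (x - t) :=
      (hκ1.differentiable one_ne_zero _).hasFDerivAt
    have h5 : HasFDerivAt (fun t => κ (x - t)) ((fderiv ℝ κ (x - t)).comp (-ContinuousLinearMap.id ℝ ℂ)) t :=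
      hk.comp t ((hasFDerivAt_id t).const_sub x)
    have h6 := Complex.ofRealCLM.hasFDerivAt.comp t h5
    have h7 : fderiv ℝ χ t = _ := h6.fderiv
    rw [h7]; simp
  have hint : ∀ v, Integrable (fun t => f t * ((fderiv ℝ κ (x - t) v : ℝ) : ℂ)) := by
    intro v
    have : Integrable (fun t => (((fderiv ℝ κ (x - t) v : ℝ) : ℂ)) • f t) := by
      apply LocallyIntegrable.integrable_smul_left_of_hasCompactSupport hf
      · have := hκ1.continuous_fderiv one_ne_zero
        fun_prop
      · have : (fun t => ((fderiv ℝ κ (x - t) v : ℝ) : ℂ)) = fun t => - fderiv ℝ χ t v := by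
          funext t; rw [h4]; simp
        rw [this]
        have := hχc.fderiv_apply (𝕜 := ℝ) v
        exact this.neg
    simpa [mul_comm] using this
  have h5 : ∀ t, f t * dbar χ t = -(1/2 : ℂ) * (f t * ((fderiv ℝ κ (x - t) 1 : ℝ) : ℂ)) -
     (1/2 : ℂ) * Complex.I * (f t * ((fderiv ℝ κ (x - t) Complex.I : ℝ) : ℂ)) := by
    intro t
    rw [dbar, h4, h4]; ring
  simp_rw [h5] at h3
  rw [integral_sub ((hint 1).const_mul _) ((hint Complex.I).const_mul _), integral_const_mul, integral_const_mul,
    ← h2, ← h2] at h3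
  have h6 : fderiv ℝ (cv κ f) x 1 = - Complex.I * fderiv ℝ (cv κ f) x Complex.I := by
    linear_combination (-2 : ℂ) * h3
  rw [h6, smul_eq_mul]
  linear_combination fderiv ℝ (cv κ f) x Complex.I * Complex.I_mul_I

theorem cv_comm {κ θ : ℂ → ℝ} {f : ℂ → ℂ} (hf : Integrable f) (hκ : Continuous κ) (hκc : HasCompactSupport κ)
    (hθ : Continuous θ) (hθc : HasCompactSupport θ) (x : ℂ) : cv κ (cv θ f) x = cv θ (cv κ f) x := by
  rw [cv_apply, cv_apply]
  simp_rw [cv_apply, ← integral_const_mul]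
  rw [integral_integral_swap]
  · congr 1; funext t; congr 1; funext s; rw [sub_right_comm]; ring
  · have hθi : Integrable (fun t => (θ t : ℂ)) :=
      (hθ.integrable_of_hasCompactSupport hθc).ofReal
    have h1 := hθi.convolution_integrand (ContinuousLinearMap.mul ℝ ℂ) (μ := volume) (ν := volume) hf
    have hmp : MeasurePreserving (fun p : ℂ × ℂ => (x - p.1, p.2)) (volume.prod volume) (volume.prod volume) :=
      (Measure.measurePreserving_sub_left volume x).prod (MeasurePreserving.id _)
    have h2 := hmp.integrable_comp_of_integrable h1
    obtain ⟨C, hC⟩ := hκc.exists_bound_of_continuous hκ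
    have h3 := h2.bdd_mul (f := fun p : ℂ × ℂ => (κ p.1 : ℂ)) (c := C) (by fun_prop)
      (Eventually.of_forall fun p => by simpa using hC p.1)
    exact h3

theorem weyl_local {f : ℂ → ℂ} {z0 : ℂ} {ρ : ℝ} (hρ : 0 < ρ) (hf : Integrable f)
    (hw : ∀ χ : ℂ → ℂ, ContDiff ℝ (⊤ : ℕ∞) χ → HasCompactSupport χ → tsupport χ ⊆ Metric.ball z0 (4 * ρ) →
      ∫ t, f t * dbar χ t = 0) :
    ∃ v : ℂ → ℂ, DifferentiableOn ℂ v (Metric.ball z0 (2 * ρ)) ∧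
      ∀ᵐ x, x ∈ Metric.ball z0 (2 * ρ) → f x = v x := by
  have hfl := hf.locallyIntegrable
  have hρ2 : 0 < ρ / 2 := by positivity
  refine ⟨cv (etaS (ρ / 2)) f, ?_, ?_⟩
  · intro x hx
    refine (cv_hol hfl (etaS_contDiff _) (etaS_compact hρ2) (fun w hw => etaS_zero hρ2 hw) hw ?_).differentiableWithinAt
    exact Metric.ball_subset_ball (by linarith) hx
  · let θ : ℕ → ContDiffBump (0 : ℂ) := fun n =>
      { rIn := ρ / 2 / (n + 1), rOut := ρ / (n + 1), rIn_pos := by positivity, rIn_lt_rOut := by gcongr; linarith }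
    have hθ0 : Tendsto (fun n => (θ n).rOut) atTop (nhds 0) :=
      tendsto_const_div_atTop_nhds_zero_nat ρ |>.comp (tendsto_add_atTop_nat 1) |>.congr (by
        intro n; simp [θ])
    have hae := ContDiffBump.ae_convolution_tendsto_right_of_locallyIntegrable (μ := volume) (K := 2)
      hθ0 (Eventually.of_forall fun n => by simp only [θ]; apply le_of_eq; ring) hfl
    have hvc : Continuous (cv (etaS (ρ / 2)) f) := by
      rw [continuous_iff_continuousAt]; intro x
      exact (cv_fderiv hfl (etaS_contDiff (n := 1) _) (etaS_compact hρ2) x).1.continuousAt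
    filter_upwards [hae] with x hx hxb
    have h2 := ContDiffBump.convolution_tendsto_right_of_continuous (μ := volume) hθ0 hvc x
    refine tendsto_nhds_unique hx (h2.congr ?_)
    intro n
    change cv ((θ n).normed volume) _ x = cv ((θ n).normed volume) f x
    have hθs : ∀ w, ρ ≤ ‖w‖ → (θ n).normed volume w = 0 := by
      intro w hw
      have : w ∉ Function.support ((θ n).normed volume) := by
        rw [(θ n).support_normed_eq]
        simp only [Metric.mem_ball, dist_zero_right, not_lt, θ]
        exact le_trans (div_le_self hρ.le (by linarith [(Nat.cast_nonneg n : (0:ℝ) ≤ n)])) hw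
      simpa using this
    have hhol : DifferentiableOn ℂ (cv ((θ n).normed volume) f) (Metric.ball x ρ) := by
      intro y hy
      refine (cv_hol (ε := ρ) hfl (θ n).contDiff_normed (θ n).hasCompactSupport_normed hθs hw ?_).differentiableWithinAt
      simp only [Metric.mem_ball] at *
      linarith [dist_triangle y x z0]
    rw [cv_comm hf (θ n).continuous_normed (θ n).hasCompactSupport_normed (etaS_continuous _) (etaS_compact hρ2)]
    rw [← mv_etaS hρ2 (by linarith) hhol, cv_apply]
    rw [← integral_neg_eq_self]
    congr 1; funext t
    have := etaS_rad (ρ / 2) t (-1) (by simp)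
    rw [neg_one_mul] at this
    rw [this, sub_neg_eq_add]

theorem weyl {f : ℂ → ℂ} {U : Set ℂ} (hU : IsOpen U) (hf : LocallyIntegrableOn f U)
    (hw : ∀ χ : ℂ → ℂ, ContDiff ℝ (⊤ : ℕ∞) χ → HasCompactSupport χ → tsupport χ ⊆ U →
      ∫ t, f t * dbar χ t = 0) :
    ∃ v : ℂ → ℂ, DifferentiableOn ℂ v U ∧ ∀ᵐ x, x ∈ U → f x = v x := by
  have key : ∀ z ∈ U, ∃ r > 0, Metric.ball z r ⊆ U ∧ ∃ v : ℂ → ℂ, DifferentiableOn ℂ v (Metric.ball z r) ∧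
      ∀ᵐ x, x ∈ Metric.ball z r → f x = v x := by
    intro z hz
    obtain ⟨r, hr, hrU⟩ := Metric.isOpen_iff.1 hU z hz
    have hsub : Metric.closedBall z (4 * (r / 8)) ⊆ U :=
      (Metric.closedBall_subset_ball (by linarith)).trans hrU
    have hint : IntegrableOn f (Metric.closedBall z (4 * (r / 8))) :=
      hf.integrableOn_compact_subset hsub (isCompact_closedBall _ _)
    have hint2 := (hint.mono_set Metric.ball_subset_closedBall).integrable_indicator Metric.isOpen_ball.measurableSet
    obtain ⟨v, hv, hv2⟩ := weyl_local (z0 := z) (ρ := r / 8) (by positivity) hint2 (by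
      intro χ h1 h2 h3
      rw [← hw χ h1 h2 (h3.trans (Metric.ball_subset_closedBall.trans hsub))]
      congr 1; funext t
      by_cases ht : t ∈ Metric.ball z (4 * (r / 8))
      · rw [indicator_of_mem ht]
      · have : dbar χ t = 0 := by
          have : fderiv ℝ χ t = 0 := by
            have h5 : t ∉ tsupport (fderiv ℝ χ) := fun h => ht (h3 (tsupport_fderiv_subset ℝ h))
            exact image_eq_zero_of_notMem_tsupport h5
          simp [dbar, this]
        simp [this])
    refine ⟨2 * (r / 8), by positivity, (Metric.ball_subset_ball (by linarith)).trans hrU, v, hv, ?_⟩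
    filter_upwards [hv2] with x hx hxb
    rw [← hx hxb, indicator_of_mem]
    exact Metric.ball_subset_ball (by linarith) hxb
  choose! r hr hrU v hv hv2 using key
  have hag : ∀ z ∈ U, ∀ y ∈ U, y ∈ Metric.ball z (r z) → v y y = v z y := by
    intro z hz y hy hyz
    have ho : IsOpen (Metric.ball z (r z) ∩ Metric.ball y (r y)) := Metric.isOpen_ball.inter Metric.isOpen_ball
    have h1 : v y =ᵐ[volume.restrict (Metric.ball z (r z) ∩ Metric.ball y (r y))] v z := by
      rw [Filter.EventuallyEq, ae_restrict_iff' ho.measurableSet]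
      filter_upwards [hv2 z hz, hv2 y hy] with x h1 h2 h3
      rw [← h1 h3.1, ← h2 h3.2]
    exact Measure.eqOn_open_of_ae_eq h1 ho ((hv y hy).continuousOn.mono inter_subset_right)
      ((hv z hz).continuousOn.mono inter_subset_left) ⟨hyz, Metric.mem_ball_self (hr y hy)⟩
  refine ⟨fun z => v z z, ?_, ?_⟩
  · intro z hz
    apply DifferentiableAt.differentiableWithinAt
    have hb : Metric.ball z (r z) ∈ nhds z := Metric.ball_mem_nhds z (hr z hz)
    refine ((hv z hz).differentiableAt hb).congr_of_eventuallyEq ?_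
    filter_upwards [hb] with y hy
    exact hag z hz y (hrU z hz hy) hy
  · have : volume {x | ¬ (x ∈ U → f x = v x x)} = 0 := by
      apply measure_null_of_locally_null
      intro x hx
      have hxU : x ∈ U := by
        by_contra h; exact hx (fun h2 => absurd h2 h)
      refine ⟨Metric.ball x (r x) ∩ {x | ¬ (x ∈ U → f x = v x x)}, ?_, ?_⟩
      · exact inter_mem (mem_nhdsWithin_of_mem_nhds (Metric.ball_mem_nhds x (hr x hxU))) self_mem_nhdsWithin
      · refine measure_mono_null ?_ (hv2 x hxU)
        rintro y ⟨hy1, hy2⟩ h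
        exact hy2 fun hyU => (h hy1).trans (hag x hxU y hyU hy1).symm
    exact this
end

noncomputable section

theorem integral_fderiv_zero {E : Type*} [NormedAddCommGroup E] [NormedSpace ℝ E] [CompleteSpace E]
    {F : ℂ → E} (hF : ContDiff ℝ 1 F)
    (hc : HasCompactSupport F) (v : ℂ) : ∫ t, fderiv ℝ F t v = 0 := by
  have hl : LocallyIntegrable (fun _ : ℂ => (1 : ℝ)) := locallyIntegrable_const _
  have h := hc.hasFDerivAt_convolution_right (ContinuousLinearMap.lsmul ℝ ℝ : ℝ →L[ℝ] E →L[ℝ] E)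
    hl hF 0
  have e : convolution (fun _ : ℂ => (1 : ℝ)) F (ContinuousLinearMap.lsmul ℝ ℝ : ℝ →L[ℝ] E →L[ℝ] E) volume
      = fun _ => ∫ t, F t := by
    funext x
    simp only [convolution_def, ContinuousLinearMap.lsmul_apply, one_smul]
    rw [integral_sub_left_eq_self]
  rw [e] at h
  have h2 := congrArg (fun L => L v) (h.unique (hasFDerivAt_const _ _))
  simp only [_root_.zero_apply] at h2
  rw [convolution_precompR_apply _ hl (hc.fderiv ℝ) (hF.continuous_fderiv one_ne_zero)] at h2
  simp only [convolution_def, ContinuousLinearMap.lsmul_apply, one_smul] at h2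
  rw [integral_sub_left_eq_self (fun t => fderiv ℝ F t v)] at h2
  exact h2

theorem fderiv_I_symm {u : ℂ → ℝ} {z : ℂ} (hu : ContDiffAt ℝ 2 u z) :
    fderiv ℝ (fun w => fderiv ℝ u w 1) z Complex.I = fderiv ℝ (fun w => fderiv ℝ u w Complex.I) z 1 := by
  have h1 : IsSymmSndFDerivAt ℝ u z := hu.isSymmSndFDerivAt (by simp)
  have hd : DifferentiableAt ℝ (fderiv ℝ u) z := (hu.fderiv_right (m := 1) (by norm_num)).differentiableAt one_ne_zero
  have h2 : ∀ v, fderiv ℝ (fun w => fderiv ℝ u w v) z = (fderiv ℝ (fderiv ℝ u) z).flip v := by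
    intro v
    have := (hd.hasFDerivAt.clm_apply (hasFDerivAt_const v z)).fderiv
    rw [this]; ext; simp
  rw [h2, h2]; simp only [ContinuousLinearMap.flip_apply]
  exact h1 _ _

theorem bochner_pt {φ u v : ℂ → ℝ} {z : ℂ} (hφ : ContDiffAt ℝ 2 φ z) (hu : ContDiffAt ℝ 2 u z)
    (hv : ContDiffAt ℝ 2 v z) :
    fderiv ℝ (fun z => Real.exp (2 * φ z) * (1/2 * (fderiv ℝ u z Complex.I * v z - u z * fderiv ℝ v z Complex.I)
        - 1/2 * fderiv ℝ φ z 1 * (u z ^ 2 + v z ^ 2))) z 1 +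
    fderiv ℝ (fun z => Real.exp (2 * φ z) * (1/2 * (u z * fderiv ℝ v z 1 - fderiv ℝ u z 1 * v z)
        - 1/2 * fderiv ℝ φ z Complex.I * (u z ^ 2 + v z ^ 2))) z Complex.I +
    1/2 * laplacian φ z * (Real.exp (2 * φ z) * (u z ^ 2 + v z ^ 2)) ≤
    Real.exp (2 * φ z) * (((fderiv ℝ u z 1 - fderiv ℝ v z Complex.I) / 2) ^ 2 +
      ((fderiv ℝ v z 1 + fderiv ℝ u z Complex.I) / 2) ^ 2) := by
  have d2 : ∀ {f : ℂ → ℝ}, ContDiffAt ℝ 2 f z → ∀ w, HasFDerivAt (fun z => fderiv ℝ f z w)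
      (fderiv ℝ (fun z => fderiv ℝ f z w) z) z := by
    intro f hf w
    have hd : DifferentiableAt ℝ (fderiv ℝ f) z := (hf.fderiv_right (m := 1) (by norm_num)).differentiableAt one_ne_zero
    exact (hd.clm_apply (differentiableAt_const w)).hasFDerivAt
  have d1 : ∀ {f : ℂ → ℝ}, ContDiffAt ℝ 2 f z → HasFDerivAt f (fderiv ℝ f z) z :=
    fun hf => (hf.differentiableAt two_ne_zero).hasFDerivAt
  have hE := ((d1 hφ).const_mul 2).exp
  have hq := ((d1 hu).pow 2).add ((d1 hv).pow 2)
  have hP := hE.mul (((((d2 hu Complex.I).mul (d1 hv)).sub ((d1 hu).mul (d2 hv Complex.I))).const_mul (1/2)).sub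
    (((d2 hφ 1).const_mul (1/2)).mul hq))
  have hQ := hE.mul (((((d1 hu).mul (d2 hv 1)).sub ((d2 hu 1).mul (d1 hv))).const_mul (1/2)).sub
    (((d2 hφ Complex.I).const_mul (1/2)).mul hq))
  have e1 := congrArg (fun L => L 1) hP.fderiv
  have e2 := congrArg (fun L => L Complex.I) hQ.fderiv
  have s1 := fderiv_I_symm hu
  have s2 := fderiv_I_symm hv
  simp only [_root_.add_apply, _root_.sub_apply, _root_.smul_apply, smul_eq_mul, nsmul_eq_mul] at e1 e2
  have e1' : fderiv ℝ (fun z => Real.exp (2 * φ z) * (1/2 * (fderiv ℝ u z Complex.I * v z - u z * fderiv ℝ v z Complex.I)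
        - 1/2 * fderiv ℝ φ z 1 * (u z ^ 2 + v z ^ 2))) z 1 = _ := e1
  have e2' : fderiv ℝ (fun z => Real.exp (2 * φ z) * (1/2 * (u z * fderiv ℝ v z 1 - fderiv ℝ u z 1 * v z)
        - 1/2 * fderiv ℝ φ z Complex.I * (u z ^ 2 + v z ^ 2))) z Complex.I = _ := e2
  rw [e1', e2', laplacian]
  rw [s1, s2]
  have hpos := Real.exp_pos (2 * φ z)
  have key : 0 ≤ Real.exp (2 * φ z) * (((fderiv ℝ u z 1 + fderiv ℝ v z Complex.I)/2 + fderiv ℝ φ z 1 * u z + fderiv ℝ φ z Complex.I * v z)^2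
     + ((fderiv ℝ v z 1 - fderiv ℝ u z Complex.I)/2 + fderiv ℝ φ z 1 * v z - fderiv ℝ φ z Complex.I * u z)^2) := by positivity
  rw [← sub_nonneg]
  refine key.trans (le_of_eq ?_)
  simp only [Pi.mul_apply, Pi.add_apply, Pi.sub_apply]
  push_cast
  ring

theorem cont_of_supp {E : Type*} [NormedAddCommGroup E] {U K : Set ℂ} (hU : IsOpen U) (hK : IsCompact K) (hKU : K ⊆ U)
    {F : ℂ → E} (hF : ContinuousOn F U) (hz : ∀ z ∉ K, F z = 0) : Continuous F ∧ HasCompactSupport F := by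
  have hc : HasCompactSupport F := HasCompactSupport.intro hK hz
  refine ⟨?_, hc⟩
  apply continuous_of_tsupport
  intro x hx
  have : tsupport F ⊆ K := closure_minimal (fun y hy => by by_contra h; exact hy (hz y h)) hK.isClosed
  exact hF.continuousAt (hU.mem_nhds (hKU (this hx)))

theorem contDiff_of_supp {E : Type*} [NormedAddCommGroup E] [NormedSpace ℝ E] {U K : Set ℂ} {n : ℕ∞}
    (hU : IsOpen U) (hK : IsCompact K) (hKU : K ⊆ U)
    {F : ℂ → E} (hF : ContDiffOn ℝ n F U) (hz : ∀ z ∉ K, F z = 0) : ContDiff ℝ n F ∧ HasCompactSupport F := by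
  have hc : HasCompactSupport F := HasCompactSupport.intro hK hz
  refine ⟨?_, hc⟩
  rw [contDiff_iff_contDiffAt]
  intro x
  by_cases hx : x ∈ tsupport F
  swap
  · exact (contDiffAt_const (c := (0 : E))).congr_of_eventuallyEq (notMem_tsupport_iff_eventuallyEq.1 hx)
  have : tsupport F ⊆ K := closure_minimal (fun y hy => by by_contra h; exact hy (hz y h)) hK.isClosed
  exact hF.contDiffAt (hU.mem_nhds (hKU (this hx)))

theorem laplacian_continuousOn {U : Set ℂ} (hU : IsOpen U) {φ : ℂ → ℝ} (hφ : ContDiffOn ℝ 2 φ U) :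
    ContinuousOn (laplacian φ) U := by
  have h1 : ContDiffOn ℝ 1 (fderiv ℝ φ) U := hφ.fderiv_of_isOpen hU (by norm_num)
  have h2 : ∀ v, ContinuousOn (fun z => fderiv ℝ (fun w => fderiv ℝ φ w v) z v) U := by
    intro v
    have h3 : ContDiffOn ℝ 1 (fun w => fderiv ℝ φ w v) U := h1.clm_apply contDiffOn_const
    have h4 := h3.continuousOn_fderiv_of_isOpen hU le_rfl
    exact h4.clm_apply continuousOn_const
  exact (h2 1).add (h2 Complex.I)

theorem dbar_continuousOn {U : Set ℂ} (hU : IsOpen U) {g : ℂ → ℂ} (hg : ContDiffOn ℝ 1 g U) :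
    ContinuousOn (dbar g) U := by
  have h4 := hg.continuousOn_fderiv_of_isOpen hU le_rfl
  unfold dbar
  exact ((h4.clm_apply continuousOn_const).add (continuousOn_const.mul (h4.clm_apply continuousOn_const))).div_const _

theorem dbar_zero_of_notMem {χ : ℂ → ℂ} {z : ℂ} (hz : z ∉ tsupport χ) : dbar χ z = 0 := by
  have : fderiv ℝ χ z = 0 := by
    have h5 : z ∉ tsupport (fderiv ℝ χ) := fun h => hz (tsupport_fderiv_subset ℝ h)
    exact image_eq_zero_of_notMem_tsupport h5
  simp [dbar, this]

theorem fderiv_zero_of_supp {E : Type*} [NormedAddCommGroup E] [NormedSpace ℝ E] {K : Set ℂ} (hK : IsClosed K)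
    {F : ℂ → E} (hz : ∀ z ∉ K, F z = 0) {z : ℂ} (h : z ∉ K) : fderiv ℝ F z = 0 := by
  have : F =ᶠ[nhds z] fun _ => 0 := by
    filter_upwards [hK.isOpen_compl.mem_nhds h] with y hy using hz y hy
  rw [this.fderiv_eq]; simp

theorem bochner {U : Set ℂ} (hU : IsOpen U) {φ : ℂ → ℝ} (hφ : ContDiffOn ℝ 2 φ U) {χ : ℂ → ℂ}
    (hχ : ContDiff ℝ (⊤ : ℕ∞) χ) (hc : HasCompactSupport χ) (hs : tsupport χ ⊆ U) :
    ∫ z, 1/2 * laplacian φ z * (Real.exp (2 * φ z) * ‖χ z‖ ^ 2) ≤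
      ∫ z, Real.exp (2 * φ z) * ‖dbar χ z‖ ^ 2 := by
  set u : ℂ → ℝ := fun z => (χ z).re with hu
  set v : ℂ → ℝ := fun z => (χ z).im with hv
  have hu2 : ContDiff ℝ (⊤ : ℕ∞) u := Complex.reCLM.contDiff.comp hχ
  have hv2 : ContDiff ℝ (⊤ : ℕ∞) v := Complex.imCLM.contDiff.comp hχ
  have le2 : (2 : WithTop ℕ∞) ≤ ((⊤ : ℕ∞) : WithTop ℕ∞) :=
    show ((2 : ℕ∞) : WithTop ℕ∞) ≤ _ from WithTop.coe_le_coe.2 le_top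
  have hz : ∀ z ∉ tsupport χ, χ z = 0 := fun z hz => image_eq_zero_of_notMem_tsupport hz
  have huz : ∀ z ∉ tsupport χ, u z = 0 := fun z h => by simp [hu, hz z h]
  have hvz : ∀ z ∉ tsupport χ, v z = 0 := fun z h => by simp [hv, hz z h]
  have hE : ContDiffOn ℝ 2 (fun z => Real.exp (2 * φ z)) U := (contDiffOn_const.mul hφ).exp
  have hE1 := hE.of_le (m := 1) (by norm_num)
  have hφ1 : ContDiffOn ℝ 1 (fderiv ℝ φ) U := hφ.fderiv_of_isOpen hU (by norm_num)
  have hu1 : ContDiff ℝ 1 (fderiv ℝ u) := hu2.fderiv_right (by rw [one_add_one_eq_two]; exact le2)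
  have hv1 : ContDiff ℝ 1 (fderiv ℝ v) := hv2.fderiv_right (by rw [one_add_one_eq_two]; exact le2)
  have hu0 : ContDiff ℝ 1 u := hu2.of_le (by exact_mod_cast le_top)
  have hv0 : ContDiff ℝ 1 v := hv2.of_le (by exact_mod_cast le_top)
  have hq : ContDiffOn ℝ 1 (fun z => u z ^ 2 + v z ^ 2) U := ((hu0.pow 2).add (hv0.pow 2)).contDiffOn
  have hq2 : ∀ z, ‖χ z‖ ^ 2 = u z ^ 2 + v z ^ 2 := by
    intro z; rw [Complex.sq_norm, Complex.normSq_apply]; ring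
  obtain ⟨P, hPd⟩ : ∃ P : ℂ → ℝ, P = fun z => Real.exp (2 * φ z) * (1/2 * (fderiv ℝ u z Complex.I * v z - u z * fderiv ℝ v z Complex.I)
        - 1/2 * fderiv ℝ φ z 1 * (u z ^ 2 + v z ^ 2)) := ⟨_, rfl⟩
  obtain ⟨Q, hQd⟩ : ∃ P : ℂ → ℝ, P = fun z => Real.exp (2 * φ z) * (1/2 * (u z * fderiv ℝ v z 1 - fderiv ℝ u z 1 * v z)
        - 1/2 * fderiv ℝ φ z Complex.I * (u z ^ 2 + v z ^ 2)) := ⟨_, rfl⟩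
  have hPz : ∀ z ∉ tsupport χ, P z = 0 := by intro z h; simp [hPd, huz z h, hvz z h]
  have hQz : ∀ z ∉ tsupport χ, Q z = 0 := by intro z h; simp [hQd, huz z h, hvz z h]
  have hP := contDiff_of_supp (n := 1) (F := P) hU hc hs (by
      rw [hPd]
      apply hE1.mul
      apply ContDiffOn.sub
      · exact (contDiff_const.mul (((hu1.clm_apply contDiff_const).mul hv0).sub (hu0.mul (hv1.clm_apply contDiff_const)))).contDiffOn
      · exact (contDiffOn_const.mul (hφ1.clm_apply contDiffOn_const)).mul hq) hPz
  have hQ := contDiff_of_supp (n := 1) (F := Q) hU hc hs (by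
      rw [hQd]
      apply hE1.mul
      apply ContDiffOn.sub
      · exact (contDiff_const.mul ((hu0.mul (hv1.clm_apply contDiff_const)).sub ((hu1.clm_apply contDiff_const).mul hv0))).contDiffOn
      · exact (contDiffOn_const.mul (hφ1.clm_apply contDiffOn_const)).mul hq) hQz
  have iP := integral_fderiv_zero hP.1 hP.2 1
  have iQ := integral_fderiv_zero hQ.1 hQ.2 Complex.I
  have nP : Integrable (fun z => fderiv ℝ P z 1) :=
    ((hP.1.continuous_fderiv one_ne_zero).clm_apply continuous_const).integrable_of_hasCompactSupport (hP.2.fderiv_apply (𝕜 := ℝ) 1)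
  have nQ : Integrable (fun z => fderiv ℝ Q z Complex.I) :=
    ((hQ.1.continuous_fderiv one_ne_zero).clm_apply continuous_const).integrable_of_hasCompactSupport (hQ.2.fderiv_apply (𝕜 := ℝ) Complex.I)
  have hL := cont_of_supp (F := fun z => 1/2 * laplacian φ z * (Real.exp (2 * φ z) * ‖χ z‖ ^ 2)) hU hc hs
    ((continuousOn_const.mul (laplacian_continuousOn hU hφ)).mul (hE.continuousOn.mul (hχ.continuous.norm.pow 2).continuousOn))
    (by intro z h; simp [hz z h])
  have hR := cont_of_supp (F := fun z => Real.exp (2 * φ z) * ‖dbar χ z‖ ^ 2) hU hc hs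
    (hE.continuousOn.mul ((dbar_continuousOn hU (hχ.of_le (by exact_mod_cast le_top)).contDiffOn).norm.pow 2))
    (by intro z h; simp [dbar_zero_of_notMem h])
  have nL := hL.1.integrable_of_hasCompactSupport hL.2 (μ := volume)
  have nR := hR.1.integrable_of_hasCompactSupport hR.2 (μ := volume)
  have h0 : ∫ z, 1/2 * laplacian φ z * (Real.exp (2 * φ z) * ‖χ z‖ ^ 2) = ∫ z,
    ((fderiv ℝ P z 1 + fderiv ℝ Q z Complex.I) + 1/2 * laplacian φ z * (Real.exp (2 * φ z) * ‖χ z‖ ^ 2)) := by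
    rw [integral_add (f := fun z => fderiv ℝ P z 1 + fderiv ℝ Q z Complex.I) (nP.add nQ) nL, integral_add nP nQ, iP, iQ]; simp
  rw [h0]
  refine integral_mono ((nP.add nQ).add nL) nR ?_
  intro z
  by_cases hzs : z ∈ tsupport χ
  · have hzU := hU.mem_nhds (hs hzs)
    have := bochner_pt (hφ.contDiffAt hzU) (hu2.contDiffAt.of_le le2) (hv2.contDiffAt.of_le le2)
    rw [← hPd, ← hQd, ← hq2] at this
    refine le_trans this (le_of_eq ?_)
    have d0 : HasFDerivAt χ (fderiv ℝ χ z) z := (hχ.differentiable (by simp) z).hasFDerivAt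
    have du : fderiv ℝ u z = Complex.reCLM.comp (fderiv ℝ χ z) := (Complex.reCLM.hasFDerivAt.comp z d0).fderiv
    have dv : fderiv ℝ v z = Complex.imCLM.comp (fderiv ℝ χ z) := (Complex.imCLM.hasFDerivAt.comp z d0).fderiv
    show _ = Real.exp (2 * φ z) * ‖dbar χ z‖ ^ 2
    rw [Complex.sq_norm, Complex.normSq_apply, dbar, du, dv]
    simp
    ring
  · simp [fderiv_zero_of_supp (isClosed_tsupport χ) hPz hzs, fderiv_zero_of_supp (isClosed_tsupport χ) hQz hzs,
      dbar_zero_of_notMem hzs, hz z hzs]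
end

noncomputable section

theorem dbar_mul {w χ : ℂ → ℂ} {z : ℂ} (hw : DifferentiableAt ℝ w z) (hχ : DifferentiableAt ℝ χ z) :
    dbar (fun z => w z * χ z) z = dbar w z * χ z + w z * dbar χ z := by
  have := (hw.hasFDerivAt.mul hχ.hasFDerivAt).fderiv
  have h2 : fderiv ℝ (fun z => w z * χ z) z = _ := this
  rw [dbar, h2, dbar, dbar]
  simp
  ring

theorem dbar_add {w χ : ℂ → ℂ} {z : ℂ} (hw : DifferentiableAt ℝ w z) (hχ : DifferentiableAt ℝ χ z) :
    dbar (fun z => w z + χ z) z = dbar w z + dbar χ z := by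
  rw [dbar, fderiv_fun_add hw hχ, dbar, dbar]
  simp
  ring

theorem dbar_holo {w : ℂ → ℂ} {z : ℂ} (hw : DifferentiableAt ℂ w z) : dbar w z = 0 := by
  have := (differentiableAt_complex_iff_differentiableAt_real.1 hw).2
  rw [dbar, this, smul_eq_mul, ← mul_assoc, Complex.I_mul_I]
  simp

theorem ibp {U : Set ℂ} (hU : IsOpen U) {w χ : ℂ → ℂ} (hw : ContDiffOn ℝ 1 w U)
    (hχ : ContDiff ℝ (⊤ : ℕ∞) χ) (hc : HasCompactSupport χ) (hs : tsupport χ ⊆ U) :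
    ∫ z, w z * dbar χ z = -∫ z, dbar w z * χ z := by
  have hχ1 : ContDiff ℝ 1 χ := hχ.of_le (by exact_mod_cast le_top)
  have hz : ∀ z ∉ tsupport χ, χ z = 0 := fun z hz => image_eq_zero_of_notMem_tsupport hz
  have hF := contDiff_of_supp (n := 1) (F := fun z => w z * χ z) hU hc hs (hw.mul hχ1.contDiffOn)
    (by intro z h; simp [hz z h])
  have h1 := integral_fderiv_zero hF.1 hF.2 1
  have h2 := integral_fderiv_zero hF.1 hF.2 Complex.I
  have n : ∀ v, Integrable (fun z => fderiv ℝ (fun z => w z * χ z) z v) := fun v =>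
    ((hF.1.continuous_fderiv one_ne_zero).clm_apply continuous_const).integrable_of_hasCompactSupport (hF.2.fderiv_apply (𝕜 := ℝ) v)
  have h3 : ∫ z, dbar (fun z => w z * χ z) z = 0 := by
    unfold dbar
    rw [integral_div, integral_add (n 1) ((n Complex.I).const_mul _), integral_const_mul, h1, h2]
    simp
  have hA := cont_of_supp (F := fun z => dbar w z * χ z) hU hc hs ((dbar_continuousOn hU hw).mul hχ.continuous.continuousOn)
    (by intro z h; simp [hz z h])
  have hB := cont_of_supp (F := fun z => w z * dbar χ z) hU hc hs (hw.continuousOn.mul (dbar_continuousOn hU hχ1.contDiffOn))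
    (by intro z h; simp [dbar_zero_of_notMem h])
  have h4 : ∀ z, dbar (fun z => w z * χ z) z = dbar w z * χ z + w z * dbar χ z := by
    intro z
    by_cases h : z ∈ tsupport χ
    · exact dbar_mul ((hw.contDiffAt (hU.mem_nhds (hs h))).differentiableAt one_ne_zero) (hχ1.differentiable one_ne_zero z)
    · have : fderiv ℝ (fun z => w z * χ z) z = 0 :=
        fderiv_zero_of_supp (isClosed_tsupport χ) (by intro z h; simp [hz z h]) h
      rw [dbar, this]
      simp [hz z h, dbar_zero_of_notMem h]
  simp_rw [h4] at h3
  rw [integral_add (hA.1.integrable_of_hasCompactSupport hA.2) (hB.1.integrable_of_hasCompactSupport hB.2)] at h3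
  linear_combination h3

/-- the test elements -/
def hormK (U : Set ℂ) (φ : ℂ → ℝ) : Submodule ℂ (Lp ℂ 2 (volume.restrict U)) where
  carrier := {s | ∃ χ : ℂ → ℂ, ContDiff ℝ (⊤ : ℕ∞) χ ∧ HasCompactSupport χ ∧ tsupport χ ⊆ U ∧
    s =ᵐ[volume.restrict U] fun z => starRingEnd ℂ ((Real.exp (φ z) : ℂ) * dbar χ z)}
  zero_mem' := by
    refine ⟨fun _ => 0, contDiff_const, HasCompactSupport.zero, by simp [tsupport], ?_⟩
    filter_upwards [Lp.coeFn_zero ℂ 2 (volume.restrict U)] with z hz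
    rw [hz]; simp [dbar]
  add_mem' := by
    rintro a b ⟨χ, h1, h2, h3, h4⟩ ⟨ψ, k1, k2, k3, k4⟩
    refine ⟨fun z => χ z + ψ z, h1.add k1, h2.add k2, (tsupport_add χ ψ).trans (union_subset h3 k3), ?_⟩
    filter_upwards [Lp.coeFn_add a b, h4, k4] with z e1 e2 e3
    rw [e1, Pi.add_apply, e2, e3, dbar_add (h1.differentiable (by simp) z) (k1.differentiable (by simp) z)]
    simp [mul_add]
  smul_mem' := by
    rintro c a ⟨χ, h1, h2, h3, h4⟩
    refine ⟨fun z => starRingEnd ℂ c * χ z, contDiff_const.mul h1, h2.mul_left, ?_, ?_⟩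
    · refine (closure_mono ?_).trans h3
      intro z hz; simp only [Function.mem_support] at *; exact right_ne_zero_of_mul hz
    · filter_upwards [Lp.coeFn_smul c a, h4] with z e1 e2
      rw [e1, Pi.smul_apply, e2, dbar_mul (differentiableAt_const _) (h1.differentiable (by simp) z)]
      rw [dbar_holo (w := fun _ => starRingEnd ℂ c) (differentiableAt_const _)]
      simp only [zero_mul, zero_add, map_mul, smul_eq_mul, Complex.conj_conj]; ring

theorem int_U {E : Type*} [NormedAddCommGroup E] [NormedSpace ℝ E] (U : Set ℂ) (F : ℂ → E) (h : ∀ z ∉ U, F z = 0) :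
    ∫ z, F z = ∫ z in U, F z := (setIntegral_eq_integral_of_forall_compl_eq_zero h).symm

theorem horm_bound {U : Set ℂ} (hU : IsOpen U) {φ : ℂ → ℝ} (hφ : ContDiffOn ℝ 2 φ U)
    (hΔ : ∀ z ∈ U, 0 < laplacian φ z) {w χ : ℂ → ℂ} (hw : ContDiffOn ℝ 1 w U)
    (hA : ∫⁻ z in U, ENNReal.ofReal (‖dbar w z‖ ^ 2 / laplacian φ z * Real.exp (-(2 * φ z))) ≠ ⊤)
    (hχ : ContDiff ℝ (⊤ : ℕ∞) χ) (hc : HasCompactSupport χ) (hs : tsupport χ ⊆ U) :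
    ‖∫ z, w z * dbar χ z‖ ≤
      Real.sqrt (2 * (∫⁻ z in U, ENNReal.ofReal (‖dbar w z‖ ^ 2 / laplacian φ z * Real.exp (-(2 * φ z)))).toReal) *
      Real.sqrt (∫ z, Real.exp (2 * φ z) * ‖dbar χ z‖ ^ 2) := by
  have hz : ∀ z ∉ tsupport χ, χ z = 0 := fun z hz => image_eq_zero_of_notMem_tsupport hz
  have hzU : ∀ z ∉ U, χ z = 0 := fun z h => hz z (fun h2 => h (hs h2))
  set f : ℂ → ℝ := fun z => ‖dbar w z‖ / Real.sqrt (laplacian φ z) * Real.exp (-φ z) with hf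
  set g : ℂ → ℝ := fun z => Real.sqrt (laplacian φ z) * Real.exp (φ z) * ‖χ z‖ with hg
  have hLc := laplacian_continuousOn hU hφ
  have hfc : ContinuousOn f U := by
    refine ((dbar_continuousOn hU hw).norm.div hLc.sqrt ?_).mul hφ.continuousOn.neg.rexp
    intro z h; exact (Real.sqrt_pos.2 (hΔ z h)).ne'
  have hgs := cont_of_supp (F := g) hU hc hs ((hLc.sqrt.mul hφ.continuousOn.rexp).mul hχ.continuous.norm.continuousOn)
    (by intro z h; simp [hg, hz z h])
  have hf2 : ∀ z ∈ U, f z ^ 2 = ‖dbar w z‖ ^ 2 / laplacian φ z * Real.exp (-(2 * φ z)) := by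
    intro z h
    simp only [hf]
    rw [mul_pow, div_pow, Real.sq_sqrt (hΔ z h).le, ← Real.exp_nat_mul]
    congr 2; push_cast; ring
  have hg2 : ∀ z ∈ U, g z ^ 2 = laplacian φ z * (Real.exp (2 * φ z) * ‖χ z‖ ^ 2) := by
    intro z h
    simp only [hg]
    rw [mul_pow, mul_pow, Real.sq_sqrt (hΔ z h).le, ← Real.exp_nat_mul]
    push_cast; ring
  have hint : ∫⁻ z in U, ENNReal.ofReal (‖dbar w z‖ ^ 2 / laplacian φ z * Real.exp (-(2 * φ z))) =
      ∫⁻ z in U, ENNReal.ofReal (f z ^ 2) :=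
    setLIntegral_congr_fun hU.measurableSet fun z h => by rw [hf2 z h]
  rw [hint] at hA ⊢
  have hfi : IntegrableOn (fun z => f z ^ 2) U := by
    refine ⟨(hfc.pow 2).aestronglyMeasurable hU.measurableSet, ?_⟩
    rw [hasFiniteIntegral_iff_ofReal (Eventually.of_forall fun z => sq_nonneg _)]
    exact hA.lt_top
  have hfm : MemLp f 2 (volume.restrict U) :=
    (memLp_two_iff_integrable_sq (hfc.aestronglyMeasurable hU.measurableSet)).2 hfi
  have hgm : MemLp g 2 (volume.restrict U) := (hgs.1.memLp_of_hasCompactSupport hgs.2).restrict U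
  have hAe : (∫⁻ z in U, ENNReal.ofReal (f z ^ 2)).toReal = ∫ z in U, f z ^ 2 := by
    rw [integral_eq_lintegral_of_nonneg_ae (Eventually.of_forall fun z => sq_nonneg _) hfi.1]
  rw [hAe, ibp hU hw hχ hc hs, norm_neg]
  have cs := integral_mul_le_Lp_mul_Lq_of_nonneg (μ := volume.restrict U) Real.HolderConjugate.two_two
    (f := f) (g := g)
    (Eventually.of_forall fun z => by simp only [hf]; positivity) (Eventually.of_forall fun z => by simp only [hg]; positivity)
    (by simpa using hfm) (by simpa using hgm)
  have hb := bochner hU hφ hχ hc hs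
  have e1 : ∫ z in U, g z ^ 2 ≤ 2 * ∫ z, Real.exp (2 * φ z) * ‖dbar χ z‖ ^ 2 := by
    have : ∫ z in U, g z ^ 2 = 2 * ∫ z, 1/2 * laplacian φ z * (Real.exp (2 * φ z) * ‖χ z‖ ^ 2) := by
      rw [← integral_const_mul, int_U U (fun z => 2 * (1/2 * laplacian φ z * (Real.exp (2 * φ z) * ‖χ z‖ ^ 2)))]
      · refine setIntegral_congr_fun hU.measurableSet fun z h => ?_
        simp only [hg2 z h]; ring
      · intro z h; simp [hzU z h]
    rw [this]; linarith
  calc ‖∫ z, dbar w z * χ z‖ = ‖∫ z in U, dbar w z * χ z‖ := by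
        rw [setIntegral_eq_integral_of_forall_compl_eq_zero]
        intro z h; simp [hzU z h]
    _ ≤ ∫ z in U, ‖dbar w z * χ z‖ := norm_integral_le_integral_norm _
    _ = ∫ z in U, f z * g z := by
        refine setIntegral_congr_fun hU.measurableSet fun z h => ?_
        have h1 := (Real.sqrt_pos.2 (hΔ z h)).ne'
        simp only [hf, hg, norm_mul]
        rw [Real.exp_neg]
        have := (Real.exp_pos (φ z)).ne'
        field_simp
    _ ≤ _ := cs
    _ ≤ _ := by
        simp only [Real.rpow_two]
        rw [← Real.sqrt_eq_rpow, ← Real.sqrt_eq_rpow, Real.sqrt_mul (by norm_num)]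
        calc _ ≤ Real.sqrt (∫ z in U, f z ^ 2) * Real.sqrt (2 * ∫ z, Real.exp (2 * φ z) * ‖dbar χ z‖ ^ 2) := by
              gcongr
          _ = _ := by rw [Real.sqrt_mul (by norm_num)]; ring

theorem horm_vol {U : Set ℂ} (hU : IsOpen U) {φ : ℂ → ℝ} (hφ : ContDiffOn ℝ 2 φ U)
    (hΔ : ∀ z ∈ U, 0 < laplacian φ z) {w : ℂ → ℂ} (hw : ContDiffOn ℝ 1 w U)
    (hwL : ∫⁻ z in U, ENNReal.ofReal (‖w z‖ ^ 2 * Real.exp (-(2 * φ z))) ≠ ⊤) :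
    ∃ v : ℂ → ℂ, DifferentiableOn ℂ v U ∧
      ∫⁻ z in U, ENNReal.ofReal (‖w z - v z‖ ^ 2 * Real.exp (-(2 * φ z))) ≤
      2 * ∫⁻ z in U, ENNReal.ofReal (‖dbar w z‖ ^ 2 / laplacian φ z * Real.exp (-(2 * φ z))) := by
  by_cases hA : ∫⁻ z in U, ENNReal.ofReal (‖dbar w z‖ ^ 2 / laplacian φ z * Real.exp (-(2 * φ z))) = ⊤
  · exact ⟨0, differentiableOn_const 0, by rw [hA]; simp⟩
  set A := ∫⁻ z in U, ENNReal.ofReal (‖dbar w z‖ ^ 2 / laplacian φ z * Real.exp (-(2 * φ z))) with hAd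
  set μ := volume.restrict U with hμ
  have ex2 : ∀ z, Real.exp (-(2 * φ z)) = Real.exp (- φ z) ^ 2 := by
    intro z; rw [← Real.exp_nat_mul]; congr 1; push_cast; ring
  have hWc : ContinuousOn (fun z => w z * (Real.exp (-φ z) : ℂ)) U :=
    hw.continuousOn.mul (Complex.continuous_ofReal.comp_continuousOn hφ.continuousOn.neg.rexp)
  have hWm : MemLp (fun z => w z * (Real.exp (-φ z) : ℂ)) 2 μ := by
    rw [memLp_two_iff_integrable_sq_norm (hWc.aestronglyMeasurable hU.measurableSet)]
    refine ⟨(hWc.norm.pow 2).aestronglyMeasurable hU.measurableSet, ?_⟩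
    rw [hasFiniteIntegral_iff_ofReal (Eventually.of_forall fun z => sq_nonneg _)]
    refine lt_of_le_of_lt (le_of_eq ?_) (lt_top_iff_ne_top.2 hwL)
    congr 1; funext z
    rw [norm_mul, mul_pow, ex2]; simp [-Complex.ofReal_exp, abs_of_pos (Real.exp_pos _)]
  set W : Lp ℂ 2 μ := hWm.toLp _ with hW
  set K := hormK U φ with hK
  set B := Real.sqrt (2 * A.toReal) with hB
  have hbd : ∀ s ∈ K, ‖inner ℂ s W‖ ≤ B * ‖s‖ := by
    rintro s ⟨χ, h1, h2, h3, h4⟩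
    have h5 : inner ℂ s W = ∫ z, w z * dbar χ z := by
      rw [L2.inner_def, int_U U (fun z => w z * dbar χ z)]
      · apply integral_congr_ae
        filter_upwards [h4, hWm.coeFn_toLp] with z e1 e2
        rw [hW, e2, e1]
        simp only [RCLike.inner_apply, Complex.conj_conj]
        rw [Real.exp_neg]
        have := (Real.exp_pos (φ z)).ne'
        push_cast
        field_simp
      · intro z h; simp [dbar_zero_of_notMem (fun h2 => h (h3 h2))]
    have h6 : ‖s‖ = Real.sqrt (∫ z, Real.exp (2 * φ z) * ‖dbar χ z‖ ^ 2) := by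
      rw [norm_eq_sqrt_re_inner (𝕜 := ℂ), L2.inner_def]
      congr 1
      rw [int_U U (fun z => Real.exp (2 * φ z) * ‖dbar χ z‖ ^ 2)]
      · have : ∀ᵐ z ∂μ, inner ℂ (s z) (s z) = ((Real.exp (2 * φ z) * ‖dbar χ z‖ ^ 2 : ℝ) : ℂ) := by
          filter_upwards [h4] with z e1
          rw [e1, inner_self_eq_norm_sq_to_K, RCLike.norm_conj, norm_mul, Complex.norm_real, Real.norm_eq_abs,
            abs_of_pos (Real.exp_pos _)]
          norm_cast
          rw [mul_pow, ← Real.exp_nat_mul]; norm_num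
        rw [integral_congr_ae this, integral_complex_ofReal]
        exact Complex.ofReal_re _
      · intro z h; simp [dbar_zero_of_notMem (fun h2 => h (h3 h2))]
    rw [h5, h6]
    exact horm_bound hU hφ hΔ hw hA h1 h2 h3
  have hbd2 : ∀ s ∈ K.topologicalClosure, ‖inner ℂ s W‖ ≤ B * ‖s‖ := by
    intro s hs
    have hcl : IsClosed {s : Lp ℂ 2 μ | ‖inner ℂ s W‖ ≤ B * ‖s‖} :=
      isClosed_le (by fun_prop) (by fun_prop)
    exact closure_minimal (fun s hs => hbd s hs) hcl hs
  set V : Lp ℂ 2 μ := W - K.topologicalClosure.starProjection W with hV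
  have hVK : V ∈ Kᗮ := by
    rw [← Submodule.orthogonal_closure]
    exact Submodule.sub_starProjection_mem_orthogonal W
  have hWV : W - V ∈ K.topologicalClosure := by
    rw [hV, sub_sub_cancel]; exact Submodule.starProjection_apply_mem _ _
  have hnorm : ‖W - V‖ ≤ B := by
    have h1 : inner ℂ (W - V) (W - V) = inner ℂ (W - V) W := by
      rw [inner_sub_right]
      have : inner ℂ (W - V) V = 0 := by
        rw [← Submodule.orthogonal_closure] at hVK
        exact hVK _ hWV
      rw [this, sub_zero]
    have h2 := hbd2 _ hWV
    rw [← h1, inner_self_eq_norm_sq_to_K] at h2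
    simp only [norm_pow, RCLike.norm_ofReal, abs_norm] at h2
    have hB0 : 0 ≤ B := Real.sqrt_nonneg _
    by_contra hlt
    nlinarith [norm_nonneg (W - V)]
  have hφe : ContinuousOn (fun z => (Real.exp (φ z) : ℂ)) U :=
    Complex.continuous_ofReal.comp_continuousOn hφ.continuousOn.rexp
  have hVl : LocallyIntegrableOn (fun z => V z * (Real.exp (φ z) : ℂ)) U := by
    have h1 : LocallyIntegrableOn (fun z => V z) U := by
      rw [locallyIntegrableOn_iff hU.isLocallyClosed]
      intro k hk hkc
      have h2 : MemLp V 2 (volume.restrict k) := (Lp.memLp V).mono_measure (Measure.restrict_mono_set _ hk)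
      have : IsFiniteMeasure (volume.restrict k) := ⟨by simpa using hkc.measure_lt_top⟩
      exact h2.integrable (by norm_num)
    exact h1.mul_continuousOn hφe hU.isLocallyClosed
  obtain ⟨v, hv, hv2⟩ := weyl hU hVl (by
    intro χ h1 h2 h3
    have hS := cont_of_supp (F := fun z => starRingEnd ℂ ((Real.exp (φ z) : ℂ) * dbar χ z)) hU h2 h3
      (Complex.continuous_conj.comp_continuousOn (hφe.mul (dbar_continuousOn hU (h1.of_le (by exact_mod_cast le_top)).contDiffOn)))
      (by intro z h; simp [dbar_zero_of_notMem h])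
    have hSm : MemLp (fun z => starRingEnd ℂ ((Real.exp (φ z) : ℂ) * dbar χ z)) 2 μ :=
      (hS.1.memLp_of_hasCompactSupport hS.2).restrict U
    have h4 := hVK (hSm.toLp _) ⟨χ, h1, h2, h3, hSm.coeFn_toLp⟩
    rw [L2.inner_def] at h4
    rw [← h4, int_U U (fun t => V t * (Real.exp (φ t) : ℂ) * dbar χ t)]
    · apply integral_congr_ae
      filter_upwards [hSm.coeFn_toLp] with z e1
      rw [e1]
      simp only [RCLike.inner_apply, Complex.conj_conj]
      ring
    · intro z h; simp [dbar_zero_of_notMem (fun h2 => h (h3 h2))])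
  refine ⟨v, hv, ?_⟩
  have h7 : ∫⁻ z in U, ENNReal.ofReal (‖w z - v z‖ ^ 2 * Real.exp (-(2 * φ z))) = ∫⁻ z, ‖(W - V) z‖ₑ ^ 2 ∂μ := by
    apply lintegral_congr_ae
    filter_upwards [Lp.coeFn_sub W V, hWm.coeFn_toLp, (ae_restrict_iff' hU.measurableSet).2 hv2] with z e1 e2 e3
    rw [e1, Pi.sub_apply, hW, e2, ← e3, ← ofReal_norm, ← ENNReal.ofReal_pow (norm_nonneg _), ex2]
    congr 1
    have h8 := (Real.exp_pos (φ z)).ne'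
    have : w z * (Real.exp (-φ z) : ℂ) - V z = (w z - V z * (Real.exp (φ z) : ℂ)) * (Real.exp (-φ z) : ℂ) := by
      rw [Real.exp_neg]; push_cast; field_simp
    rw [this, norm_mul, mul_pow, Complex.norm_real, Real.norm_eq_abs, abs_of_pos (Real.exp_pos _)]
  rw [h7]
  have h9 : ∫⁻ z, ‖(W - V) z‖ₑ ^ 2 ∂μ = ENNReal.ofReal (‖W - V‖ ^ 2) := by
    rw [Lp.norm_def, ← ENNReal.toReal_pow, ENNReal.ofReal_toReal (ENNReal.pow_ne_top (Lp.eLpNorm_ne_top _)),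
      eLpNorm_eq_lintegral_rpow_enorm_toReal (by norm_num) (by norm_num)]
    simp only [ENNReal.toReal_ofNat, ENNReal.rpow_ofNat]
    rw [← ENNReal.rpow_natCast, ← ENNReal.rpow_mul]; norm_num
  rw [h9]
  calc ENNReal.ofReal (‖W - V‖ ^ 2) ≤ ENNReal.ofReal (B ^ 2) := by gcongr
    _ = 2 * A := by
      rw [hB, Real.sq_sqrt (by positivity), ENNReal.ofReal_mul (by norm_num), ENNReal.ofReal_toReal hA]
      simp
end

noncomputable section

theorem lintegral_dA (s : Set ℂ) (f : ℂ → ℝ≥0∞) :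
    ∫⁻ z in s, f z ∂dA = (ENNReal.ofReal Real.pi)⁻¹ * ∫⁻ z in s, f z := by
  rw [dA, Measure.restrict_smul, lintegral_smul_measure, smul_eq_mul]

theorem dA_ball (z : ℂ) {R : ℝ} (hR : 0 ≤ R) : dA (Metric.ball z R) = ENNReal.ofReal (R ^ 2) := by
  rw [dA, Measure.smul_apply, Complex.volume_ball, smul_eq_mul, mul_comm, mul_assoc]
  have h : (ENNReal.ofReal Real.pi) = (NNReal.pi : ℝ≥0∞) := by
    rw [ENNReal.ofReal_eq_coe_nnreal Real.pi_pos.le]; rfl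
  rw [h, ENNReal.mul_inv_cancel (by simpa using NNReal.pi_ne_zero) ENNReal.coe_ne_top, mul_one, ENNReal.ofReal_pow hR]

theorem ae_dA {p : ℂ → Prop} : (∀ᵐ z ∂dA, p z) ↔ ∀ᵐ z, p z := by
  unfold dA
  rw [Measure.ae_ennreal_smul_measure_iff]
  simp

theorem isOpen_unitDisc : IsOpen unitDisc := Metric.isOpen_ball

theorem mem_unitDisc {z : ℂ} : z ∈ unitDisc ↔ ‖z‖ < 1 := by simp [unitDisc]

/-- Constant in the sub-mean-value estimate. -/
def smC : ℝ := 4 * Real.pi / etaI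

theorem smC_pos : 0 < smC := div_pos (by positivity) etaI_pos

theorem submean {G : ℂ → ℂ} {z : ℂ} {R : ℝ} (hR : 0 < R) (hG : DifferentiableOn ℂ G (Metric.ball z R)) :
    ENNReal.ofReal (‖G z‖ ^ 2) ≤
      ENNReal.ofReal (smC / R ^ 2) * ∫⁻ w in Metric.ball z R, ENNReal.ofReal (‖G w‖ ^ 2) ∂dA := by
  have h1 := mv_etaS (ε := R / 2) (by positivity) (by linarith) (hG.pow 2)
  simp only [Pi.pow_apply] at h1
  have hpi := Real.pi_pos
  have hI := etaI_pos
  calc ENNReal.ofReal (‖G z‖ ^ 2) = ‖∫ w, (etaS (R / 2) w : ℂ) * G (z + w) ^ 2‖ₑ := by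
        rw [h1, ← norm_pow, ofReal_norm]
    _ ≤ ∫⁻ w, ‖(etaS (R / 2) w : ℂ) * G (z + w) ^ 2‖ₑ := enorm_integral_le_lintegral_enorm _
    _ ≤ ∫⁻ w, (Metric.ball z R).indicator (fun w => ENNReal.ofReal ((etaI * (R / 2) ^ 2)⁻¹) *
          ENNReal.ofReal (‖G w‖ ^ 2)) (z + w) := by
        apply lintegral_mono
        intro w
        by_cases hw : ‖w‖ < R / 2
        · have : z + w ∈ Metric.ball z R := by simp; linarith
          simp only [Set.indicator_of_mem this]
          rw [← ENNReal.ofReal_mul (by positivity), ← ofReal_norm, norm_mul, norm_pow, Complex.norm_real]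
          rw [Real.norm_of_nonneg (etaS_nonneg w)]
          gcongr
          exact etaS_le w
        · simp [etaS_zero (by positivity : 0 < R / 2) (not_lt.1 hw)]
    _ = ∫⁻ w, (Metric.ball z R).indicator (fun w => ENNReal.ofReal ((etaI * (R / 2) ^ 2)⁻¹) *
          ENNReal.ofReal (‖G w‖ ^ 2)) w := lintegral_add_left_eq_self _ z
    _ = _ := by
        rw [lintegral_indicator measurableSet_ball, lintegral_const_mul' _ _ ENNReal.ofReal_ne_top,
          lintegral_dA, ← mul_assoc]
        congr 1
        rw [← ENNReal.ofReal_inv_of_pos hpi, ← ENNReal.ofReal_mul (by have := smC_pos; positivity)]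
        congr 1
        unfold smC
        field_simp; norm_num

section
variable {ω φ : ℂ → ℝ} {τ : ℝ → ℝ}

theorem omega_contOn (hW : IsClassW ω φ τ) : ContinuousOn ω unitDisc := by
  have : ContinuousOn (fun z => Real.exp (-(2 * φ z))) unitDisc :=
    ((continuousOn_const.mul hW.smooth.continuousOn).neg).rexp
  exact this.congr hW.omega_eq

theorem omega_aem (hW : IsClassW ω φ τ) {s : Set ℂ} (hs : s ⊆ unitDisc) :
    AEMeasurable (fun z => ENNReal.ofReal (ω z)) (dA.restrict s) := by
  have h1 : AEMeasurable (fun z => ENNReal.ofReal (ω z)) (dA.restrict unitDisc) :=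
    ((omega_contOn hW).aemeasurable isOpen_unitDisc.measurableSet).ennreal_ofReal
  exact h1.mono_set hs

theorem muW_restrict (_hW : IsClassW ω φ τ) {s : Set ℂ} (hs : s ⊆ unitDisc) (hm : MeasurableSet s) :
    (muW ω).restrict s = (dA.restrict s).withDensity fun z => ENNReal.ofReal (ω z) := by
  rw [muW, restrict_withDensity hm, Measure.restrict_restrict hm, inter_eq_left.2 hs]

theorem muW_restrict_disc (ω : ℂ → ℝ) : (muW ω).restrict unitDisc = muW ω := by
  rw [muW, restrict_withDensity isOpen_unitDisc.measurableSet, Measure.restrict_restrict isOpen_unitDisc.measurableSet,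
    inter_self]

theorem lintegral_muW (hW : IsClassW ω φ τ) {s : Set ℂ} (hs : s ⊆ unitDisc) (hm : MeasurableSet s) (f : ℂ → ℝ≥0∞) :
    ∫⁻ z in s, f z ∂(muW ω) = ∫⁻ z in s, ENNReal.ofReal (ω z) * f z ∂dA := by
  rw [muW_restrict hW hs hm, lintegral_withDensity_eq_lintegral_mul_non_measurable₀ _ (omega_aem hW hs)
    (Eventually.of_forall fun z => ENNReal.ofReal_lt_top)]
  rfl

theorem ae_muW (hW : IsClassW ω φ τ) {p : ℂ → Prop} :
    (∀ᵐ z ∂(muW ω), p z) ↔ ∀ᵐ z, z ∈ unitDisc → p z := by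
  rw [muW, ae_withDensity_iff' (omega_aem hW le_rfl), ae_restrict_iff' isOpen_unitDisc.measurableSet, ae_dA]
  refine eventually_congr (Eventually.of_forall fun z => ?_)
  constructor
  · intro h hz; exact h hz (by simpa using hW.pos z hz)
  · intro h hz _; exact h hz

theorem muW_finite (hW : IsClassW ω φ τ) : IsFiniteMeasure (muW ω) := by
  constructor
  rw [muW, withDensity_apply _ MeasurableSet.univ, Measure.restrict_univ]
  exact hW.integrable

theorem norm_sq_Lp {μ : Measure ℂ} (f : Lp ℂ 2 μ) :
    ENNReal.ofReal (‖f‖ ^ 2) = ∫⁻ z, ENNReal.ofReal (‖f z‖ ^ 2) ∂μ := by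
  rw [Lp.norm_def, ← ENNReal.toReal_pow, ENNReal.ofReal_toReal (ENNReal.pow_ne_top (Lp.eLpNorm_ne_top _)),
      eLpNorm_eq_lintegral_rpow_enorm_toReal (by norm_num) (by norm_num)]
  simp only [ENNReal.toReal_ofNat, ENNReal.rpow_ofNat]
  rw [← ENNReal.rpow_natCast, ← ENNReal.rpow_mul]
  norm_num [← ofReal_norm, ENNReal.ofReal_pow]

theorem norm_sq_Lp' {μ : Measure ℂ} (f : Lp ℂ 2 μ) {F : ℂ → ℂ} (h : f =ᵐ[μ] F) :
    ENNReal.ofReal (‖f‖ ^ 2) = ∫⁻ z, ENNReal.ofReal (‖F z‖ ^ 2) ∂μ := by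
  rw [norm_sq_Lp]
  apply lintegral_congr_ae
  filter_upwards [h] with z hz
  rw [hz]

theorem memLp_of_lint {μ : Measure ℂ} {F : ℂ → ℂ} (hF : AEStronglyMeasurable F μ)
    (h : ∫⁻ z, ENNReal.ofReal (‖F z‖ ^ 2) ∂μ ≠ ⊤) : MemLp F 2 μ := by
  rw [memLp_two_iff_integrable_sq_norm hF]
  refine ⟨(hF.norm.pow 2), ?_⟩
  rw [hasFiniteIntegral_iff_ofReal (Eventually.of_forall fun z => sq_nonneg _)]
  exact lt_top_iff_ne_top.2 h

theorem lint_of_memLp {μ : Measure ℂ} {F : ℂ → ℂ} (h : MemLp F 2 μ) :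
    ∫⁻ z, ENNReal.ofReal (‖F z‖ ^ 2) ∂μ ≠ ⊤ := by
  have := norm_sq_Lp' (h.toLp F) h.coeFn_toLp
  rw [← this]; exact ENNReal.ofReal_ne_top

theorem aesm_contOn (_hW : IsClassW ω φ τ) {F : ℂ → ℂ} (hF : ContinuousOn F unitDisc) :
    AEStronglyMeasurable F (muW ω) := by
  have h1 : AEStronglyMeasurable F (dA.restrict unitDisc) := hF.aestronglyMeasurable isOpen_unitDisc.measurableSet
  exact h1.mono_ac (withDensity_absolutelyContinuous _ _)

theorem horm_muW (hW : IsClassW ω φ τ) {w : ℂ → ℂ} (hw : ContDiffOn ℝ 1 w unitDisc)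
    (hwL : ∫⁻ z, ENNReal.ofReal (‖w z‖ ^ 2) ∂(muW ω) ≠ ⊤) :
    ∃ v : ℂ → ℂ, DifferentiableOn ℂ v unitDisc ∧
      ∫⁻ z, ENNReal.ofReal (‖w z - v z‖ ^ 2) ∂(muW ω) ≤
      2 * ∫⁻ z, ENNReal.ofReal (‖dbar w z‖ ^ 2 / laplacian φ z) ∂(muW ω) := by
  have key : ∀ f : ℂ → ℝ, ∫⁻ z, ENNReal.ofReal (f z) ∂(muW ω) =
      (ENNReal.ofReal Real.pi)⁻¹ * ∫⁻ z in unitDisc, ENNReal.ofReal (f z * Real.exp (-(2 * φ z))) := by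
    intro f
    rw [← muW_restrict_disc, lintegral_muW hW le_rfl isOpen_unitDisc.measurableSet, lintegral_dA]
    congr 1
    refine setLIntegral_congr_fun isOpen_unitDisc.measurableSet fun z hz => ?_
    rw [← ENNReal.ofReal_mul (hW.pos z hz).le, hW.omega_eq z hz, mul_comm]
  have hpi : ENNReal.ofReal Real.pi ≠ 0 := by simpa using Real.pi_pos
  obtain ⟨v, hv, h⟩ := horm_vol isOpen_unitDisc hW.smooth hW.lap_pos hw (by
    intro h
    rw [key, h, ENNReal.mul_top (by simp)] at hwL
    exact hwL rfl)
  refine ⟨v, hv, ?_⟩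
  rw [key, key, mul_left_comm]
  gcongr

theorem berg_rep (hW : IsClassW ω φ τ) (f : bergmanH ω) :
    ∃ F : ℂ → ℂ, DifferentiableOn ℂ F unitDisc ∧ ((f : Lp ℂ 2 (muW ω)) : ℂ → ℂ) =ᵐ[muW ω] F := by
  have := muW_finite hW
  have key : ∀ χ : ℂ → ℂ, ContDiff ℝ (⊤ : ℕ∞) χ → HasCompactSupport χ → tsupport χ ⊆ unitDisc →
      ∃ k : Lp ℂ 2 (muW ω), ∀ u : Lp ℂ 2 (muW ω), inner ℂ k u =
        (Real.pi⁻¹ : ℂ) * ∫ t, u t * dbar χ t := by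
    intro χ h1 h2 h3
    have hS := cont_of_supp (F := fun z => starRingEnd ℂ (((ω z)⁻¹ : ℝ) * dbar χ z)) isOpen_unitDisc h2 h3
      (Complex.continuous_conj.comp_continuousOn ((Complex.continuous_ofReal.comp_continuousOn
        ((omega_contOn hW).inv₀ (fun z hz => (hW.pos z hz).ne'))).mul
          (dbar_continuousOn isOpen_unitDisc (h1.of_le (by exact_mod_cast le_top)).contDiffOn)))
      (by intro z h; simp [dbar_zero_of_notMem h])
    have hSm : MemLp (fun z => starRingEnd ℂ (((ω z)⁻¹ : ℝ) * dbar χ z)) 2 (muW ω) :=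
      hS.1.memLp_of_hasCompactSupport hS.2
    refine ⟨hSm.toLp _, fun u => ?_⟩
    rw [L2.inner_def]
    have e1 : ∫ z, inner ℂ ((hSm.toLp _ : Lp ℂ 2 (muW ω)) z) (u z) ∂(muW ω) =
        ∫ z, (((ω z)⁻¹ : ℝ) : ℂ) * dbar χ z * u z ∂(muW ω) := by
      apply integral_congr_ae
      filter_upwards [hSm.coeFn_toLp] with z hz
      rw [hz]; simp only [RCLike.inner_apply, Complex.conj_conj]; ring
    rw [e1]
    refine (integral_withDensity_eq_integral_toReal_smul₀ (omega_aem hW le_rfl)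
      (Eventually.of_forall fun z => ENNReal.ofReal_lt_top) _).trans ?_
    rw [dA, Measure.restrict_smul, integral_smul_measure, int_U unitDisc (fun t => u t * dbar χ t)]
    · rw [← ENNReal.ofReal_inv_of_pos Real.pi_pos, ENNReal.toReal_ofReal (by positivity)]
      rw [Complex.real_smul]; push_cast; congr 1
      refine setIntegral_congr_fun isOpen_unitDisc.measurableSet fun z hz => ?_
      have := hW.pos z hz
      simp only [ENNReal.toReal_ofReal this.le, Complex.real_smul]
      have : (ω z : ℂ) ≠ 0 := by exact_mod_cast this.ne'
      push_cast; field_simp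
    · intro z h; simp [dbar_zero_of_notMem (fun h2 => h (h3 h2))]
  have hz : ∀ χ : ℂ → ℂ, ContDiff ℝ (⊤ : ℕ∞) χ → HasCompactSupport χ → tsupport χ ⊆ unitDisc →
      ∫ t, (f : Lp ℂ 2 (muW ω)) t * dbar χ t = 0 := by
    intro χ h1 h2 h3
    obtain ⟨k, hk⟩ := key χ h1 h2 h3
    have hcl : IsClosed {u : Lp ℂ 2 (muW ω) | inner ℂ k u = 0} :=
      isClosed_eq (by fun_prop) continuous_const
    have : (f : Lp ℂ 2 (muW ω)) ∈ {u : Lp ℂ 2 (muW ω) | inner ℂ k u = 0} := by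
      refine closure_minimal ?_ hcl f.2
      rintro u ⟨F, hF, hu⟩
      change inner ℂ k u = 0
      rw [hk]
      have h4 : ∫ t, u t * dbar χ t = ∫ t, F t * dbar χ t := by
        apply integral_congr_ae
        filter_upwards [(ae_muW hW).1 hu] with z hz
        by_cases h : z ∈ unitDisc
        · rw [hz h]
        · simp [dbar_zero_of_notMem (fun h2 => h (h3 h2))]
      have hF1 : ContDiffOn ℝ 1 F unitDisc := by
        have := (hF.contDiffOn (n := 1) isOpen_unitDisc)
        exact this.restrict_scalars ℝ
      rw [h4, ibp isOpen_unitDisc hF1 h1 h2 h3]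
      have : ∀ t, dbar F t * χ t = 0 := by
        intro t
        by_cases h : t ∈ unitDisc
        · rw [dbar_holo (hF.differentiableAt (isOpen_unitDisc.mem_nhds h)), zero_mul]
        · rw [image_eq_zero_of_notMem_tsupport (fun h2 => h (h3 h2)), mul_zero]
      simp [this]
    have h5 : inner ℂ k (f : Lp ℂ 2 (muW ω)) = 0 := this
    rw [hk] at h5
    have hpi : (Real.pi⁻¹ : ℂ) ≠ 0 := by simp [Real.pi_ne_zero]
    exact (mul_eq_zero.1 h5).resolve_left hpi
  have hloc : LocallyIntegrableOn (fun z => (f : Lp ℂ 2 (muW ω)) z) unitDisc := by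
    rw [locallyIntegrableOn_iff isOpen_unitDisc.isLocallyClosed]
    intro k hk hkc
    have h2 : Integrable (fun z => (f : Lp ℂ 2 (muW ω)) z) (muW ω) := (Lp.memLp _).integrable (by norm_num)
    replace h2 := (integrable_withDensity_iff_integrable_smul₀' (omega_aem hW le_rfl)
      (Eventually.of_forall fun z => ENNReal.ofReal_lt_top)).1 h2
    have h3 : IntegrableOn (fun z => (ENNReal.ofReal (ω z)).toReal • (f : Lp ℂ 2 (muW ω)) z) unitDisc := by
      unfold IntegrableOn
      rw [dA, Measure.restrict_smul] at h2
      exact (integrable_smul_measure (by simp) (by simp [Real.pi_pos])).1 h2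
    have h4 := (h3.mono_set hk).continuousOn_smul (((omega_contOn hW).mono hk).inv₀ (fun z hz => (hW.pos z (hk hz)).ne')) hkc
    refine h4.congr_fun ?_ hkc.measurableSet
    intro z hz
    have := hW.pos z (hk hz)
    simp only [ENNReal.toReal_ofReal this.le, smul_smul, Pi.inv_apply, inv_mul_cancel₀ this.ne', one_smul]
  obtain ⟨v, hv, h⟩ := weyl isOpen_unitDisc hloc hz
  exact ⟨v, hv, (ae_muW hW).2 h⟩
end
end

noncomputable section

/-- cutoff -/
def cutm (m : ℕ) (w : ℂ) : ℝ := min 1 (max 0 (m * (1 - ‖w‖) - 1))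

theorem cutm_cont (m : ℕ) : Continuous (cutm m) := by unfold cutm; fun_prop
theorem cutm_nonneg (m : ℕ) (w : ℂ) : 0 ≤ cutm m w := le_min zero_le_one (le_max_left _ _)
theorem cutm_le (m : ℕ) (w : ℂ) : cutm m w ≤ 1 := min_le_left _ _
theorem cutm_zero {m : ℕ} {w : ℂ} (h : m * (1 - ‖w‖) ≤ 1) : cutm m w = 0 := by
  unfold cutm; rw [max_eq_left (by linarith)]; simp
theorem cutm_lim {w : ℂ} (h : ‖w‖ < 1) : Tendsto (fun m => cutm m w) atTop (nhds 1) := by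
  obtain ⟨N, hN⟩ := exists_nat_gt (2 / (1 - ‖w‖))
  refine tendsto_const_nhds.congr' ?_
  filter_upwards [eventually_ge_atTop N] with m hm
  have h1 : (N : ℝ) ≤ m := by exact_mod_cast hm
  have h2 : 2 < m * (1 - ‖w‖) := by
    rw [div_lt_iff₀ (by linarith)] at hN
    nlinarith
  unfold cutm
  rw [max_eq_right (by linarith), min_eq_left (by linarith)]

section
variable {ω φ : ℂ → ℝ} {τ : ℝ → ℝ}

theorem omega_rad (hW : IsClassW ω φ τ) {z u : ℂ} (hz : z ∈ unitDisc) (hu : ‖u‖ = 1) : ω (u * z) = ω z := by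
  have h1 : u * z ∈ unitDisc := by rw [mem_unitDisc] at *; simpa [hu] using hz
  rw [hW.omega_eq z hz, hW.omega_eq _ h1, hW.radial _ h1 z hz (by simp [hu])]

theorem mv_omega (hW : IsClassW ω φ τ) (n : ℕ) {h : ℂ → ℂ} (hh : DifferentiableOn ℂ h unitDisc)
    (hi : IntegrableOn (fun w => ((ω w * ‖w‖ ^ (2 * n) : ℝ) : ℂ) * h w) unitDisc)
    (hi2 : IntegrableOn (fun w => ω w * ‖w‖ ^ (2 * n)) unitDisc) :
    ∫ w in unitDisc, ((ω w * ‖w‖ ^ (2 * n) : ℝ) : ℂ) * h w =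
      (∫ w in unitDisc, ω w * ‖w‖ ^ (2 * n) : ℝ) * h 0 := by
  have hωc := omega_contOn hW
  have key : ∀ m : ℕ, 1 ≤ m → ∫ w in unitDisc, (cutm m w : ℂ) * (((ω w * ‖w‖ ^ (2 * n) : ℝ) : ℂ) * h w) =
      (∫ w in unitDisc, cutm m w * (ω w * ‖w‖ ^ (2 * n)) : ℝ) * h 0 := by
    intro m hm
    have hm' : (1 : ℝ) ≤ m := by exact_mod_cast hm
    set k : ℂ → ℝ := fun w => cutm m w * (ω w * ‖w‖ ^ (2 * n)) with hk
    have hz : ∀ w : ℂ, 1 - 1 / (m : ℝ) ≤ ‖w‖ → k w = 0 := by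
      intro w hw
      simp only [hk]
      rw [cutm_zero, zero_mul]
      rw [← le_div_iff₀' (by linarith)]; linarith
    have hlt : 1 - 1 / (m : ℝ) < 1 := by
      have : 0 < 1 / (m : ℝ) := by positivity
      linarith
    have hkc : Continuous k := by
      refine (cont_of_supp isOpen_unitDisc (isCompact_closedBall (0 : ℂ) (1 - 1 / (m : ℝ))) ?_ ?_ ?_).1
      · intro w hw; rw [mem_unitDisc]; simp at hw ⊢; linarith [hlt, one_div (m : ℝ)]
      · exact (cutm_cont m).continuousOn.mul (hωc.mul (by fun_prop))
      · intro w hw; apply hz; simp at hw ⊢; linarith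
    have h1 := mv_radial (z := 0) hlt hh k hkc (by
      intro w u hu
      by_cases hw : w ∈ unitDisc
      · simp only [hk]; rw [omega_rad hW hw hu]; simp [cutm, hu]
      · rw [mem_unitDisc, not_lt] at hw
        rw [hz w (by linarith), hz _ (by rw [norm_mul, hu]; linarith)]) hz
    simp only [zero_add] at h1
    have hz' : ∀ w ∉ unitDisc, k w = 0 := fun w hw => hz w (by rw [mem_unitDisc, not_lt] at hw; linarith)
    rw [integral_complex_ofReal, int_U unitDisc _ hz', int_U unitDisc _ (fun w hw => by simp [hz' w hw])] at h1
    rw [← h1]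
    congr 1; funext w; simp only [hk]; push_cast; ring
  have hc : ∀ m, AEStronglyMeasurable (fun w => cutm m w) (volume.restrict unitDisc) :=
    fun m => (cutm_cont m).aestronglyMeasurable
  have ha : ∀ m w, ‖cutm m w‖ ≤ 1 := fun m w => by
    rw [Real.norm_of_nonneg (cutm_nonneg m w)]; exact cutm_le m w
  have l1 : Tendsto (fun m : ℕ => ∫ w in unitDisc, (cutm m w : ℂ) * (((ω w * ‖w‖ ^ (2 * n) : ℝ) : ℂ) * h w)) atTop
      (nhds (∫ w in unitDisc, ((ω w * ‖w‖ ^ (2 * n) : ℝ) : ℂ) * h w)) := by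
    refine tendsto_integral_of_dominated_convergence _
      (fun m => (Complex.continuous_ofReal.comp_aestronglyMeasurable (hc m)).mul hi.aestronglyMeasurable) hi.norm ?_ ?_
    · intro m; refine Eventually.of_forall fun w => ?_
      rw [norm_mul, Complex.norm_real]
      exact mul_le_of_le_one_left (norm_nonneg _) (ha m w)
    · refine (ae_restrict_iff' isOpen_unitDisc.measurableSet).2 (Eventually.of_forall fun w hw => ?_)
      have := (Complex.continuous_ofReal.tendsto _).comp (cutm_lim (mem_unitDisc.1 hw))
      simpa using this.mul_const (((ω w * ‖w‖ ^ (2 * n) : ℝ) : ℂ) * h w)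
  have l2 : Tendsto (fun m : ℕ => ∫ w in unitDisc, cutm m w * (ω w * ‖w‖ ^ (2 * n))) atTop
      (nhds (∫ w in unitDisc, ω w * ‖w‖ ^ (2 * n))) := by
    refine tendsto_integral_of_dominated_convergence _
      (fun m => (hc m).mul hi2.aestronglyMeasurable) hi2.norm ?_ ?_
    · intro m; refine Eventually.of_forall fun w => ?_
      rw [norm_mul]
      exact mul_le_of_le_one_left (norm_nonneg _) (ha m w)
    · refine (ae_restrict_iff' isOpen_unitDisc.measurableSet).2 (Eventually.of_forall fun w hw => ?_)
      simpa using (cutm_lim (mem_unitDisc.1 hw)).mul_const (ω w * ‖w‖ ^ (2 * n))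
  refine tendsto_nhds_unique l1 ?_
  have l3 := ((Complex.continuous_ofReal.tendsto _).comp l2).mul_const (h 0)
  refine l3.congr' ?_
  filter_upwards [eventually_ge_atTop 1] with m hm
  exact (key m hm).symm

theorem integral_muW (hW : IsClassW ω φ τ) (F : ℂ → ℂ) :
    ∫ z, F z ∂(muW ω) = (Real.pi⁻¹ : ℂ) * ∫ z in unitDisc, (ω z : ℂ) * F z := by
  refine (integral_withDensity_eq_integral_toReal_smul₀ (omega_aem hW le_rfl)
      (Eventually.of_forall fun z => ENNReal.ofReal_lt_top) _).trans ?_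
  rw [dA, Measure.restrict_smul, integral_smul_measure]
  rw [← ENNReal.ofReal_inv_of_pos Real.pi_pos, ENNReal.toReal_ofReal (by positivity), Complex.real_smul]
  push_cast
  congr 1
  refine setIntegral_congr_fun isOpen_unitDisc.measurableSet fun z hz => ?_
  simp only [ENNReal.toReal_ofReal (hW.pos z hz).le, Complex.real_smul]

theorem integrable_muW {F : ℂ → ℂ} (hW : IsClassW ω φ τ) (hF : Integrable F (muW ω)) :
    IntegrableOn (fun z => (ω z : ℂ) * F z) unitDisc := by
  have h2 := (integrable_withDensity_iff_integrable_smul₀' (omega_aem hW le_rfl)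
      (Eventually.of_forall fun z => ENNReal.ofReal_lt_top)).1 hF
  rw [dA, Measure.restrict_smul] at h2
  have h3 := (integrable_smul_measure (by simp) (by simp [Real.pi_pos])).1 h2
  refine IntegrableOn.congr_fun h3 ?_ isOpen_unitDisc.measurableSet
  intro z hz
  simp only [ENNReal.toReal_ofReal (hW.pos z hz).le, Complex.real_smul]

theorem bdd_memLp (hW : IsClassW ω φ τ) {F : ℂ → ℂ} (hF : ContinuousOn F unitDisc) {M : ℝ}
    (hM : ∀ z ∈ unitDisc, ‖F z‖ ≤ M) : MemLp F 2 (muW ω) := by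
  have := muW_finite hW
  refine MemLp.of_bound (aesm_contOn hW hF) M ?_
  exact (ae_muW hW).2 (Eventually.of_forall hM)

/-- element of Bergman space from a holomorphic `L²` function -/
theorem berg_mk {F : ℂ → ℂ} (hF : DifferentiableOn ℂ F unitDisc)
    (hm : MemLp F 2 (muW ω)) : ∃ f : bergmanH ω, ((f : Lp ℂ 2 (muW ω)) : ℂ → ℂ) =ᵐ[muW ω] F :=
  ⟨⟨hm.toLp F, Submodule.le_topologicalClosure _ ⟨F, hF, hm.coeFn_toLp⟩⟩, hm.coeFn_toLp⟩

/-- Bounded holomorphic functions. -/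
def hinf (ω : ℂ → ℝ) : Submodule ℂ (bergmanH ω) where
  carrier := {f | ∃ F : ℂ → ℂ, ∃ M : ℝ, DifferentiableOn ℂ F unitDisc ∧ (∀ z ∈ unitDisc, ‖F z‖ ≤ M) ∧
    ((f : Lp ℂ 2 (muW ω)) : ℂ → ℂ) =ᵐ[muW ω] F}
  zero_mem' := ⟨0, 0, differentiableOn_const 0, by simp, Lp.coeFn_zero ℂ 2 (muW ω)⟩
  add_mem' := by
    rintro a b ⟨F, M, hF, hM, ha⟩ ⟨G, N, hG, hN, hb⟩
    refine ⟨F + G, M + N, hF.add hG, fun z hz => (norm_add_le _ _).trans (add_le_add (hM z hz) (hN z hz)), ?_⟩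
    filter_upwards [Lp.coeFn_add (a : Lp ℂ 2 (muW ω)) (b : Lp ℂ 2 (muW ω)), ha, hb] with w h1 h2 h3
    rw [Submodule.coe_add, h1]; simp only [Pi.add_apply, h2, h3]
  smul_mem' := by
    rintro c a ⟨F, M, hF, hM, ha⟩
    refine ⟨c • F, ‖c‖ * M, hF.const_smul c, fun z hz => ?_, ?_⟩
    · rw [Pi.smul_apply, norm_smul]; exact mul_le_mul_of_nonneg_left (hM z hz) (norm_nonneg c)
    · filter_upwards [Lp.coeFn_smul c (a : Lp ℂ 2 (muW ω)), ha] with w h1 h2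
      rw [Submodule.coe_smul, h1]; simp only [Pi.smul_apply, h2]

theorem hinf_dense (hW : IsClassW ω φ τ) : Dense (hinf ω : Set (bergmanH ω)) := by
  have hfin := muW_finite hW
  rw [Submodule.dense_iff_topologicalClosure_eq_top, Submodule.topologicalClosure_eq_top_iff, Submodule.eq_bot_iff]
  intro f hf
  obtain ⟨F, hF, hfF⟩ := berg_rep hW f
  have h0 : (0 : ℂ) ∈ unitDisc := by rw [mem_unitDisc]; simp
  have hn0 : unitDisc ∈ nhds (0 : ℂ) := isOpen_unitDisc.mem_nhds h0
  have step : ∀ n : ℕ, ∃ h : ℂ → ℂ, DifferentiableOn ℂ h unitDisc ∧ ∀ z ∈ unitDisc, F z = z ^ n * h z := by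
    intro n
    induction n with
    | zero => exact ⟨F, hF, by simp⟩
    | succ n ih =>
      obtain ⟨h, hh, hFh⟩ := ih
      have hpd : DifferentiableOn ℂ (fun z : ℂ => z ^ n) unitDisc := by fun_prop
      have hpm : MemLp (fun z : ℂ => z ^ n) 2 (muW ω) := bdd_memLp hW hpd.continuousOn (M := 1) (by
        intro z hz; rw [mem_unitDisc] at hz; rw [norm_pow]; exact pow_le_one₀ (norm_nonneg _) hz.le)
      obtain ⟨q, hq⟩ := berg_mk hpd hpm
      have h1 : inner ℂ q f = 0 := hf q ⟨_, 1, hpd, (by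
        intro z hz; rw [mem_unitDisc] at hz; rw [norm_pow]; exact pow_le_one₀ (norm_nonneg _) hz.le), hq⟩
      have e0 : ∀ z : ℂ, (((‖z‖ ^ (2 * n) : ℝ) : ℂ)) = starRingEnd ℂ z ^ n * z ^ n := by
        intro z; rw [← mul_pow, ← Complex.normSq_eq_conj_mul_self, Complex.normSq_eq_norm_sq, pow_mul]; push_cast; ring
      have hint : Integrable (fun z => starRingEnd ℂ z ^ n * F z) (muW ω) := by
        have h3 : Integrable F (muW ω) := ((Lp.memLp (f : Lp ℂ 2 (muW ω))).ae_eq hfF).integrable (by norm_num)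
        refine h3.bdd_mul (c := 1) (Continuous.aestronglyMeasurable (by fun_prop)) ?_
        refine (ae_muW hW).2 (Eventually.of_forall fun z hz => ?_)
        rw [mem_unitDisc] at hz; rw [norm_pow, RCLike.norm_conj]; exact pow_le_one₀ (norm_nonneg _) hz.le
      have hint2 : Integrable (fun z => ((‖z‖ ^ (2 * n) : ℝ) : ℂ)) (muW ω) := by
        refine (bdd_memLp hW (Continuous.continuousOn (by fun_prop)) (M := 1) ?_).integrable (by norm_num)
        intro z hz; rw [mem_unitDisc] at hz; rw [Complex.norm_real, norm_pow, norm_norm]; exact pow_le_one₀ (norm_nonneg _) hz.le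
      have i1 := integrable_muW hW hint
      have i2 := integrable_muW hW hint2
      have e1 : ∀ z ∈ unitDisc, (ω z : ℂ) * (starRingEnd ℂ z ^ n * F z) = ((ω z * ‖z‖ ^ (2 * n) : ℝ) : ℂ) * h z := by
        intro z hz
        rw [hFh z hz, Complex.ofReal_mul, e0]; ring
      have i2' : IntegrableOn (fun w => ω w * ‖w‖ ^ (2 * n)) unitDisc := by
        have := i2.re
        refine this.congr (Eventually.of_forall fun z => ?_)
        simp only [← Complex.ofReal_mul]; exact Complex.ofReal_re _
      have h4 : ∫ z, starRingEnd ℂ z ^ n * F z ∂(muW ω) = 0 := by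
        rw [← h1, Submodule.coe_inner, L2.inner_def]
        apply integral_congr_ae
        filter_upwards [hq, hfF] with z e1 e2
        rw [e1, e2]; simp [mul_comm]
      rw [integral_muW hW, setIntegral_congr_fun isOpen_unitDisc.measurableSet e1,
        mv_omega hW n hh (i1.congr_fun e1 isOpen_unitDisc.measurableSet) i2'] at h4
      have hpi : (Real.pi⁻¹ : ℂ) ≠ 0 := by simp [Real.pi_ne_zero]
      have hpos : 0 < ∫ w in unitDisc, ω w * ‖w‖ ^ (2 * n) := by
        rw [setIntegral_pos_iff_support_of_nonneg_ae ?_ i2']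
        · have hs : unitDisc \ {0} ⊆ Function.support (fun w => ω w * ‖w‖ ^ (2 * n)) ∩ unitDisc := by
            rintro w ⟨hw, hw0⟩
            refine ⟨?_, hw⟩
            have := hW.pos w hw
            have h5 : 0 < ‖w‖ := norm_pos_iff.2 hw0
            exact (by positivity : ω w * ‖w‖ ^ (2 * n) ≠ 0)
          refine lt_of_lt_of_le ?_ (measure_mono hs)
          rw [measure_sdiff_null (measure_singleton _)]
          exact isOpen_unitDisc.measure_pos _ ⟨0, h0⟩
        · refine (ae_restrict_iff' isOpen_unitDisc.measurableSet).2 (Eventually.of_forall fun w hw => ?_)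
          have := hW.pos w hw
          exact (by positivity : 0 ≤ ω w * ‖w‖ ^ (2 * n))
      have h6 : h 0 = 0 := by
        have h7 := (mul_eq_zero.1 h4).resolve_left hpi
        exact (mul_eq_zero.1 h7).resolve_left (by exact_mod_cast hpos.ne')
      refine ⟨dslope h 0, (Complex.differentiableOn_dslope hn0).2 hh, fun z hz => ?_⟩
      have h8 := sub_smul_dslope h 0 z
      rw [h6, sub_zero, sub_zero, smul_eq_mul] at h8
      rw [hFh z hz, ← h8]; ring
  have hA : AnalyticOnNhd ℂ F unitDisc := hF.analyticOnNhd isOpen_unitDisc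
  have htop : analyticOrderAt F 0 = ⊤ := by
    rw [ENat.eq_top_iff_forall_ge]
    intro n
    rw [natCast_le_analyticOrderAt (hA 0 h0)]
    obtain ⟨h, hh, hFh⟩ := step n
    refine ⟨h, hh.analyticOnNhd isOpen_unitDisc 0 h0, ?_⟩
    filter_upwards [hn0] with z hz
    simp [hFh z hz]
  have hz := hA.eqOn_zero_of_preconnected_of_eventuallyEq_zero
    (convex_ball (0 : ℂ) 1).isPreconnected h0 (analyticOrderAt_eq_top.1 htop)
  apply Subtype.ext
  apply Lp.ext
  have hF0 : F =ᵐ[muW ω] (0 : ℂ → ℂ) := (ae_muW hW).2 (Eventually.of_forall fun z h => hz h)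
  exact hfF.trans (hF0.trans (Lp.coeFn_zero ℂ 2 (muW ω)).symm)
end
end

noncomputable section

section
variable {ω φ : ℂ → ℝ} {τ : ℝ → ℝ}

theorem phi_fd (hW : IsClassW ω φ τ) {z : ℂ} (hz : z ∈ unitDisc) :
    DifferentiableAt ℝ φ z ∧ DifferentiableAt ℝ (fderiv ℝ φ) z := by
  have h1 := hW.smooth.contDiffAt (isOpen_unitDisc.mem_nhds hz)
  refine ⟨h1.differentiableAt (by norm_num), ?_⟩
  have h2 : ContDiffOn ℝ 1 (fderiv ℝ φ) unitDisc := hW.smooth.fderiv_of_isOpen isOpen_unitDisc (by norm_num)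
  exact (h2.contDiffAt (isOpen_unitDisc.mem_nhds hz)).differentiableAt (by norm_num)

theorem rad_tangent (hW : IsClassW ω φ τ) {z : ℂ} (hz : z ∈ unitDisc) :
    fderiv ℝ φ z (Complex.I * z) = 0 := by
  have h1 : HasDerivAt (fun θ : ℝ => Complex.exp (θ * Complex.I) * z) (Complex.I * z) 0 := by
    have h2 : HasDerivAt (fun θ : ℝ => (θ : ℂ) * Complex.I) Complex.I 0 := by
      simpa using (Complex.ofRealCLM.hasDerivAt (x := (0 : ℝ))).mul_const Complex.I
    have h3 := (h2.cexp).mul_const z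
    simpa using h3
  have h4 : HasFDerivAt φ (fderiv ℝ φ z) (Complex.exp ((0 : ℝ) * Complex.I) * z) := by
    simpa using (phi_fd hW hz).1.hasFDerivAt
  have h5 := h4.comp_hasDerivAt (0 : ℝ) h1
  have h6 : (φ ∘ fun θ : ℝ => Complex.exp (θ * Complex.I) * z) = fun _ => φ z := by
    funext θ
    have hn : ‖Complex.exp (θ * Complex.I) * z‖ = ‖z‖ := by simp [Complex.norm_exp_ofReal_mul_I]
    exact hW.radial _ (by rw [mem_unitDisc, hn]; exact mem_unitDisc.1 hz) z hz hn
  rw [h6] at h5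
  exact h5.unique (hasDerivAt_const _ _)

/-- `X(r) = r ψ'(r)`. -/
def Xr (φ : ℂ → ℝ) (r : ℝ) : ℝ := r * fderiv ℝ φ (r : ℂ) 1

theorem real_mem {r : ℝ} (hr : |r| < 1) : (r : ℂ) ∈ unitDisc := by
  rw [mem_unitDisc, Complex.norm_real]; exact hr

theorem Xr_deriv (hW : IsClassW ω φ τ) {r : ℝ} (hr : |r| < 1) :
    HasDerivAt (Xr φ) (r * laplacian φ r) r := by
  have hz := real_mem hr
  obtain ⟨d1, d2⟩ := phi_fd hW hz
  set A := fderiv ℝ (fderiv ℝ φ) (r : ℂ) with hA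
  have hA' : HasFDerivAt (fderiv ℝ φ) A (r : ℂ) := d2.hasFDerivAt
  have hv : ∀ v u, fderiv ℝ (fun w => fderiv ℝ φ w v) (r : ℂ) u = A u v := by
    intro v u
    have := (hA'.clm_apply (hasFDerivAt_const v (r : ℂ))).fderiv
    rw [this]; simp
  have hyy : r * A Complex.I Complex.I = fderiv ℝ φ (r : ℂ) 1 := by
    have h1 : HasFDerivAt (fun w : ℂ => Complex.I * w) ((ContinuousLinearMap.mul ℝ ℂ Complex.I)) (r : ℂ) :=
      (ContinuousLinearMap.mul ℝ ℂ Complex.I).hasFDerivAt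
    have h2 := hA'.clm_apply h1
    have h3 : (fun w => fderiv ℝ φ w (Complex.I * w)) =ᶠ[nhds (r : ℂ)] fun _ => 0 := by
      filter_upwards [isOpen_unitDisc.mem_nhds hz] with w hw using rad_tangent hW hw
    have h4 := h2.congr_of_eventuallyEq h3.symm
    have h5 := h4.unique (hasFDerivAt_const (0 : ℝ) (r : ℂ))
    have h6 := congrArg (fun L => L Complex.I) h5
    simp only [_root_.add_apply, ContinuousLinearMap.comp_apply, ContinuousLinearMap.mul_apply',
      ContinuousLinearMap.flip_apply, Complex.I_mul_I, _root_.zero_apply] at h6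
    have h7 : Complex.I * (r : ℂ) = r • Complex.I := by rw [Complex.real_smul, mul_comm]
    rw [h7, map_smul, smul_eq_mul, map_neg] at h6
    linarith
  have hx : HasDerivAt (fun s : ℝ => fderiv ℝ φ (s : ℂ) 1) (A 1 1) r := by
    have h1 := hA'.clm_apply (hasFDerivAt_const (1 : ℂ) (r : ℂ))
    have h2 := h1.comp_hasDerivAt r (Complex.ofRealCLM.hasDerivAt (x := r))
    simp at h2
    exact h2
  have h3 := (hasDerivAt_id r).mul hx
  have h4 : r * laplacian φ r = 1 * fderiv ℝ φ (r : ℂ) 1 + id r * A 1 1 := by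
    unfold laplacian
    rw [hv, hv, mul_add, hyy]; simp [add_comm]
  rw [h4]
  exact h3

/-- `ψ(r) = φ(r)` -/
def psi (φ : ℂ → ℝ) (r : ℝ) : ℝ := φ (r : ℂ)

theorem psi_deriv (hW : IsClassW ω φ τ) {r : ℝ} (hr : |r| < 1) (h0 : r ≠ 0) :
    HasDerivAt (psi φ) (Xr φ r / r) r := by
  have h := (phi_fd hW (real_mem hr)).1.hasFDerivAt.comp_hasDerivAt r (Complex.ofRealCLM.hasDerivAt (x := r))
  have : Xr φ r / r = fderiv ℝ φ (r : ℂ) 1 := by unfold Xr; field_simp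
  rw [this]
  simp at h
  exact h

theorem phi_psi (hW : IsClassW ω φ τ) {z : ℂ} (hz : z ∈ unitDisc) : φ z = psi φ ‖z‖ := by
  have hz' := mem_unitDisc.1 hz
  exact hW.radial z hz _ (real_mem (by simpa using hz')) (by simp)

theorem omega_psi (hW : IsClassW ω φ τ) {z : ℂ} (hz : z ∈ unitDisc) :
    Real.sqrt (ω z) = Real.exp (- psi φ ‖z‖) := by
  rw [hW.omega_eq z hz, phi_psi hW hz, Real.sqrt_eq_iff_mul_self_eq (Real.exp_pos _).le (Real.exp_pos _).le, ← Real.exp_add]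
  ring_nf

theorem lap_bd (hW : IsClassW ω φ τ) : ∃ C : ℝ, 1 ≤ C ∧ ∀ z ∈ unitDisc,
    1 / (C * τ ‖z‖ ^ 2) ≤ laplacian φ z ∧ laplacian φ z ≤ C / τ ‖z‖ ^ 2 := by
  obtain ⟨C, hC, h⟩ := hW.comp
  refine ⟨C ^ 2, one_le_pow₀ hC, fun z hz => ?_⟩
  have hL := hW.lap_pos z hz
  have ht := hW.tau_pos ‖z‖ ⟨norm_nonneg _, mem_unitDisc.1 hz⟩
  obtain ⟨h1, h2⟩ := h z hz
  set L := laplacian φ z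
  have e : L ^ (-(1 / 2 : ℝ)) = 1 / Real.sqrt L := by
    rw [Real.rpow_neg hL.le, ← Real.sqrt_eq_rpow, one_div]
  rw [e] at h1 h2
  have hs := Real.sqrt_pos.2 hL
  have hs2 := Real.sq_sqrt hL.le
  constructor
  · rw [div_le_iff₀ hs] at h2
    have h3 : 1 ≤ (C * τ ‖z‖ * Real.sqrt L) ^ 2 := one_le_pow₀ h2
    rw [div_le_iff₀ (by positivity)]
    rw [mul_pow, hs2] at h3; nlinarith
  · rw [div_le_div_iff₀ (by linarith) hs, one_mul] at h1
    rw [le_div_iff₀ (by positivity), ← hs2]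
    nlinarith [mul_pos ht hs]
end
end

noncomputable section

section
variable {τC : ℂ → ℝ} {c₁ c₂ δ : ℝ}

theorem mTau_bds (hL : IsClassL τC c₁ c₂) : 0 < mTau c₁ c₂ ∧ mTau c₁ c₂ ≤ 1 / 4 ∧ c₁ * mTau c₁ c₂ ≤ 1 / 4 ∧
    c₂ * mTau c₁ c₂ ≤ 1 / 4 := by
  have h1 := hL.c₁_pos
  have h2 := hL.c₂_pos
  unfold mTau
  refine ⟨by positivity, ?_, ?_, ?_⟩
  · have : min 1 (min c₁⁻¹ c₂⁻¹) ≤ 1 := min_le_left _ _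
    linarith
  · have : min 1 (min c₁⁻¹ c₂⁻¹) ≤ c₁⁻¹ := (min_le_right _ _).trans (min_le_left _ _)
    have h3 := mul_le_mul_of_nonneg_left this h1.le
    rw [mul_inv_cancel₀ h1.ne'] at h3; linarith
  · have : min 1 (min c₁⁻¹ c₂⁻¹) ≤ c₂⁻¹ := (min_le_right _ _).trans (min_le_right _ _)
    have h3 := mul_le_mul_of_nonneg_left this h2.le
    rw [mul_inv_cancel₀ h2.ne'] at h3; linarith

theorem rad_le (hL : IsClassL τC c₁ c₂) (hδ0 : 0 ≤ δ) (hδ : δ ≤ mTau c₁ c₂) {z : ℂ} (hz : z ∈ unitDisc) :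
    δ * τC z ≤ (1 - ‖z‖) / 4 := by
  obtain ⟨m0, m1, m2, m3⟩ := mTau_bds hL
  have h1 := hL.upper z hz
  have h2 := hL.pos z hz
  have h3 := mem_unitDisc.1 hz
  have h4 : δ * τC z ≤ mTau c₁ c₂ * (c₁ * (1 - ‖z‖)) := mul_le_mul hδ h1 h2.le m0.le
  nlinarith

theorem mem_disc_of (hL : IsClassL τC c₁ c₂) (hδ0 : 0 ≤ δ) (hδ : δ ≤ mTau c₁ c₂) {z w : ℂ} (hz : z ∈ unitDisc)
    {s : ℝ} (hs0 : 0 ≤ s) (hs : s < 4) (h : ‖w - z‖ ≤ s * (δ * τC z)) : w ∈ unitDisc := by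
  have h1 := rad_le hL hδ0 hδ hz
  have h3 := mem_unitDisc.1 hz
  rw [mem_unitDisc]
  have h4 : ‖w‖ ≤ ‖z‖ + ‖w - z‖ := by simpa using norm_add_le z (w - z)
  nlinarith

theorem ball_sub_disc (hL : IsClassL τC c₁ c₂) (hδ0 : 0 ≤ δ) (hδ : δ ≤ mTau c₁ c₂) {z : ℂ} (hz : z ∈ unitDisc)
    {s : ℝ} (hs0 : 0 ≤ s) (hs : s < 4) : Metric.ball z (s * (δ * τC z)) ⊆ unitDisc := fun w hw =>
  mem_disc_of hL hδ0 hδ hz hs0 hs (by rw [Metric.mem_ball, dist_eq_norm] at hw; exact hw.le)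

theorem ball_sub_disc1 (hL : IsClassL τC c₁ c₂) (hδ0 : 0 ≤ δ) (hδ : δ ≤ mTau c₁ c₂) {z : ℂ} (hz : z ∈ unitDisc) :
    Metric.ball z (δ * τC z) ⊆ unitDisc := by
  have := ball_sub_disc hL hδ0 hδ hz (s := 1) (by norm_num) (by norm_num)
  rwa [one_mul] at this

theorem tau_cmp (hL : IsClassL τC c₁ c₂) (hδ0 : 0 ≤ δ) (hδ : δ ≤ mTau c₁ c₂) {z w : ℂ} (hz : z ∈ unitDisc)
    (hw : w ∈ unitDisc)
    {s : ℝ} (hs0 : 0 ≤ s) (h : ‖w - z‖ ≤ s * (δ * τC z)) : |τC w - τC z| ≤ s / 4 * τC z := by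
  obtain ⟨m0, m1, m2, m3⟩ := mTau_bds hL
  have h1 := hL.lip w hw z hz
  have h2 := hL.pos z hz
  have h3 : c₂ * ‖w - z‖ ≤ c₂ * (s * (δ * τC z)) := mul_le_mul_of_nonneg_left h hL.c₂_pos.le
  have h4 : c₂ * δ ≤ 1 / 4 := (mul_le_mul_of_nonneg_left hδ hL.c₂_pos.le).trans m3
  have h5 : c₂ * δ * (s * τC z) ≤ 1 / 4 * (s * τC z) := mul_le_mul_of_nonneg_right h4 (by positivity)
  nlinarith
end

section
variable {ω φ : ℂ → ℝ} {τ : ℝ → ℝ} {c₁ c₂ : ℝ}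

theorem Xr_mono (hW : IsClassW ω φ τ) : MonotoneOn (Xr φ) (Ico 0 1) := by
  apply monotoneOn_of_hasDerivWithinAt_nonneg (f' := fun r => r * laplacian φ r) (convex_Ico 0 1)
  · intro r hr
    exact (Xr_deriv hW (by rw [abs_of_nonneg hr.1]; exact hr.2)).continuousAt.continuousWithinAt
  · intro r hr
    rw [interior_Ico] at hr
    exact (Xr_deriv hW (by rw [abs_of_pos hr.1]; exact hr.2)).hasDerivWithinAt
  · intro r hr
    rw [interior_Ico] at hr
    exact mul_nonneg hr.1.le (hW.lap_pos _ (real_mem (by rw [abs_of_pos hr.1]; exact hr.2))).le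

theorem Xr_nonneg (hW : IsClassW ω φ τ) {r : ℝ} (hr : r ∈ Ico (0 : ℝ) 1) : 0 ≤ Xr φ r := by
  have := Xr_mono hW (show (0 : ℝ) ∈ Ico (0 : ℝ) 1 by simp) hr hr.1
  simpa [Xr] using this

theorem tau_real_lip (hL : IsClassL (radialize τ) c₁ c₂) {r s : ℝ} (hr : r ∈ Ico (0 : ℝ) 1) (hs : s ∈ Ico (0 : ℝ) 1) :
    |τ r - τ s| ≤ c₂ * |r - s| := by
  have h := hL.lip (r : ℂ) (real_mem (by rw [abs_of_nonneg hr.1]; exact hr.2)) (s : ℂ)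
    (real_mem (by rw [abs_of_nonneg hs.1]; exact hs.2))
  rw [← Complex.ofReal_sub, Complex.norm_real] at h
  simpa [radialize, abs_of_nonneg hr.1, abs_of_nonneg hs.1] using h

/-- second-order estimate for the potential. -/
theorem psi_taylor (hW : IsClassW ω φ τ) (hL : IsClassL (radialize τ) c₁ c₂) : ∃ K : ℝ, 0 ≤ K ∧ ∀ s r : ℝ,
    1 / 2 ≤ s → s < 1 → 1 / 8 ≤ r → r < 1 → |r - s| ≤ 3 * (mTau c₁ c₂ * τ s) →
    |psi φ s + Xr φ s * Real.log (r / s) - psi φ r| ≤ K := by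
  obtain ⟨C, hC, hl⟩ := lap_bd hW
  obtain ⟨m0, m1, m2, m3⟩ := mTau_bds hL
  refine ⟨128 * C, by positivity, fun s r hs hs1 hr hr1 hrs => ?_⟩
  have hts := hW.tau_pos s ⟨by linarith, hs1⟩
  set d := 3 * (mTau c₁ c₂ * τ s) with hd
  have hd1 : d ≤ 3 / 4 * τ s := by nlinarith
  have hd0 : 0 ≤ d := by positivity
  have hmem : ∀ ξ ∈ uIcc s r, 1 / 8 ≤ ξ ∧ ξ < 1 ∧ |ξ - s| ≤ |r - s| := by
    intro ξ hξ
    refine ⟨le_trans (le_min (by linarith) hr) hξ.1, lt_of_le_of_lt hξ.2 (max_lt hs1 hr1), ?_⟩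
    exact abs_sub_left_of_mem_uIcc hξ
  have htau : ∀ ξ ∈ uIcc s r, τ s / 4 ≤ τ ξ := by
    intro ξ hξ
    obtain ⟨h1, h2, h3⟩ := hmem ξ hξ
    have h4 := tau_real_lip hL (r := ξ) (s := s) ⟨by linarith, h2⟩ ⟨by linarith, hs1⟩
    have h5 : c₂ * |ξ - s| ≤ c₂ * d := mul_le_mul_of_nonneg_left (h3.trans hrs) hL.c₂_pos.le
    have h6 : c₂ * d ≤ 3 / 4 * τ s := by
      have : c₂ * d = 3 * (c₂ * mTau c₁ c₂) * τ s := by rw [hd]; ring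
      rw [this]; nlinarith
    have := (abs_le.1 (h4.trans (h5.trans h6))).1
    linarith
  have hX : ∀ ξ ∈ uIcc s r, |Xr φ ξ - Xr φ s| ≤ 16 * C / τ s ^ 2 * d := by
    intro ξ hξ
    have := Convex.norm_image_sub_le_of_norm_hasDerivWithin_le (f := Xr φ) (f' := fun r => r * laplacian φ r)
      (s := uIcc s r) (C := 16 * C / τ s ^ 2) (x := s) (y := ξ) ?_ ?_ (convex_uIcc s r) left_mem_uIcc hξ
    · rw [Real.norm_eq_abs, Real.norm_eq_abs] at this
      refine this.trans ?_
      gcongr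
      exact (hmem ξ hξ).2.2.trans hrs
    · intro x hx
      obtain ⟨h1, h2, h3⟩ := hmem x hx
      exact (Xr_deriv hW (by rw [abs_of_nonneg (by linarith)]; exact h2)).hasDerivWithinAt
    · intro x hx
      obtain ⟨h1, h2, h3⟩ := hmem x hx
      have hx1 := real_mem (r := x) (by rw [abs_of_nonneg (by linarith)]; exact h2)
      have h4 := (hl _ hx1).2
      have h5 := hW.lap_pos _ hx1
      rw [Complex.norm_real, Real.norm_of_nonneg (by linarith : 0 ≤ x)] at h4
      rw [Real.norm_of_nonneg (by positivity)]
      have h6 := htau x hx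
      calc x * laplacian φ x ≤ 1 * laplacian φ x := by gcongr
        _ ≤ C / τ x ^ 2 := by rw [one_mul]; exact h4
        _ ≤ C / (τ s / 4) ^ 2 := by gcongr
        _ = _ := by field_simp; norm_num
  have hH := Convex.norm_image_sub_le_of_norm_hasDerivWithin_le
      (f := fun ξ => psi φ s + Xr φ s * Real.log (ξ / s) - psi φ ξ) (f' := fun ξ => Xr φ s / ξ - Xr φ ξ / ξ)
      (s := uIcc s r) (C := 8 * (16 * C / τ s ^ 2 * d)) (x := s) (y := r) ?_ ?_ (convex_uIcc s r) left_mem_uIcc right_mem_uIcc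
  · simp only [div_self (by linarith : s ≠ 0), Real.log_one, mul_zero, add_zero, sub_self, sub_zero, Real.norm_eq_abs] at hH
    refine hH.trans ?_
    calc 8 * (16 * C / τ s ^ 2 * d) * |r - s| ≤ 8 * (16 * C / τ s ^ 2 * d) * d := by gcongr
      _ = 128 * C * (d / τ s) ^ 2 := by field_simp; ring
      _ ≤ 128 * C * 1 ^ 2 := by
          gcongr
          rw [div_le_one hts]; linarith
      _ = _ := by ring
  · intro x hx
    obtain ⟨h1, h2, h3⟩ := hmem x hx
    have hx0 : x ≠ 0 := by linarith
    have e1 := psi_deriv hW (r := x) (by rw [abs_of_nonneg (by linarith)]; exact h2) hx0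
    have e2 : HasDerivAt (fun ξ => Real.log (ξ / s)) (1 / x) x := by
      have := ((hasDerivAt_id x).div_const s).log (by simp; constructor <;> linarith)
      have h4 : (1 : ℝ) / s / (id x / s) = 1 / x := by simp only [id]; field_simp
      rw [h4] at this; exact this
    have e3 := (((e2.const_mul (Xr φ s)).const_add (psi φ s)).sub e1)
    have : Xr φ s * (1 / x) - Xr φ x / x = Xr φ s / x - Xr φ x / x := by ring
    rw [this] at e3
    exact e3.hasDerivWithinAt
  · intro x hx
    obtain ⟨h1, h2, h3⟩ := hmem x hx
    rw [← sub_div, Real.norm_eq_abs, abs_div, abs_of_pos (by linarith : 0 < x), div_le_iff₀ (by linarith), abs_sub_comm]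
    have := hX x hx
    have h4 : 0 ≤ 16 * C / τ s ^ 2 * d := by positivity
    nlinarith

theorem LW (hW : IsClassW ω φ τ) (hL : IsClassL (radialize τ) c₁ c₂) : ∃ C : ℝ, 1 ≤ C ∧ ∀ a ∈ unitDisc,
    ∃ E : ℂ → ℂ, Differentiable ℂ E ∧ ∀ z ∈ unitDisc, ‖z - a‖ ≤ 3 * (mTau c₁ c₂ * radialize τ a) →
      E z ≠ 0 ∧ C⁻¹ ≤ ‖E z‖ ^ 2 * ω z ∧ ‖E z‖ ^ 2 * ω z ≤ C := by
  obtain ⟨K, hK0, hK⟩ := psi_taylor hW hL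
  obtain ⟨m0, m1, m2, m3⟩ := mTau_bds hL
  have hsub : Metric.closedBall (0 : ℂ) (7 / 8) ⊆ unitDisc := by
    intro z hz; rw [mem_unitDisc]; simp at hz; linarith
  obtain ⟨z1, hz1, hmax⟩ := (isCompact_closedBall (0 : ℂ) (7 / 8)).exists_isMaxOn (f := ω) ⟨0, by simp; norm_num⟩
    ((omega_contOn hW).mono hsub)
  obtain ⟨z2, hz2, hmin⟩ := (isCompact_closedBall (0 : ℂ) (7 / 8)).exists_isMinOn (f := ω) ⟨0, by simp; norm_num⟩
    ((omega_contOn hW).mono hsub)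
  have hp1 := hW.pos z1 (hsub hz1)
  have hp2 := hW.pos z2 (hsub hz2)
  set K1 := K + Real.log 8 with hK1
  refine ⟨max (Real.exp (2 * K1)) (max 1 (max (ω z1) (ω z2)⁻¹)), (le_max_left _ _).trans (le_max_right _ _), fun a ha => ?_⟩
  set C := max (Real.exp (2 * K1)) (max 1 (max (ω z1) (ω z2)⁻¹)) with hC
  have hC1 : Real.exp (2 * K1) ≤ C := le_max_left _ _
  have hC2 : ω z1 ≤ C := (le_max_left _ _).trans ((le_max_right _ _).trans (le_max_right _ _))
  have hC3 : (ω z2)⁻¹ ≤ C := (le_max_right _ _).trans ((le_max_right _ _).trans (le_max_right _ _))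
  have ha1 := mem_unitDisc.1 ha
  have hrl := rad_le hL m0.le le_rfl ha
  by_cases hs : 1 / 2 ≤ ‖a‖
  · have ha0 : a ≠ 0 := by intro h; rw [h] at hs; norm_num at hs
    set s := ‖a‖ with hsd
    set n := ⌈Xr φ s⌉₊ with hn
    have hx0 := Xr_nonneg hW (r := s) ⟨by linarith, ha1⟩
    refine ⟨fun z => (Real.exp (psi φ s) : ℂ) * (z / a) ^ n, by fun_prop, fun z hz hza => ?_⟩
    set r := ‖z‖ with hrd
    have hr1 := mem_unitDisc.1 hz
    have hrs : |r - s| ≤ ‖z - a‖ := abs_norm_sub_norm_le z a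
    have hr : 1 / 8 ≤ r := by
      have := (abs_le.1 hrs).1
      linarith
    have h1 := hK s r hs ha1 hr hr1 (hrs.trans hza)
    have hlog : |Real.log (r / s)| ≤ Real.log 8 := by
      rw [abs_le, ← Real.log_inv]
      constructor
      · apply Real.log_le_log (by norm_num)
        rw [le_div_iff₀ (by linarith)]; linarith
      · apply Real.log_le_log (div_pos (by linarith) (by linarith))
        rw [div_le_iff₀ (by linarith)]; linarith
    have hn1 : |(n : ℝ) - Xr φ s| ≤ 1 := by
      rw [abs_le]
      constructor
      · linarith [Nat.le_ceil (Xr φ s)]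
      · linarith [Nat.ceil_lt_add_one hx0]
    have hb : |psi φ s + n * Real.log (r / s) - psi φ r| ≤ K1 := by
      have e : psi φ s + n * Real.log (r / s) - psi φ r = (psi φ s + Xr φ s * Real.log (r / s) - psi φ r) +
        ((n : ℝ) - Xr φ s) * Real.log (r / s) := by ring
      rw [e, hK1]
      refine (abs_add_le _ _).trans (add_le_add h1 ?_)
      rw [abs_mul]
      calc _ ≤ 1 * Real.log 8 := by gcongr
        _ = _ := one_mul _
    have hval : ‖(Real.exp (psi φ s) : ℂ) * (z / a) ^ n‖ ^ 2 * ω z =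
        Real.exp (2 * (psi φ s + n * Real.log (r / s) - psi φ r)) := by
      have hrs0 : 0 < r / s := div_pos (by linarith) (by linarith)
      rw [norm_mul, Complex.norm_real, Real.norm_of_nonneg (Real.exp_pos _).le, norm_pow, norm_div,
        hW.omega_eq z hz, phi_psi hW hz, ← hrd, ← hsd]
      have : (r / s) ^ n = Real.exp (n * Real.log (r / s)) := by
        rw [mul_comm, Real.exp_mul, Real.exp_log hrs0, Real.rpow_natCast]
      rw [this, ← Real.exp_add, ← Real.exp_nat_mul, ← Real.exp_add]
      congr 1; push_cast; ring
    have hz0 : z ≠ 0 := by intro h; rw [hrd, h] at hr; norm_num at hr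
    refine ⟨?_, ?_, ?_⟩
    · exact mul_ne_zero (by exact_mod_cast (Real.exp_pos _).ne') (pow_ne_zero _ (div_ne_zero hz0 ha0))
    · rw [hval]
      calc C⁻¹ ≤ (Real.exp (2 * K1))⁻¹ := by gcongr
        _ = Real.exp (-(2 * K1)) := (Real.exp_neg _).symm
        _ ≤ _ := by gcongr; linarith [(abs_le.1 hb).1]
    · rw [hval]
      refine le_trans ?_ hC1
      gcongr; exact (abs_le.1 hb).2
  · refine ⟨fun _ => 1, by fun_prop, fun z hz hza => ?_⟩
    have hz' : z ∈ Metric.closedBall (0 : ℂ) (7 / 8) := by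
      have h4 : ‖z‖ ≤ ‖a‖ + ‖z - a‖ := by simpa using norm_add_le a (z - a)
      simp; linarith
    simp only [norm_one, one_pow, one_mul]
    refine ⟨one_ne_zero, ?_, (hmax hz').trans hC2⟩
    exact (inv_le_of_inv_le₀ hp2 hC3).trans (hmin hz')
end
end

noncomputable section
section
variable {ω φ : ℂ → ℝ} {τ : ℝ → ℝ} {c₁ c₂ : ℝ}

theorem tf_growth (hW : IsClassW ω φ τ) (A : ℝ) (hA : 0 ≤ A) : ∃ K r0 : ℝ, 1 / 2 ≤ r0 ∧ r0 < 1 ∧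
    (∀ s, r0 ≤ s → s < 1 → τ s ≤ 1) ∧
    ∀ s r : ℝ, r0 ≤ s → s ≤ r → r < 1 →
      psi φ s - psi φ r + Xr φ s * Real.log (r / s) + A * ((r - s) / τ s) + 5 * Real.log (τ s / τ r) ≤ K := by
  obtain ⟨C, hC, hl⟩ := lap_bd hW
  set b := 1 / (2 * C) with hb
  have hb0 : 0 < b := by positivity
  have hb1 : b ≤ 1 / 2 := by
    rw [hb]; apply one_div_le_one_div_of_le <;> linarith
  set ε := b / 10 with hε
  have hε0 : 0 < ε := by positivity
  have hev1 : ∀ᶠ r in nhdsWithin 1 (Set.Iio 1), |deriv τ r| < ε := by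
    have := hW.tau_deriv_lim.abs
    rw [abs_zero] at this
    exact this.eventually (gt_mem_nhds hε0)
  have hev2 : ∀ᶠ r in nhdsWithin 1 (Set.Iio 1), τ r < 1 := hW.tau_lim.eventually (gt_mem_nhds one_pos)
  obtain ⟨l, hl1, hlI⟩ := (mem_nhdsLT_iff_exists_Ioo_subset (a := (1:ℝ))).1 (hev1.and hev2)
  have hl1' : l < 1 := hl1
  set r0 := max (1 / 2) ((l + 1) / 2) with hr0
  have hr0l : l < r0 := lt_of_lt_of_le (by linarith) (le_max_right _ _)
  have hr0h : 1 / 2 ≤ r0 := le_max_left _ _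
  refine ⟨(A + 5) ^ 2 / b, r0, hr0h, max_lt (by norm_num) (by linarith), ?_, ?_⟩
  · intro s hs hs1
    exact (hlI ⟨by linarith, hs1⟩).2.le
  intro s r hs hsr hr1
  have hts : 0 < τ s := hW.tau_pos s ⟨by linarith, by linarith⟩
  have hpos : ∀ x ∈ Ico s 1, 0 < τ x := fun x hx => hW.tau_pos x ⟨by linarith [hx.1], hx.2⟩
  have hle : ∀ x ∈ Ico s 1, τ x ≤ τ s := fun x hx => hW.tau_anti ⟨by linarith, by linarith [hx.1, hx.2]⟩ ⟨by linarith [hx.1], hx.2⟩ hx.1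
  have hdX : ∀ x ∈ Ico s 1, HasDerivAt (Xr φ) (x * laplacian φ x) x := fun x hx =>
    Xr_deriv hW (by rw [abs_of_nonneg (by linarith [hx.1])]; exact hx.2)
  have hdX2 : ∀ x ∈ Ico s 1, b / τ x ^ 2 ≤ x * laplacian φ x := by
    intro x hx
    have hx1 := hx.1
    have hx2 := hx.2
    have h1 := (hl (x : ℂ) (real_mem (by rw [abs_of_nonneg (by linarith)]; exact hx.2))).1
    rw [Complex.norm_real, Real.norm_of_nonneg (by linarith)] at h1
    have h2 := hpos x hx
    calc b / τ x ^ 2 = (1/2) * (1 / (C * τ x ^ 2)) := by rw [hb]; field_simp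
      _ ≤ x * laplacian φ x := by
        apply mul_le_mul (by linarith) h1 (by positivity) (by linarith)
  have hdτ : ∀ x ∈ Ico s 1, HasDerivAt τ (deriv τ x) x := fun x hx =>
    (hW.tau_diff x ⟨by linarith [hx.1], hx.2⟩).hasDerivAt
  have hdτ2 : ∀ x ∈ Ico s 1, |deriv τ x| < ε := fun x hx => (hlI ⟨by linarith [hx.1], hx.2⟩).1
  -- first lower bound
  have m1 : MonotoneOn (fun x => Xr φ x - 10 * (τ x)⁻¹) (Ico s 1) := by
    have hd : ∀ x ∈ Ico s 1, HasDerivAt (fun x => Xr φ x - 10 * (τ x)⁻¹) (x * laplacian φ x - 10 * (-deriv τ x / τ x ^ 2)) x :=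
      fun x hx => (hdX x hx).sub (((hdτ x hx).inv (hpos x hx).ne').const_mul 10)
    apply monotoneOn_of_hasDerivWithinAt_nonneg (convex_Ico s 1)
      (fun x hx => (hd x hx).continuousAt.continuousWithinAt)
      (fun x hx => (hd x (interior_subset hx)).hasDerivWithinAt)
    intro x hx
    replace hx := interior_subset hx
    have h1 := hdX2 x hx
    have h2 := (abs_lt.1 (hdτ2 x hx)).1
    have h3 := hpos x hx
    have h4 : 10 * (-deriv τ x / τ x ^ 2) ≤ b / τ x ^ 2 := by
      rw [← mul_div_assoc]; gcongr; linarith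
    linarith
  have m2 : MonotoneOn (fun x => Xr φ x - b / τ s ^ 2 * x) (Ico s 1) := by
    have hd : ∀ x ∈ Ico s 1, HasDerivAt (fun x => Xr φ x - b / τ s ^ 2 * x) (x * laplacian φ x - b / τ s ^ 2 * 1) x :=
      fun x hx => (hdX x hx).sub ((hasDerivAt_id' x).const_mul _)
    apply monotoneOn_of_hasDerivWithinAt_nonneg (convex_Ico s 1)
      (fun x hx => (hd x hx).continuousAt.continuousWithinAt)
      (fun x hx => (hd x (interior_subset hx)).hasDerivWithinAt)
    intro x hx
    replace hx := interior_subset hx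
    have h1 := hdX2 x hx
    have h3 := hpos x hx
    have h5 := hle x hx
    have h4 : b / τ s ^ 2 ≤ b / τ x ^ 2 := by gcongr
    linarith
  have m3 : AntitoneOn (fun x => (psi φ s - psi φ x) + Xr φ s * Real.log (x / s) + A * ((x - s) / τ s) + 5 * Real.log (τ s / τ x)
      - (A + 5) / τ s * (x - s) + b / 4 / τ s ^ 2 * (x - s) ^ 2) (Ico s 1) := by
    have hd : ∀ x ∈ Ico s 1, HasDerivAt (fun x => (psi φ s - psi φ x) + Xr φ s * Real.log (x / s) + A * ((x - s) / τ s) + 5 * Real.log (τ s / τ x)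
      - (A + 5) / τ s * (x - s) + b / 4 / τ s ^ 2 * (x - s) ^ 2)
       ((- (Xr φ x / x)) + Xr φ s * (1 / x) + A * (1 / τ s) + 5 * (- deriv τ x / τ x) - (A + 5) / τ s * 1 +
          b / 4 / τ s ^ 2 * (2 * (x - s))) x := by
      intro x hx
      have hx1 := hx.1
      have hs0 : 0 < s := by linarith
      have hx0 : 0 < x := by linarith
      have e1 := (psi_deriv hW (r := x) (by rw [abs_of_pos hx0]; exact hx.2) hx0.ne').const_sub (psi φ s)
      have e2 : HasDerivAt (fun ξ => Real.log (ξ / s)) (1 / x) x := by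
        have := ((hasDerivAt_id x).div_const s).log (by simp; constructor <;> linarith)
        have h4 : (1 : ℝ) / s / (id x / s) = 1 / x := by simp only [id]; field_simp
        rw [h4] at this; exact this
      have e3 : HasDerivAt (fun ξ => Real.log (τ s / τ ξ)) (- deriv τ x / τ x) x := by
        have h0 := hpos x hx
        have := ((((hdτ x hx).inv h0.ne').const_mul (τ s))).log (mul_ne_zero hts.ne' (inv_ne_zero h0.ne'))
        have h4 : τ s * (-deriv τ x / τ x ^ 2) / (τ s * (τ⁻¹) x) = - deriv τ x / τ x := by
          simp only [Pi.inv_apply]; field_simp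
        rw [h4] at this
        simpa [div_eq_mul_inv] using this
      have e4 : HasDerivAt (fun ξ => (ξ - s) / τ s) (1 / τ s) x := ((hasDerivAt_id' x).sub_const s).div_const _
      have e5 : HasDerivAt (fun ξ => (ξ - s) ^ 2) (2 * (x - s)) x := by
        have := ((hasDerivAt_id' x).sub_const s).pow 2
        simp at this; exact this
      exact ((((e1.add (e2.const_mul _)).add (e4.const_mul A)).add (e3.const_mul 5)).sub
        (((hasDerivAt_id' x).sub_const s).const_mul _)).add (e5.const_mul _)
    apply antitoneOn_of_hasDerivWithinAt_nonpos (convex_Ico s 1)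
      (fun x hx => (hd x hx).continuousAt.continuousWithinAt)
      (fun x hx => (hd x (interior_subset hx)).hasDerivWithinAt)
    intro x hx
    replace hx := interior_subset hx
    have hx1 := hx.1
    have hx2 := hx.2
    have hsm : s ∈ Ico s 1 := ⟨le_rfl, by linarith⟩
    have h1 := m1 hsm hx hx1
    have h2 := m2 hsm hx hx1
    simp only at h1 h2
    have h3 := hpos x hx
    have h5 := hle x hx
    have h6 : (τ s)⁻¹ ≤ (τ x)⁻¹ := by gcongr
    have h7 := (abs_lt.1 (hdτ2 x hx)).1
    have h8 : 5 * (- deriv τ x / τ x) ≤ 5 * (τ x)⁻¹ := by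
      rw [div_eq_mul_inv]; gcongr
      have : - deriv τ x ≤ 1 := by linarith
      calc _ ≤ 1 * (τ x)⁻¹ := by gcongr
        _ = _ := one_mul _
    have h9 : Xr φ x - Xr φ s ≤ (Xr φ x - Xr φ s) / x := by
      rw [le_div_iff₀ (by linarith)]
      have : 0 ≤ Xr φ x - Xr φ s := by
        have : 0 ≤ b / τ s ^ 2 * (x - s) := by
          have : 0 ≤ x - s := by linarith
          positivity
        linarith
      nlinarith
    have e : (- (Xr φ x / x)) + Xr φ s * (1 / x) + A * (1 / τ s) + 5 * (- deriv τ x / τ x) - (A + 5) / τ s * 1 +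
          b / 4 / τ s ^ 2 * (2 * (x - s)) = - ((Xr φ x - Xr φ s) / x) + 5 * (- deriv τ x / τ x) - 5 * (τ s)⁻¹ +
          (b / τ s ^ 2 * x - b / τ s ^ 2 * s) / 2 := by ring
    rw [e]
    linarith
  have h1 := m3 (show s ∈ Ico s 1 from ⟨le_rfl, by linarith⟩) (show r ∈ Ico s 1 from ⟨hsr, hr1⟩) hsr
  have hs0 : s ≠ 0 := by linarith
  simp only [sub_self, div_self hs0, div_self hts.ne', Real.log_one, zero_div, mul_zero, add_zero] at h1
  set u := (r - s) / τ s with hu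
  have e1 : (A + 5) / τ s * (r - s) = (A + 5) * u := by rw [hu]; ring
  have e2 : b / 4 / τ s ^ 2 * (r - s) ^ 2 = b / 4 * u ^ 2 := by rw [hu]; field_simp
  rw [e1, e2] at h1
  have h2 : (A + 5) * u - b / 4 * u ^ 2 ≤ (A + 5) ^ 2 / b := by
    rw [le_div_iff₀ hb0]
    nlinarith [sq_nonneg (b * u / 2 - (A + 5))]
  simp only [ne_eq, OfNat.ofNat_ne_zero, not_false_eq_true, zero_pow, mul_zero, add_zero] at h1
  linarith
end
end

noncomputable section
section
variable {ω φ : ℂ → ℝ} {τ : ℝ → ℝ} {c₁ c₂ : ℝ}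

def qN (N : ℕ) (ζ : ℂ) : ℂ := (∑ k ∈ Finset.range N, ζ ^ k) / N

theorem gs_le {N : ℕ} {ζ : ℂ} {ρ : ℝ} (h1 : 1 ≤ ρ) (h : ‖ζ‖ ≤ ρ) : ‖∑ k ∈ Finset.range N, ζ ^ k‖ ≤ N * ρ ^ N := by
  refine (norm_sum_le _ _).trans ?_
  calc ∑ k ∈ Finset.range N, ‖ζ ^ k‖ ≤ ∑ k ∈ Finset.range N, ρ ^ N := by
        apply Finset.sum_le_sum
        intro k hk
        rw [norm_pow]
        calc ‖ζ‖ ^ k ≤ ρ ^ k := by gcongr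
          _ ≤ ρ ^ N := pow_le_pow_right₀ h1 (Finset.mem_range.1 hk).le
    _ = _ := by simp

theorem qN_le {N : ℕ} (hN : 0 < N) {ζ : ℂ} {ρ : ℝ} (h1 : 1 ≤ ρ) (h : ‖ζ‖ ≤ ρ) : ‖qN N ζ‖ ≤ ρ ^ N := by
  have hN' : (0 : ℝ) < N := by exact_mod_cast hN
  rw [qN, norm_div, Complex.norm_natCast, div_le_iff₀ hN', mul_comm]
  exact gs_le h1 h

theorem qN_le2 {N : ℕ} (hN : 0 < N) {ζ : ℂ} {ρ : ℝ} (h1 : 1 ≤ ρ) (h : ‖ζ‖ ≤ ρ) :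
    ‖qN N ζ‖ * (N * ‖ζ - 1‖) ≤ 2 * ρ ^ N := by
  have hN' : (0 : ℝ) < N := by exact_mod_cast hN
  rw [qN, norm_div, Complex.norm_natCast]
  have e : ‖∑ k ∈ Finset.range N, ζ ^ k‖ / N * (N * ‖ζ - 1‖) = ‖ζ ^ N - 1‖ := by
    rw [← geom_sum_mul, norm_mul]; field_simp
  rw [e]
  calc ‖ζ ^ N - 1‖ ≤ ‖ζ ^ N‖ + ‖(1 : ℂ)‖ := norm_sub_le _ _
    _ ≤ ρ ^ N + 1 := by rw [norm_pow, norm_one]; gcongr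
    _ ≤ _ := by linarith [one_le_pow₀ h1 (n := N)]

theorem qN_near {N : ℕ} (hN : 0 < N) {ζ : ℂ} (h : N * ‖ζ - 1‖ ≤ 1 / 4) : 1 / 2 ≤ ‖qN N ζ‖ := by
  have hN' : (0 : ℝ) < N := by exact_mod_cast hN
  have hpow : ∀ k ∈ Finset.range N, ‖ζ ^ k - 1‖ ≤ 1 / 2 := by
    intro k hk
    have hk' : (k : ℝ) ≤ N := by exact_mod_cast (Finset.mem_range.1 hk).le
    have ht : ‖ζ‖ ≤ 1 + ‖ζ - 1‖ := by simpa using norm_add_le 1 (ζ - 1)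
    rw [← geom_sum_mul, norm_mul]
    have h1 := gs_le (N := k) (by linarith [norm_nonneg (ζ - 1)] : 1 ≤ 1 + ‖ζ - 1‖) ht
    have h2 : (1 + ‖ζ - 1‖) ^ k ≤ Real.exp (1 / 4) := by
      calc (1 + ‖ζ - 1‖) ^ k ≤ (Real.exp ‖ζ - 1‖) ^ k := by gcongr; linarith [Real.add_one_le_exp ‖ζ - 1‖]
        _ = Real.exp (k * ‖ζ - 1‖) := by rw [← Real.exp_nat_mul]
        _ ≤ _ := by gcongr; refine le_trans ?_ h; gcongr
    have h3 : Real.exp (1 / 4) ≤ 2 := by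
      have h4 : Real.exp (1 / 4) ≤ Real.exp (Real.log 2) := by gcongr; linarith [Real.log_two_gt_d9]
      rwa [Real.exp_log (by norm_num)] at h4
    calc ‖∑ i ∈ Finset.range k, ζ ^ i‖ * ‖ζ - 1‖ ≤ (k * 2) * ‖ζ - 1‖ := by
          gcongr; refine h1.trans ?_; gcongr; linarith
      _ ≤ (N * 2) * ‖ζ - 1‖ := by gcongr
      _ ≤ _ := by linarith
  have h5 : ‖qN N ζ - 1‖ ≤ 1 / 2 := by
    have e : qN N ζ - 1 = (∑ k ∈ Finset.range N, (ζ ^ k - 1)) / N := by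
      have : (N : ℂ) ≠ 0 := by exact_mod_cast hN.ne'
      rw [qN, Finset.sum_sub_distrib]; simp; field_simp
    rw [e, norm_div, Complex.norm_natCast, div_le_iff₀ hN']
    refine (norm_sum_le _ _).trans ?_
    calc _ ≤ ∑ k ∈ Finset.range N, (1 / 2 : ℝ) := Finset.sum_le_sum hpow
      _ = _ := by simp; ring
  have h6 : ‖(1 : ℂ)‖ ≤ ‖qN N ζ‖ + ‖qN N ζ - 1‖ := by
    have := norm_sub_le (qN N ζ) (qN N ζ - 1)
    simpa using this
  rw [norm_one] at h6
  linarith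

theorem psi_below (hW : IsClassW ω φ τ) {s r : ℝ} (hr : 0 < r) (hrs : r ≤ s) (hs : s < 1) :
    psi φ s - psi φ r + Xr φ s * Real.log (r / s) ≤ 0 := by
  have hd : ∀ x ∈ Icc r s, HasDerivAt (fun x => (psi φ s - psi φ x) + Xr φ s * Real.log (x / s))
      (- (Xr φ x / x) + Xr φ s * (1 / x)) x := by
    intro x hx
    have hx0 : 0 < x := by linarith [hx.1]
    have e1 := (psi_deriv hW (r := x) (by rw [abs_of_pos hx0]; linarith [hx.2]) hx0.ne').const_sub (psi φ s)
    have e2 : HasDerivAt (fun ξ => Real.log (ξ / s)) (1 / x) x := by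
      have := ((hasDerivAt_id x).div_const s).log (by simp; constructor <;> linarith)
      have h4 : (1 : ℝ) / s / (id x / s) = 1 / x := by
        have : s ≠ 0 := by linarith
        simp only [id]; field_simp
      rw [h4] at this; exact this
    exact e1.add (e2.const_mul _)
  have m : MonotoneOn (fun x => (psi φ s - psi φ x) + Xr φ s * Real.log (x / s)) (Icc r s) := by
    apply monotoneOn_of_hasDerivWithinAt_nonneg (convex_Icc r s)
      (fun x hx => (hd x hx).continuousAt.continuousWithinAt)
      (fun x hx => (hd x (interior_subset hx)).hasDerivWithinAt)
    intro x hx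
    replace hx := interior_subset hx
    have hx0 : 0 < x := by linarith [hx.1]
    have := Xr_mono hW (show x ∈ Ico (0 : ℝ) 1 from ⟨hx0.le, by linarith [hx.2]⟩) (show s ∈ Ico (0 : ℝ) 1 from ⟨by linarith, hs⟩) hx.2
    have e : - (Xr φ x / x) + Xr φ s * (1 / x) = (Xr φ s - Xr φ x) / x := by ring
    rw [e]; apply div_nonneg <;> linarith
  have h := m (left_mem_Icc.2 hrs) (right_mem_Icc.2 hrs) hrs
  simpa [div_self (by linarith : s ≠ 0)] using h

theorem Xr_pos (hW : IsClassW ω φ τ) {r : ℝ} (h0 : 0 < r) (h1 : r < 1) : 0 < Xr φ r := by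
  have : StrictMonoOn (Xr φ) (Icc 0 r) := by
    apply strictMonoOn_of_hasDerivWithinAt_pos (f' := fun r => r * laplacian φ r) (convex_Icc 0 r)
    · intro x hx
      exact (Xr_deriv hW (by rw [abs_of_nonneg hx.1]; linarith [hx.2])).continuousAt.continuousWithinAt
    · intro x hx
      rw [interior_Icc] at hx
      exact (Xr_deriv hW (by rw [abs_of_pos hx.1]; linarith [hx.2])).hasDerivWithinAt
    · intro x hx
      rw [interior_Icc] at hx
      exact mul_pos hx.1 (hW.lap_pos _ (real_mem (by rw [abs_of_pos hx.1]; linarith [hx.2])))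
  have := this (left_mem_Icc.2 h0.le) (right_mem_Icc.2 h0.le) h0
  simpa [Xr] using this

set_option maxHeartbeats 1000000 in
theorem TFn (hW : IsClassW ω φ τ) (hL : IsClassL (radialize τ) c₁ c₂) :
    ∃ C c δ0 r0 : ℝ, 0 < C ∧ 0 < c ∧ 0 < δ0 ∧ r0 < 1 ∧ ∀ a ∈ unitDisc, r0 ≤ ‖a‖ →
      ∃ F : ℂ → ℂ, Differentiable ℂ F ∧
      (∀ z ∈ unitDisc, ‖F z‖ * Real.sqrt (ω z) ≤
        C * (min (radialize τ a) (radialize τ z) / (radialize τ a + ‖z - a‖)) ^ 5) ∧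
      (∀ z ∈ unitDisc, ‖z - a‖ ≤ δ0 * radialize τ a → c ≤ ‖F z‖ * Real.sqrt (ω z)) := by
  obtain ⟨K, hK0, hK⟩ := psi_taylor hW hL
  obtain ⟨K2, r0, hr0, hr01, hτ1, hK2⟩ := tf_growth hW 22 (by norm_num)
  obtain ⟨m0, m1, m2, m3⟩ := mTau_bds hL
  set K1 := K + Real.log 8 with hK1
  refine ⟨Real.exp (max K2 0) * 4 ^ 5, Real.exp (- K1) * (1 / 2) ^ 5, min (mTau c₁ c₂) (1 / 32), r0,
    by positivity, by positivity, by positivity, hr01, fun a ha har => ?_⟩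
  have ha1 := mem_unitDisc.1 ha
  have hrl := rad_le hL m0.le le_rfl ha
  have ht := hL.pos a ha
  have ha0 : a ≠ 0 := by intro h; rw [h] at har; simp at har; linarith
  have ht1 : radialize τ a ≤ 1 := hτ1 _ har ha1
  have hta : radialize τ a = τ ‖a‖ := rfl
  set t := radialize τ a with htd
  set s := ‖a‖ with hsd
  have hs0 : 0 < s := by linarith
  set n := ⌈Xr φ s⌉₊ with hn
  have hx0 := Xr_pos hW hs0 ha1
  have hn0 : n ≠ 0 := (Nat.ceil_pos.2 hx0).ne'
  set N := ⌈1 / t⌉₊ with hNd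
  have hN0 : 0 < N := Nat.ceil_pos.2 (by positivity)
  have hN0' : (0 : ℝ) < N := by exact_mod_cast hN0
  have hN1 : 1 / t ≤ N := Nat.le_ceil _
  have hN2 : (N : ℝ) ≤ 1 / t + 1 := (Nat.ceil_lt_add_one (by positivity)).le
  have hn1 : Xr φ s ≤ n := Nat.le_ceil _
  have hn2 : (n : ℝ) ≤ Xr φ s + 1 := (Nat.ceil_lt_add_one hx0.le).le
  have hbase : ∀ z ∈ unitDisc, z ≠ 0 → ‖(Real.exp (psi φ s) : ℂ) * (z / a) ^ n‖ * Real.sqrt (ω z) =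
        Real.exp (psi φ s + n * Real.log (‖z‖ / s) - psi φ ‖z‖) := by
    intro z hz hz0
    have hrs0 : 0 < ‖z‖ / s := div_pos (norm_pos_iff.2 hz0) hs0
    rw [norm_mul, Complex.norm_real, Real.norm_of_nonneg (Real.exp_pos _).le, norm_pow, norm_div, omega_psi hW hz, ← hsd]
    have : (‖z‖ / s) ^ n = Real.exp (n * Real.log (‖z‖ / s)) := by
      rw [mul_comm, Real.exp_mul, Real.exp_log hrs0, Real.rpow_natCast]
    rw [this, ← Real.exp_add, ← Real.exp_add]
    congr 1
  have hq : ∀ (z : ℂ) (ρ : ℝ), 1 ≤ ρ → ‖z‖ / s ≤ ρ → ‖qN N (z / a)‖ ≤ ρ ^ N * (4 * t / (t + ‖z - a‖)) := by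
    intro z ρ h1 h2
    have hz2 : ‖z / a‖ ≤ ρ := by rwa [norm_div]
    have h3 := qN_le hN0 h1 hz2
    have h4 := qN_le2 hN0 h1 hz2
    have e : ‖z / a - 1‖ = ‖z - a‖ / s := by
      rw [show z / a - 1 = (z - a) / a by field_simp, norm_div]
    rw [e] at h4
    rw [← mul_div_assoc, le_div_iff₀ (by positivity)]
    have h5 : ‖qN N (z / a)‖ * ‖z - a‖ ≤ 2 * ρ ^ N * t := by
      have h6 : ‖z - a‖ ≤ (N * (‖z - a‖ / s)) * t := by
        have : 1 ≤ N * t := by rwa [div_le_iff₀ ht] at hN1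
        have h7 : ‖z - a‖ ≤ ‖z - a‖ / s := by
          rw [le_div_iff₀ hs0]; nlinarith [norm_nonneg (z - a)]
        calc ‖z - a‖ ≤ 1 * (‖z - a‖ / s) := by rwa [one_mul]
          _ ≤ (N * t) * (‖z - a‖ / s) := by gcongr
          _ = _ := by ring
      calc _ ≤ ‖qN N (z / a)‖ * ((N * (‖z - a‖ / s)) * t) := by gcongr
        _ = (‖qN N (z / a)‖ * (N * (‖z - a‖ / s))) * t := by ring
        _ ≤ _ := by gcongr
    have h8 : ‖qN N (z / a)‖ * t ≤ ρ ^ N * t := by gcongr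
    have h9 : 0 ≤ ρ ^ N * t := by positivity
    nlinarith
  refine ⟨fun z => (Real.exp (psi φ s) : ℂ) * (z / a) ^ n * qN N (z / a) ^ 5, by unfold qN; fun_prop, ?_, ?_⟩
  · intro z hz
    have hz1 := mem_unitDisc.1 hz
    have htz := hL.pos z hz
    by_cases hz0 : z = 0
    · subst hz0
      simp [hn0]; positivity
    have hzp : 0 < ‖z‖ := norm_pos_iff.2 hz0
    rw [norm_mul, mul_right_comm, hbase z hz hz0, norm_pow]
    rcases le_total ‖z‖ s with hzs | hzs
    · have h1 := hq z 1 le_rfl ((div_le_one hs0).2 hzs)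
      rw [one_pow, one_mul] at h1
      have h2 := psi_below hW hzp hzs ha1
      have hlog : Real.log (‖z‖ / s) ≤ 0 := Real.log_nonpos (by positivity) ((div_le_one hs0).2 hzs)
      have h3 : psi φ s + n * Real.log (‖z‖ / s) - psi φ ‖z‖ ≤ max K2 0 := by
        refine le_trans ?_ (le_max_right _ _)
        nlinarith
      have hmin : min t (radialize τ z) = t := min_eq_left
        (hW.tau_anti ⟨norm_nonneg _, hz1⟩ ⟨norm_nonneg _, ha1⟩ hzs)
      rw [hmin]
      calc _ ≤ Real.exp (max K2 0) * (4 * t / (t + ‖z - a‖)) ^ 5 := by gcongr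
        _ = _ := by rw [mul_div_assoc, mul_pow]; ring
    · have hρ : 1 ≤ ‖z‖ / s := (one_le_div hs0).2 hzs
      have h1 := hq z _ hρ le_rfl
      have h2 := hK2 s ‖z‖ har hzs hz1
      have hmin : min t (radialize τ z) = τ ‖z‖ := min_eq_right
        (hW.tau_anti ⟨norm_nonneg _, ha1⟩ ⟨norm_nonneg _, hz1⟩ hzs)
      have htz' : 0 < τ ‖z‖ := htz
      rw [hmin]
      have hlog0 : 0 ≤ Real.log (‖z‖ / s) := Real.log_nonneg hρ
      have hlog : Real.log (‖z‖ / s) ≤ 2 * (‖z‖ - s) := by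
        refine (Real.log_le_sub_one_of_pos (by positivity)).trans ?_
        rw [div_sub_one hs0.ne', div_le_iff₀ hs0]
        nlinarith
      rw [← hta] at h2
      have hmain : psi φ s + n * Real.log (‖z‖ / s) - psi φ ‖z‖ + 5 * (N * Real.log (‖z‖ / s)) + 5 * Real.log (t / τ ‖z‖) ≤ max K2 0 := by
        refine le_trans ?_ (le_max_left _ _)
        have h3 : (n - Xr φ s + 5 * N) * Real.log (‖z‖ / s) ≤ 22 * ((‖z‖ - s) / t) := by
          have h4 : 1 ≤ 1 / t := by rwa [le_div_iff₀ ht, one_mul]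
          calc (n - Xr φ s + 5 * N) * Real.log (‖z‖ / s) ≤ (11 * (1 / t)) * Real.log (‖z‖ / s) := by gcongr; linarith
            _ ≤ (11 * (1 / t)) * (2 * (‖z‖ - s)) := by gcongr
            _ = _ := by ring
        linarith
      have e1 : ((‖z‖ / s) ^ N) ^ 5 = Real.exp (5 * (N * Real.log (‖z‖ / s))) := by
        have hp : 0 < ‖z‖ / s := by positivity
        rw [show (5 : ℝ) = ((5 : ℕ) : ℝ) by norm_num, Real.exp_nat_mul, Real.exp_nat_mul, Real.exp_log hp]
      have e2 : (t / τ ‖z‖) ^ 5 = Real.exp (5 * Real.log (t / τ ‖z‖)) := by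
        have hp : 0 < t / τ ‖z‖ := by positivity
        rw [show (5 : ℝ) = ((5 : ℕ) : ℝ) by norm_num, Real.exp_nat_mul, Real.exp_log hp]
      calc _ ≤ Real.exp (psi φ s + n * Real.log (‖z‖ / s) - psi φ ‖z‖) * ((‖z‖ / s) ^ N * (4 * t / (t + ‖z - a‖))) ^ 5 := by gcongr
        _ = (Real.exp (psi φ s + n * Real.log (‖z‖ / s) - psi φ ‖z‖) * ((‖z‖ / s) ^ N) ^ 5 * (t / τ ‖z‖) ^ 5) * (4 ^ 5 * (τ ‖z‖ / (t + ‖z - a‖)) ^ 5) := by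
            field_simp
        _ = Real.exp (psi φ s + n * Real.log (‖z‖ / s) - psi φ ‖z‖ + 5 * (N * Real.log (‖z‖ / s)) + 5 * Real.log (t / τ ‖z‖)) * (4 ^ 5 * (τ ‖z‖ / (t + ‖z - a‖)) ^ 5) := by
            rw [e1, e2, ← Real.exp_add, ← Real.exp_add]
        _ ≤ Real.exp (max K2 0) * (4 ^ 5 * (τ ‖z‖ / (t + ‖z - a‖)) ^ 5) := by gcongr
        _ = _ := by ring
  · intro z hz hza
    have hza1 : ‖z - a‖ ≤ mTau c₁ c₂ * t := hza.trans (by gcongr; exact min_le_left _ _)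
    have hza2 : ‖z - a‖ ≤ 1 / 32 * t := hza.trans (by gcongr; exact min_le_right _ _)
    have hz1 := mem_unitDisc.1 hz
    have hrs : |‖z‖ - s| ≤ ‖z - a‖ := abs_norm_sub_norm_le z a
    have hr : 1 / 8 ≤ ‖z‖ := by
      have := (abs_le.1 hrs).1
      linarith
    have hz0 : z ≠ 0 := by intro h; rw [h] at hr; norm_num at hr
    rw [norm_mul, mul_right_comm, hbase z hz hz0, norm_pow]
    have h1 := hK s ‖z‖ (by linarith) ha1 hr hz1 (hrs.trans (by
      rw [← hta]; nlinarith [mul_pos m0 ht]))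
    have hlog : |Real.log (‖z‖ / s)| ≤ Real.log 8 := by
      rw [abs_le, ← Real.log_inv]
      constructor
      · apply Real.log_le_log (by norm_num)
        rw [le_div_iff₀ (by linarith)]; linarith
      · apply Real.log_le_log (div_pos (by linarith) (by linarith))
        rw [div_le_iff₀ (by linarith)]; linarith
    have hb : - K1 ≤ psi φ s + n * Real.log (‖z‖ / s) - psi φ ‖z‖ := by
      have h2 : -Real.log 8 ≤ ((n : ℝ) - Xr φ s) * Real.log (‖z‖ / s) := by
        have h3 : |((n : ℝ) - Xr φ s) * Real.log (‖z‖ / s)| ≤ 1 * Real.log 8 := by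
          rw [abs_mul]
          gcongr
          rw [abs_le]; constructor <;> linarith
        rw [one_mul] at h3
        exact (abs_le.1 h3).1
      have h4 := (abs_le.1 h1).1
      rw [hK1]
      have h5 : psi φ s + n * Real.log (‖z‖ / s) - psi φ ‖z‖ = (psi φ s + Xr φ s * Real.log (‖z‖ / s) - psi φ ‖z‖) +
        ((n : ℝ) - Xr φ s) * Real.log (‖z‖ / s) := by ring
      rw [h5]
      linarith
    have hqn : 1 / 2 ≤ ‖qN N (z / a)‖ := by
      apply qN_near hN0
      have e : ‖z / a - 1‖ = ‖z - a‖ / s := by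
        rw [show z / a - 1 = (z - a) / a by field_simp, norm_div]
      rw [e]
      calc N * (‖z - a‖ / s) ≤ (1 / t + 1) * ((1 / 32 * t) / (1 / 2)) := by gcongr; linarith
        _ = (1 + t) / 16 := by field_simp; ring
        _ ≤ _ := by linarith
    gcongr
end
end

noncomputable section
section
variable {τC : ℂ → ℝ} {c₁ c₂ δ : ℝ}

theorem decay_int : ∃ I : ℝ, 0 < I ∧ ∀ (t : ℝ) (a : ℂ), 0 < t →
    ∫⁻ w, ENNReal.ofReal (1 / (t + ‖w - a‖) ^ 4) ∂dA ≤ ENNReal.ofReal (I / t ^ 2) := by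
  have hint : Integrable (fun w : ℂ => (1 + ‖w‖) ^ (-(4 : ℝ))) volume :=
    integrable_one_add_norm (by simp [Complex.finrank_real_complex]; norm_num)
  set I0 := ∫ w : ℂ, (1 + ‖w‖) ^ (-(4 : ℝ)) with hI0
  have hI0' : 0 ≤ I0 := integral_nonneg (fun w => by positivity)
  refine ⟨I0 + 1, by positivity, fun t a ht => ?_⟩
  have h1 := lintegral_dA univ (fun w => ENNReal.ofReal (1 / (t + ‖w - a‖) ^ 4))
  simp only [Measure.restrict_univ] at h1
  rw [h1, lintegral_sub_right_eq_self (fun w => ENNReal.ofReal (1 / (t + ‖w‖) ^ 4)) a]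
  have e : ∀ w : ℂ, 1 / (t + ‖w‖) ^ 4 = t⁻¹ ^ 4 * (1 + ‖t⁻¹ • w‖) ^ (-(4 : ℝ)) := by
    intro w
    rw [Real.rpow_neg (by positivity), norm_smul, Real.norm_of_nonneg (by positivity : (0:ℝ) ≤ t⁻¹)]
    rw [show (4 : ℝ) = ((4 : ℕ) : ℝ) by norm_num, Real.rpow_natCast]
    field_simp
  simp_rw [e]
  rw [← ofReal_integral_eq_lintegral_ofReal ((hint.comp_smul (inv_ne_zero ht.ne')).const_mul _)
    (Eventually.of_forall fun w => by positivity), integral_const_mul, Measure.integral_comp_smul volume (fun w : ℂ => (1 + ‖w‖) ^ (-(4 : ℝ))),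
    Complex.finrank_real_complex, ← ENNReal.ofReal_inv_of_pos Real.pi_pos, ← ENNReal.ofReal_mul (by positivity)]
  apply ENNReal.ofReal_le_ofReal
  rw [← hI0, abs_of_pos (by positivity), smul_eq_mul]
  have hpi : Real.pi⁻¹ ≤ 1 := inv_le_one_of_one_le₀ (by linarith [Real.pi_gt_three])
  have e2 : t⁻¹ ^ 4 * ((t⁻¹ ^ 2)⁻¹ * I0) = I0 / t ^ 2 := by field_simp
  rw [e2]
  have h3 : 0 ≤ I0 / t ^ 2 := by positivity
  calc Real.pi⁻¹ * (I0 / t ^ 2) ≤ 1 * (I0 / t ^ 2) := by gcongr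
    _ ≤ _ := by rw [one_mul]; gcongr; linarith

theorem sep_sum {ι : Type*} [Countable ι] : ∃ C : ℝ, 0 < C ∧ ∀ (τC : ℂ → ℝ) (c₁ c₂ δ : ℝ), IsClassL τC c₁ c₂ → 0 < δ → δ ≤ mTau c₁ c₂ →
    ∀ (z : ι → ℂ), (∀ j, z j ∈ unitDisc) → (∀ j k, j ≠ k → δ * τC (z k) ≤ ‖z j - z k‖) → ∀ a ∈ unitDisc,
    ∑' j, ENNReal.ofReal (τC (z j) ^ 2 / (τC a + ‖z j - a‖) ^ 4) ≤ ENNReal.ofReal (C / (δ ^ 2 * τC a ^ 2)) := by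
  obtain ⟨I, hI, hint⟩ := decay_int
  refine ⟨64 * I, by positivity, fun τC c₁ c₂ δ hL hδ0 hδ z hz hsep a ha => ?_⟩
  obtain ⟨m0, m1, m2, m3⟩ := mTau_bds hL
  have hta := hL.pos a ha
  have hterm : ∀ j, ENNReal.ofReal (τC (z j) ^ 2 / (τC a + ‖z j - a‖) ^ 4) ≤ ENNReal.ofReal (64 / δ ^ 2) *
      ∫⁻ w in Metric.ball (z j) (δ * τC (z j) / 2), ENNReal.ofReal (1 / (τC a + ‖w - a‖) ^ 4) ∂dA := by
    intro j
    have htj := hL.pos _ (hz j)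
    have h1 : ∫⁻ w in Metric.ball (z j) (δ * τC (z j) / 2), ENNReal.ofReal (1 / (2 * (τC a + ‖z j - a‖)) ^ 4) ∂dA ≤
        ∫⁻ w in Metric.ball (z j) (δ * τC (z j) / 2), ENNReal.ofReal (1 / (τC a + ‖w - a‖) ^ 4) ∂dA := by
      apply setLIntegral_mono' Metric.isOpen_ball.measurableSet
      intro w hw
      rw [Metric.mem_ball, dist_eq_norm] at hw
      apply ENNReal.ofReal_le_ofReal
      have h2 : ‖w - a‖ ≤ ‖w - z j‖ + ‖z j - a‖ := norm_sub_le_norm_sub_add_norm_sub _ _ _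
      have h3 := (abs_le.1 (hL.lip _ (hz j) a ha)).2
      have h4 : δ * τC (z j) ≤ τC a + ‖z j - a‖ := by
        have h5 : δ * τC (z j) ≤ δ * (τC a + c₂ * ‖z j - a‖) := by gcongr; linarith
        have h6 : δ * c₂ ≤ 1 := by nlinarith [hL.c₂_pos]
        have h7 : δ * c₂ * ‖z j - a‖ ≤ 1 * ‖z j - a‖ := by gcongr
        have h8 : δ * τC a ≤ 1 * τC a := by gcongr; linarith
        nlinarith
      gcongr
      linarith [norm_nonneg (z j - a)]
    rw [setLIntegral_const, dA_ball _ (by positivity)] at h1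
    refine le_trans ?_ (mul_le_mul_right h1 _)
    rw [← ENNReal.ofReal_mul (by positivity), ← ENNReal.ofReal_mul (by positivity)]
    apply ENNReal.ofReal_le_ofReal
    apply le_of_eq
    have : 0 < τC a + ‖z j - a‖ := by positivity
    field_simp
    norm_num
  refine (ENNReal.tsum_le_tsum hterm).trans ?_
  rw [ENNReal.tsum_mul_left, ← lintegral_iUnion (fun j => Metric.isOpen_ball.measurableSet) ?_]
  · refine (mul_le_mul_right ((setLIntegral_le_lintegral _ _).trans (hint _ a hta)) _).trans ?_
    rw [← ENNReal.ofReal_mul (by positivity)]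
    apply ENNReal.ofReal_le_ofReal
    apply le_of_eq; field_simp
  · intro j k hjk
    apply Metric.ball_disjoint_ball
    rw [dist_eq_norm]
    have h1 := hsep j k hjk
    have h2 := hsep k j hjk.symm
    rw [norm_sub_rev] at h2
    linarith
end
end

noncomputable section
section
variable {τ : ℝ → ℝ} {τC : ℂ → ℝ} {c₁ c₂ δ : ℝ}

theorem count_le : ∃ C : ℝ, 0 < C ∧ ∀ (τC : ℂ → ℝ) (c₁ c₂ δ : ℝ), IsClassL τC c₁ c₂ → 0 < δ → δ ≤ mTau c₁ c₂ →
    ∀ (z : ℕ → ℂ), (∀ j, z j ∈ unitDisc) → (∀ j k, j ≠ k → δ * τC (z k) ≤ ‖z j - z k‖) → ∀ a ∈ unitDisc,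
    ∀ (κ R : ℝ), 0 < κ → 0 ≤ R → ∀ J : Finset ℕ, (∀ j ∈ J, κ * τC a ≤ τC (z j) ∧ ‖z j - a‖ ≤ R * τC a) →
      (J.card : ℝ) ≤ C * (1 + R) ^ 4 / (κ ^ 2 * δ ^ 2) := by
  obtain ⟨C, hC, h⟩ := sep_sum (ι := ℕ)
  refine ⟨C, hC, fun τC c₁ c₂ δ hL hδ0 hδ z hz hsep a ha κ R hκ hR J hJ => ?_⟩
  have h1 := h τC c₁ c₂ δ hL hδ0 hδ z hz hsep a ha
  have hta := hL.pos a ha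
  have h2 := (ENNReal.sum_le_tsum J).trans h1
  have h3 : ∑ j ∈ J, ENNReal.ofReal (κ ^ 2 / ((1 + R) ^ 4 * τC a ^ 2)) ≤ ∑ j ∈ J, ENNReal.ofReal (τC (z j) ^ 2 / (τC a + ‖z j - a‖) ^ 4) := by
    apply Finset.sum_le_sum
    intro j hj
    apply ENNReal.ofReal_le_ofReal
    obtain ⟨h4, h5⟩ := hJ j hj
    calc κ ^ 2 / ((1 + R) ^ 4 * τC a ^ 2) = (κ * τC a) ^ 2 / (τC a + R * τC a) ^ 4 := by
          rw [show τC a + R * τC a = (1 + R) * τC a by ring]; field_simp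
      _ ≤ _ := by gcongr
  replace h2 := h3.trans h2
  rw [Finset.sum_const, nsmul_eq_mul, ← ENNReal.ofReal_natCast, ← ENNReal.ofReal_mul (by positivity),
    ENNReal.ofReal_le_ofReal_iff (by positivity)] at h2
  rw [le_div_iff₀ (by positivity)]
  have e1 : (J.card : ℝ) * (κ ^ 2 / ((1 + R) ^ 4 * τC a ^ 2)) = (J.card * (κ ^ 2 * δ ^ 2)) / ((1 + R) ^ 4 * (δ ^ 2 * τC a ^ 2)) := by
    field_simp
  have e2 : C / (δ ^ 2 * τC a ^ 2) = (C * (1 + R) ^ 4) / ((1 + R) ^ 4 * (δ ^ 2 * τC a ^ 2)) := by field_simp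
  rw [e1, e2, div_le_div_iff_of_pos_right (by positivity)] at h2
  exact h2

theorem finite_of_count {s : Set ℕ} {B : ℝ} (h : ∀ J : Finset ℕ, (J : Set ℕ) ⊆ s → (J.card : ℝ) ≤ B) :
    s.Finite ∧ (s.ncard : ℝ) ≤ B := by
  have hf : s.Finite := by
    by_contra hinf
    obtain ⟨t, ht, hc⟩ := Set.Infinite.exists_subset_card_eq hinf (⌈B⌉₊ + 1)
    have h1 := h t ht
    rw [hc] at h1
    push_cast at h1
    linarith [Nat.le_ceil B]
  refine ⟨hf, ?_⟩
  have := h hf.toFinset (by simp)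
  rwa [Set.ncard_eq_toFinset_card s hf]

/-- separated sequences have uniformly finite overlap -/
theorem overlap (hL : IsClassL τC c₁ c₂) (hδ0 : 0 < δ) (hδ : δ ≤ mTau c₁ c₂) {z : ℕ → ℂ} (hz : ∀ j, z j ∈ unitDisc)
    (hsep : ∀ j k, j ≠ k → δ * τC (z k) ≤ ‖z j - z k‖) {η : ℝ} (hη0 : 0 < η) (hη : η ≤ mTau c₁ c₂) :
    ∃ N : ℕ, ∀ w ∈ unitDisc, {j | ‖w - z j‖ ≤ 3 * (η * τC (z j))}.Finite ∧ {j | ‖w - z j‖ ≤ 3 * (η * τC (z j))}.ncard ≤ N := by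
  obtain ⟨C, hC, h⟩ := count_le
  obtain ⟨m0, m1, m2, m3⟩ := mTau_bds hL
  refine ⟨⌈C * (1 + 3) ^ 4 / ((4 / 7) ^ 2 * δ ^ 2)⌉₊, fun w hw => ?_⟩
  obtain ⟨h1, h2⟩ := finite_of_count (s := {j | ‖w - z j‖ ≤ 3 * (η * τC (z j))}) (B := C * (1 + 3) ^ 4 / ((4 / 7) ^ 2 * δ ^ 2)) (by
    intro J hJ
    refine h τC c₁ c₂ δ hL hδ0 hδ z hz hsep w hw _ _ (by norm_num) (by norm_num) J fun j hj => ?_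
    have h3 : ‖w - z j‖ ≤ 3 * (η * τC (z j)) := hJ hj
    have h4 := abs_le.1 (tau_cmp hL hη0.le hη (hz j) hw (by norm_num) h3)
    have htj := hL.pos _ (hz j)
    refine ⟨by linarith, ?_⟩
    rw [norm_sub_rev]
    nlinarith)
  refine ⟨h1, ?_⟩
  have h5 := h2.trans (Nat.le_ceil _)
  exact_mod_cast h5

theorem lat_sep {z : ℕ → ℂ} (h : IsLattice τC δ z) : ∀ j k, j ≠ k → δ * τC (z k) ≤ ‖z j - z k‖ := by
  intro j k hjk
  have := h.sep j k hjk
  rwa [Metric.mem_ball, not_lt, dist_eq_norm] at this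

theorem lat_of (hL : IsClassL τC c₁ c₂) (hδ0 : 0 < δ) (hδ : δ ≤ mTau c₁ c₂) {z : ℕ → ℂ} (hz : ∀ j, z j ∈ unitDisc)
    (hsep : ∀ j k, j ≠ k → δ * τC (z k) ≤ ‖z j - z k‖) (hc : ∀ w ∈ unitDisc, ∃ j, w ∈ Metric.ball (z j) (δ * τC (z j))) :
    IsLattice τC δ z := by
  refine ⟨hz, fun j k hjk => by rw [Metric.mem_ball, not_lt, dist_eq_norm]; exact hsep j k hjk, hc, ?_⟩
  obtain ⟨N, hN⟩ := overlap hL hδ0 hδ hz hsep hδ0 hδ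
  refine ⟨N, fun w hw => ?_⟩
  obtain ⟨h1, h2⟩ := hN w hw
  refine le_trans (Set.ncard_le_ncard ?_ h1) h2
  intro j hj
  replace hj : w ∈ Metric.ball (z j) (3 * (δ * τC (z j))) := hj
  rw [Metric.mem_ball, dist_eq_norm] at hj
  exact hj.le

def ringR (τ : ℝ → ℝ) (δ : ℝ) : ℕ → ℝ
  | 0 => 0
  | n + 1 => ringR τ δ n + δ * τ (ringR τ δ n)

def ringN (τ : ℝ → ℝ) (δ : ℝ) (n : ℕ) : ℕ :=
  ⌊Real.pi / Real.arcsin (δ * τ (ringR τ δ n) / (2 * ringR τ δ n))⌋₊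

/-- points of the ring lattice -/
def ringP (τ : ℝ → ℝ) (δ : ℝ) (n : ℕ) (k : ℤ) : ℂ :=
  ringR τ δ n * Complex.exp (Complex.I * ((2 * Real.pi * k / ringN τ δ n : ℝ) : ℂ))

theorem polar_dist (r ρ θ α : ℝ) : ‖(ρ : ℂ) * Complex.exp (Complex.I * (θ : ℝ)) - r * Complex.exp (Complex.I * (α : ℝ))‖ ^ 2 =
    (ρ - r) ^ 2 + 4 * ρ * r * Real.sin ((θ - α) / 2) ^ 2 := by
  have e1 : ∀ x : ℝ, Complex.exp (Complex.I * (x : ℝ)) = (Real.cos x : ℂ) + Real.sin x * Complex.I := by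
    intro x
    rw [mul_comm, Complex.exp_mul_I]; simp
  rw [e1, e1, Complex.sq_norm, Complex.normSq_apply]
  simp only [Complex.sub_re, Complex.sub_im, Complex.mul_re, Complex.mul_im, Complex.add_re, Complex.add_im,
    Complex.ofReal_re, Complex.ofReal_im, Complex.I_re, Complex.I_im]
  have e2 : Real.sin ((θ - α) / 2) ^ 2 = (1 - (Real.cos θ * Real.cos α + Real.sin θ * Real.sin α)) / 2 := by
    have := Real.cos_sub θ α
    rw [← this, Real.sin_sq_eq_half_sub]
    ring_nf
  rw [e2]
  have h1 := Real.sin_sq_add_cos_sq θ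
  have h2 := Real.sin_sq_add_cos_sq α
  linear_combination (ρ ^ 2) * h1 + r ^ 2 * h2

theorem sin_int_lower {N : ℕ} (hN : 2 ≤ N) {m : ℤ} (hm : ¬ (N : ℤ) ∣ m) : Real.sin (Real.pi / N) ^ 2 ≤ Real.sin (Real.pi * m / N) ^ 2 := by
  have hN0 : (0 : ℝ) < N := by positivity
  have hNz : (N : ℤ) ≠ 0 := by omega
  set q := m / (N : ℤ) with hq
  set l := m % (N : ℤ) with hl
  have h1 : 0 ≤ l := Int.emod_nonneg _ hNz
  have h2 : l < N := Int.emod_lt_of_pos _ (by omega)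
  have h3 : l ≠ 0 := fun h => hm (Int.dvd_of_emod_eq_zero h)
  have hml : m = l + N * q := (Int.emod_add_mul_ediv m N).symm
  have e : Real.sin (Real.pi * m / N) ^ 2 = Real.sin (Real.pi * l / N) ^ 2 := by
    have : Real.pi * m / N = Real.pi * l / N + q * Real.pi := by
      rw [hml]; push_cast; field_simp
    rw [this, Real.sin_add_int_mul_pi, mul_pow]
    have : ((-1 : ℝ) ^ q) ^ 2 = 1 := by
      rw [← zpow_natCast, ← zpow_mul, mul_comm, zpow_mul]; norm_num
    rw [this, one_mul]
  rw [e]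
  have hl1 : (1 : ℝ) ≤ l := by exact_mod_cast (by omega : 1 ≤ l)
  have hl2 : (l : ℝ) ≤ N - 1 := by
    have : l ≤ N - 1 := by omega
    exact_mod_cast this
  have hpi := Real.pi_pos
  have hN2 : (2 : ℝ) ≤ N := by exact_mod_cast hN
  have hs0 : 0 ≤ Real.sin (Real.pi / N) := Real.sin_nonneg_of_nonneg_of_le_pi (by positivity) (by
    rw [div_le_iff₀ hN0]; nlinarith)
  have hpN : Real.pi / N ≤ Real.pi / 2 := by gcongr
  have hmain : Real.sin (Real.pi / N) ≤ Real.sin (Real.pi * l / N) := by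
    rcases le_total (Real.pi * l / N) (Real.pi / 2) with h | h
    · apply Real.sin_le_sin_of_le_of_le_pi_div_two _ h
      · gcongr; nlinarith
      · have : 0 ≤ Real.pi / N := by positivity
        linarith
    · rw [← Real.sin_pi_sub (Real.pi * l / N)]
      apply Real.sin_le_sin_of_le_of_le_pi_div_two
      · have : 0 ≤ Real.pi / N := by positivity
        linarith
      · linarith
      · rw [le_sub_iff_add_le, ← add_div, div_le_iff₀ hN0]
        nlinarith
  gcongr
end
end

noncomputable section
section
variable {ω φ : ℂ → ℝ} {τ : ℝ → ℝ} {c₁ c₂ δ : ℝ}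

theorem ringR_mem (hL : IsClassL (radialize τ) c₁ c₂) (hδ0 : 0 < δ) (hδ : δ ≤ mTau c₁ c₂) (n : ℕ) :
    ringR τ δ n ∈ Ico (0 : ℝ) 1 := by
  induction n with
  | zero => simp [ringR]
  | succ n ih =>
    have hm := real_mem (r := ringR τ δ n) (by rw [abs_of_nonneg ih.1]; exact ih.2)
    have h1 := rad_le hL hδ0.le hδ hm
    have h2 := hL.pos _ hm
    simp only [radialize, Complex.norm_real, Real.norm_of_nonneg ih.1] at h1 h2
    have h3 := mul_pos hδ0 h2
    have h4 := ih.1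
    have h5 := ih.2
    simp only [ringR]
    constructor <;> linarith

theorem ringN_facts (hW : IsClassW ω φ τ) (hL : IsClassL (radialize τ) c₁ c₂) (hδ0 : 0 < δ) (hδ : δ ≤ mTau c₁ c₂) (n : ℕ)
    (hn : 1 ≤ n) : δ * τ (ringR τ δ n) ≤ ringR τ δ n ∧ 2 ≤ ringN τ δ n ∧
      δ * τ (ringR τ δ n) ≤ 2 * ringR τ δ n * Real.sin (Real.pi / ringN τ δ n) ∧
      ∀ θ : ℝ, ∃ k : ℤ, 4 * Real.sin ((θ - 2 * Real.pi * k / ringN τ δ n) / 2) ^ 2 ≤ 0.4 * (δ * τ (ringR τ δ n) / ringR τ δ n) ^ 2 := by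
  have hm := ringR_mem hL hδ0 hδ
  have hmono : Monotone (ringR τ δ) := monotone_nat_of_le_succ (fun k => by
    have := mul_pos hδ0 (hW.tau_pos _ (hm k))
    simp only [ringR]; linarith)
  have hanti := fun k => hW.tau_anti (hm 0) (hm k) (hmono (Nat.zero_le k))
  have h1 : δ * τ (ringR τ δ n) ≤ ringR τ δ n := by
    have h2 := hmono hn
    have h3 : δ * τ (ringR τ δ n) ≤ δ * τ (ringR τ δ 0) := by gcongr; exact hanti n
    have h4 : ringR τ δ 1 = δ * τ (ringR τ δ 0) := by simp [ringR]
    linarith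
  have hh := mul_pos hδ0 (hW.tau_pos _ (hm n))
  set r := ringR τ δ n with hr
  set h := δ * τ r with hhd
  have hr0 : 0 < r := by linarith
  set s := h / (2 * r) with hs
  have hs0 : 0 < s := by positivity
  have hs1 : s ≤ 1 / 2 := by rw [hs, div_le_iff₀ (by positivity)]; linarith
  set α := Real.arcsin s with hα
  have hpi := Real.pi_gt_three
  have hpi2 := Real.pi_lt_d4
  have hα0 : 0 < α := Real.arcsin_pos.2 hs0
  have hα1 : α ≤ Real.pi / 6 := by
    rw [hα, Real.arcsin_le_iff_le_sin' ⟨by linarith, by linarith⟩, Real.sin_pi_div_six]; exact hs1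
  have hsin : Real.sin α = s := Real.sin_arcsin (by linarith) (by linarith)
  have hNdef : ringN τ δ n = ⌊Real.pi / α⌋₊ := rfl
  have hN6 : 6 ≤ ringN τ δ n := by
    rw [hNdef]; apply Nat.le_floor
    rw [le_div_iff₀ hα0]; push_cast; linarith
  set N := ringN τ δ n with hN
  have hN6' : (6 : ℝ) ≤ N := by exact_mod_cast hN6
  have hN1 : (N : ℝ) ≤ Real.pi / α := by rw [hNdef]; exact Nat.floor_le (by positivity)
  have hN2 : Real.pi / α < N + 1 := by rw [hNdef]; exact Nat.lt_floor_add_one _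
  rw [le_div_iff₀ hα0] at hN1
  rw [div_lt_iff₀ hα0] at hN2
  refine ⟨h1, by omega, ?_, ?_⟩
  · have h5 : Real.sin α ≤ Real.sin (Real.pi / N) := by
      apply Real.sin_le_sin_of_le_of_le_pi_div_two (by linarith)
      · gcongr; linarith
      · rw [le_div_iff₀ (by linarith)]; linarith
    rw [hsin, hs, div_le_iff₀ (by positivity)] at h5
    linarith
  · intro θ
    refine ⟨round (θ * N / (2 * Real.pi)), ?_⟩
    set k := round (θ * N / (2 * Real.pi)) with hk
    have h6 := abs_sub_round (θ * N / (2 * Real.pi))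
    rw [← hk] at h6
    have h7 : |(θ - 2 * Real.pi * k / N) / 2| ≤ 7 / 12 * α := by
      have e : (θ - 2 * Real.pi * k / N) / 2 = (θ * N / (2 * Real.pi) - k) * (Real.pi / N) := by
        field_simp
      rw [e, abs_mul, abs_of_pos (by positivity : 0 < Real.pi / N)]
      calc _ ≤ 1 / 2 * (Real.pi / N) := by gcongr
        _ ≤ 7 / 12 * α := by
          rw [← mul_div_assoc, div_le_iff₀ (by linarith)]
          nlinarith
    have h8 : Real.sin ((θ - 2 * Real.pi * k / N) / 2) ^ 2 ≤ (7 / 12 * α) ^ 2 := by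
      rw [← sq_abs]
      gcongr
      exact (Real.abs_sin_le_abs).trans h7
    have h9 : 0.93 * α ≤ s := by
      have h10 := Real.sin_gt_sub_cube hα0
      rw [hsin] at h10
      have : α ^ 2 ≤ 0.28 := by nlinarith
      nlinarith
    have e3 : h / r = 2 * s := by rw [hs]; field_simp
    rw [e3]
    have h11 : α ^ 2 * 0.93 ^ 2 ≤ s ^ 2 := by
      rw [← mul_pow, mul_comm]; gcongr
    nlinarith

theorem exists_lattice (hW : IsClassW ω φ τ) (hL : IsClassL (radialize τ) c₁ c₂) (hδ0 : 0 < δ) (hδ : δ ≤ mTau c₁ c₂) :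
    ∃ z : ℕ → ℂ, IsLattice (radialize τ) δ z ∧
      ∀ w ∈ unitDisc, ∃ j, ‖w - z j‖ ≤ 0.95 * (δ * radialize τ (z j)) := by
  have hm := ringR_mem hL hδ0 hδ
  have hpos : ∀ n, 0 < δ * τ (ringR τ δ n) := fun n => mul_pos hδ0 (hW.tau_pos _ (hm n))
  have hstep : ∀ n, ringR τ δ (n + 1) = ringR τ δ n + δ * τ (ringR τ δ n) := fun n => rfl
  have hsm : StrictMono (ringR τ δ) := strictMono_nat_of_lt_succ (fun k => by
    rw [hstep]; linarith [hpos k])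
  have hnorm : ∀ n k, ‖ringP τ δ n k‖ = ringR τ δ n := by
    intro n k
    rw [ringP, norm_mul, Complex.norm_real, Real.norm_of_nonneg (hm n).1, Complex.norm_exp_I_mul_ofReal, mul_one]
  have htau : ∀ n k, radialize τ (ringP τ δ n k) = τ (ringR τ δ n) := fun n k => by rw [radialize, hnorm]
  have hmem : ∀ n k, ringP τ δ n k ∈ unitDisc := fun n k => by rw [mem_unitDisc, hnorm]; exact (hm n).2
  have hsepP : ∀ n k n' k', ringP τ δ n k ≠ ringP τ δ n' k' →
      δ * τ (ringR τ δ n') ≤ ‖ringP τ δ n k - ringP τ δ n' k'‖ := by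
    intro n k n' k' hne
    have habs : |ringR τ δ n - ringR τ δ n'| ≤ ‖ringP τ δ n k - ringP τ δ n' k'‖ := by
      have := abs_norm_sub_norm_le (ringP τ δ n k) (ringP τ δ n' k')
      rwa [hnorm, hnorm] at this
    rcases lt_trichotomy n n' with h | h | h
    · have h1 := hsm.monotone (Nat.succ_le_of_lt h)
      rw [Nat.succ_eq_add_one, hstep] at h1
      have h2 := hW.tau_anti (hm n) (hm n') (hsm h).le
      have h3 : δ * τ (ringR τ δ n') ≤ δ * τ (ringR τ δ n) := by gcongr
      have := (abs_le.1 habs).1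
      linarith
    · subst h
      rcases Nat.eq_zero_or_pos n with h0 | h0
      · subst h0
        exfalso; apply hne; simp [ringP, ringR]
      · obtain ⟨f1, f2, f3, f4⟩ := ringN_facts hW hL hδ0 hδ n h0
        have hN0 : (0 : ℝ) < ringN τ δ n := by
          have : (2 : ℝ) ≤ ringN τ δ n := by exact_mod_cast f2
          linarith
        have hdvd : ¬ ((ringN τ δ n : ℤ) ∣ (k - k')) := by
          rintro ⟨q, hq⟩
          apply hne
          have : (k : ℝ) = k' + ringN τ δ n * q := by
            have : k = k' + ringN τ δ n * q := by linarith
            exact_mod_cast this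
          rw [ringP, ringP]
          congr 1
          have e : Complex.I * ((2 * Real.pi * k / ringN τ δ n : ℝ) : ℂ) = Complex.I * ((2 * Real.pi * k' / ringN τ δ n : ℝ) : ℂ) + q * (2 * Real.pi * Complex.I) := by
            have e2 : 2 * Real.pi * k / ringN τ δ n = 2 * Real.pi * k' / ringN τ δ n + q * (2 * Real.pi) := by
              rw [this]; field_simp
            rw [e2]; push_cast; ring
          rw [e, Complex.exp_add, Complex.exp_int_mul_two_pi_mul_I, mul_one]
        have h2 := sin_int_lower f2 hdvd
        have h3 := polar_dist (ringR τ δ n) (ringR τ δ n) (2 * Real.pi * k / ringN τ δ n) (2 * Real.pi * k' / ringN τ δ n)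
        have e : (2 * Real.pi * k / ringN τ δ n - 2 * Real.pi * k' / ringN τ δ n) / 2 = Real.pi * ((k - k' : ℤ) : ℝ) / ringN τ δ n := by
          push_cast; field_simp
        rw [e, sub_self] at h3
        apply le_of_sq_le_sq _ (norm_nonneg _)
        rw [ringP, ringP, h3]
        have h4 : 0 ≤ ringR τ δ n := (hm n).1
        calc (δ * τ (ringR τ δ n)) ^ 2 ≤ (2 * ringR τ δ n * Real.sin (Real.pi / ringN τ δ n)) ^ 2 := by
              have := hpos n
              gcongr
          _ = 4 * ringR τ δ n * ringR τ δ n * Real.sin (Real.pi / ringN τ δ n) ^ 2 := by ring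
          _ ≤ 4 * ringR τ δ n * ringR τ δ n * Real.sin (Real.pi * ((k - k' : ℤ) : ℝ) / ringN τ δ n) ^ 2 := by gcongr
          _ = _ := by ring
    · have h1 := hsm.monotone (Nat.succ_le_of_lt h)
      rw [Nat.succ_eq_add_one, hstep] at h1
      have := (abs_le.1 habs).2
      linarith
  have hcov : ∀ w ∈ unitDisc, ∃ n k, ‖w - ringP τ δ n k‖ ≤ 0.95 * (δ * τ (ringR τ δ n)) := by
    intro w hw
    have hw1 := mem_unitDisc.1 hw
    have hex : ∃ n, ‖w‖ < ringR τ δ n := by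
      by_contra hcon
      push Not at hcon
      have hlow : ∀ n : ℕ, n * (δ * τ ‖w‖) ≤ ringR τ δ n := by
        intro n
        induction n with
        | zero => simp [ringR]
        | succ n ih =>
          rw [hstep]
          have := hW.tau_anti (hm n) ⟨norm_nonneg w, hw1⟩ (hcon n)
          have h2 : δ * τ ‖w‖ ≤ δ * τ (ringR τ δ n) := by gcongr
          push_cast; linarith
      obtain ⟨n, hn⟩ := exists_nat_gt (1 / (δ * τ ‖w‖))
      have h0 : 0 < δ * τ ‖w‖ := mul_pos hδ0 (hW.tau_pos _ ⟨norm_nonneg w, hw1⟩)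
      rw [div_lt_iff₀ h0] at hn
      linarith [hlow n, (hm n).2]
    classical
    obtain ⟨n, hn1, hn2⟩ : ∃ n, ringR τ δ n ≤ ‖w‖ ∧ ‖w‖ < ringR τ δ (n + 1) := by
      have h1 := Nat.find_spec hex
      have h2 : Nat.find hex ≠ 0 := by
        intro h
        rw [h] at h1; simp [ringR] at h1
        exact absurd h1 (not_lt.2 (norm_nonneg _))
      refine ⟨Nat.find hex - 1, ?_, ?_⟩
      · exact not_lt.1 (Nat.find_min hex (by omega))
      · rw [Nat.sub_add_cancel (by omega)]; exact h1
    have hwp : w = (‖w‖ : ℂ) * Complex.exp (Complex.I * (Complex.arg w : ℝ)) := by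
      rw [mul_comm Complex.I]; exact (Complex.norm_mul_exp_arg_mul_I w).symm
    set r := ringR τ δ n with hr
    set h := δ * τ r with hhd
    have hh : 0 < h := hpos n
    have hr1 := hstep n
    rw [← hr, ← hhd] at hr1
    by_cases hx : ‖w‖ - r ≤ h / 2
    · rcases Nat.eq_zero_or_pos n with h0 | h0
      · refine ⟨0, 0, ?_⟩
        have hr0 : r = 0 := by rw [hr, h0]; rfl
        have : ringP τ δ 0 0 = 0 := by simp [ringP, ringR]
        rw [this, sub_zero]
        have h2 : ringR τ δ 0 = r := by rw [hr, h0]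
        rw [h2, ← hhd]
        linarith
      · obtain ⟨f1, f2, f3, f4⟩ := ringN_facts hW hL hδ0 hδ n h0
        obtain ⟨k, hk⟩ := f4 (Complex.arg w)
        refine ⟨n, k, ?_⟩
        rw [← hr, ← hhd] at f1 hk ⊢
        have hr0 : 0 < r := by linarith
        apply le_of_sq_le_sq _ (by positivity)
        rw [ringP, ← hr]
        conv_lhs => rw [hwp]
        rw [polar_dist]
        have h5 : ‖w‖ ≤ 1.5 * r := by linarith
        have h6 : 4 * ‖w‖ * r * Real.sin ((Complex.arg w - 2 * Real.pi * k / ringN τ δ n) / 2) ^ 2 ≤ 0.6 * h ^ 2 := by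
          calc _ = ‖w‖ * r * (4 * Real.sin ((Complex.arg w - 2 * Real.pi * k / ringN τ δ n) / 2) ^ 2) := by ring
            _ ≤ (1.5 * r) * r * (0.4 * (h / r) ^ 2) := by gcongr
            _ = _ := by field_simp; norm_num
        have h7 : (‖w‖ - r) ^ 2 ≤ (h / 2) ^ 2 := by
          have : 0 ≤ ‖w‖ - r := by linarith
          gcongr
        nlinarith [sq_nonneg h]
    · obtain ⟨f1, f2, f3, f4⟩ := ringN_facts hW hL hδ0 hδ (n + 1) (by omega)
      obtain ⟨k, hk⟩ := f4 (Complex.arg w)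
      refine ⟨n + 1, k, ?_⟩
      have htt : 3 / 4 * h ≤ δ * τ (ringR τ δ (n + 1)) := by
        have h2 := tau_real_lip hL (hm (n + 1)) (hm n)
        have h3 := (abs_le.1 h2).1
        rw [hstep n, ← hr, ← hhd, add_sub_cancel_left, abs_of_pos hh] at h3
        obtain ⟨m0, m1, m2, m3⟩ := mTau_bds hL
        have h4 : c₂ * δ ≤ 1 / 4 := le_trans (by gcongr; exact hL.c₂_pos.le) m3
        have ht := hW.tau_pos _ (hm n)
        rw [← hr] at ht
        have h5 : c₂ * h ≤ 1 / 4 * τ r := by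
          rw [hhd, ← mul_assoc]; gcongr
        rw [hstep n, ← hr, ← hhd]
        have h6 : 3 / 4 * τ r ≤ τ (r + h) := by linarith
        calc 3 / 4 * h = δ * (3 / 4 * τ r) := by rw [hhd]; ring
          _ ≤ _ := by gcongr
      set r' := ringR τ δ (n + 1) with hr'
      set h' := δ * τ r' with hh'
      have hh'0 : 0 < h' := hpos (n + 1)
      have hr0 : 0 < r' := by linarith
      apply le_of_sq_le_sq _ (by positivity)
      rw [ringP, ← hr']
      conv_lhs => rw [hwp]
      rw [polar_dist]
      have h6 : 4 * ‖w‖ * r' * Real.sin ((Complex.arg w - 2 * Real.pi * k / ringN τ δ (n + 1)) / 2) ^ 2 ≤ 0.4 * h' ^ 2 := by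
        calc _ = ‖w‖ * r' * (4 * Real.sin ((Complex.arg w - 2 * Real.pi * k / ringN τ δ (n + 1)) / 2) ^ 2) := by ring
          _ ≤ r' * r' * (0.4 * (h' / r') ^ 2) := by gcongr
          _ = _ := by field_simp
      have h7 : (‖w‖ - r') ^ 2 ≤ (h / 2) ^ 2 := by
        apply sq_le_sq'
        · linarith
        · linarith
      nlinarith [sq_nonneg h']
  -- enumerate
  set S : Set ℂ := Set.range (fun p : ℕ × ℤ => ringP τ δ p.1 p.2) with hS
  have hSc : S.Countable := Set.countable_range _
  have hSi : S.Infinite := by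
    refine Set.infinite_of_injective_forall_mem (f := fun n : ℕ => ringP τ δ n 0) ?_ (fun n => ⟨(n, 0), rfl⟩)
    intro n m hnm
    have := congrArg norm hnm
    simp only [hnorm] at this
    exact hsm.injective this
  obtain ⟨hD⟩ := (Set.countable_infinite_iff_nonempty_denumerable).1 ⟨hSc, hSi⟩
  set e := (Denumerable.eqv S).symm with he
  have hej : ∀ j, ∃ n k, (e j : ℂ) = ringP τ δ n k := by
    intro j
    obtain ⟨p, hp⟩ := (e j).2
    exact ⟨p.1, p.2, hp.symm⟩
  have hcov2 : ∀ w ∈ unitDisc, ∃ j, ‖w - e j‖ ≤ 0.95 * (δ * radialize τ (e j)) := by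
    intro w hw
    obtain ⟨n, k, hnk⟩ := hcov w hw
    refine ⟨e.symm ⟨ringP τ δ n k, ⟨(n, k), rfl⟩⟩, ?_⟩
    rw [Equiv.apply_symm_apply, htau]
    exact hnk
  refine ⟨fun j => (e j : ℂ), lat_of hL hδ0 hδ ?_ ?_ ?_, hcov2⟩
  · intro j
    obtain ⟨n, k, h⟩ := hej j
    rw [h]; exact hmem n k
  · intro j k hjk
    obtain ⟨n, l, h⟩ := hej j
    obtain ⟨n', l', h'⟩ := hej k
    have hne : (e j : ℂ) ≠ e k := fun hh => hjk (e.injective (Subtype.ext hh))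
    rw [h, h'] at hne ⊢
    rw [htau]
    exact hsepP _ _ _ _ hne
  · intro w hw
    obtain ⟨j, hj⟩ := hcov2 w hw
    refine ⟨j, ?_⟩
    rw [Metric.mem_ball, dist_eq_norm]
    obtain ⟨n, k, h⟩ := hej j
    have : 0 < δ * radialize τ (e j) := by rw [h, htau]; exact hpos n
    linarith
end
end

noncomputable section
section
variable {ω φ : ℂ → ℝ} {τ : ℝ → ℝ} {c₁ c₂ δ : ℝ}

def quadPhi (z : ℂ) (k : ℝ) (w : ℂ) : ℝ := ((w.re - z.re) ^ 2 + (w.im - z.im) ^ 2) * k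

lemma quadPhi_contDiff (z : ℂ) (k : ℝ) : ContDiff ℝ 2 (quadPhi z k) := by
  unfold quadPhi
  have h1 : ContDiff ℝ 2 (fun w : ℂ => w.re) := Complex.reCLM.contDiff
  have h2 : ContDiff ℝ 2 (fun w : ℂ => w.im) := Complex.imCLM.contDiff
  fun_prop

lemma quadPhi_fderiv (z : ℂ) (k : ℝ) (w v : ℂ) :
    fderiv ℝ (quadPhi z k) w v = (2 * (w.re - z.re) * v.re + 2 * (w.im - z.im) * v.im) * k := by
  have h1 : HasFDerivAt (fun w : ℂ => w.re) Complex.reCLM w := Complex.reCLM.hasFDerivAt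
  have h2 : HasFDerivAt (fun w : ℂ => w.im) Complex.imCLM w := Complex.imCLM.hasFDerivAt
  have h3 := (((h1.sub_const z.re).pow 2).add ((h2.sub_const z.im).pow 2)).mul_const k
  have h4 : HasFDerivAt (quadPhi z k) _ w := h3
  rw [h4.fderiv]
  simp
  ring

lemma quadPhi_lap (z : ℂ) (k : ℝ) (w : ℂ) : laplacian (quadPhi z k) w = 4 * k := by
  have e1 : (fun w => fderiv ℝ (quadPhi z k) w 1) = fun w : ℂ => 2 * k * (w.re - z.re) := by
    funext w; rw [quadPhi_fderiv]; simp; ring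
  have e2 : (fun w => fderiv ℝ (quadPhi z k) w Complex.I) = fun w : ℂ => 2 * k * (w.im - z.im) := by
    funext w; rw [quadPhi_fderiv]; simp; ring
  unfold laplacian
  rw [e1, e2]
  have h1 : HasFDerivAt (fun w : ℂ => w.re) Complex.reCLM w := Complex.reCLM.hasFDerivAt
  have h2 : HasFDerivAt (fun w : ℂ => w.im) Complex.imCLM w := Complex.imCLM.hasFDerivAt
  have h3 := (h1.sub_const z.re).const_mul (2 * k)
  have h4 := (h2.sub_const z.im).const_mul (2 * k)
  rw [h3.fderiv, h4.fderiv]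
  simp
  ring

lemma quadPhi_norm (z : ℂ) (k : ℝ) (w : ℂ) : quadPhi z k w = ‖w - z‖ ^ 2 * k := by
  unfold quadPhi
  rw [← Complex.normSq_eq_norm_sq, Complex.normSq_apply, Complex.sub_re, Complex.sub_im]
  ring

/-- local dbar estimate, unweighted -/
lemma local_dbar {g : ℂ → ℂ} {z : ℂ} {R : ℝ} (hR : 0 < R)
    (hsub : Metric.closedBall z R ⊆ unitDisc)
    (hg : ContDiffOn ℝ 1 g unitDisc) :
    ∃ h : ℂ → ℂ, DifferentiableOn ℂ h (Metric.ball z R) ∧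
      ∫⁻ w in Metric.ball z R, ENNReal.ofReal (‖g w - h w‖ ^ 2) ∂dA ≤
      ENNReal.ofReal (Real.exp 2) * ∫⁻ w in Metric.ball z R, ENNReal.ofReal (R ^ 2 * ‖dbar g w‖ ^ 2) ∂dA := by
  have hk : 0 < (R ^ 2)⁻¹ := by positivity
  obtain ⟨M, hM⟩ := (isCompact_closedBall z R).exists_bound_of_continuousOn (hg.continuousOn.mono hsub)
  have hbs : Metric.ball z R ⊆ unitDisc := Metric.ball_subset_closedBall.trans hsub
  have hq0 : ∀ w, 0 ≤ quadPhi z (R ^ 2)⁻¹ w := fun w => by rw [quadPhi_norm]; positivity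
  have hq1 : ∀ w ∈ Metric.ball z R, quadPhi z (R ^ 2)⁻¹ w ≤ 1 := fun w hw => by
    rw [quadPhi_norm, ← div_eq_mul_inv, div_le_one (by positivity)]
    have := mem_ball_iff_norm.1 hw
    gcongr
  have hwL : ∫⁻ w in Metric.ball z R, ENNReal.ofReal (‖g w‖ ^ 2 * Real.exp (-(2 * quadPhi z (R ^ 2)⁻¹ w))) ≠ ⊤ := by
    refine (lt_of_le_of_lt (setLIntegral_mono' measurableSet_ball (g := fun _ => ENNReal.ofReal (M ^ 2)) ?_) ?_).ne
    · intro w hw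
      apply ENNReal.ofReal_le_ofReal
      have h1 := hM w (Metric.ball_subset_closedBall hw)
      have h2 : Real.exp (-(2 * quadPhi z (R ^ 2)⁻¹ w)) ≤ 1 := by
        rw [Real.exp_le_one_iff]; linarith [hq0 w]
      calc ‖g w‖ ^ 2 * Real.exp (-(2 * quadPhi z (R ^ 2)⁻¹ w)) ≤ M ^ 2 * 1 := by gcongr
        _ = _ := mul_one _
    · rw [setLIntegral_const]
      exact ENNReal.mul_lt_top ENNReal.ofReal_lt_top measure_ball_lt_top
  obtain ⟨h, hh, hint⟩ := horm_vol Metric.isOpen_ball (quadPhi_contDiff z (R ^ 2)⁻¹).contDiffOn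
    (fun w _ => by rw [quadPhi_lap]; positivity) (hg.mono hbs) hwL
  refine ⟨h, hh, ?_⟩
  rw [lintegral_dA, lintegral_dA]
  rw [mul_left_comm]
  refine mul_le_mul_right ?_ _
  calc ∫⁻ w in Metric.ball z R, ENNReal.ofReal (‖g w - h w‖ ^ 2)
      ≤ ∫⁻ w in Metric.ball z R, ENNReal.ofReal (Real.exp 2) * ENNReal.ofReal (‖g w - h w‖ ^ 2 * Real.exp (-(2 * quadPhi z (R ^ 2)⁻¹ w))) := by
        refine setLIntegral_mono' measurableSet_ball fun w hw => ?_
        rw [← ENNReal.ofReal_mul (by positivity)]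
        apply ENNReal.ofReal_le_ofReal
        have h3 : 1 ≤ Real.exp 2 * Real.exp (-(2 * quadPhi z (R ^ 2)⁻¹ w)) := by
          rw [← Real.exp_add, Real.one_le_exp_iff]; linarith [hq1 w hw]
        have h4 := mul_le_mul_of_nonneg_left h3 (sq_nonneg ‖g w - h w‖)
        linarith
    _ = ENNReal.ofReal (Real.exp 2) * ∫⁻ w in Metric.ball z R, ENNReal.ofReal (‖g w - h w‖ ^ 2 * Real.exp (-(2 * quadPhi z (R ^ 2)⁻¹ w))) :=
        lintegral_const_mul' _ _ ENNReal.ofReal_ne_top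
    _ ≤ _ := by
        refine mul_le_mul_right ?_ _
        refine hint.trans ?_
        rw [← lintegral_const_mul' _ _ (by simp)]
        refine setLIntegral_mono' measurableSet_ball fun w hw => ?_
        rw [show (2 : ℝ≥0∞) = ENNReal.ofReal 2 by simp, ← ENNReal.ofReal_mul (by norm_num)]
        apply ENNReal.ofReal_le_ofReal
        rw [quadPhi_lap]
        have h2 : Real.exp (-(2 * quadPhi z (R ^ 2)⁻¹ w)) ≤ 1 := by
          rw [Real.exp_le_one_iff]; linarith [hq0 w]
        have e : ‖dbar g w‖ ^ 2 / (4 * (R ^ 2)⁻¹) = R ^ 2 * ‖dbar g w‖ ^ 2 / 4 := by field_simp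
        rw [e]
        have h5 : 0 ≤ R ^ 2 * ‖dbar g w‖ ^ 2 := by positivity
        have := mul_le_mul_of_nonneg_left h2 h5
        linarith

lemma closedBall_sub (hL : IsClassL (radialize τ) c₁ c₂) (hδ0 : 0 < δ) (hδ : δ ≤ mTau c₁ c₂)
    {z : ℂ} (hz : z ∈ unitDisc) : Metric.closedBall z (δ * radialize τ z) ⊆ unitDisc := by
  intro w hw
  refine mem_disc_of hL hδ0.le hδ hz (s := 1) (by norm_num) (by norm_num) ?_
  rw [one_mul]; exact mem_closedBall_iff_norm.1 hw

/-- comparison of `R²|∂̄g|²` with the weighted one -/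
lemma dbar_cmp (hW : IsClassW ω φ τ) (hL : IsClassL (radialize τ) c₁ c₂) :
    ∃ K : ℝ, 1 ≤ K ∧ ∀ δ, 0 < δ → δ ≤ mTau c₁ c₂ → ∀ (g : ℂ → ℂ), ∀ z ∈ unitDisc, ∀ w ∈ Metric.ball z (δ * radialize τ z),
      (δ * radialize τ z) ^ 2 * ‖dbar g w‖ ^ 2 ≤ K * ‖dbar g w / (Real.sqrt (laplacian φ w) : ℂ)‖ ^ 2 := by
  obtain ⟨C, hC1, hC⟩ := lap_bd hW
  refine ⟨4 * C, by linarith, fun δ hδ0 hδ g z hz w hw => ?_⟩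
  have hwD := closedBall_sub hL hδ0 hδ hz (Metric.ball_subset_closedBall hw)
  have h1 := hW.lap_pos w hwD
  have h2 := (hC w hwD).2
  have h3 := tau_cmp hL hδ0.le hδ hz hwD (s := 1) (by norm_num) (by rw [one_mul]; exact (mem_ball_iff_norm.1 hw).le)
  have h4 := hL.pos z hz
  have h5 := hL.pos w hwD
  have hm := mTau_bds hL
  rw [norm_div, div_pow, Complex.norm_real, Real.norm_eq_abs, sq_abs, Real.sq_sqrt h1.le]
  have h6 : radialize τ z ≤ 2 * radialize τ w := by
    have := abs_le.1 h3; linarith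
  have h7 : laplacian φ w * radialize τ w ^ 2 ≤ C := by
    rw [le_div_iff₀ (by exact pow_pos h5 2)] at h2; exact h2
  have h8 : (δ * radialize τ z) ^ 2 * laplacian φ w ≤ 4 * C := by
    have : δ * radialize τ z ≤ 1 * (2 * radialize τ w) := by
      apply mul_le_mul _ h6 h4.le (by norm_num); linarith
    calc (δ * radialize τ z) ^ 2 * laplacian φ w ≤ (1 * (2 * radialize τ w)) ^ 2 * laplacian φ w := by gcongr
      _ = 4 * (laplacian φ w * radialize τ w ^ 2) := by ring
      _ ≤ _ := by linarith
  rw [mul_div_assoc', le_div_iff₀ h1]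
  have := mul_le_mul_of_nonneg_right h8 (sq_nonneg ‖dbar g w‖)
  linarith

lemma three_two_pt (hW : IsClassW ω φ τ) (hL : IsClassL (radialize τ) c₁ c₂) :
    ∃ K : ℝ≥0∞, K ≠ ⊤ ∧ ∀ δ, 0 < δ → δ ≤ mTau c₁ c₂ → ∀ (g g₁ g₂ : ℂ → ℂ),
      (∀ z ∈ unitDisc, g z = g₁ z + g₂ z) → ContDiffOn ℝ 1 g₂ unitDisc → ∀ z ∈ unitDisc,
      FdeltaSqE (radialize τ) δ g z ≤ K * (localMeanE (radialize τ) δ g₁ z + localMeanE (radialize τ) δ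
        (fun w => dbar g₂ w / (Real.sqrt (laplacian φ w) : ℂ)) z) := by
  obtain ⟨K, hK1, hK⟩ := dbar_cmp hW hL
  refine ⟨ENNReal.ofReal (2 * (Real.exp 2 * K)), ENNReal.ofReal_ne_top, fun δ hδ0 hδ g g₁ g₂ hg hg2 z hz => ?_⟩
  have hR : 0 < δ * radialize τ z := mul_pos hδ0 (hL.pos z hz)
  have hsub := closedBall_sub hL hδ0 hδ hz
  have hbs := Metric.ball_subset_closedBall.trans hsub
  obtain ⟨h, hh, hint⟩ := local_dbar hR hsub hg2
  refine (iInf₂_le h hh).trans ?_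
  unfold localMeanE
  rw [← mul_add, mul_left_comm]
  refine mul_le_mul_right ?_ _
  have hE : (1:ℝ) ≤ Real.exp 2 * K := by
    have : (1:ℝ) ≤ Real.exp 2 := Real.one_le_exp (by norm_num)
    nlinarith
  have hm : AEMeasurable (fun w => ENNReal.ofReal (2 * ‖g₂ w - h w‖ ^ 2)) (dA.restrict (Metric.ball z (δ * radialize τ z))) := by
    have : ContinuousOn (fun w => ENNReal.ofReal (2 * ‖g₂ w - h w‖ ^ 2)) (Metric.ball z (δ * radialize τ z)) := by
      apply ENNReal.continuous_ofReal.comp_continuousOn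
      have := (hg2.continuousOn.mono hbs).sub hh.continuousOn
      exact (this.norm.pow 2).const_mul 2
    exact this.aemeasurable measurableSet_ball
  calc ∫⁻ w in Metric.ball z (δ * radialize τ z), ENNReal.ofReal (‖g w - h w‖ ^ 2) ∂dA
      ≤ ∫⁻ w in Metric.ball z (δ * radialize τ z), (ENNReal.ofReal (2 * ‖g₁ w‖ ^ 2) + ENNReal.ofReal (2 * ‖g₂ w - h w‖ ^ 2)) ∂dA := by
        refine setLIntegral_mono' measurableSet_ball fun w hw => ?_
        rw [← ENNReal.ofReal_add (by positivity) (by positivity)]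
        apply ENNReal.ofReal_le_ofReal
        rw [hg w (hbs hw), add_sub_assoc]
        have h1 := norm_add_le (g₁ w) (g₂ w - h w)
        have h2 := norm_nonneg (g₁ w + (g₂ w - h w))
        nlinarith [sq_nonneg (‖g₁ w‖ - ‖g₂ w - h w‖)]
    _ = ∫⁻ w in Metric.ball z (δ * radialize τ z), ENNReal.ofReal (2 * ‖g₁ w‖ ^ 2) ∂dA + ∫⁻ w in Metric.ball z (δ * radialize τ z), ENNReal.ofReal (2 * ‖g₂ w - h w‖ ^ 2) ∂dA :=
        lintegral_add_right' _ hm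
    _ ≤ _ := by
        rw [mul_add]
        gcongr
        · rw [← lintegral_const_mul' _ _ ENNReal.ofReal_ne_top]
          refine setLIntegral_mono' measurableSet_ball fun w hw => ?_
          rw [← ENNReal.ofReal_mul (by positivity)]
          apply ENNReal.ofReal_le_ofReal
          have := sq_nonneg ‖g₁ w‖
          nlinarith
        · simp_rw [ENNReal.ofReal_mul (show (0:ℝ) ≤ 2 by norm_num)]
          rw [lintegral_const_mul' _ _ ENNReal.ofReal_ne_top, mul_assoc]
          refine mul_le_mul_right ?_ _
          refine hint.trans ?_
          rw [ENNReal.ofReal_mul (by positivity), mul_assoc]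
          refine mul_le_mul_right ?_ _
          rw [← lintegral_const_mul' _ _ ENNReal.ofReal_ne_top]
          refine setLIntegral_mono' measurableSet_ball fun w hw => ?_
          rw [← ENNReal.ofReal_mul (by positivity)]
          exact ENNReal.ofReal_le_ofReal (hK δ hδ0 hδ g₂ z hz w hw)

theorem three_two (hW : IsClassW ω φ τ) (hL : IsClassL (radialize τ) c₁ c₂) {g : ℂ → ℂ} {p : ℝ}
    (hp : p ∈ Set.Ioo (0:ℝ) 1) (h : SchattenCondThree (radialize τ) φ c₁ c₂ g p) :
    SchattenCondTwo (radialize τ) c₁ c₂ g p := by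
  obtain ⟨δ, hδ, g₁, g₂, hg, hg2, hsum⟩ := h
  obtain ⟨K, hKt, hK⟩ := three_two_pt hW hL
  have hp2 : 0 ≤ p / 2 := by linarith [hp.1]
  refine ⟨δ, hδ, fun z hz => ?_⟩
  obtain ⟨s1, s2⟩ := hsum z hz
  refine lt_of_le_of_lt (ENNReal.tsum_le_tsum (g := fun j => K ^ (p / 2) * (localMeanE (radialize τ) δ g₁ (z j) ^ (p / 2) + localMeanE (radialize τ) δ
        (fun w => dbar g₂ w / (Real.sqrt (laplacian φ w) : ℂ)) (z j) ^ (p / 2))) fun j => ?_) ?_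
  · refine (ENNReal.rpow_le_rpow (hK δ hδ.1 hδ.2.le g g₁ g₂ hg hg2 (z j) (hz.mem j)) hp2).trans ?_
    rw [ENNReal.mul_rpow_of_nonneg _ _ hp2]
    refine mul_le_mul_right ?_ _
    exact ENNReal.rpow_add_le_add_rpow _ _ hp2 (by linarith [hp.2])
  · rw [ENNReal.tsum_mul_left, ENNReal.tsum_add]
    exact ENNReal.mul_lt_top (ENNReal.rpow_lt_top_of_nonneg hp2 hKt) (ENNReal.add_lt_top.2 ⟨s1, s2⟩)
end
end

noncomputable section
section
variable {ω φ : ℂ → ℝ} {τ : ℝ → ℝ} {c₁ c₂ δ : ℝ} {τC : ℂ → ℝ}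

theorem dbar_congr {u v : ℂ → ℂ} {z : ℂ} (h : u =ᶠ[nhds z] v) : dbar u z = dbar v z := by
  unfold dbar; rw [h.fderiv_eq]

theorem dbar_sum {ι : Type*} {u : ι → ℂ → ℂ} {z : ℂ} (J : Finset ι) (h : ∀ j ∈ J, DifferentiableAt ℝ (u j) z) :
    dbar (fun w => ∑ j ∈ J, u j w) z = ∑ j ∈ J, dbar (u j) z := by
  unfold dbar
  rw [fderiv_fun_sum h]
  simp only [_root_.sum_apply, Finset.mul_sum]
  rw [← Finset.sum_add_distrib, Finset.sum_div]

theorem germ_est {z0 : ℂ} {J : Finset ℕ} {H Ψ : ℕ → ℂ → ℂ} {g₂ : ℂ → ℂ} {c D B : ℝ} {s : ℕ → ℝ} {k : ℕ}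
    (hH : ∀ j ∈ J, DifferentiableAt ℂ (H j) z0) (hHc : ∀ j ∈ J, ContDiffAt ℝ 1 (H j) z0)
    (hΨ : ∀ j ∈ J, ContDiffAt ℝ 1 (Ψ j) z0) (hs : ∀ j ∈ J, Ψ j z0 = s j) (hs0 : ∀ j ∈ J, 0 ≤ s j)
    (hc : 0 < c) (hS : c ≤ ∑ j ∈ J, s j) (hD : ∀ j ∈ J, ‖dbar (Ψ j) z0‖ ≤ D) (hk : k ∈ J)
    (hB : ∀ j ∈ J, ‖H j z0 - H k z0‖ ≤ B)
    (hg : g₂ =ᶠ[nhds z0] fun w => (∑ j ∈ J, H j w * Ψ j w) / ∑ j ∈ J, Ψ j w) :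
    ContDiffAt ℝ 1 g₂ z0 ∧ ‖g₂ z0 - H k z0‖ ≤ B ∧ ‖dbar g₂ z0‖ ≤ 2 * J.card * B * D / c := by
  have hB0 : 0 ≤ B := (norm_nonneg _).trans (hB k hk)
  have hD0 : 0 ≤ D := (norm_nonneg _).trans (hD k hk)
  have hSv : ∑ j ∈ J, Ψ j z0 = ((∑ j ∈ J, s j : ℝ) : ℂ) := by
    rw [Complex.ofReal_sum]; exact Finset.sum_congr rfl hs
  have hS0 : ∑ j ∈ J, Ψ j z0 ≠ 0 := by
    rw [hSv, Complex.ofReal_ne_zero]; linarith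
  have hnS : ‖∑ j ∈ J, Ψ j z0‖ = ∑ j ∈ J, s j := by
    rw [hSv, Complex.norm_real, Real.norm_of_nonneg (by linarith)]
  have cS : ContDiffAt ℝ 1 (fun w => ∑ j ∈ J, Ψ j w) z0 := ContDiffAt.sum hΨ
  have cN : ContDiffAt ℝ 1 (fun w => ∑ j ∈ J, H j w * Ψ j w) z0 := ContDiffAt.sum fun j hj => (hHc j hj).mul (hΨ j hj)
  have hcd : ContDiffAt ℝ 1 g₂ z0 := by
    have h := cN.mul (cS.inv hS0)
    refine h.congr_of_eventuallyEq (hg.trans (Eventually.of_forall fun w => ?_))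
    simp [div_eq_mul_inv]
  have dH : ∀ j ∈ J, DifferentiableAt ℝ (H j) z0 := fun j hj => (hHc j hj).differentiableAt (by norm_num)
  have dΨ : ∀ j ∈ J, DifferentiableAt ℝ (Ψ j) z0 := fun j hj => (hΨ j hj).differentiableAt (by norm_num)
  have dS := cS.differentiableAt (by norm_num)
  have dg := hcd.differentiableAt (by norm_num)
  have hne : ∀ᶠ w in nhds z0, ∑ j ∈ J, Ψ j w ≠ 0 := cS.continuousAt.eventually_ne hS0
  have key : (fun w => (g₂ w + -H k w) * ∑ j ∈ J, Ψ j w) =ᶠ[nhds z0] fun w => ∑ j ∈ J, (H j w + -H k w) * Ψ j w := by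
    filter_upwards [hg, hne] with w h1 h2
    rw [h1, add_mul, div_mul_cancel₀ _ h2, Finset.mul_sum, ← Finset.sum_add_distrib]
    exact Finset.sum_congr rfl fun j _ => by ring
  have hval := key.self_of_nhds
  beta_reduce at hval
  have h1 : ‖g₂ z0 - H k z0‖ ≤ B := by
    have h2 : ‖(g₂ z0 + -H k z0) * ∑ j ∈ J, Ψ j z0‖ ≤ B * ∑ j ∈ J, s j := by
      rw [hval, Finset.mul_sum]
      refine norm_sum_le_of_le _ fun j hj => ?_
      rw [norm_mul, hs j hj, Complex.norm_real, Real.norm_of_nonneg (hs0 j hj), ← sub_eq_add_neg]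
      exact mul_le_mul_of_nonneg_right (hB j hj) (hs0 j hj)
    rw [norm_mul, hnS, ← sub_eq_add_neg] at h2
    exact le_of_mul_le_mul_right h2 (by linarith)
  refine ⟨hcd, h1, ?_⟩
  have hd := dbar_congr key
  have holo0 : ∀ j ∈ J, dbar (H j) z0 = 0 := fun j hj => dbar_holo (hH j hj)
  have hneg : dbar (fun w => -H k w) z0 = 0 := dbar_holo (hH k hk).fun_neg
  rw [dbar_mul (dg.fun_add (dH k hk).fun_neg) dS, dbar_add dg (dH k hk).fun_neg, hneg, add_zero, dbar_sum J dΨ,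
    dbar_sum J (fun j hj => ((dH j hj).fun_add (dH k hk).fun_neg).fun_mul (dΨ j hj))] at hd
  have e : ∀ j ∈ J, dbar (fun w => (H j w + -H k w) * Ψ j w) z0 = (H j z0 - H k z0) * dbar (Ψ j) z0 := by
    intro j hj
    rw [dbar_mul ((dH j hj).fun_add (dH k hk).fun_neg) (dΨ j hj), dbar_add (dH j hj) (dH k hk).fun_neg, hneg, holo0 j hj]
    ring
  rw [Finset.sum_congr rfl e] at hd
  have hd2 : dbar g₂ z0 * ∑ j ∈ J, Ψ j z0 = ∑ j ∈ J, (H j z0 - H k z0) * dbar (Ψ j) z0 - (g₂ z0 - H k z0) * ∑ j ∈ J, dbar (Ψ j) z0 := by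
    rw [← hd]; ring
  have n1 : ‖∑ j ∈ J, (H j z0 - H k z0) * dbar (Ψ j) z0‖ ≤ J.card * (B * D) := by
    rw [← nsmul_eq_mul]
    refine (norm_sum_le _ _).trans (Finset.sum_le_card_nsmul _ _ _ fun j hj => ?_)
    rw [norm_mul]; exact mul_le_mul (hB j hj) (hD j hj) (norm_nonneg _) hB0
  have n2 : ‖∑ j ∈ J, dbar (Ψ j) z0‖ ≤ J.card * D := by
    rw [← nsmul_eq_mul]
    exact (norm_sum_le _ _).trans (Finset.sum_le_card_nsmul _ _ _ hD)
  have n3 : ‖dbar g₂ z0‖ * c ≤ 2 * J.card * B * D := by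
    calc ‖dbar g₂ z0‖ * c ≤ ‖dbar g₂ z0‖ * ∑ j ∈ J, s j := by gcongr
      _ = ‖dbar g₂ z0 * ∑ j ∈ J, Ψ j z0‖ := by rw [norm_mul, hnS]
      _ ≤ J.card * (B * D) + B * (J.card * D) := by
        rw [hd2]
        refine (norm_sub_le _ _).trans (add_le_add n1 ?_)
        rw [norm_mul]; exact mul_le_mul h1 n2 (norm_nonneg _) hB0
      _ = _ := by ring
  rwa [le_div_iff₀ hc]

/-- bump at `a` of radius `R` -/
def bmp (a : ℂ) (R : ℝ) (z : ℂ) : ℝ := eta ((R⁻¹ : ℝ) • (z - a))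

theorem bmp_contDiff (a : ℂ) (R : ℝ) : ContDiff ℝ 1 (fun z => (bmp a R z : ℂ)) := by
  unfold bmp
  have := (eta_contDiff (n := 1)).comp (f := fun z : ℂ => (R⁻¹ : ℝ) • (z - a)) (by fun_prop)
  exact Complex.ofRealCLM.contDiff.comp this

theorem bmp_zero {a : ℂ} {R : ℝ} (hR : 0 < R) {z : ℂ} (h : R ≤ ‖z - a‖) : bmp a R z = 0 := by
  apply eta_zero
  rw [norm_smul, norm_inv, Real.norm_of_nonneg hR.le, inv_mul_eq_div, le_div_iff₀ hR]; linarith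

theorem bmp_lower : ∃ c > 0, ∀ (a : ℂ) (R : ℝ), 0 < R → ∀ z, ‖z - a‖ ≤ 0.98 * R → c ≤ bmp a R z := by
  obtain ⟨w0, hw0, hmin⟩ := (isCompact_closedBall (0:ℂ) 0.98).exists_isMinOn ⟨0, by simp; norm_num⟩ eta_continuous.continuousOn
  refine ⟨eta w0, eta_pos ?_, fun a R hR z hz => hmin ?_⟩
  · have := mem_closedBall_zero_iff.1 hw0
    exact lt_of_le_of_lt this (by norm_num)
  · rw [mem_closedBall_zero_iff, norm_smul, norm_inv, Real.norm_of_nonneg hR.le, inv_mul_eq_div, div_le_iff₀ hR]; exact hz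

theorem bmp_dbar : ∃ L > 0, ∀ (a : ℂ) (R : ℝ), 0 < R → ∀ z, ‖dbar (fun z => (bmp a R z : ℂ)) z‖ ≤ L / R := by
  obtain ⟨L, hL⟩ := eta_lip
  refine ⟨L + 1, by positivity, fun a R hR z => ?_⟩
  have h1 : LipschitzWith (L * (R⁻¹).toNNReal) (fun z => (bmp a R z : ℂ)) := by
    refine LipschitzWith.of_dist_le_mul fun x y => ?_
    rw [dist_eq_norm, ← Complex.ofReal_sub, Complex.norm_real, ← dist_eq_norm]
    refine (hL.dist_le_mul _ _).trans ?_
    rw [dist_eq_norm, ← smul_sub, norm_smul, norm_inv, Real.norm_of_nonneg hR.le, NNReal.coe_mul, Real.coe_toNNReal _ (by positivity), dist_eq_norm]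
    rw [sub_sub_sub_cancel_right, mul_assoc]
  have h2 := norm_fderiv_le_of_lipschitz ℝ (x₀ := z) h1
  rw [NNReal.coe_mul, Real.coe_toNNReal _ (by positivity)] at h2
  unfold dbar
  set A := fderiv ℝ (fun z => (bmp a R z : ℂ)) z
  have h3 := A.le_opNorm 1
  have h4 := A.le_opNorm Complex.I
  rw [norm_one, mul_one] at h3
  rw [Complex.norm_I, mul_one] at h4
  rw [norm_div, Complex.norm_ofNat]
  have h5 := norm_add_le (A 1) (Complex.I * A Complex.I)
  rw [norm_mul, Complex.norm_I, one_mul] at h5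
  have h6 : (L:ℝ) * R⁻¹ ≤ (L + 1) / R := by
    rw [div_eq_mul_inv]; gcongr; linarith
  linarith
end
end

noncomputable section
section
variable {ω φ : ℂ → ℝ} {τ : ℝ → ℝ} {c₁ c₂ δ : ℝ} {τC : ℂ → ℝ}

theorem aem_disc (hW : IsClassW ω φ τ) {g : ℂ → ℂ} (hg : AEStronglyMeasurable g (muW ω)) :
    AEStronglyMeasurable g (dA.restrict unitDisc) := by
  refine hg.mono_ac ?_
  unfold muW
  refine withDensity_absolutelyContinuous' (omega_aem hW le_rfl) ?_
  rw [ae_restrict_iff' isOpen_unitDisc.measurableSet]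
  exact Eventually.of_forall fun z hz => by simpa using hW.pos z hz

/-- comparison of two local holomorphic approximations -/
theorem holo_cmp (hL : IsClassL τC c₁ c₂) (hδ0 : 0 < δ) (hδ : δ ≤ mTau c₁ c₂) {g : ℂ → ℂ}
    (hg : AEStronglyMeasurable g (dA.restrict unitDisc)) {a₁ a₂ z0 : ℂ} (h1 : a₁ ∈ unitDisc) (h2 : a₂ ∈ unitDisc)
    (hz0 : z0 ∈ unitDisc) {h₁ h₂ : ℂ → ℂ} (d1 : DifferentiableOn ℂ h₁ (Metric.ball a₁ (δ * τC a₁)))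
    (d2 : DifferentiableOn ℂ h₂ (Metric.ball a₂ (δ * τC a₂))) {b₁ b₂ : ℝ} (hb1 : 0 ≤ b₁) (hb2 : 0 ≤ b₂)
    (m1 : localMeanE τC δ (fun w => g w - h₁ w) a₁ ≤ ENNReal.ofReal b₁)
    (m2 : localMeanE τC δ (fun w => g w - h₂ w) a₂ ≤ ENNReal.ofReal b₂)
    (n1 : ‖z0 - a₁‖ ≤ 0.97 * (δ * τC a₁)) (n2 : ‖z0 - a₂‖ ≤ 0.97 * (δ * τC a₂)) :
    ‖h₁ z0 - h₂ z0‖ ^ 2 ≤ 10000 * smC * (b₁ + b₂) := by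
  have hm : ∀ a ∈ unitDisc, ∀ h : ℂ → ℂ, ∀ b : ℝ, 0 ≤ b → localMeanE τC δ (fun w => g w - h w) a ≤ ENNReal.ofReal b →
      ‖z0 - a‖ ≤ 0.97 * (δ * τC a) → Metric.ball z0 (0.02 * (δ * τC z0)) ⊆ Metric.ball a (δ * τC a) ∧
      ∫⁻ w in Metric.ball z0 (0.02 * (δ * τC z0)), ENNReal.ofReal (‖g w - h w‖ ^ 2) ∂dA ≤ ENNReal.ofReal (2 * (δ * τC z0) ^ 2 * b) := by
    intro a ha h b hb hmean hn
    have t := abs_le.1 (tau_cmp hL hδ0.le hδ ha hz0 (s := 0.97) (by norm_num) hn)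
    have pa := hL.pos a ha
    have p0 := hL.pos z0 hz0
    have q1 : δ * τC z0 ≤ 1.25 * (δ * τC a) := by nlinarith
    have q2 : δ * τC a ≤ 1.33 * (δ * τC z0) := by nlinarith
    have hsub : Metric.ball z0 (0.02 * (δ * τC z0)) ⊆ Metric.ball a (δ * τC a) := by
      intro w hw
      rw [mem_ball_iff_norm] at hw ⊢
      have : ‖w - a‖ ≤ ‖w - z0‖ + ‖z0 - a‖ := by simpa using norm_add_le (w - z0) (z0 - a)
      have : 0 < δ * τC a := by positivity
      linarith
    refine ⟨hsub, (lintegral_mono_set hsub).trans ?_⟩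
    unfold localMeanE at hmean
    have pR : 0 < (δ * τC a) ^ 2 := by positivity
    rw [ENNReal.inv_mul_le_iff (ENNReal.ofReal_pos.2 pR).ne' ENNReal.ofReal_ne_top, ← ENNReal.ofReal_mul pR.le] at hmean
    refine hmean.trans (ENNReal.ofReal_le_ofReal ?_)
    have : (δ * τC a) ^ 2 ≤ (1.33 * (δ * τC z0)) ^ 2 := by gcongr
    gcongr
    nlinarith [sq_nonneg (δ * τC z0)]
  obtain ⟨s1, i1⟩ := hm a₁ h1 h₁ b₁ hb1 m1 n1
  obtain ⟨s2, i2⟩ := hm a₂ h2 h₂ b₂ hb2 m2 n2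
  have p0 := hL.pos z0 hz0
  have hr : 0 < 0.02 * (δ * τC z0) := by positivity
  have hsm := submean hr ((d1.mono s1).sub (d2.mono s2))
  simp only [Pi.sub_apply] at hsm
  have hbD : Metric.ball z0 (0.02 * (δ * τC z0)) ⊆ unitDisc := s1.trans (ball_sub_disc1 hL hδ0.le hδ h1)
  have hmeas : AEMeasurable (fun w => ENNReal.ofReal (2 * ‖g w - h₂ w‖ ^ 2)) (dA.restrict (Metric.ball z0 (0.02 * (δ * τC z0)))) := by
    have e1 := hg.mono_measure (Measure.restrict_mono hbD le_rfl)
    have e2 : AEStronglyMeasurable h₂ (dA.restrict (Metric.ball z0 (0.02 * (δ * τC z0)))) :=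
      (d2.mono s2).continuousOn.aestronglyMeasurable measurableSet_ball
    exact ((((e1.sub e2).norm.pow 2).const_mul 2).aemeasurable).ennreal_ofReal
  have hfin : ENNReal.ofReal (‖h₁ z0 - h₂ z0‖ ^ 2) ≤ ENNReal.ofReal (10000 * smC * (b₁ + b₂)) := by
    refine hsm.trans ?_
    have : ∫⁻ w in Metric.ball z0 (0.02 * (δ * τC z0)), ENNReal.ofReal (‖h₁ w - h₂ w‖ ^ 2) ∂dA ≤
        ENNReal.ofReal (4 * (δ * τC z0) ^ 2 * (b₁ + b₂)) := by
      calc _ ≤ ∫⁻ w in Metric.ball z0 (0.02 * (δ * τC z0)), (ENNReal.ofReal (2 * ‖g w - h₁ w‖ ^ 2) + ENNReal.ofReal (2 * ‖g w - h₂ w‖ ^ 2)) ∂dA := by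
            refine lintegral_mono fun w => ?_
            rw [← ENNReal.ofReal_add (by positivity) (by positivity)]
            apply ENNReal.ofReal_le_ofReal
            have q1 : ‖h₁ w - h₂ w‖ ≤ ‖g w - h₂ w‖ + ‖g w - h₁ w‖ := by
              have := norm_sub_le (g w - h₂ w) (g w - h₁ w)
              rwa [sub_sub_sub_cancel_left] at this
            nlinarith [sq_nonneg (‖g w - h₁ w‖ - ‖g w - h₂ w‖), norm_nonneg (h₁ w - h₂ w)]
        _ = _ := lintegral_add_right' _ hmeas
        _ ≤ ENNReal.ofReal 2 * ENNReal.ofReal (2 * (δ * τC z0) ^ 2 * b₁) + ENNReal.ofReal 2 * ENNReal.ofReal (2 * (δ * τC z0) ^ 2 * b₂) := by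
            have e : ∀ h : ℂ → ℂ, ∫⁻ w in Metric.ball z0 (0.02 * (δ * τC z0)), ENNReal.ofReal (2 * ‖g w - h w‖ ^ 2) ∂dA =
                ENNReal.ofReal 2 * ∫⁻ w in Metric.ball z0 (0.02 * (δ * τC z0)), ENNReal.ofReal (‖g w - h w‖ ^ 2) ∂dA := by
              intro h
              rw [← lintegral_const_mul' _ _ ENNReal.ofReal_ne_top]
              exact lintegral_congr fun w => ENNReal.ofReal_mul (by norm_num)
            rw [e, e]
            exact add_le_add (mul_le_mul_right i1 _) (mul_le_mul_right i2 _)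
        _ = _ := by
            rw [← ENNReal.ofReal_mul (by norm_num), ← ENNReal.ofReal_mul (by norm_num), ← ENNReal.ofReal_add (by positivity) (by positivity)]
            congr 1; ring
    refine (mul_le_mul_right this _).trans ?_
    have hs := smC_pos
    rw [← ENNReal.ofReal_mul (by positivity)]
    apply le_of_eq
    congr 1
    field_simp
    norm_num
    try ring
  have hs := smC_pos
  rwa [ENNReal.ofReal_le_ofReal_iff (by positivity)] at hfin

set_option maxHeartbeats 1000000 in
theorem glue (hL : IsClassL τC c₁ c₂) (hδ0 : 0 < δ) (hδ : δ ≤ mTau c₁ c₂) {g : ℂ → ℂ}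
    (hg : AEStronglyMeasurable g (dA.restrict unitDisc)) {z : ℕ → ℂ} (hz : ∀ j, z j ∈ unitDisc)
    (hsep : ∀ j k, j ≠ k → δ * τC (z k) ≤ ‖z j - z k‖)
    (hcov : ∀ w ∈ unitDisc, ∃ j, ‖w - z j‖ ≤ 0.95 * (δ * τC (z j)))
    {H : ℕ → ℂ → ℂ} (hH : ∀ j, DifferentiableOn ℂ (H j) (Metric.ball (z j) (δ * τC (z j)))) {b : ℕ → ℝ}
    (hb : ∀ j, 0 ≤ b j) (hm : ∀ j, localMeanE τC δ (fun w => g w - H j w) (z j) ≤ ENNReal.ofReal (b j)) :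
    ∃ K > 0, ∃ g₂ : ℂ → ℂ, ContDiffOn ℝ 1 g₂ unitDisc ∧ ∀ z0 ∈ unitDisc, ∀ k, ‖z0 - z k‖ ≤ 0.97 * (δ * τC (z k)) →
      ∀ β : ℝ, (∀ j, ‖z0 - z j‖ ≤ 0.97 * (δ * τC (z j)) → b j ≤ β) → ‖g₂ z0 - H k z0‖ ^ 2 ≤ K * β ∧
        τC z0 ^ 2 * ‖dbar g₂ z0‖ ^ 2 ≤ K * β := by
  obtain ⟨N, hN⟩ := overlap hL hδ0 hδ hz hsep hδ0 hδ
  obtain ⟨c, hc, hlow⟩ := bmp_lower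
  obtain ⟨L, hL0, hLip⟩ := bmp_dbar
  have hsm := smC_pos
  have hR : ∀ j, 0 < 0.97 * (δ * τC (z j)) := fun j => by
    have := hL.pos _ (hz j); positivity
  set Ψ : ℕ → ℂ → ℝ := fun j w => bmp (z j) (0.97 * (δ * τC (z j))) w with hΨ
  set g₂ : ℂ → ℂ := fun w => (∑' j, H j w * (Ψ j w : ℂ)) / ∑' j, (Ψ j w : ℂ) with hg₂
  have hloc : ∀ z0 ∈ unitDisc, ∃ J : Finset ℕ, J.card ≤ N ∧ (∀ j, j ∈ J ↔ ‖z0 - z j‖ ≤ 0.97 * (δ * τC (z j))) ∧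
      g₂ =ᶠ[nhds z0] fun w => (∑ j ∈ J, H j w * (Ψ j w : ℂ)) / ∑ j ∈ J, (Ψ j w : ℂ) := by
    intro z0 hz0
    obtain ⟨hA, hAN⟩ := hN z0 hz0
    have hsubA : {j | ‖z0 - z j‖ ≤ 0.97 * (δ * τC (z j))} ⊆ {j | ‖z0 - z j‖ ≤ 3 * (δ * τC (z j))} := by
      intro j hj
      have hj' : ‖z0 - z j‖ ≤ 0.97 * (δ * τC (z j)) := hj
      change ‖z0 - z j‖ ≤ 3 * (δ * τC (z j))
      have := hR j
      linarith
    have hJ := hA.subset hsubA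
    refine ⟨hJ.toFinset, ?_, fun j => by simp, ?_⟩
    · rw [← Set.ncard_eq_toFinset_card _ hJ]
      exact (Set.ncard_le_ncard hsubA hA).trans hAN
    have ev1 : ∀ᶠ w in nhds z0, ‖w - z0‖ < 1 / 2 * (δ * τC z0) := by
      have : Metric.ball z0 (1 / 2 * (δ * τC z0)) ∈ nhds z0 := Metric.ball_mem_nhds _ (by have := hL.pos _ hz0; positivity)
      filter_upwards [this] with w hw
      exact mem_ball_iff_norm.1 hw
    have ev2 : ∀ᶠ w in nhds z0, ∀ j ∈ {j | ‖z0 - z j‖ ≤ 3 * (δ * τC (z j))}, j ∉ hJ.toFinset → 0.97 * (δ * τC (z j)) < ‖w - z j‖ := by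
      rw [eventually_all_finite hA]
      intro j _
      by_cases hj : j ∈ hJ.toFinset
      · exact Eventually.of_forall fun w h => absurd hj h
      · have hj' : 0.97 * (δ * τC (z j)) < ‖z0 - z j‖ := by simpa using hj
        have : ContinuousAt (fun w => ‖w - z j‖) z0 := by fun_prop
        filter_upwards [this.eventually (lt_mem_nhds hj')] with w hw _ using hw
    filter_upwards [ev1, ev2] with w h1 h2
    have hz0w : ∀ j, j ∉ hJ.toFinset → Ψ j w = 0 := by
      intro j hj
      apply bmp_zero (hR j)
      by_contra hlt
      push Not at hlt
      by_cases hjA : ‖z0 - z j‖ ≤ 3 * (δ * τC (z j))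
      · linarith [h2 j hjA hj]
      · apply hjA
        have hwD : w ∈ unitDisc := mem_disc_of hL hδ0.le hδ hz0 (by norm_num) (by norm_num) h1.le
        have t1 := abs_le.1 (tau_cmp hL hδ0.le hδ hz0 hwD (by norm_num) h1.le)
        have t2 := abs_le.1 (tau_cmp hL hδ0.le hδ (hz j) hwD (by norm_num) hlt.le)
        have pj := hL.pos _ (hz j)
        have p0 := hL.pos _ hz0
        have q : τC z0 ≤ 2 * τC (z j) := by linarith
        have q2 := mul_le_mul_of_nonneg_left q hδ0.le
        have : ‖z0 - z j‖ ≤ ‖w - z0‖ + ‖w - z j‖ := by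
          have := norm_sub_le (w - z j) (w - z0)
          rw [sub_sub_sub_cancel_left] at this; linarith
        have := hR j
        linarith
    simp only [hg₂]
    rw [tsum_eq_sum (s := hJ.toFinset) (fun j hj => by rw [hz0w j hj]; simp),
      tsum_eq_sum (s := hJ.toFinset) (fun j hj => by rw [hz0w j hj]; simp)]
  set K0 := 20000 * smC with hK0
  set D := 4 * L / δ with hDdef
  have hD0 : 0 < D := by positivity
  set K := K0 + (2 * N * D / c) ^ 2 * K0 with hK
  have hmain : ∀ z0 ∈ unitDisc, ∀ k, ‖z0 - z k‖ ≤ 0.97 * (δ * τC (z k)) →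
      ∀ β : ℝ, (∀ j, ‖z0 - z j‖ ≤ 0.97 * (δ * τC (z j)) → b j ≤ β) → ContDiffAt ℝ 1 g₂ z0 ∧ ‖g₂ z0 - H k z0‖ ≤ √(K0 * β) ∧
        ‖dbar g₂ z0‖ ≤ 2 * N * √(K0 * β) * (D / τC z0) / c := by
    intro z0 hz0 k hk β hβ
    obtain ⟨J, hJc, hJ, hgJ⟩ := hloc z0 hz0
    have p0 := hL.pos _ hz0
    have hmem : ∀ j ∈ J, z0 ∈ Metric.ball (z j) (δ * τC (z j)) := by
      intro j hj
      rw [mem_ball_iff_norm]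
      have := hR j
      linarith [(hJ j).1 hj]
    have hHan : ∀ j ∈ J, AnalyticAt ℂ (H j) z0 := fun j hj =>
      (hH j).analyticAt (Metric.isOpen_ball.mem_nhds (hmem j hj))
    have hS : c ≤ ∑ j ∈ J, Ψ j z0 := by
      obtain ⟨i, hi⟩ := hcov z0 hz0
      have hRi := hR i
      have hiJ : i ∈ J := (hJ i).2 (by linarith)
      refine le_trans (hlow (z i) _ (hR i) z0 (by linarith)) (Finset.single_le_sum (f := fun j => Ψ j z0) (fun j _ => eta_nonneg _) hiJ)
    have hDj : ∀ j ∈ J, ‖dbar (fun w => (Ψ j w : ℂ)) z0‖ ≤ D / τC z0 := by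
      intro j hj
      refine (hLip (z j) _ (hR j) z0).trans ?_
      have t := abs_le.1 (tau_cmp hL hδ0.le hδ (hz j) hz0 (by norm_num) ((hJ j).1 hj))
      have pj := hL.pos _ (hz j)
      have : τC z0 ≤ 2 * τC (z j) := by linarith
      rw [hDdef, div_div, div_le_div_iff₀ (hR j) (by positivity)]
      have := mul_le_mul_of_nonneg_left this (show 0 ≤ L * δ by positivity)
      nlinarith [show 0 < L * δ * τC (z j) by positivity]
    have hBj : ∀ j ∈ J, ‖H j z0 - H k z0‖ ≤ √(K0 * β) := by
      intro j hj
      apply Real.le_sqrt_of_sq_le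
      refine (holo_cmp hL hδ0 hδ hg (hz j) (hz k) hz0 (hH j) (hH k) (hb j) (hb k) (hm j) (hm k) ((hJ j).1 hj) hk).trans ?_
      have e1 := hβ j ((hJ j).1 hj)
      have e2 := hβ k hk
      rw [hK0]
      have := mul_le_mul_of_nonneg_left (add_le_add e1 e2) (show 0 ≤ 10000 * smC by positivity)
      linarith
    obtain ⟨r1, r2, r3⟩ := germ_est (fun j hj => (hHan j hj).differentiableAt)
      (fun j hj => ((hHan j hj).contDiffAt (n := 1)).restrict_scalars ℝ)
      (fun j hj => (bmp_contDiff (z j) _).contDiffAt) (fun j hj => rfl) (fun j hj => eta_nonneg _) hc hS hDj ((hJ k).2 hk) hBj hgJ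
    refine ⟨r1, r2, r3.trans ?_⟩
    have : (J.card : ℝ) ≤ N := by exact_mod_cast hJc
    gcongr
  refine ⟨K, by positivity, g₂, ?_, ?_⟩
  · intro z0 hz0
    obtain ⟨k, hk⟩ := hcov z0 hz0
    have hRk := hR k
    obtain ⟨J, hJc, hJ, hgJ⟩ := hloc z0 hz0
    refine (hmain z0 hz0 k (by linarith) (∑ j ∈ J, b j) fun j hj => ?_).1.contDiffWithinAt
    exact Finset.single_le_sum (fun j _ => hb j) ((hJ j).2 hj)
  · intro z0 hz0 k hk β hβ
    obtain ⟨_, r2, r3⟩ := hmain z0 hz0 k hk β hβ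
    have hβ0 : 0 ≤ β := (hb k).trans (hβ k hk)
    have p0 := hL.pos _ hz0
    have hKβ : √(K0 * β) ^ 2 = K0 * β := Real.sq_sqrt (by positivity)
    have hle : K0 * β ≤ K * β := by
      rw [hK]; gcongr; exact le_add_of_nonneg_right (by positivity)
    constructor
    · calc _ ≤ √(K0 * β) ^ 2 := by gcongr
        _ ≤ _ := by rw [hKβ]; exact hle
    · have : τC z0 * ‖dbar g₂ z0‖ ≤ (2 * N * D / c) * √(K0 * β) := by
        calc τC z0 * ‖dbar g₂ z0‖ ≤ τC z0 * (2 * N * √(K0 * β) * (D / τC z0) / c) := by gcongr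
          _ = _ := by field_simp
      rw [← mul_pow]
      calc _ ≤ ((2 * N * D / c) * √(K0 * β)) ^ 2 := by gcongr
        _ = (2 * N * D / c) ^ 2 * K0 * β := by rw [mul_pow, hKβ]; ring
        _ ≤ _ := by
          rw [hK]; gcongr; exact le_add_of_nonneg_left (by positivity)
end
end

noncomputable section
section
variable {ω φ : ℂ → ℝ} {τ : ℝ → ℝ} {c₁ c₂ δ : ℝ} {τC : ℂ → ℝ}

theorem rpow_sum_le {ι : Type*} (J : Finset ι) (c : ι → ℝ≥0∞) {q : ℝ} (hq0 : 0 < q) (hq : q ≤ 1) :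
    (∑ j ∈ J, c j) ^ q ≤ ∑ j ∈ J, c j ^ q := by
  classical
  induction J using Finset.induction_on with
  | empty => simp [hq0]
  | insert a s ha ih =>
    rw [Finset.sum_insert ha, Finset.sum_insert ha]
    exact (ENNReal.rpow_add_le_add_rpow _ _ hq0.le hq).trans (by gcongr)

theorem sum_near {A : ℕ → Finset ℕ} {B : ℝ} (hB : ∀ j, ∀ I : Finset ℕ, (∀ i ∈ I, j ∈ A i) → (I.card : ℝ) ≤ B) (c : ℕ → ℝ≥0∞) :
    ∑' i, ∑ j ∈ A i, c j ≤ ENNReal.ofReal B * ∑' j, c j := by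
  classical
  rw [ENNReal.tsum_eq_iSup_sum]
  refine iSup_le fun I => ?_
  have e : ∀ i, ∑ j ∈ A i, c j = ∑' j, if j ∈ A i then c j else 0 := by
    intro i
    rw [tsum_eq_sum (s := A i) (fun j hj => by simp [hj])]
    exact Finset.sum_congr rfl fun j hj => by simp [hj]
  simp_rw [e]
  rw [← Summable.tsum_finsetSum (fun i _ => ENNReal.summable), ← ENNReal.tsum_mul_left]
  refine ENNReal.tsum_le_tsum fun j => ?_
  rw [← Finset.sum_filter, Finset.sum_const, nsmul_eq_mul]
  gcongr
  rw [← ENNReal.ofReal_natCast]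
  exact ENNReal.ofReal_le_ofReal (hB j _ fun i hi => (Finset.mem_filter.1 hi).2)

theorem localMean_le_const (hL : IsClassL τC c₁ c₂) (hδ0 : 0 < δ) {a : ℂ} (ha : a ∈ unitDisc) {u : ℂ → ℂ} {M : ℝ}
    (h : ∀ w ∈ Metric.ball a (δ * τC a), ‖u w‖ ^ 2 ≤ M) : localMeanE τC δ u a ≤ ENNReal.ofReal M := by
  have hR : 0 < δ * τC a := mul_pos hδ0 (hL.pos a ha)
  unfold localMeanE
  have pR : 0 < (δ * τC a) ^ 2 := by positivity
  rw [ENNReal.inv_mul_le_iff (ENNReal.ofReal_pos.2 pR).ne' ENNReal.ofReal_ne_top, ← dA_ball a hR.le, mul_comm (dA _), ← setLIntegral_const]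
  exact setLIntegral_mono' measurableSet_ball fun w hw => ENNReal.ofReal_le_ofReal (h w hw)

theorem num_aux {x y bk β K : ℝ} (hx : 0 < x) (hy : 0 < y) (h : x ≤ 140 * y) (hb : 0 ≤ bk) (hbβ : bk ≤ β) (hK : 0 < K) :
    ENNReal.ofReal 2 * ENNReal.ofReal (x ^ 2 * bk) + ENNReal.ofReal (2 * (K * β)) * ENNReal.ofReal (y ^ 2) ≤
      ENNReal.ofReal (y ^ 2 * ((80000 + 2 * K) * β)) := by
  have hβ := hb.trans hbβ
  rw [← ENNReal.ofReal_mul (by norm_num), ← ENNReal.ofReal_mul (by positivity), ← ENNReal.ofReal_add (by positivity) (by positivity)]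
  apply ENNReal.ofReal_le_ofReal
  have e2 : x ^ 2 ≤ 40000 * y ^ 2 := by
    calc _ ≤ (140 * y) ^ 2 := by gcongr
      _ = 19600 * y ^ 2 := by ring
      _ ≤ _ := by nlinarith [sq_nonneg y]
  have e3 : x ^ 2 * bk ≤ 40000 * y ^ 2 * β := mul_le_mul e2 hbβ hb (by positivity)
  linarith

set_option maxHeartbeats 2000000 in
theorem two_three (hW : IsClassW ω φ τ) (hL : IsClassL (radialize τ) c₁ c₂) {g : ℂ → ℂ} (hg : MemLp g 2 (muW ω)) {p : ℝ}
    (hp : p ∈ Set.Ioo (0:ℝ) 1) (h : SchattenCondTwo (radialize τ) c₁ c₂ g p) :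
    SchattenCondThree (radialize τ) φ c₁ c₂ g p := by
  obtain ⟨δ, hδ, hsum⟩ := h
  obtain ⟨hδ0, hδ1⟩ := hδ
  obtain ⟨z, hlat, hcov⟩ := exists_lattice hW hL hδ0 hδ1.le
  have hfin := hsum z hlat
  have hz := hlat.mem
  have hsep := lat_sep hlat
  have hgm := aem_disc hW hg.1
  set τC := radialize τ with hτC
  have hp2 : 0 < p / 2 := by linarith [hp.1]
  have hp21 : p / 2 ≤ 1 := by linarith [hp.2]
  set ε : ℕ → ℝ≥0∞ := fun j => ((2:ℝ≥0∞)⁻¹ ^ j) ^ (2 / p) with hε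
  have hε0 : ∀ j, ε j ≠ 0 := by
    intro j
    have : (2:ℝ≥0∞)⁻¹ ^ j ≠ 0 := pow_ne_zero _ (by simp)
    simp only [hε]
    exact (ENNReal.rpow_pos (pos_iff_ne_zero.2 this) (ENNReal.pow_ne_top (by simp))).ne'
  have hεt : ∀ j, ε j ≠ ⊤ := fun j => ENNReal.rpow_ne_top_of_nonneg (by have := hp.1; positivity) (ENNReal.pow_ne_top (by simp))
  have hεs : ∑' j, (ε j) ^ (p / 2) ≠ ⊤ := by
    have : ∀ j, (ε j) ^ (p / 2) = (2:ℝ≥0∞)⁻¹ ^ j := by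
      intro j
      simp only [hε]
      rw [← ENNReal.rpow_mul, show 2 / p * (p / 2) = 1 by have := hp.1.ne'; field_simp, ENNReal.rpow_one]
    simp_rw [this, ENNReal.tsum_geometric]
    simp
  have hat : ∀ j, FdeltaSqE τC δ g (z j) ≠ ⊤ := by
    intro j hj
    have h1 := ENNReal.ne_top_of_tsum_ne_top hfin.ne j
    rw [hj, ENNReal.top_rpow_of_pos hp2] at h1
    exact h1 rfl
  have hex : ∀ j, ∃ H : ℂ → ℂ, DifferentiableOn ℂ H (Metric.ball (z j) (δ * τC (z j))) ∧
      localMeanE τC δ (fun w => g w - H w) (z j) ≤ FdeltaSqE τC δ g (z j) + ε j := by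
    intro j
    have h1 : FdeltaSqE τC δ g (z j) < FdeltaSqE τC δ g (z j) + ε j := ENNReal.lt_add_right (hat j) (hε0 j)
    conv_lhs at h1 => unfold FdeltaSqE
    simp only [iInf_lt_iff] at h1
    obtain ⟨H, hH, h2⟩ := h1
    exact ⟨H, hH, h2.le⟩
  choose H hH hHm using hex
  set b : ℕ → ℝ := fun j => (FdeltaSqE τC δ g (z j) + ε j).toReal with hb
  have hbe : ∀ j, ENNReal.ofReal (b j) = FdeltaSqE τC δ g (z j) + ε j := fun j =>
    ENNReal.ofReal_toReal (ENNReal.add_ne_top.2 ⟨hat j, hεt j⟩)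
  have hb0 : ∀ j, 0 ≤ b j := fun j => ENNReal.toReal_nonneg
  have hbm : ∀ j, localMeanE τC δ (fun w => g w - H j w) (z j) ≤ ENNReal.ofReal (b j) := fun j => by rw [hbe]; exact hHm j
  have hbs : ∑' j, ENNReal.ofReal (b j) ^ (p / 2) ≠ ⊤ := by
    refine (lt_of_le_of_lt (ENNReal.tsum_le_tsum (g := fun j => FdeltaSqE τC δ g (z j) ^ (p / 2) + ε j ^ (p / 2)) fun j => ?_) ?_).ne
    · rw [hbe]; exact ENNReal.rpow_add_le_add_rpow _ _ hp2.le hp21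
    · rw [ENNReal.tsum_add]; exact ENNReal.add_lt_top.2 ⟨hfin, lt_top_iff_ne_top.2 hεs⟩
  obtain ⟨K, hK0, g₂, hg₂, hest⟩ := glue hL hδ0 hδ1.le hgm hz hsep hcov hH hb0 hbm
  obtain ⟨CΔ, hC1, hCΔ⟩ := lap_bd hW
  set δ' := δ / 100 with hδ'
  have hδ'0 : 0 < δ' := by positivity
  have hδ'1 : δ' < mTau c₁ c₂ := by rw [hδ']; linarith
  obtain ⟨N, hN⟩ := overlap hL hδ0 hδ1.le hz hsep hδ0 hδ1.le
  obtain ⟨Cc, hCc, hcount⟩ := count_le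
  refine ⟨δ', ⟨hδ'0, hδ'1⟩, fun w => g w - g₂ w, g₂, fun w _ => by ring, hg₂, fun w hw => ?_⟩
  have hwm := hw.mem
  have hwsep := lat_sep hw
  set A : ℕ → Finset ℕ := fun i => (hN (w i) (hwm i)).1.toFinset with hA
  have hAmem : ∀ i j, j ∈ A i ↔ ‖w i - z j‖ ≤ 3 * (δ * τC (z j)) := fun i j => by simp [hA]
  set β : ℕ → ℝ := fun i => ∑ j ∈ A i, b j with hβ
  -- local geometry
  have hgeo : ∀ i, ∃ k ∈ A i, τC (z k) ≤ 1.4 * τC (w i) ∧ ∀ z0 ∈ Metric.ball (w i) (δ' * τC (w i)), z0 ∈ unitDisc ∧ ‖z0 - z k‖ ≤ 0.97 * (δ * τC (z k)) ∧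
      ∀ j, ‖z0 - z j‖ ≤ 0.97 * (δ * τC (z j)) → b j ≤ β i := by
    intro i
    obtain ⟨k, hk⟩ := hcov (w i) (hwm i)
    have pk := hL.pos _ (hz k)
    have pi := hL.pos _ (hwm i)
    have pδk : 0 < δ * τC (z k) := by positivity
    have t := abs_le.1 (tau_cmp hL hδ0.le hδ1.le (hz k) (hwm i) (by norm_num) hk)
    refine ⟨k, (hAmem i k).2 (by linarith), by linarith, fun z0 hz0 => ?_⟩
    have hzD := ball_sub_disc1 hL hδ'0.le hδ'1.le (hwm i) hz0
    rw [mem_ball_iff_norm] at hz0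
    have t1 : τC (w i) ≤ 1.25 * τC (z k) := by linarith
    have t1' := mul_le_mul_of_nonneg_left t1 hδ'0.le
    have e1 : δ' * (1.25 * τC (z k)) = 0.0125 * (δ * τC (z k)) := by rw [hδ']; ring
    refine ⟨hzD, ?_, fun j hj => ?_⟩
    · have : ‖z0 - z k‖ ≤ ‖z0 - w i‖ + ‖w i - z k‖ := by simpa using norm_add_le (z0 - w i) (w i - z k)
      linarith
    · refine Finset.single_le_sum (f := b) (fun j _ => hb0 j) ((hAmem i j).2 ?_)
      have pj := hL.pos _ (hz j)
      have pδj : 0 < δ * τC (z j) := by positivity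
      have s1 := abs_le.1 (tau_cmp hL hδ'0.le hδ'1.le (hwm i) hzD (s := 1) (by norm_num) (by linarith))
      have s2 := abs_le.1 (tau_cmp hL hδ0.le hδ1.le (hz j) hzD (by norm_num) hj)
      have s3 : τC (w i) ≤ 2 * τC (z j) := by linarith
      have s4 := mul_le_mul_of_nonneg_left s3 hδ'0.le
      have e2 : δ' * (2 * τC (z j)) = 0.02 * (δ * τC (z j)) := by rw [hδ']; ring
      have : ‖w i - z j‖ ≤ ‖z0 - z j‖ + ‖z0 - w i‖ := by
        have := norm_sub_le (z0 - z j) (z0 - w i)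
        rwa [sub_sub_sub_cancel_left] at this
      linarith
  have hβ0 : ∀ i, 0 ≤ β i := fun i => Finset.sum_nonneg fun j _ => hb0 j
  -- summation
  have hfinal : ∀ (M : ℝ), 0 ≤ M → ∀ u : ℂ → ℂ, (∀ i, localMeanE τC δ' u (w i) ≤ ENNReal.ofReal (M * β i)) →
      ∑' i, localMeanE τC δ' u (w i) ^ (p / 2) < ⊤ := by
    intro M hM u hu
    have hnear := sum_near (A := A) (B := Cc * (1 + 3) ^ 4 / ((1 / 4) ^ 2 * δ' ^ 2)) (by
      intro j I hI
      refine hcount τC c₁ c₂ δ' hL hδ'0 hδ'1.le w hwm hwsep (z j) (hz j) _ _ (by norm_num) (by norm_num) I fun i hi => ?_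
      have h1 := (hAmem i j).1 (hI i hi)
      have t := abs_le.1 (tau_cmp hL hδ0.le hδ1.le (hz j) (hwm i) (by norm_num) h1)
      have pj := hL.pos _ (hz j)
      have m := mTau_bds hL
      refine ⟨by linarith, h1.trans ?_⟩
      have : δ * τC (z j) ≤ 1 * τC (z j) := mul_le_mul_of_nonneg_right (by linarith) pj.le
      linarith) (fun j => ENNReal.ofReal (b j) ^ (p / 2))
    refine lt_of_le_of_lt (ENNReal.tsum_le_tsum (g := fun i => ENNReal.ofReal M ^ (p / 2) * ∑ j ∈ A i, ENNReal.ofReal (b j) ^ (p / 2)) fun i => ?_) ?_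
    · refine (ENNReal.rpow_le_rpow (hu i) hp2.le).trans ?_
      rw [ENNReal.ofReal_mul hM, ENNReal.mul_rpow_of_nonneg _ _ hp2.le]
      refine mul_le_mul_right ?_ _
      rw [hβ, ENNReal.ofReal_sum_of_nonneg (fun j _ => hb0 j)]
      exact rpow_sum_le _ _ hp2 hp21
    · rw [ENNReal.tsum_mul_left]
      refine ENNReal.mul_lt_top (ENNReal.rpow_lt_top_of_nonneg hp2.le ENNReal.ofReal_ne_top) (lt_of_le_of_lt hnear ?_)
      exact ENNReal.mul_lt_top ENNReal.ofReal_lt_top (lt_top_iff_ne_top.2 hbs)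
  constructor
  · refine hfinal (80000 + 2 * K) (by positivity) _ fun i => ?_
    obtain ⟨k, hkA, hτk, hk⟩ := hgeo i
    have pi := hL.pos _ (hwm i)
    have pk := hL.pos _ (hz k)
    have hR : 0 < δ' * τC (w i) := by positivity
    have pR : 0 < (δ' * τC (w i)) ^ 2 := by positivity
    have pRk : 0 < (δ * τC (z k)) ^ 2 := by positivity
    have hsub : Metric.ball (w i) (δ' * τC (w i)) ⊆ Metric.ball (z k) (δ * τC (z k)) := by
      intro z0 hz0
      rw [mem_ball_iff_norm]
      have := (hk z0 hz0).2.1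
      have : 0 < δ * τC (z k) := by positivity
      linarith
    have hmean := hbm k
    unfold localMeanE at hmean
    rw [ENNReal.inv_mul_le_iff (ENNReal.ofReal_pos.2 pRk).ne' ENNReal.ofReal_ne_top, ← ENNReal.ofReal_mul pRk.le] at hmean
    unfold localMeanE
    rw [ENNReal.inv_mul_le_iff (ENNReal.ofReal_pos.2 pR).ne' ENNReal.ofReal_ne_top, ← ENNReal.ofReal_mul pR.le]
    have hbk : b k ≤ β i := Finset.single_le_sum (f := b) (fun j _ => hb0 j) hkA
    calc ∫⁻ v in Metric.ball (w i) (δ' * τC (w i)), ENNReal.ofReal (‖g v - g₂ v‖ ^ 2) ∂dA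
        ≤ ∫⁻ v in Metric.ball (w i) (δ' * τC (w i)), (ENNReal.ofReal 2 * ENNReal.ofReal (‖g v - H k v‖ ^ 2) + ENNReal.ofReal (2 * (K * β i))) ∂dA := by
          refine setLIntegral_mono' measurableSet_ball fun v hv => ?_
          obtain ⟨v1, v2, v3⟩ := hk v hv
          have h1 := (hest v v1 k v2 (β i) v3).1
          have hKb : 0 ≤ K * β i := mul_nonneg hK0.le (hβ0 i)
          rw [← ENNReal.ofReal_mul (by norm_num), ← ENNReal.ofReal_add (by positivity) (by positivity)]
          apply ENNReal.ofReal_le_ofReal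
          have h2 : ‖g v - g₂ v‖ ≤ ‖g v - H k v‖ + ‖g₂ v - H k v‖ := by
            have := norm_sub_le (g v - H k v) (g₂ v - H k v)
            rwa [sub_sub_sub_cancel_right] at this
          nlinarith [sq_nonneg (‖g v - H k v‖ - ‖g₂ v - H k v‖), norm_nonneg (g v - g₂ v)]
      _ = ENNReal.ofReal 2 * ∫⁻ v in Metric.ball (w i) (δ' * τC (w i)), ENNReal.ofReal (‖g v - H k v‖ ^ 2) ∂dA + ENNReal.ofReal (2 * (K * β i)) * ENNReal.ofReal ((δ' * τC (w i)) ^ 2) := by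
          rw [lintegral_add_right _ measurable_const, lintegral_const_mul' _ _ ENNReal.ofReal_ne_top, setLIntegral_const, dA_ball _ hR.le]
      _ ≤ ENNReal.ofReal 2 * ENNReal.ofReal ((δ * τC (z k)) ^ 2 * b k) + ENNReal.ofReal (2 * (K * β i)) * ENNReal.ofReal ((δ' * τC (w i)) ^ 2) :=
          add_le_add (mul_le_mul_right ((lintegral_mono_set hsub).trans hmean) _) le_rfl
      _ ≤ _ := by
          have e1 : δ * τC (z k) ≤ 140 * (δ' * τC (w i)) := by
            have := mul_le_mul_of_nonneg_left hτk hδ0.le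
            rw [hδ']; linarith
          exact num_aux (mul_pos hδ0 pk) hR e1 (hb0 k) hbk hK0
  · refine hfinal (CΔ * K) (by positivity) _ fun i => ?_
    obtain ⟨k, hkA, hτk, hk⟩ := hgeo i
    refine localMean_le_const hL hδ'0 (hwm i) fun v hv => ?_
    obtain ⟨v1, v2, v3⟩ := hk v hv
    have h1 := (hest v v1 k v2 (β i) v3).2
    have h2 := (hCΔ v v1).1
    have pv := hL.pos v v1
    have pl := hW.lap_pos v v1
    change 1 / (CΔ * τC v ^ 2) ≤ _ at h2
    rw [div_le_iff₀ (by positivity)] at h2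
    rw [norm_div, div_pow, Complex.norm_real, Real.norm_eq_abs, sq_abs, Real.sq_sqrt pl.le, div_le_iff₀ pl]
    calc ‖dbar g₂ v‖ ^ 2 = 1 * ‖dbar g₂ v‖ ^ 2 := (one_mul _).symm
      _ ≤ laplacian φ v * (CΔ * τC v ^ 2) * ‖dbar g₂ v‖ ^ 2 := by gcongr
      _ = laplacian φ v * CΔ * (τC v ^ 2 * ‖dbar g₂ v‖ ^ 2) := by ring
      _ ≤ laplacian φ v * CΔ * (K * β i) := by gcongr
      _ = _ := by ring
end
end

noncomputable section
section
variable {E F : Type*} [NormedAddCommGroup E] [InnerProductSpace ℂ E] [CompleteSpace E]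
  [NormedAddCommGroup F] [NormedSpace ℂ F]

theorem sn_bdd (T : E →L[ℂ] F) (n : ℕ) : BddBelow {c : ℝ | ∃ K : E →L[ℂ] F,
    Module.rank ℂ (LinearMap.range (K : E →ₗ[ℂ] F)) ≤ (n : Cardinal) ∧ c = ‖T - K‖} :=
  ⟨0, by rintro c ⟨K, _, rfl⟩; exact norm_nonneg _⟩

theorem sn_le (T K : E →L[ℂ] F) {n : ℕ} (hK : Module.rank ℂ (LinearMap.range (K : E →ₗ[ℂ] F)) ≤ (n : Cardinal)) :
    singularNumber T n ≤ ‖T - K‖ := csInf_le (sn_bdd T n) ⟨K, hK, rfl⟩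

theorem sn_nonempty (T : E →L[ℂ] F) (n : ℕ) : {c : ℝ | ∃ K : E →L[ℂ] F,
    Module.rank ℂ (LinearMap.range (K : E →ₗ[ℂ] F)) ≤ (n : Cardinal) ∧ c = ‖T - K‖}.Nonempty := by
  refine ⟨‖T - 0‖, 0, ?_, rfl⟩
  simp

theorem sn_nonneg (T : E →L[ℂ] F) (n : ℕ) : 0 ≤ singularNumber T n :=
  le_csInf (sn_nonempty T n) (by rintro c ⟨K, _, rfl⟩; exact norm_nonneg _)

theorem sn_anti (T : E →L[ℂ] F) {m n : ℕ} (h : m ≤ n) : singularNumber T n ≤ singularNumber T m := by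
  refine le_csInf (sn_nonempty T m) ?_
  rintro c ⟨K, hK, rfl⟩
  exact sn_le T K (hK.trans (by exact_mod_cast h))

theorem sn_le_of_ker (T : E →L[ℂ] F) {ι : Type*} [Fintype ι] (L : E →ₗ[ℂ] (ι → ℂ)) {c : ℝ} (hc : 0 ≤ c)
    (h : ∀ f, L f = 0 → ‖T f‖ ≤ c * ‖f‖) : singularNumber T (Fintype.card ι) ≤ c := by
  set V := (LinearMap.ker L).topologicalClosure with hV
  haveI : CompleteSpace V := IsClosed.completeSpace_coe (hs := Submodule.isClosed_topologicalClosure _)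
  have hTV : ∀ f ∈ V, ‖T f‖ ≤ c * ‖f‖ := by
    have hcl : IsClosed {f : E | ‖T f‖ ≤ c * ‖f‖} := isClosed_le (by fun_prop) (by fun_prop)
    intro f hf
    have : (V : Set E) ⊆ {f : E | ‖T f‖ ≤ c * ‖f‖} := by
      rw [hV, Submodule.topologicalClosure_coe]
      exact closure_minimal (fun f hf => h f (by simpa using hf)) hcl
    exact this hf
  set Q := Vᗮ.starProjection with hQ
  have hrank : Module.rank ℂ (LinearMap.range ((T.comp Q : E →L[ℂ] F) : E →ₗ[ℂ] F)) ≤ (Fintype.card ι : Cardinal) := by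
    have hinj : Function.Injective (L.comp Vᗮ.subtype) := by
      rw [← LinearMap.ker_eq_bot, LinearMap.ker_eq_bot']
      rintro ⟨f, hf⟩ hLf
      have h1 : f ∈ V := Submodule.le_topologicalClosure _ (by simpa using hLf)
      have : f = 0 := by
        have := Submodule.inner_right_of_mem_orthogonal h1 hf
        simpa using this
      simpa using this
    have hfd : FiniteDimensional ℂ Vᗮ := FiniteDimensional.of_injective _ hinj
    have hle : Module.finrank ℂ Vᗮ ≤ Fintype.card ι := by
      have := LinearMap.finrank_le_finrank_of_injective hinj
      simpa using this
    have hsub : LinearMap.range ((T.comp Q : E →L[ℂ] F) : E →ₗ[ℂ] F) ≤ Submodule.map (T : E →ₗ[ℂ] F) Vᗮ := by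
      rintro _ ⟨f, rfl⟩
      exact ⟨Q f, Submodule.starProjection_apply_mem _ _, rfl⟩
    haveI : FiniteDimensional ℂ (Submodule.map (T : E →ₗ[ℂ] F) Vᗮ) := inferInstance
    refine (Submodule.rank_mono hsub).trans ?_
    rw [← Module.finrank_eq_rank]
    exact_mod_cast (Submodule.finrank_map_le _ _).trans hle
  refine (sn_le T _ hrank).trans ?_
  refine ContinuousLinearMap.opNorm_le_bound _ hc fun f => ?_
  have e : (T - T.comp Q) f = T (V.starProjection f) := by
    have := Submodule.starProjection_add_starProjection_orthogonal (K := V) f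
    simp only [_root_.sub_apply, ContinuousLinearMap.comp_apply, ← map_sub]
    congr 1
    rw [sub_eq_iff_eq_add]
    exact this.symm
  rw [e]
  refine (hTV _ (Submodule.starProjection_apply_mem _ _)).trans ?_
  gcongr
  exact Submodule.norm_starProjection_apply_le _ _

theorem sn_ge (T : E →L[ℂ] F) {ι : Type*} [Fintype ι] {n : ℕ} (hn : n < Fintype.card ι) (A : EuclideanSpace ℂ ι →ₗ[ℂ] E) {b C : ℝ}
    (hb : 0 ≤ b) (hC : 0 < C) (h1 : ∀ c, ‖A c‖ ≤ C * ‖c‖) (h2 : ∀ c, b * ‖c‖ ≤ ‖T (A c)‖) :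
    b / C ≤ singularNumber T n := by
  refine le_csInf (sn_nonempty T n) ?_
  rintro _ ⟨K, hK, rfl⟩
  set B : EuclideanSpace ℂ ι →ₗ[ℂ] LinearMap.range (K : E →ₗ[ℂ] F) := (K : E →ₗ[ℂ] F).rangeRestrict.comp A with hB
  have hfd : FiniteDimensional ℂ (LinearMap.range (K : E →ₗ[ℂ] F)) :=
    Module.rank_lt_aleph0_iff.1 (lt_of_le_of_lt hK (Cardinal.natCast_lt_aleph0))
  have hfr : Module.finrank ℂ (LinearMap.range (K : E →ₗ[ℂ] F)) ≤ n := Module.finrank_le_of_rank_le hK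
  have hker : LinearMap.ker B ≠ ⊥ := by
    apply LinearMap.ker_ne_bot_of_finrank_lt
    rw [finrank_euclideanSpace]; omega
  obtain ⟨c, hc, hc0⟩ := (Submodule.ne_bot_iff _).1 hker
  have hKc : K (A c) = 0 := by
    have : B c = 0 := hc
    have := congrArg Subtype.val this
    exact this
  have hcn : 0 < ‖c‖ := norm_pos_iff.2 hc0
  have h3 : ‖T (A c)‖ ≤ ‖T - K‖ * ‖A c‖ := by
    have := (T - K).le_opNorm (A c)
    rwa [_root_.sub_apply, hKc, sub_zero] at this
  have h4 : b * ‖c‖ ≤ ‖T - K‖ * (C * ‖c‖) := (h2 c).trans (h3.trans (by gcongr; exact h1 c))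
  rw [div_le_iff₀ hC]
  have : b * ‖c‖ ≤ ‖T - K‖ * C * ‖c‖ := by linarith
  exact le_of_mul_le_mul_right this hcn

/-- the summation argument for sufficiency -/
theorem schatten_of (T : E →L[ℂ] F) {ι : Type*} {a : ι → ℝ} {p C : ℝ} (hp : 0 < p) (hC : 0 < C) (ha : ∀ i, 0 ≤ a i)
    (hs : Summable fun i => a i ^ p)
    (h : ∀ t > 0, ∀ A : Finset ι, (∀ i, i ∈ A ↔ t < a i) → singularNumber T A.card ≤ C * t) : MemSchatten p T := by
  classical
  have hfin : ∀ t > 0, {i | t < a i}.Finite := by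
    intro t ht
    have h1 := hs.tendsto_cofinite_zero.eventually (gt_mem_nhds (show 0 < t ^ p by positivity))
    rw [eventually_cofinite] at h1
    refine h1.subset fun i hi => ?_
    have hi' : t < a i := hi
    change ¬ (a i ^ p < t ^ p)
    rw [not_lt]; gcongr
  have key : ∀ M : ℕ, ∃ I : Finset ι, I.card ≤ M ∧ ∑ n ∈ Finset.range M, singularNumber T n ^ p ≤ (2 * C) ^ p * ∑ i ∈ I, a i ^ p := by
    intro M
    induction M with
    | zero => exact ⟨∅, by simp, by simp⟩
    | succ M ih =>
      obtain ⟨I, hI, hIs⟩ := ih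
      rcases (sn_nonneg T M).eq_or_lt with h0 | h0
      · refine ⟨I, by omega, ?_⟩
        rw [Finset.sum_range_succ, ← h0, Real.zero_rpow hp.ne', add_zero]; exact hIs
      · set t := singularNumber T M / (2 * C) with ht
        have ht0 : 0 < t := by positivity
        have hA := h t ht0 (hfin t ht0).toFinset (fun i => by simp)
        have hcard : M < (hfin t ht0).toFinset.card := by
          by_contra hle
          push Not at hle
          have h1 := (sn_anti T hle).trans hA
          have : C * t = singularNumber T M / 2 := by rw [ht]; field_simp
          linarith
        obtain ⟨i, hiA, hiI⟩ := Finset.exists_mem_notMem_of_card_lt_card (lt_of_le_of_lt hI hcard)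
        refine ⟨insert i I, (Finset.card_insert_le _ _).trans (by omega), ?_⟩
        rw [Finset.sum_range_succ, Finset.sum_insert hiI, mul_add, add_comm]
        refine add_le_add ?_ hIs
        have h2 : t < a i := by simpa using hiA
        rw [← Real.mul_rpow (by positivity) (ha i)]
        apply Real.rpow_le_rpow h0.le _ hp.le
        have : singularNumber T M = 2 * C * t := by rw [ht]; field_simp
        rw [this]; gcongr
  refine summable_of_sum_range_le (c := (2 * C) ^ p * ∑' i, a i ^ p) (fun n => Real.rpow_nonneg (sn_nonneg T n) _) fun M => ?_
  obtain ⟨I, _, hI⟩ := key M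
  refine hI.trans ?_
  gcongr
  exact hs.sum_le_tsum I fun i _ => Real.rpow_nonneg (ha i) _

/-- the summation argument for necessity -/
theorem sum_le_schatten (T : E →L[ℂ] F) {ι : Type*} {a : ι → ℝ} {p C : ℝ} (hp : 0 < p) (hC : 0 < C) (ha : ∀ i, 0 ≤ a i)
    (hT : MemSchatten p T) (I : Finset ι)
    (h : ∀ J ⊆ I, ∀ t, 0 ≤ t → (∀ i ∈ J, t ≤ a i) → ∀ n, n < J.card → t ≤ C * singularNumber T n) :
    ∑ i ∈ I, a i ^ p ≤ C ^ p * schattenSum p T := by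
  classical
  have key : ∀ M : ℕ, ∀ J ⊆ I, J.card = M → ∑ i ∈ J, a i ^ p ≤ ∑ n ∈ Finset.range M, (C * singularNumber T n) ^ p := by
    intro M
    induction M with
    | zero => intro J _ hJ; rw [Finset.card_eq_zero.1 hJ]; simp
    | succ M ih =>
      intro J hJI hJ
      obtain ⟨i, hi, hmin⟩ := Finset.exists_min_image J a (Finset.card_pos.1 (by omega))
      rw [← Finset.sum_erase_add _ _ hi, Finset.sum_range_succ]
      refine add_le_add (ih _ ((Finset.erase_subset _ _).trans hJI) (by rw [Finset.card_erase_of_mem hi, hJ]; rfl)) ?_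
      exact Real.rpow_le_rpow (ha i) (h J hJI (a i) (ha i) hmin M (by omega)) hp.le
  refine (key _ I le_rfl rfl).trans ?_
  unfold schattenSum
  rw [← tsum_mul_left]
  have e : ∀ n, (C * singularNumber T n) ^ p = C ^ p * singularNumber T n ^ p := fun n => Real.mul_rpow hC.le (sn_nonneg T n)
  simp_rw [e]
  exact (hT.mul_left _).sum_le_tsum _ fun n _ => mul_nonneg (Real.rpow_nonneg hC.le _) (Real.rpow_nonneg (sn_nonneg T n) _)
end
end

noncomputable section
section
variable {ω φ : ℂ → ℝ} {τ : ℝ → ℝ} {c₁ c₂ δ : ℝ}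

/-- Iterated divided difference at `a`. -/
def itD (a : ℂ) (F : ℂ → ℂ) : ℕ → ℂ → ℂ
  | 0 => F
  | k + 1 => dslope (itD a F k) a

theorem itD_diff {a : ℂ} (ha : a ∈ unitDisc) {F : ℂ → ℂ} (hF : DifferentiableOn ℂ F unitDisc) (k : ℕ) :
    DifferentiableOn ℂ (itD a F k) unitDisc := by
  induction k with
  | zero => exact hF
  | succ k ih => exact (Complex.differentiableOn_dslope (isOpen_unitDisc.mem_nhds ha)).2 ih

theorem dslope_eqOn {a : ℂ} (ha : a ∈ unitDisc) {F G : ℂ → ℂ} (h : EqOn F G unitDisc) :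
    EqOn (dslope F a) (dslope G a) unitDisc := by
  intro z hz
  rcases eq_or_ne z a with rfl | hne
  · rw [dslope_same, dslope_same]
    exact (h.eventuallyEq_of_mem (isOpen_unitDisc.mem_nhds hz)).deriv_eq
  · rw [dslope_of_ne _ hne, dslope_of_ne _ hne, slope, slope, h hz, h ha]

theorem itD_eqOn {a : ℂ} (ha : a ∈ unitDisc) {F G : ℂ → ℂ} (h : EqOn F G unitDisc) (k : ℕ) :
    EqOn (itD a F k) (itD a G k) unitDisc := by
  induction k with
  | zero => exact h
  | succ k ih => exact dslope_eqOn ha ih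

theorem itD_lin {a : ℂ} (ha : a ∈ unitDisc) {F G : ℂ → ℂ} (hF : DifferentiableOn ℂ F unitDisc)
    (hG : DifferentiableOn ℂ G unitDisc) (c : ℂ) (k : ℕ) :
    EqOn (itD a (fun z => c * F z + G z) k) (fun z => c * itD a F k z + itD a G k z) unitDisc := by
  induction k with
  | zero => exact fun z _ => rfl
  | succ k ih =>
    refine (dslope_eqOn ha ih).trans fun z hz => ?_
    simp only [itD]
    rcases eq_or_ne z a with rfl | hne
    · have hn := isOpen_unitDisc.mem_nhds hz
      have d1 := (itD_diff hz hF k).differentiableAt hn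
      have d2 := (itD_diff hz hG k).differentiableAt hn
      rw [dslope_same, dslope_same, dslope_same, deriv_fun_add (d1.const_mul c) d2, deriv_const_mul c d1]
    · rw [dslope_of_ne _ hne, dslope_of_ne _ hne, dslope_of_ne _ hne]
      simp only [slope, vsub_eq_sub, smul_eq_mul]
      ring

theorem itD_factor {a : ℂ} {F : ℂ → ℂ} (n : ℕ) (h : ∀ k < n, itD a F k a = 0) (z : ℂ) :
    F z = (z - a) ^ n * itD a F n z := by
  induction n with
  | zero => simp [itD]
  | succ n ih =>
    rw [ih (fun k hk => h k (by omega))]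
    have := sub_smul_dslope (itD a F n) a z
    rw [h n (by omega), sub_zero, smul_eq_mul] at this
    rw [← this, pow_succ]; simp only [itD]; ring

theorem rep_unique (hW : IsClassW ω φ τ) {F G : ℂ → ℂ} (hF : ContinuousOn F unitDisc) (hG : ContinuousOn G unitDisc)
    (h : F =ᵐ[muW ω] G) : EqOn F G unitDisc := by
  refine Measure.eqOn_open_of_ae_eq (μ := volume) ?_ isOpen_unitDisc hF hG
  exact (ae_restrict_iff' isOpen_unitDisc.measurableSet).2 ((ae_muW hW).1 h)

/-- The holomorphic representative. -/
def hrep (hW : IsClassW ω φ τ) (f : bergmanH ω) : ℂ → ℂ := Classical.choose (berg_rep hW f)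

theorem hrep_diff (hW : IsClassW ω φ τ) (f : bergmanH ω) : DifferentiableOn ℂ (hrep hW f) unitDisc :=
  (Classical.choose_spec (berg_rep hW f)).1

theorem hrep_ae (hW : IsClassW ω φ τ) (f : bergmanH ω) :
    ((f : Lp ℂ 2 (muW ω)) : ℂ → ℂ) =ᵐ[muW ω] hrep hW f :=
  (Classical.choose_spec (berg_rep hW f)).2

theorem hrep_lin (hW : IsClassW ω φ τ) (c : ℂ) (f g : bergmanH ω) :
    EqOn (hrep hW (c • f + g)) (fun z => c * hrep hW f z + hrep hW g z) unitDisc := by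
  refine rep_unique hW (hrep_diff hW _).continuousOn
    ((continuousOn_const.mul (hrep_diff hW f).continuousOn).add (hrep_diff hW g).continuousOn) ?_
  filter_upwards [hrep_ae hW (c • f + g), hrep_ae hW f, hrep_ae hW g,
    Lp.coeFn_add (c • (f : Lp ℂ 2 (muW ω))) (g : Lp ℂ 2 (muW ω)), Lp.coeFn_smul c (f : Lp ℂ 2 (muW ω))] with z h1 h2 h3 h4 h5
  rw [← h1, ← h2, ← h3, Submodule.coe_add, Submodule.coe_smul, h4, Pi.add_apply, h5, Pi.smul_apply, smul_eq_mul]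

/-- The vanishing functionals. -/
def vanL (hW : IsClassW ω φ τ) {a : ℂ} (ha : a ∈ unitDisc) (k : ℕ) : bergmanH ω →ₗ[ℂ] ℂ :=
  IsLinearMap.mk' (fun f => itD a (hrep hW f) k a) (by
    have key : ∀ (c : ℂ) (f g : bergmanH ω), itD a (hrep hW (c • f + g)) k a =
        c * itD a (hrep hW f) k a + itD a (hrep hW g) k a := fun c f g =>
      (itD_eqOn ha (hrep_lin hW c f g) k ha).trans (itD_lin ha (hrep_diff hW f) (hrep_diff hW g) c k ha)
    have h0 : itD a (hrep hW (0 : bergmanH ω)) k a = 0 := by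
      have := key 1 0 0
      simp only [smul_zero, add_zero, one_mul] at this
      simpa using this
    constructor
    · intro f g; have := key 1 f g; simpa using this
    · intro c f; have := key c f 0; simpa [h0] using this)

theorem vanL_apply (hW : IsClassW ω φ τ) {a : ℂ} (ha : a ∈ unitDisc) (k : ℕ) (f : bergmanH ω) :
    vanL hW ha k f = itD a (hrep hW f) k a := rfl

theorem loc_max {a : ℂ} {R B : ℝ} (hR : 0 < R) {n : ℕ} {H : ℂ → ℂ} (hH : DifferentiableOn ℂ H (Metric.ball a (3 * R)))
    (hB : ∀ ζ, ‖ζ - a‖ = 2 * R → ‖(ζ - a) ^ n * H ζ‖ ^ 2 ≤ B) {w : ℂ} (hw : w ∈ Metric.ball a R) :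
    ‖(w - a) ^ n * H w‖ ^ 2 ≤ (1 / 4) ^ n * B := by
  rw [mem_ball_iff_norm] at hw
  have hp : (0:ℝ) < (2 * R) ^ n := by positivity
  have h1 : ‖H w‖ ≤ Real.sqrt B / (2 * R) ^ n := by
    refine Complex.norm_le_of_forall_mem_frontier_norm_le (U := Metric.ball a (2 * R)) Metric.isBounded_ball ?_ ?_ ?_
    · refine DifferentiableOn.diffContOnCl (hH.mono ?_)
      rw [closure_ball a (by positivity)]
      exact Metric.closedBall_subset_ball (by linarith)
    · intro ζ hζ
      rw [frontier_ball a (by positivity), mem_sphere_iff_norm] at hζ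
      rw [le_div_iff₀ hp]
      have h2 := Real.le_sqrt_of_sq_le (hB ζ hζ)
      rw [norm_mul, norm_pow, hζ] at h2
      linarith
    · rw [closure_ball a (by positivity), mem_closedBall_iff_norm]; linarith
  have hB0 : 0 ≤ B := by
    refine le_trans (by positivity) (hB (a + (2 * R : ℝ)) ?_)
    rw [add_sub_cancel_left, Complex.norm_real, Real.norm_of_nonneg (by positivity)]
  rw [norm_mul, norm_pow, mul_pow]
  have h3 : ‖H w‖ ^ 2 ≤ B / ((2 * R) ^ n) ^ 2 := by
    calc ‖H w‖ ^ 2 ≤ (Real.sqrt B / (2 * R) ^ n) ^ 2 := by gcongr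
      _ = _ := by rw [div_pow, Real.sq_sqrt hB0]
  calc (‖w - a‖ ^ n) ^ 2 * ‖H w‖ ^ 2 ≤ (R ^ n) ^ 2 * (B / ((2 * R) ^ n) ^ 2) := by gcongr
    _ = (1 / 4) ^ n * B := by
      have e : ((1:ℝ) / 4) ^ n * (2 ^ n) ^ 2 = 1 := by
        rw [← pow_mul, mul_comm n 2, pow_mul, ← mul_pow]; norm_num
      rw [mul_pow 2 R n]
      have : ((2:ℝ) ^ n) ^ 2 ≠ 0 := by positivity
      rw [mul_div_assoc', div_eq_iff (by positivity)]
      linear_combination (-(R ^ n) ^ 2 * B) * e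

theorem loc_sup (hW : IsClassW ω φ τ) (hL : IsClassL (radialize τ) c₁ c₂) : ∃ C : ℝ, 0 < C ∧
    ∀ δ, 0 < δ → δ ≤ mTau c₁ c₂ → ∀ a ∈ unitDisc, ∀ F G : ℂ → ℂ, DifferentiableOn ℂ F unitDisc →
    DifferentiableOn ℂ G unitDisc → ∀ n : ℕ, (∀ z ∈ unitDisc, F z = (z - a) ^ n * G z) →
    ∀ w ∈ Metric.ball a (δ * radialize τ a), ENNReal.ofReal (ω w * ‖F w‖ ^ 2) ≤
      ENNReal.ofReal (C * (1 / 4) ^ n / (δ * radialize τ a) ^ 2) *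
        ∫⁻ z in Metric.ball a (3 * (δ * radialize τ a)), ENNReal.ofReal (‖F z‖ ^ 2) ∂(muW ω) := by
  obtain ⟨C, hC, hE⟩ := LW hW hL
  have hC0 : 0 < C := by linarith
  have hsm := smC_pos
  refine ⟨C ^ 2 * smC, by positivity, ?_⟩
  intro δ hδ0 hδ a ha F G hF hG n hFG w hw
  obtain ⟨E, hEd, hE⟩ := hE a ha
  have hR : 0 < δ * radialize τ a := mul_pos hδ0 (hL.pos a ha)
  set R := δ * radialize τ a with hRd
  have hsub : Metric.ball a (3 * R) ⊆ unitDisc := ball_sub_disc hL hδ0.le hδ ha (by norm_num) (by norm_num)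
  have hloc : ∀ z ∈ Metric.ball a (3 * R), E z ≠ 0 ∧ C⁻¹ ≤ ‖E z‖ ^ 2 * ω z ∧ ‖E z‖ ^ 2 * ω z ≤ C := by
    intro z hz
    refine hE z (hsub hz) ?_
    rw [mem_ball_iff_norm] at hz
    refine hz.le.trans ?_
    have := hL.pos a ha
    rw [hRd]; gcongr
  have hHd : DifferentiableOn ℂ (fun z => G z / E z) (Metric.ball a (3 * R)) :=
    (hG.mono hsub).div hEd.differentiableOn (fun z hz => (hloc z hz).1)
  have hud : DifferentiableOn ℂ (fun z => F z / E z) (Metric.ball a (3 * R)) :=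
    (hF.mono hsub).div hEd.differentiableOn (fun z hz => (hloc z hz).1)
  have hu : ∀ z ∈ Metric.ball a (3 * R), F z / E z = (z - a) ^ n * (G z / E z) := by
    intro z hz; rw [hFG z (hsub hz)]; ring
  set I := ∫⁻ z in Metric.ball a (3 * R), ENNReal.ofReal (‖F z‖ ^ 2) ∂(muW ω) with hI
  rcases eq_or_ne I ⊤ with hT | hT
  · rw [hT, ENNReal.mul_top]
    · exact le_top
    · rw [Ne, ENNReal.ofReal_eq_zero, not_le]; positivity
  have hIl : I = ∫⁻ z in Metric.ball a (3 * R), ENNReal.ofReal (ω z) * ENNReal.ofReal (‖F z‖ ^ 2) ∂dA :=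
    lintegral_muW hW hsub Metric.isOpen_ball.measurableSet _
  have hbd : ∀ ζ, ‖ζ - a‖ = 2 * R → ‖(ζ - a) ^ n * (G ζ / E ζ)‖ ^ 2 ≤ smC / R ^ 2 * (C * I.toReal) := by
    intro ζ hζ
    have hζb : ζ ∈ Metric.ball a (3 * R) := by rw [mem_ball_iff_norm]; linarith
    rw [← hu ζ hζb]
    have hss : Metric.ball ζ R ⊆ Metric.ball a (3 * R) := Metric.ball_subset_ball' (by rw [dist_eq_norm]; linarith)
    have h1 := submean hR (hud.mono hss)
    have h2 : ∫⁻ z in Metric.ball ζ R, ENNReal.ofReal (‖F z / E z‖ ^ 2) ∂dA ≤ ENNReal.ofReal C * I := by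
      refine (lintegral_mono_set hss).trans ?_
      rw [hIl, ← lintegral_const_mul' _ _ ENNReal.ofReal_ne_top]
      refine setLIntegral_mono' Metric.isOpen_ball.measurableSet fun z hz => ?_
      obtain ⟨h3, h4, -⟩ := hloc z hz
      have hω := hW.pos z (hsub hz)
      rw [← ENNReal.ofReal_mul hω.le, ← ENNReal.ofReal_mul hC0.le]
      apply ENNReal.ofReal_le_ofReal
      have hE2 : 0 < ‖E z‖ ^ 2 := by positivity
      rw [norm_div, div_pow, div_le_iff₀ hE2]
      have h5 : 1 ≤ C * (‖E z‖ ^ 2 * ω z) := by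
        rw [inv_le_iff_one_le_mul₀ hC0] at h4; linarith
      nlinarith [sq_nonneg ‖F z‖]
    have h6 := h1.trans (mul_le_mul_right h2 _)
    rw [← ENNReal.ofReal_toReal hT, ← ENNReal.ofReal_mul hC0.le, ← ENNReal.ofReal_mul (by positivity)] at h6
    exact (ENNReal.ofReal_le_ofReal_iff (by positivity)).1 h6
  have hm := loc_max hR hHd hbd hw
  have hwb : w ∈ Metric.ball a (3 * R) := Metric.ball_subset_ball (by linarith) hw
  rw [← hu w hwb] at hm
  obtain ⟨h3, -, h4⟩ := hloc w hwb
  rw [← ENNReal.ofReal_toReal hT, ← ENNReal.ofReal_mul (by positivity)]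
  apply ENNReal.ofReal_le_ofReal
  have hE2 : 0 < ‖E w‖ ^ 2 := by positivity
  rw [norm_div, div_pow] at hm
  calc ω w * ‖F w‖ ^ 2 = (‖E w‖ ^ 2 * ω w) * (‖F w‖ ^ 2 / ‖E w‖ ^ 2) := by field_simp
    _ ≤ C * ((1 / 4) ^ n * (smC / R ^ 2 * (C * I.toReal))) := by gcongr
    _ = _ := by ring

end
end

noncomputable section
section
variable {ω φ : ℂ → ℝ} {τ : ℝ → ℝ} {c₁ c₂ δ : ℝ}

theorem overlap_int (hW : IsClassW ω φ τ) (hL : IsClassL (radialize τ) c₁ c₂) (hδ0 : 0 < δ) (hδ : δ ≤ mTau c₁ c₂)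
    {z : ℕ → ℂ} (hz : IsLattice (radialize τ) δ z) : ∃ N : ℕ, ∀ f : ℂ → ℝ≥0∞, AEMeasurable f (muW ω) →
    ∑' j, ∫⁻ w in Metric.ball (z j) (3 * (δ * radialize τ (z j))), f w ∂(muW ω) ≤ N * ∫⁻ w, f w ∂(muW ω) := by
  obtain ⟨N, hN⟩ := overlap hL hδ0 hδ hz.mem (lat_sep hz) hδ0 hδ
  refine ⟨N, fun f hf => ?_⟩
  have e : ∀ j, ∫⁻ w in Metric.ball (z j) (3 * (δ * radialize τ (z j))), f w ∂(muW ω) =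
      ∫⁻ w, (Metric.ball (z j) (3 * (δ * radialize τ (z j)))).indicator f w ∂(muW ω) := fun j =>
    (lintegral_indicator Metric.isOpen_ball.measurableSet _).symm
  simp_rw [e]
  rw [← lintegral_tsum (fun j => hf.indicator Metric.isOpen_ball.measurableSet),
    ← lintegral_const_mul' _ _ (ENNReal.natCast_ne_top N)]
  refine lintegral_mono_ae ((ae_muW hW).2 (Eventually.of_forall fun w hw => ?_))
  obtain ⟨hfin, hcard⟩ := hN w hw
  rw [tsum_eq_sum (s := hfin.toFinset)]
  · refine (Finset.sum_le_card_nsmul _ _ (f w) fun j _ => indicator_le_self _ _ _).trans ?_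
    rw [nsmul_eq_mul]
    gcongr
    rwa [← Set.ncard_eq_toFinset_card _ hfin]
  · intro j hj
    refine indicator_of_notMem (fun hm => hj ?_) _
    rw [Finite.mem_toFinset]
    rw [mem_ball_iff_norm] at hm
    exact hm.le

theorem carl (hW : IsClassW ω φ τ) (hL : IsClassL (radialize τ) c₁ c₂) (hδ0 : 0 < δ) (hδ : δ ≤ mTau c₁ c₂)
    {z : ℕ → ℂ} (hz : IsLattice (radialize τ) δ z) : ∃ K : ℝ, 0 < K ∧ ∀ u F : ℂ → ℂ, DifferentiableOn ℂ F unitDisc →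
    ∫⁻ w, ENNReal.ofReal (‖F w‖ ^ 2) ∂(muW ω) ≠ ⊤ → ∀ ν : ℕ → ℕ, (∀ j, ∀ k < ν j, itD (z j) F k (z j) = 0) →
    ∀ S : ℝ≥0∞, (∀ j, ENNReal.ofReal ((1 / 4) ^ ν j) * localMeanE (radialize τ) δ u (z j) ≤ S) →
    ∫⁻ w, ENNReal.ofReal (‖u w * F w‖ ^ 2) ∂(muW ω) ≤
      ENNReal.ofReal K * S * ∫⁻ w, ENNReal.ofReal (‖F w‖ ^ 2) ∂(muW ω) := by
  obtain ⟨N, hN⟩ := overlap_int hW hL hδ0 hδ hz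
  obtain ⟨C, hC, hloc⟩ := loc_sup hW hL
  refine ⟨C * (N + 1), by positivity, ?_⟩
  intro u F hF hFi ν hν S hS
  have hm : AEMeasurable (fun w => ENNReal.ofReal (‖F w‖ ^ 2)) (muW ω) :=
    ((aesm_contOn hW hF.continuousOn).norm.aemeasurable.pow_const 2).ennreal_ofReal
  have hstep : ∀ j, ∫⁻ w in Metric.ball (z j) (δ * radialize τ (z j)), ENNReal.ofReal (‖u w * F w‖ ^ 2) ∂(muW ω) ≤
      ENNReal.ofReal C * S * ∫⁻ w in Metric.ball (z j) (3 * (δ * radialize τ (z j))), ENNReal.ofReal (‖F w‖ ^ 2) ∂(muW ω) := by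
    intro j
    have hsub := ball_sub_disc1 hL hδ0.le hδ (hz.mem j)
    have hR : 0 < δ * radialize τ (z j) := mul_pos hδ0 (hL.pos _ (hz.mem j))
    set R := δ * radialize τ (z j) with hRd
    set I := ∫⁻ w in Metric.ball (z j) (3 * R), ENNReal.ofReal (‖F w‖ ^ 2) ∂(muW ω) with hI
    have hIf : I ≠ ⊤ := ne_top_of_le_ne_top hFi (setLIntegral_le_lintegral _ _)
    rw [lintegral_muW hW hsub Metric.isOpen_ball.measurableSet]
    have h1 : ∫⁻ w in Metric.ball (z j) R, ENNReal.ofReal (ω w) * ENNReal.ofReal (‖u w * F w‖ ^ 2) ∂dA ≤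
        ∫⁻ w in Metric.ball (z j) R, ENNReal.ofReal (C * (1 / 4) ^ ν j / R ^ 2) * I * ENNReal.ofReal (‖u w‖ ^ 2) ∂dA := by
      refine setLIntegral_mono' Metric.isOpen_ball.measurableSet fun w hw => ?_
      have h2 := hloc δ hδ0 hδ (z j) (hz.mem j) F _ hF (itD_diff (hz.mem j) hF (ν j)) (ν j)
        (fun x _ => itD_factor (ν j) (hν j) x) w hw
      have hω := hW.pos w (hsub hw)
      rw [← ENNReal.ofReal_mul hω.le]
      have e : ω w * ‖u w * F w‖ ^ 2 = ω w * ‖F w‖ ^ 2 * ‖u w‖ ^ 2 := by rw [norm_mul]; ring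
      rw [e, ENNReal.ofReal_mul (by positivity)]
      exact mul_le_mul_left h2 _
    refine h1.trans ?_
    rw [lintegral_const_mul' _ _ (ENNReal.mul_ne_top ENNReal.ofReal_ne_top hIf)]
    have h3 := hS j
    rw [localMeanE, ← hRd] at h3
    have e2 : ENNReal.ofReal (C * (1 / 4) ^ ν j / R ^ 2) =
        ENNReal.ofReal C * ENNReal.ofReal ((1 / 4) ^ ν j) * (ENNReal.ofReal (R ^ 2))⁻¹ := by
      rw [ENNReal.ofReal_div_of_pos (by positivity), ENNReal.ofReal_mul hC.le, div_eq_mul_inv]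
    rw [e2]
    calc _ = ENNReal.ofReal C * (ENNReal.ofReal ((1 / 4) ^ ν j) * ((ENNReal.ofReal (R ^ 2))⁻¹ *
          ∫⁻ w in Metric.ball (z j) R, ENNReal.ofReal (‖u w‖ ^ 2) ∂dA)) * I := by ring
      _ ≤ _ := by gcongr
  calc ∫⁻ w, ENNReal.ofReal (‖u w * F w‖ ^ 2) ∂(muW ω)
      = ∫⁻ w in unitDisc, ENNReal.ofReal (‖u w * F w‖ ^ 2) ∂(muW ω) := by rw [muW_restrict_disc]
    _ ≤ ∫⁻ w in ⋃ j, Metric.ball (z j) (δ * radialize τ (z j)), ENNReal.ofReal (‖u w * F w‖ ^ 2) ∂(muW ω) :=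
        lintegral_mono_set (fun w hw => mem_iUnion.2 (hz.covers w hw))
    _ ≤ ∑' j, ∫⁻ w in Metric.ball (z j) (δ * radialize τ (z j)), ENNReal.ofReal (‖u w * F w‖ ^ 2) ∂(muW ω) :=
        lintegral_iUnion_le _ _
    _ ≤ ∑' j, ENNReal.ofReal C * S * ∫⁻ w in Metric.ball (z j) (3 * (δ * radialize τ (z j))), ENNReal.ofReal (‖F w‖ ^ 2) ∂(muW ω) :=
        ENNReal.tsum_le_tsum hstep
    _ ≤ ENNReal.ofReal C * S * (N * ∫⁻ w, ENNReal.ofReal (‖F w‖ ^ 2) ∂(muW ω)) := by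
        rw [ENNReal.tsum_mul_left]
        exact mul_le_mul_right (hN _ hm) _
    _ ≤ ENNReal.ofReal C * S * (ENNReal.ofReal (N + 1) * ∫⁻ w, ENNReal.ofReal (‖F w‖ ^ 2) ∂(muW ω)) := by
        gcongr
        rw [← ENNReal.ofReal_natCast]; exact ENNReal.ofReal_le_ofReal (by linarith)
    _ = _ := by rw [ENNReal.ofReal_mul hC.le]; ring

theorem two_sq (a b : ℂ) : ENNReal.ofReal (‖a + b‖ ^ 2) ≤ 2 * ENNReal.ofReal (‖a‖ ^ 2) + 2 * ENNReal.ofReal (‖b‖ ^ 2) := by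
  have e : (2 : ℝ≥0∞) = ENNReal.ofReal 2 := by simp
  rw [e, ← ENNReal.ofReal_mul (by norm_num), ← ENNReal.ofReal_mul (by norm_num),
    ← ENNReal.ofReal_add (by positivity) (by positivity)]
  apply ENNReal.ofReal_le_ofReal
  have := norm_add_le a b
  nlinarith [norm_nonneg (a + b), sq_nonneg (‖a‖ - ‖b‖)]

theorem lint_two_sq {μ : Measure ℂ} {a b : ℂ → ℂ} (ha : AEStronglyMeasurable a μ) :
    ∫⁻ z, ENNReal.ofReal (‖a z + b z‖ ^ 2) ∂μ ≤ 2 * ∫⁻ z, ENNReal.ofReal (‖a z‖ ^ 2) ∂μ + 2 * ∫⁻ z, ENNReal.ofReal (‖b z‖ ^ 2) ∂μ := by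
  have hm : AEMeasurable (fun w => 2 * ENNReal.ofReal (‖a w‖ ^ 2)) μ :=
    ((ha.norm.aemeasurable.pow_const 2).ennreal_ofReal).const_mul _
  rw [← lintegral_const_mul' _ _ (by simp), ← lintegral_const_mul' _ _ (by simp), ← lintegral_add_left' hm]
  exact lintegral_mono fun z => two_sq _ _

theorem hank_min {g : ℂ → ℂ} {T : bergmanH ω →L[ℂ] Lp ℂ 2 (muW ω)} (hT : IsHankelExtension ω g T)
    {f : bergmanH ω} {F : ℂ → ℂ} {M : ℝ} (hF : DifferentiableOn ℂ F unitDisc) (hM : ∀ z ∈ unitDisc, ‖F z‖ ≤ M)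
    (hf : ((f : Lp ℂ 2 (muW ω)) : ℂ → ℂ) =ᵐ[muW ω] F) (hgF : MemLp (fun z => g z * F z) 2 (muW ω)) (v : bergmanH ω) :
    ‖T f‖ ≤ ‖hgF.toLp _ - (v : Lp ℂ 2 (muW ω))‖ := by
  rw [hT f F M hF hM hf _ hgF.coeFn_toLp]
  have := (Submodule.starProjection_minimal (U := bergmanH ω) (hgF.toLp _)).le
  refine this.trans (ciInf_le ⟨0, ?_⟩ v)
  rintro _ ⟨x, rfl⟩; exact norm_nonneg _

theorem gF_memLp (hW : IsClassW ω φ τ) {g F : ℂ → ℂ} {M : ℝ} (hg : MemLp g 2 (muW ω)) (hF : DifferentiableOn ℂ F unitDisc)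
    (hM : ∀ z ∈ unitDisc, ‖F z‖ ≤ M) : MemLp (fun z => g z * F z) 2 (muW ω) := by
  refine hg.of_le_mul (c := M) (hg.1.mul (aesm_contOn hW hF.continuousOn)) ?_
  refine (ae_muW hW).2 (Eventually.of_forall fun z hz => ?_)
  rw [norm_mul, mul_comm]
  exact mul_le_mul_of_nonneg_right (hM z hz) (norm_nonneg _)

theorem stepA (hW : IsClassW ω φ τ) {g g₁ g₂ : ℂ → ℂ} (hg : MemLp g 2 (muW ω)) {T : bergmanH ω →L[ℂ] Lp ℂ 2 (muW ω)}
    (hT : IsHankelExtension ω g T) (hgg : ∀ z ∈ unitDisc, g z = g₁ z + g₂ z) (hg₂ : ContDiffOn ℝ 1 g₂ unitDisc)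
    {f : bergmanH ω} {F : ℂ → ℂ} {M : ℝ} (hF : DifferentiableOn ℂ F unitDisc) (hM : ∀ z ∈ unitDisc, ‖F z‖ ≤ M)
    (hf : ((f : Lp ℂ 2 (muW ω)) : ℂ → ℂ) =ᵐ[muW ω] F) :
    ENNReal.ofReal (‖T f‖ ^ 2) ≤ 2 * ∫⁻ z, ENNReal.ofReal (‖g₁ z * F z‖ ^ 2) ∂(muW ω) +
      4 * ∫⁻ z, ENNReal.ofReal (‖dbar g₂ z / (Real.sqrt (laplacian φ z) : ℂ) * F z‖ ^ 2) ∂(muW ω) := by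
  have hgF := gF_memLp hW hg hF hM
  have hFm := aesm_contOn hW hF.continuousOn
  have hg₂m := aesm_contOn hW hg₂.continuousOn
  have hae : ∀ᵐ z ∂(muW ω), g z = g₁ z + g₂ z := (ae_muW hW).2 (Eventually.of_forall hgg)
  have hg₁m : AEStronglyMeasurable g₁ (muW ω) := by
    refine (hg.1.sub hg₂m).congr ?_
    filter_upwards [hae] with z hz; simp [hz]
  set Q1 := ∫⁻ z, ENNReal.ofReal (‖g₁ z * F z‖ ^ 2) ∂(muW ω) with hQ1
  set Q2 := ∫⁻ z, ENNReal.ofReal (‖dbar g₂ z / (Real.sqrt (laplacian φ z) : ℂ) * F z‖ ^ 2) ∂(muW ω) with hQ2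
  rcases eq_or_ne Q1 ⊤ with h1 | h1
  · rw [h1]; simp
  rcases eq_or_ne Q2 ⊤ with h2 | h2
  · rw [h2]; simp
  have hg₁F : MemLp (fun z => g₁ z * F z) 2 (muW ω) := memLp_of_lint (hg₁m.mul hFm) h1
  have hg₂F : MemLp (fun z => g₂ z * F z) 2 (muW ω) := by
    refine (hgF.sub hg₁F).ae_eq ?_
    filter_upwards [hae] with z hz
    simp only [Pi.sub_apply, hz]; ring
  have hFR : ContDiffOn ℝ 1 F unitDisc := ((hF.contDiffOn isOpen_unitDisc).restrict_scalars ℝ)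
  obtain ⟨v, hv, hvL⟩ := horm_muW hW (hg₂.mul hFR) (lint_of_memLp hg₂F)
  have e : ∫⁻ z, ENNReal.ofReal (‖dbar (fun z => g₂ z * F z) z‖ ^ 2 / laplacian φ z) ∂(muW ω) = Q2 := by
    refine lintegral_congr_ae ((ae_muW hW).2 (Eventually.of_forall fun z hz => ?_))
    have hn := isOpen_unitDisc.mem_nhds hz
    have hFd := hF.differentiableAt hn
    have hlap := hW.lap_pos z hz
    beta_reduce
    rw [dbar_mul ((hg₂.contDiffAt hn).differentiableAt one_ne_zero) (hFd.restrictScalars ℝ), dbar_holo hFd]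
    congr 1
    rw [mul_zero, add_zero, norm_mul, norm_mul, norm_div, Complex.norm_real, Real.norm_of_nonneg (Real.sqrt_nonneg _),
      mul_pow, mul_pow, div_pow, Real.sq_sqrt hlap.le]
    ring
  have hvL' : ∫⁻ z, ENNReal.ofReal (‖g₂ z * F z - v z‖ ^ 2) ∂(muW ω) ≤ 2 * Q2 := by
    rw [← e]; exact hvL
  have hd : MemLp (fun z => g₂ z * F z - v z) 2 (muW ω) :=
    memLp_of_lint ((hg₂m.mul hFm).sub (aesm_contOn hW hv.continuousOn))
      (ne_top_of_le_ne_top (ENNReal.mul_ne_top (by simp) h2) hvL')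
  have hvm : MemLp v 2 (muW ω) := by
    refine (hg₂F.sub hd).ae_eq (Eventually.of_forall fun z => ?_)
    simp
  obtain ⟨V, hV⟩ := berg_mk hv hvm
  have hmin := hank_min hT hF hM hf hgF V
  have h3 : ENNReal.ofReal (‖T f‖ ^ 2) ≤ ENNReal.ofReal (‖hgF.toLp _ - (V : Lp ℂ 2 (muW ω))‖ ^ 2) :=
    ENNReal.ofReal_le_ofReal (by gcongr)
  refine h3.trans ?_
  have h4 : (hgF.toLp _ - (V : Lp ℂ 2 (muW ω)) : Lp ℂ 2 (muW ω)) =ᵐ[muW ω] fun z => g₁ z * F z + (g₂ z * F z - v z) := by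
    filter_upwards [Lp.coeFn_sub (hgF.toLp _) (V : Lp ℂ 2 (muW ω)), hgF.coeFn_toLp, hV, hae] with z a1 a2 a3 a4
    rw [a1, Pi.sub_apply, a2, a3, a4]; ring
  rw [norm_sq_Lp' _ h4]
  refine (lint_two_sq (hg₁m.mul hFm)).trans ?_
  refine add_le_add le_rfl ((mul_le_mul_right hvL' _).trans (le_of_eq ?_))
  rw [← mul_assoc]; norm_num

end
end

noncomputable section
section
variable {ω φ : ℂ → ℝ} {τ : ℝ → ℝ} {c₁ c₂ δ : ℝ}

theorem Q_split (hW : IsClassW ω φ τ) {u F F' : ℂ → ℂ} (hu : AEStronglyMeasurable u (muW ω))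
    (hF : DifferentiableOn ℂ F unitDisc) :
    ∫⁻ z, ENNReal.ofReal (‖u z * F' z‖ ^ 2) ∂(muW ω) ≤ 2 * ∫⁻ z, ENNReal.ofReal (‖u z * F z‖ ^ 2) ∂(muW ω) +
      2 * ∫⁻ z, ENNReal.ofReal (‖u z * (F' z - F z)‖ ^ 2) ∂(muW ω) := by
  refine le_trans (le_of_eq ?_) (lint_two_sq (hu.mul (aesm_contOn hW hF.continuousOn)))
  refine lintegral_congr fun z => ?_
  congr 3
  ring

theorem ofReal_num_aux {q1 q2 d : ℝ≥0∞} {q1' q2' d1 d2 : ℝ≥0∞} (h1 : q1' ≤ 2 * q1 + 2 * d1) (h2 : q2' ≤ 2 * q2 + 2 * d2)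
    (e1 : d1 ≤ d) (e2 : d2 ≤ d) : 2 * q1' + 4 * q2' ≤ 4 * q1 + 8 * q2 + 12 * d := by
  calc 2 * q1' + 4 * q2' ≤ 2 * (2 * q1 + 2 * d) + 4 * (2 * q2 + 2 * d) := by
        refine add_le_add (mul_le_mul_right (h1.trans ?_) _) (mul_le_mul_right (h2.trans ?_) _)
        · gcongr
        · gcongr
    _ = 4 * q1 + 8 * q2 + 12 * d := by ring

theorem stepB (hW : IsClassW ω φ τ) (hL : IsClassL (radialize τ) c₁ c₂) (hδ0 : 0 < δ) (hδ : δ ≤ mTau c₁ c₂)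
    {z : ℕ → ℂ} (hz : IsLattice (radialize τ) δ z) {g g₁ g₂ : ℂ → ℂ} (hg : MemLp g 2 (muW ω)) {T : bergmanH ω →L[ℂ] Lp ℂ 2 (muW ω)}
    (hT : IsHankelExtension ω g T) (hgg : ∀ z ∈ unitDisc, g z = g₁ z + g₂ z) (hg₂ : ContDiffOn ℝ 1 g₂ unitDisc)
    {S0 : ℝ} (hS0 : 0 ≤ S0) (hS1 : ∀ j, localMeanE (radialize τ) δ g₁ (z j) ≤ ENNReal.ofReal S0)
    (hS2 : ∀ j, localMeanE (radialize τ) δ (fun w => dbar g₂ w / (Real.sqrt (laplacian φ w) : ℂ)) (z j) ≤ ENNReal.ofReal S0)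
    (f : bergmanH ω) :
    ENNReal.ofReal (‖T f‖ ^ 2) ≤ 4 * ∫⁻ z, ENNReal.ofReal (‖g₁ z * hrep hW f z‖ ^ 2) ∂(muW ω) +
      8 * ∫⁻ z, ENNReal.ofReal (‖dbar g₂ z / (Real.sqrt (laplacian φ z) : ℂ) * hrep hW f z‖ ^ 2) ∂(muW ω) := by
  obtain ⟨K, hK, hcarl⟩ := carl hW hL hδ0 hδ hz
  have hg₂m := aesm_contOn hW hg₂.continuousOn
  have hg₁m : AEStronglyMeasurable g₁ (muW ω) := by
    refine (hg.1.sub hg₂m).congr ?_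
    filter_upwards [(ae_muW hW).2 (Eventually.of_forall hgg)] with z hz; simp [hz]
  have hu2 : AEStronglyMeasurable (fun w => dbar g₂ w / (Real.sqrt (laplacian φ w) : ℂ)) (muW ω) := by
    refine aesm_contOn hW ((dbar_continuousOn isOpen_unitDisc hg₂).div
      (Complex.continuous_ofReal.comp_continuousOn (Real.continuous_sqrt.comp_continuousOn
        (laplacian_continuousOn isOpen_unitDisc hW.smooth))) fun z hz => ?_)
    have := Real.sqrt_pos.2 (hW.lap_pos z hz)
    exact_mod_cast this.ne'
  have hclosed : IsClosed {f' : bergmanH ω | ENNReal.ofReal (‖T f'‖ ^ 2) ≤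
      4 * ∫⁻ z, ENNReal.ofReal (‖g₁ z * hrep hW f z‖ ^ 2) ∂(muW ω) +
      8 * ∫⁻ z, ENNReal.ofReal (‖dbar g₂ z / (Real.sqrt (laplacian φ z) : ℂ) * hrep hW f z‖ ^ 2) ∂(muW ω) +
      ENNReal.ofReal (12 * (K * S0 * ‖f' - f‖ ^ 2))} :=
    isClosed_le (ENNReal.continuous_ofReal.comp (by fun_prop))
      (continuous_const.add (ENNReal.continuous_ofReal.comp (by fun_prop)))
  have hmem := hclosed.closure_subset_iff.2 (?_ : (hinf ω : Set (bergmanH ω)) ⊆ _)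
  · rw [(hinf_dense hW).closure_eq] at hmem
    have := hmem (mem_univ f)
    simpa using this
  rintro f' ⟨F', M, hF', hM, hf'⟩
  have hA := stepA hW hg hT hgg hg₂ hF' hM hf'
  have hF := hrep_diff hW f
  have hd : ((f' - f : bergmanH ω) : Lp ℂ 2 (muW ω)) =ᵐ[muW ω] fun z => F' z - hrep hW f z := by
    filter_upwards [Lp.coeFn_sub (f' : Lp ℂ 2 (muW ω)) (f : Lp ℂ 2 (muW ω)), hf', hrep_ae hW f] with z a1 a2 a3
    rw [AddSubgroupClass.coe_sub, a1, Pi.sub_apply, a2, a3]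
  have hn := norm_sq_Lp' _ hd
  have hfin : ∫⁻ z, ENNReal.ofReal (‖F' z - hrep hW f z‖ ^ 2) ∂(muW ω) ≠ ⊤ := by rw [← hn]; exact ENNReal.ofReal_ne_top
  have hb : ∀ u : ℂ → ℂ, (∀ j, localMeanE (radialize τ) δ u (z j) ≤ ENNReal.ofReal S0) →
      ∫⁻ z, ENNReal.ofReal (‖u z * (F' z - hrep hW f z)‖ ^ 2) ∂(muW ω) ≤ ENNReal.ofReal (K * S0 * ‖f' - f‖ ^ 2) := by
    intro u hu
    have := hcarl u _ (hF'.sub hF) hfin (fun _ => 0) (fun j k hk => absurd hk (by omega)) (ENNReal.ofReal S0)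
      (fun j => by simpa using hu j)
    refine this.trans (le_of_eq ?_)
    rw [ENNReal.ofReal_mul (by positivity), ENNReal.ofReal_mul hK.le]
    congr 1
    exact hn.symm
  refine hA.trans ?_
  rw [ENNReal.ofReal_mul (by norm_num : (0:ℝ) ≤ 12), show ENNReal.ofReal 12 = 12 by simp]
  exact ofReal_num_aux (Q_split hW hg₁m hF) (Q_split hW hu2 hF) (hb _ hS1) (hb _ hS2)

theorem sqrt_rpow_aux {a : ℝ} (ha : 0 ≤ a) (p : ℝ) : Real.sqrt a ^ p = a ^ (p / 2) := by
  rw [Real.sqrt_eq_rpow, ← Real.rpow_mul ha]; congr 1; ring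

theorem summ_aux {l1 l2 : ℕ → ℝ≥0∞} {p : ℝ} (hp0 : 0 < p) (hp1 : p < 1) (h1 : ∑' j, l1 j ^ (p / 2) < ⊤) (h2 : ∑' j, l2 j ^ (p / 2) < ⊤) :
    (∀ j, l1 j + l2 j ≠ ⊤) ∧ Summable (fun j => Real.sqrt (l1 j + l2 j).toReal ^ p) := by
  have hq : 0 < p / 2 := by positivity
  have key : ∀ l : ℕ → ℝ≥0∞, ∑' j, l j ^ (p / 2) < ⊤ → ∀ j, l j ≠ ⊤ := by
    intro l hl j hj
    have := ENNReal.ne_top_of_tsum_ne_top hl.ne j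
    rw [hj, ENNReal.top_rpow_of_pos hq] at this
    exact this rfl
  have hf : ∀ j, l1 j + l2 j ≠ ⊤ := fun j => ENNReal.add_ne_top.2 ⟨key _ h1 j, key _ h2 j⟩
  refine ⟨hf, ?_⟩
  have e : (fun j => Real.sqrt (l1 j + l2 j).toReal ^ p) = fun j => ((l1 j + l2 j) ^ (p / 2)).toReal := by
    funext j
    rw [sqrt_rpow_aux ENNReal.toReal_nonneg, ENNReal.toReal_rpow]
  rw [e]
  apply ENNReal.summable_toReal
  refine ne_top_of_le_ne_top (b := ∑' j, (l1 j ^ (p / 2) + l2 j ^ (p / 2))) ?_ ?_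
  · rw [ENNReal.tsum_add]; exact ENNReal.add_ne_top.2 ⟨h1.ne, h2.ne⟩
  · exact ENNReal.tsum_le_tsum fun j => ENNReal.rpow_add_le_add_rpow _ _ hq.le (by linarith)

set_option maxHeartbeats 1000000 in
theorem three_one (hW : IsClassW ω φ τ) (hL : IsClassL (radialize τ) c₁ c₂) {g : ℂ → ℂ} (hg : MemLp g 2 (muW ω))
    {T : bergmanH ω →L[ℂ] Lp ℂ 2 (muW ω)} (hT : IsHankelExtension ω g T) {p : ℝ}
    (hp : p ∈ Set.Ioo (0:ℝ) 1) (h : SchattenCondThree (radialize τ) φ c₁ c₂ g p) : MemSchatten p T := by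
  obtain ⟨δ, ⟨hδ0, hδ⟩, g₁, g₂, hgg, hg₂, hsum⟩ := h
  obtain ⟨z, hz, -⟩ := exists_lattice hW hL hδ0 hδ.le
  obtain ⟨h1, h2⟩ := hsum z hz
  have hp0 := hp.1
  obtain ⟨K, hK, hcarl⟩ := carl hW hL hδ0 hδ.le hz
  obtain ⟨hfin, hsm⟩ := summ_aux hp0 hp.2 h1 h2
  set l1 := fun j => localMeanE (radialize τ) δ g₁ (z j) with hl1
  set l2 := fun j => localMeanE (radialize τ) δ (fun w => dbar g₂ w / (Real.sqrt (laplacian φ w) : ℂ)) (z j) with hl2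
  set m : ℕ → ℝ := fun j => Real.sqrt (l1 j + l2 j).toReal with hm
  have hm0 : ∀ j, 0 ≤ m j := fun j => Real.sqrt_nonneg _
  have hmsq : ∀ j, l1 j + l2 j = ENNReal.ofReal (m j ^ 2) := by
    intro j; rw [hm]; beta_reduce; rw [Real.sq_sqrt ENNReal.toReal_nonneg, ENNReal.ofReal_toReal (hfin j)]
  -- bound on m
  obtain ⟨B, hB0, hB⟩ : ∃ B : ℝ, 0 ≤ B ∧ ∀ j, m j ≤ B := by
    refine ⟨(∑' j, m j ^ p) ^ (1 / p), by positivity, fun j => ?_⟩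
    have h3 : m j ^ p ≤ ∑' j, m j ^ p := hsm.le_tsum j (fun k _ => Real.rpow_nonneg (hm0 k) p)
    calc m j = (m j ^ p) ^ (1 / p) := by rw [← Real.rpow_mul (hm0 j), mul_one_div_cancel hp0.ne', Real.rpow_one]
      _ ≤ _ := Real.rpow_le_rpow (Real.rpow_nonneg (hm0 j) p) h3 (by positivity)
  have hle : ∀ j, ENNReal.ofReal (m j ^ 2) ≤ ENNReal.ofReal (B ^ 2) := fun j =>
    ENNReal.ofReal_le_ofReal (pow_le_pow_left₀ (hm0 j) (hB j) 2)
  have hStepB := stepB hW hL hδ0 hδ.le hz hg hT hgg hg₂ (sq_nonneg B)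
    (fun j => (le_self_add.trans (hmsq j).le).trans (hle j)) (fun j => (le_add_self.trans (hmsq j).le).trans (hle j))
  have ha : ∀ i : ℕ × ℕ, 0 ≤ m i.1 * (1 / 2 : ℝ) ^ i.2 := fun i => mul_nonneg (hm0 _) (by positivity)
  refine schatten_of T (a := fun i : ℕ × ℕ => m i.1 * (1 / 2 : ℝ) ^ i.2) (C := Real.sqrt (12 * K)) hp0 (by positivity) ha ?_ ?_
  · have e : (fun i : ℕ × ℕ => (m i.1 * (1 / 2 : ℝ) ^ i.2) ^ p) = fun i => m i.1 ^ p * ((1 / 2 : ℝ) ^ p) ^ i.2 := by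
      funext i
      rw [Real.mul_rpow (hm0 _) (by positivity), ← Real.rpow_natCast, ← Real.rpow_natCast, ← Real.rpow_mul (by norm_num),
        ← Real.rpow_mul (by norm_num), mul_comm p]
    rw [e]
    exact Summable.mul_of_nonneg hsm (summable_geometric_of_lt_one (by positivity)
      (Real.rpow_lt_one (by norm_num) (by norm_num) hp0)) (fun j => Real.rpow_nonneg (hm0 j) p) (fun n => by positivity)
  · intro t ht A hA
    have hex : ∀ j, ∃ n : ℕ, m j * (1 / 2 : ℝ) ^ n ≤ t := by
      intro j
      have : Tendsto (fun n : ℕ => m j * (1 / 2 : ℝ) ^ n) atTop (nhds (m j * 0)) :=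
        (tendsto_pow_atTop_nhds_zero_of_lt_one (by norm_num) (by norm_num)).const_mul _
      rw [mul_zero] at this
      obtain ⟨n, hn⟩ := (this.eventually (ge_mem_nhds ht)).exists
      exact ⟨n, hn⟩
    classical
    rw [← Fintype.card_coe A]
    refine sn_le_of_ker T (LinearMap.pi (fun i : A => vanL hW (hz.mem i.1.1) i.1.2)) (by positivity) ?_
    intro f hf
    have hv : ∀ j, ∀ k < Nat.find (hex j), itD (z j) (hrep hW f) k (z j) = 0 := by
      intro j k hk
      have h4 := Nat.find_min (hex j) hk
      have h5 : (j, k) ∈ A := (hA (j, k)).2 (not_le.1 h4)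
      have h6 := congrFun hf ⟨(j, k), h5⟩
      exact h6
    have hn := norm_sq_Lp' _ (hrep_ae hW f)
    have hbb : ∀ u : ℂ → ℂ, (∀ j, localMeanE (radialize τ) δ u (z j) ≤ ENNReal.ofReal (m j ^ 2)) →
      ∫⁻ w, ENNReal.ofReal (‖u w * hrep hW f w‖ ^ 2) ∂(muW ω) ≤ ENNReal.ofReal (K * t ^ 2 * ‖f‖ ^ 2) := by
      intro u hu
      have := hcarl u _ (hrep_diff hW f) (by rw [← hn]; exact ENNReal.ofReal_ne_top) (fun j => Nat.find (hex j)) hv (ENNReal.ofReal (t ^ 2))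
        (fun j => by
          refine (mul_le_mul_right (hu j) _).trans ?_
          rw [← ENNReal.ofReal_mul (by positivity)]
          apply ENNReal.ofReal_le_ofReal
          have h7 := Nat.find_spec (hex j)
          calc (1 / 4 : ℝ) ^ Nat.find (hex j) * m j ^ 2 = (m j * (1 / 2 : ℝ) ^ Nat.find (hex j)) ^ 2 := by
                rw [mul_pow, ← pow_mul, mul_comm _ 2, pow_mul]; norm_num; ring
            _ ≤ t ^ 2 := pow_le_pow_left₀ (ha (j, _)) h7 2)
      refine this.trans (le_of_eq ?_)
      rw [ENNReal.ofReal_mul (by positivity), ENNReal.ofReal_mul hK.le]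
      congr 1
      exact hn.symm
    have hb1 := hbb g₁ (fun j => le_self_add.trans (hmsq j).le)
    have hb2 := hbb _ (fun j => le_add_self.trans (hmsq j).le)
    have hfinal := (hStepB f).trans (add_le_add (mul_le_mul_right hb1 4) (mul_le_mul_right hb2 8))
    rw [← add_mul, show (4 + 8 : ℝ≥0∞) = ENNReal.ofReal 12 by norm_num, ← ENNReal.ofReal_mul (by norm_num),
      ENNReal.ofReal_le_ofReal_iff (by positivity)] at hfinal
    refine abs_le_of_sq_le_sq' ?_ (by positivity) |>.2
    rw [mul_pow, mul_pow, Real.sq_sqrt (by positivity)]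
    linarith

end
end

noncomputable section
section
variable {ω φ : ℂ → ℝ} {τ : ℝ → ℝ} {c₁ c₂ δ : ℝ}

theorem greedy {ι : Type*} [DecidableEq ι] (near : ι → ι → Prop) [DecidableRel near] (hs : ∀ i j, near i j → near j i)
    (hr : ∀ i, near i i)
    (a : ι → ℝ) (ha : ∀ i, 0 ≤ a i) {B : ℝ} : ∀ J : Finset ι, (∀ j ∈ J, ((J.filter (near j)).card : ℝ) ≤ B) →
    ∃ I ⊆ J, (∀ i ∈ I, ∀ j ∈ I, i ≠ j → ¬ near i j) ∧ ∑ j ∈ J, a j ≤ B * ∑ i ∈ I, a i := by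
  intro J
  induction J using Finset.strongInduction with
  | H J ih =>
    intro hB
    rcases J.eq_empty_or_nonempty with rfl | hne
    · exact ⟨∅, by simp, by simp, by simp⟩
    obtain ⟨m, hm, hmax⟩ := J.exists_max_image a hne
    have hsub : J.filter (fun j => ¬ near m j) ⊂ J := by
      refine Finset.filter_ssubset.2 ⟨m, hm, by simpa using hr m⟩
    obtain ⟨I, hI, hI2, hI3⟩ := ih _ hsub (fun j hj => by
      refine le_trans ?_ (hB j (Finset.mem_filter.1 hj).1)
      exact_mod_cast Finset.card_le_card (Finset.filter_subset_filter _ hsub.1))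
    have hmI : m ∉ I := fun h => (Finset.mem_filter.1 (hI h)).2 (hr m)
    refine ⟨insert m I, ?_, ?_, ?_⟩
    · exact Finset.insert_subset hm (hI.trans hsub.1)
    · intro i hi j hj hij
      rcases Finset.mem_insert.1 hi with rfl | hi' <;> rcases Finset.mem_insert.1 hj with rfl | hj'
      · exact absurd rfl hij
      · exact (Finset.mem_filter.1 (hI hj')).2
      · exact fun h => (Finset.mem_filter.1 (hI hi')).2 (hs _ _ h)
      · exact hI2 i hi' j hj' hij
    · rw [Finset.sum_insert hmI, ← Finset.sum_filter_add_sum_filter_not J (near m), mul_add]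
      refine add_le_add ?_ hI3
      calc ∑ j ∈ J.filter (near m), a j ≤ ∑ j ∈ J.filter (near m), a m :=
            Finset.sum_le_sum fun j hj => hmax j (Finset.mem_filter.1 hj).1
        _ = ((J.filter (near m)).card : ℝ) * a m := by rw [Finset.sum_const, nsmul_eq_mul]
        _ ≤ B * a m := mul_le_mul_of_nonneg_right (hB m hm) (ha m)

theorem schur {ι : Type*} [Fintype ι] (ε : ι → ι → ℝ) (x : ι → ℝ) {B : ℝ} (hε : ∀ k j, 0 ≤ ε k j)
    (hrow : ∀ k, ∑ j, ε k j ≤ B) (hcol : ∀ j, ∑ k, ε k j ≤ B) :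
    ∑ k, (∑ j, ε k j * x j) ^ 2 ≤ B ^ 2 * ∑ j, x j ^ 2 := by
  rcases isEmpty_or_nonempty ι with hι | ⟨⟨i0⟩⟩
  · simp
  have hB : 0 ≤ B := (Finset.sum_nonneg fun j _ => hε i0 j).trans (hrow i0)
  have h1 : ∀ k, (∑ j, ε k j * x j) ^ 2 ≤ B * ∑ j, ε k j * x j ^ 2 := by
    intro k
    refine (Finset.sum_sq_le_sum_mul_sum_of_sq_le_mul Finset.univ (f := fun j => ε k j) (g := fun j => ε k j * x j ^ 2)
      (fun j _ => hε k j) (fun j _ => mul_nonneg (hε k j) (sq_nonneg _)) (fun j _ => le_of_eq (by ring))).trans ?_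
    exact mul_le_mul_of_nonneg_right (hrow k) (Finset.sum_nonneg fun j _ => mul_nonneg (hε k j) (sq_nonneg _))
  calc ∑ k, (∑ j, ε k j * x j) ^ 2 ≤ ∑ k, B * ∑ j, ε k j * x j ^ 2 := Finset.sum_le_sum fun k _ => h1 k
    _ = B * ∑ j, (∑ k, ε k j) * x j ^ 2 := by
        rw [← Finset.mul_sum, Finset.sum_comm]; simp_rw [Finset.sum_mul]
    _ ≤ B * ∑ j, B * x j ^ 2 := by
        gcongr with j
        exact hcol j
    _ = _ := by rw [← Finset.mul_sum]; ring

set_option maxHeartbeats 1000000 in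
theorem disc_est (hW : IsClassW ω φ τ) (hL : IsClassL (radialize τ) c₁ c₂) (hδ0 : 0 < δ) (hδ : δ ≤ mTau c₁ c₂)
    {g : ℂ → ℂ} (hg : MemLp g 2 (muW ω)) {a : ℂ} (ha : a ∈ unitDisc) {e r v : ℂ → ℂ} {α : ℂ} {c S A : ℝ} (hc : 0 < c)
    (hA : 0 < A)
    (he : DifferentiableOn ℂ e unitDisc) (hr : DifferentiableOn ℂ r unitDisc) (hv : DifferentiableOn ℂ v unitDisc)
    (h1 : ∀ w ∈ Metric.ball a (δ * radialize τ a), c / radialize τ a ≤ ‖e w‖ * √(ω w))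
    (h2 : ∀ w ∈ Metric.ball a (δ * radialize τ a), ‖r w‖ * √(ω w) ≤ S / radialize τ a)
    (hF : FdeltaSqE (radialize τ) δ g a = ENNReal.ofReal (A ^ 2)) :
    ENNReal.ofReal (‖α‖ ^ 2 * c ^ 2 * δ ^ 2 * A ^ 2) ≤
      2 * ∫⁻ w in Metric.ball a (δ * radialize τ a), ENNReal.ofReal (‖g w * (α * e w + r w) - v w‖ ^ 2) ∂(muW ω) +
      ENNReal.ofReal (4 * S ^ 2 * δ ^ 2 * A ^ 2) := by
  rcases eq_or_ne α 0 with rfl | hα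
  · simp
  set t := radialize τ a with ht
  have ht0 : 0 < t := hL.pos a ha
  have hR : 0 < δ * t := mul_pos hδ0 ht0
  set D := Metric.ball a (δ * t) with hD
  have hDd : D ⊆ unitDisc := Metric.ball_subset_closedBall.trans (closedBall_sub hL hδ0 hδ ha)
  have hDm : MeasurableSet D := measurableSet_ball
  have he0 : ∀ w ∈ D, e w ≠ 0 := by
    intro w hw h0
    have := h1 w hw
    rw [h0, norm_zero, zero_mul] at this
    exact absurd this (not_le.2 (by positivity))
  -- choose h
  obtain ⟨h, hh, hlt⟩ : ∃ h : ℂ → ℂ, DifferentiableOn ℂ h D ∧ localMeanE (radialize τ) δ (fun w => g w - h w) a < ENNReal.ofReal (2 * A ^ 2) := by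
    have : FdeltaSqE (radialize τ) δ g a < ENNReal.ofReal (2 * A ^ 2) := by
      rw [hF]; exact (ENNReal.ofReal_lt_ofReal_iff (by positivity)).2 (by nlinarith [sq_pos_of_pos hA])
    unfold FdeltaSqE at this
    simp only [iInf_lt_iff] at this
    obtain ⟨h, hh, h3⟩ := this
    exact ⟨h, hh, h3⟩
  set h' : ℂ → ℂ := fun w => h w - (h w * (α * e w + r w) - v w) / (α * e w) with hh'
  have heD := he.mono hDd
  have hrD := hr.mono hDd
  have hvD := hv.mono hDd
  have hd' : DifferentiableOn ℂ h' D := by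
    refine hh.sub (DifferentiableOn.div ((hh.mul (((differentiableOn_const α).mul heD).add hrD)).sub hvD) ((differentiableOn_const α).mul heD) ?_)
    intro w hw; exact mul_ne_zero hα (he0 w hw)
  have hmean : ENNReal.ofReal (A ^ 2) ≤ localMeanE (radialize τ) δ (fun w => g w - h' w) a := by
    rw [← hF]; exact iInf₂_le h' hd'
  have hR2 : ENNReal.ofReal ((δ * t) ^ 2) ≠ 0 := by
    rw [Ne, ENNReal.ofReal_eq_zero, not_le]; positivity
  have hlow : ENNReal.ofReal ((δ * t) ^ 2 * A ^ 2) ≤ ∫⁻ w in D, ENNReal.ofReal (‖g w - h' w‖ ^ 2) ∂dA := by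
    rw [ENNReal.ofReal_mul (by positivity)]
    refine (mul_le_mul_right hmean _).trans ?_
    unfold localMeanE
    rw [← mul_assoc, ENNReal.mul_inv_cancel hR2 ENNReal.ofReal_ne_top, one_mul]
  have hup : ∫⁻ w in D, ENNReal.ofReal (‖g w - h w‖ ^ 2) ∂dA ≤ ENNReal.ofReal ((δ * t) ^ 2 * (2 * A ^ 2)) := by
    rw [ENNReal.ofReal_mul (by positivity)]
    refine le_trans ?_ (mul_le_mul_right hlt.le _)
    unfold localMeanE
    rw [← mul_assoc, ENNReal.mul_inv_cancel hR2 ENNReal.ofReal_ne_top, one_mul]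
  have hgD : AEStronglyMeasurable g ((muW ω).restrict D) := hg.1.restrict
  have hac : (muW ω).restrict D ≪ dA.restrict D := by
    have : muW ω ≪ dA := (withDensity_absolutelyContinuous _ _).trans Measure.absolutelyContinuous_restrict
    exact this.restrict D
  have hm : AEStronglyMeasurable (fun w => g w * (α * e w + r w) - v w) ((muW ω).restrict D) := by
    refine AEStronglyMeasurable.sub (hgD.mul ?_) ?_
    · exact (((((differentiableOn_const α).mul heD).add hrD).continuousOn).aestronglyMeasurable hDm).mono_ac hac
    · exact (hvD.continuousOn.aestronglyMeasurable hDm).mono_ac hac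
  have hωsq : ∀ w ∈ D, √(ω w) ^ 2 = ω w := fun w hw => Real.sq_sqrt (hW.pos w (hDd hw)).le
  have key1 : ENNReal.ofReal (‖α‖ ^ 2 * c ^ 2 * δ ^ 2 * A ^ 2) ≤ ∫⁻ w in D, ENNReal.ofReal (‖α * e w * (g w - h' w)‖ ^ 2) ∂(muW ω) := by
    rw [lintegral_muW hW hDd hDm]
    calc ENNReal.ofReal (‖α‖ ^ 2 * c ^ 2 * δ ^ 2 * A ^ 2) = ENNReal.ofReal (‖α‖ ^ 2 * (c / t) ^ 2) * ENNReal.ofReal ((δ * t) ^ 2 * A ^ 2) := by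
          rw [← ENNReal.ofReal_mul (by positivity)]; congr 1; field_simp
      _ ≤ ENNReal.ofReal (‖α‖ ^ 2 * (c / t) ^ 2) * ∫⁻ w in D, ENNReal.ofReal (‖g w - h' w‖ ^ 2) ∂dA := mul_le_mul_right hlow _
      _ = ∫⁻ w in D, ENNReal.ofReal (‖α‖ ^ 2 * (c / t) ^ 2) * ENNReal.ofReal (‖g w - h' w‖ ^ 2) ∂dA :=
          (lintegral_const_mul' _ _ ENNReal.ofReal_ne_top).symm
      _ ≤ _ := by
          refine setLIntegral_mono' hDm fun w hw => ?_
          rw [← ENNReal.ofReal_mul (by positivity), ← ENNReal.ofReal_mul (hW.pos w (hDd hw)).le]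
          apply ENNReal.ofReal_le_ofReal
          have h3 := pow_le_pow_left₀ (by positivity) (h1 w hw) 2
          rw [mul_pow, hωsq w hw] at h3
          rw [norm_mul, norm_mul]
          calc ‖α‖ ^ 2 * (c / t) ^ 2 * ‖g w - h' w‖ ^ 2 ≤ ‖α‖ ^ 2 * (‖e w‖ ^ 2 * ω w) * ‖g w - h' w‖ ^ 2 := by gcongr
            _ = _ := by ring
  have key2 : ∫⁻ w in D, ENNReal.ofReal (‖(-(g w - h w) * r w)‖ ^ 2) ∂(muW ω) ≤ ENNReal.ofReal (2 * S ^ 2 * δ ^ 2 * A ^ 2) := by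
    rw [lintegral_muW hW hDd hDm]
    calc _ ≤ ∫⁻ w in D, ENNReal.ofReal ((S / t) ^ 2) * ENNReal.ofReal (‖g w - h w‖ ^ 2) ∂dA := by
          refine setLIntegral_mono' hDm fun w hw => ?_
          rw [← ENNReal.ofReal_mul (hW.pos w (hDd hw)).le, ← ENNReal.ofReal_mul (sq_nonneg _)]
          apply ENNReal.ofReal_le_ofReal
          have h3 := pow_le_pow_left₀ (by positivity) (h2 w hw) 2
          rw [mul_pow, hωsq w hw] at h3
          rw [norm_mul, norm_neg]
          calc _ = ‖r w‖ ^ 2 * ω w * ‖g w - h w‖ ^ 2 := by ring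
            _ ≤ _ := by gcongr
      _ = ENNReal.ofReal ((S / t) ^ 2) * ∫⁻ w in D, ENNReal.ofReal (‖g w - h w‖ ^ 2) ∂dA := lintegral_const_mul' _ _ ENNReal.ofReal_ne_top
      _ ≤ ENNReal.ofReal ((S / t) ^ 2) * ENNReal.ofReal ((δ * t) ^ 2 * (2 * A ^ 2)) := mul_le_mul_right hup _
      _ = _ := by rw [← ENNReal.ofReal_mul (by positivity)]; congr 1; field_simp
  have key3 : ∫⁻ w in D, ENNReal.ofReal (‖α * e w * (g w - h' w)‖ ^ 2) ∂(muW ω) =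
      ∫⁻ w in D, ENNReal.ofReal (‖(g w * (α * e w + r w) - v w) + (-(g w - h w) * r w)‖ ^ 2) ∂(muW ω) := by
    have : ∀ w ∈ D, α * e w * (g w - h' w) = (g w * (α * e w + r w) - v w) + (-(g w - h w) * r w) := by
      intro w hw
      have := he0 w hw
      simp only [hh']
      field_simp
      ring
    exact setLIntegral_congr_fun hDm fun w hw => by beta_reduce; rw [this w hw]
  refine key1.trans (key3.le.trans ((lint_two_sq hm).trans (add_le_add le_rfl ((mul_le_mul_right key2 2).trans (le_of_eq ?_)))))
  rw [show (2:ℝ≥0∞) = ENNReal.ofReal 2 by simp, ← ENNReal.ofReal_mul (by norm_num)]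
  congr 1; ring

end
end

noncomputable section
section
variable {ω φ : ℂ → ℝ} {τ : ℝ → ℝ} {c₁ c₂ δ : ℝ} {τC : ℂ → ℝ}

theorem fin_sums (hL : IsClassL τC c₁ c₂) (hδ0 : 0 < δ) (hδ : δ ≤ mTau c₁ c₂) {z : ℕ → ℂ} (hz : IsLattice τC δ z) :
    ∃ Q : ℝ, 0 < Q ∧ ∀ J : Finset ℕ, ∀ a ∈ unitDisc,
      (∑ j : J, τC (z j) ^ 2 * τC a ^ 2 / (τC (z j) + ‖z j - a‖) ^ 4 ≤ Q) ∧
      (∑ j : J, τC (z j) ^ 2 * τC a ^ 2 / (τC a + ‖z j - a‖) ^ 4 ≤ Q) := by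
  obtain ⟨Cs, hCs, hsum⟩ := sep_sum (ι := ℕ)
  have h2 := hL.c₂_pos
  refine ⟨(1 + c₂) ^ 4 * (Cs / δ ^ 2), by positivity, fun J a ha => ?_⟩
  have hta := hL.pos a ha
  have hs := hsum τC c₁ c₂ δ hL hδ0 hδ z hz.mem (lat_sep hz) a ha
  have htj : ∀ j, 0 < τC (z j) := fun j => hL.pos _ (hz.mem j)
  have hfin : ∑ j ∈ J, τC (z j) ^ 2 / (τC a + ‖z j - a‖) ^ 4 ≤ Cs / (δ ^ 2 * τC a ^ 2) := by
    have h3 := (ENNReal.sum_le_tsum J).trans hs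
    rw [← ENNReal.ofReal_sum_of_nonneg (fun j _ => by positivity), ENNReal.ofReal_le_ofReal_iff (by positivity)] at h3
    exact h3
  have hB : ∑ j : J, τC (z j) ^ 2 * τC a ^ 2 / (τC a + ‖z j - a‖) ^ 4 ≤ Cs / δ ^ 2 := by
    rw [Finset.sum_coe_sort J (fun j => τC (z j) ^ 2 * τC a ^ 2 / (τC a + ‖z j - a‖) ^ 4)]
    calc _ = τC a ^ 2 * ∑ j ∈ J, τC (z j) ^ 2 / (τC a + ‖z j - a‖) ^ 4 := by
          rw [Finset.mul_sum]; exact Finset.sum_congr rfl fun j _ => by ring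
      _ ≤ τC a ^ 2 * (Cs / (δ ^ 2 * τC a ^ 2)) := by gcongr
      _ = _ := by field_simp
  have h1c : 1 ≤ (1 + c₂) ^ 4 := one_le_pow₀ (by linarith)
  have hpos : 0 ≤ Cs / δ ^ 2 := by positivity
  refine ⟨?_, hB.trans (by nlinarith)⟩
  calc _ ≤ ∑ j : J, (1 + c₂) ^ 4 * (τC (z j) ^ 2 * τC a ^ 2 / (τC a + ‖z j - a‖) ^ 4) := by
        refine Finset.sum_le_sum fun j _ => ?_
        have hj := htj j
        have hlip := (abs_le.1 (hL.lip _ (hz.mem j) a ha)).1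
        have hn := norm_nonneg (z j - a)
        have h5 : τC a + ‖z j - a‖ ≤ (1 + c₂) * (τC (z j) + ‖z j - a‖) := by
          have : 0 ≤ c₂ * τC (z j) := by positivity
          linarith [show (1 + c₂) * (τC (z j) + ‖z j - a‖) = τC (z j) + ‖z j - a‖ + c₂ * τC (z j) + c₂ * ‖z j - a‖ by ring]
        have h6 := pow_le_pow_left₀ (by positivity) h5 4
        rw [mul_pow] at h6
        rw [← mul_div_assoc, div_le_div_iff₀ (by positivity) (by positivity)]
        calc _ ≤ τC (z j) ^ 2 * τC a ^ 2 * ((1 + c₂) ^ 4 * (τC (z j) + ‖z j - a‖) ^ 4) := by gcongr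
          _ = _ := by ring
    _ = (1 + c₂) ^ 4 * ∑ j : J, (τC (z j) ^ 2 * τC a ^ 2 / (τC a + ‖z j - a‖) ^ 4) := by rw [Finset.mul_sum]
    _ ≤ _ := by gcongr

theorem pw1 {t u d : ℝ} (ht : 0 < t) (hu : 0 < u) (hd : 0 ≤ d) :
    (min t u / (t + d)) ^ 5 / t ≤ t ^ 2 * u / (t + d) ^ 4 := by
  have hm0 : 0 < min t u := lt_min ht hu
  rw [div_pow, div_div, div_le_div_iff₀ (by positivity) (by positivity)]
  have h1 : min t u ^ 5 ≤ t ^ 3 * (t + d) * u := by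
    calc min t u ^ 5 = min t u ^ 3 * min t u * min t u := by ring
      _ ≤ t ^ 3 * (t + d) * u := by
        gcongr
        · exact min_le_left _ _
        · exact (min_le_left _ _).trans (by linarith)
        · exact min_le_right _ _
  calc _ ≤ t ^ 3 * (t + d) * u * (t + d) ^ 4 := by gcongr
    _ = _ := by ring

theorem pw2 {t u v d s M : ℝ} (ht : 0 < t) (hu : 0 < u) (hv : 0 < v) (hd : 0 ≤ d) (hM : 0 < M) (hu' : u ≤ 5 / 4 * v)
    (hs : 3 / 4 * (t + d) ≤ s) (hMd : M * min t v ≤ d) :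
    (min t u / s) ^ 5 / t ≤ 13 / M * (v * t ^ 2 / (t + d) ^ 4) := by
  have hm0 : 0 < min t u := lt_min ht hu
  have hS : 0 < t + d := by linarith
  have hs0 : 0 < s := by linarith
  have h1 : M * min t u ≤ 5 / 4 * (t + d) := by
    have : min t u ≤ 5 / 4 * min t v := by
      rcases le_total t v with h | h
      · rw [min_eq_left h]; exact (min_le_left _ _).trans (by linarith)
      · rw [min_eq_right h]; exact (min_le_right _ _).trans hu'
    have := mul_le_mul_of_nonneg_left this hM.le
    linarith
  have h2 : M * min t u ^ 5 ≤ 25 / 16 * ((t + d) * v * t ^ 3) := by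
    calc M * min t u ^ 5 = (M * min t u) * min t u * min t u ^ 3 := by ring
      _ ≤ (5 / 4 * (t + d)) * (5 / 4 * v) * t ^ 3 := by
        gcongr
        · exact (min_le_right _ _).trans hu'
        · exact min_le_left _ _
      _ = _ := by ring
  have h3 := pow_le_pow_left₀ (by positivity) hs 5
  have h4 : (t + d) ^ 5 ≤ (4 / 3) ^ 5 * s ^ 5 := by
    rw [mul_pow] at h3; norm_num at h3 ⊢; linarith
  rw [div_pow, div_div, div_mul_div_comm, div_le_div_iff₀ (by positivity) (by positivity)]
  calc min t u ^ 5 * (M * (t + d) ^ 4) = (M * min t u ^ 5) * (t + d) ^ 4 := by ring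
    _ ≤ 25 / 16 * ((t + d) * v * t ^ 3) * (t + d) ^ 4 := by gcongr
    _ = 25 / 16 * v * t ^ 3 * (t + d) ^ 5 := by ring
    _ ≤ 25 / 16 * v * t ^ 3 * ((4 / 3) ^ 5 * s ^ 5) := by gcongr
    _ = (25 / 16 * (4 / 3) ^ 5) * (v * t ^ 3 * s ^ 5) := by ring
    _ ≤ 13 * (v * t ^ 3 * s ^ 5) := by
        refine mul_le_mul_of_nonneg_right (by norm_num) (by positivity)
    _ = _ := by ring

/-- Upper bound for combinations of test functions. -/
theorem comb_upper (hW : IsClassW ω φ τ) (hL : IsClassL (radialize τ) c₁ c₂) {C Q I : ℝ} (hC : 0 < C) (hQ : 0 < Q)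
    (hI : 0 < I)
    (hInt : ∀ t a, 0 < t → ∫⁻ w, ENNReal.ofReal (1 / (t + ‖w - a‖) ^ 4) ∂dA ≤ ENNReal.ofReal (I / t ^ 2))
    {ι : Type*} [Fintype ι] {z : ι → ℂ} (hz : ∀ j, z j ∈ unitDisc)
    (hS : ∀ a ∈ unitDisc, ∑ j, radialize τ (z j) ^ 2 * radialize τ a ^ 2 / (radialize τ (z j) + ‖z j - a‖) ^ 4 ≤ Q)
    {F : ι → ℂ → ℂ}
    (hF : ∀ j, ∀ w ∈ unitDisc, ‖F j w‖ * √(ω w) ≤ C * (min (radialize τ (z j)) (radialize τ w) / (radialize τ (z j) + ‖w - z j‖)) ^ 5)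
    (c : ι → ℂ) :
    ∫⁻ w, ENNReal.ofReal (‖∑ j, c j * (F j w / (radialize τ (z j) : ℂ))‖ ^ 2) ∂(muW ω) ≤
      ENNReal.ofReal (C ^ 2 * Q * I * ∑ j, ‖c j‖ ^ 2) := by
  have ht : ∀ j, 0 < radialize τ (z j) := fun j => hL.pos _ (hz j)
  have hpt : ∀ w ∈ unitDisc, ω w * ‖∑ j, c j * (F j w / (radialize τ (z j) : ℂ))‖ ^ 2 ≤
      ∑ j, C ^ 2 * Q * ‖c j‖ ^ 2 * radialize τ (z j) ^ 2 * (1 / (radialize τ (z j) + ‖w - z j‖) ^ 4) := by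
    intro w hw
    have htw := hL.pos w hw
    have h1 : ‖∑ j, c j * (F j w / (radialize τ (z j) : ℂ))‖ * √(ω w) ≤
        ∑ j, C * (‖c j‖ * (radialize τ (z j) ^ 2 * radialize τ w / (radialize τ (z j) + ‖w - z j‖) ^ 4)) := by
      refine (mul_le_mul_of_nonneg_right (norm_sum_le _ _) (Real.sqrt_nonneg _)).trans ?_
      rw [Finset.sum_mul]
      refine Finset.sum_le_sum fun j _ => ?_
      have h2 := pw1 (ht j) htw (norm_nonneg (w - z j))
      rw [norm_mul, norm_div, Complex.norm_real, Real.norm_of_nonneg (ht j).le]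
      calc _ = ‖c j‖ * ((‖F j w‖ * √(ω w)) / radialize τ (z j)) := by ring
        _ ≤ ‖c j‖ * ((C * (min (radialize τ (z j)) (radialize τ w) / (radialize τ (z j) + ‖w - z j‖)) ^ 5) / radialize τ (z j)) :=
            mul_le_mul_of_nonneg_left (div_le_div_of_nonneg_right (hF j w hw) (ht j).le) (norm_nonneg _)
        _ = C * (‖c j‖ * ((min (radialize τ (z j)) (radialize τ w) / (radialize τ (z j) + ‖w - z j‖)) ^ 5 / radialize τ (z j))) := by ring
        _ ≤ _ := by gcongr
    have h3 := pow_le_pow_left₀ (by positivity) h1 2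
    rw [mul_pow, Real.sq_sqrt (hW.pos w hw).le, ← Finset.mul_sum, mul_pow] at h3
    have h4 := Finset.sum_sq_le_sum_mul_sum_of_sq_le_mul Finset.univ
      (r := fun j => ‖c j‖ * (radialize τ (z j) ^ 2 * radialize τ w / (radialize τ (z j) + ‖w - z j‖) ^ 4))
      (f := fun j => radialize τ (z j) ^ 2 * radialize τ w ^ 2 / (radialize τ (z j) + ‖z j - w‖) ^ 4)
      (g := fun j => ‖c j‖ ^ 2 * radialize τ (z j) ^ 2 * (1 / (radialize τ (z j) + ‖w - z j‖) ^ 4))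
      (fun j _ => by have := ht j; positivity) (fun j _ => by have := ht j; positivity)
      (fun j _ => by rw [norm_sub_rev (z j) w]; apply le_of_eq; ring)
    have h5 : 0 ≤ ∑ j, ‖c j‖ ^ 2 * radialize τ (z j) ^ 2 * (1 / (radialize τ (z j) + ‖w - z j‖) ^ 4) :=
      Finset.sum_nonneg fun j _ => by have := ht j; positivity
    calc _ = ‖∑ j, c j * (F j w / (radialize τ (z j) : ℂ))‖ ^ 2 * ω w := mul_comm _ _
      _ ≤ _ := h3
      _ ≤ C ^ 2 * (Q * ∑ j, ‖c j‖ ^ 2 * radialize τ (z j) ^ 2 * (1 / (radialize τ (z j) + ‖w - z j‖) ^ 4)) :=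
          mul_le_mul_of_nonneg_left (h4.trans (mul_le_mul_of_nonneg_right (hS w hw) h5)) (by positivity)
      _ = _ := by rw [Finset.mul_sum, Finset.mul_sum]; exact Finset.sum_congr rfl fun j _ => by ring
  have hm : ∀ j, Measurable fun w : ℂ => ENNReal.ofReal (1 / (radialize τ (z j) + ‖w - z j‖) ^ 4) := by
    intro j; fun_prop
  rw [← muW_restrict_disc, lintegral_muW hW le_rfl isOpen_unitDisc.measurableSet]
  calc _ ≤ ∫⁻ w in unitDisc, ∑ j, ENNReal.ofReal (C ^ 2 * Q * ‖c j‖ ^ 2 * radialize τ (z j) ^ 2) * ENNReal.ofReal (1 / (radialize τ (z j) + ‖w - z j‖) ^ 4) ∂dA := by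
        refine setLIntegral_mono' isOpen_unitDisc.measurableSet fun w hw => ?_
        rw [← ENNReal.ofReal_mul (hW.pos w hw).le]
        refine (ENNReal.ofReal_le_ofReal (hpt w hw)).trans (le_of_eq ?_)
        rw [ENNReal.ofReal_sum_of_nonneg (fun j _ => by have := ht j; positivity)]
        refine Finset.sum_congr rfl fun j _ => ?_
        rw [ENNReal.ofReal_mul (by positivity)]
    _ ≤ ∫⁻ w, ∑ j, ENNReal.ofReal (C ^ 2 * Q * ‖c j‖ ^ 2 * radialize τ (z j) ^ 2) * ENNReal.ofReal (1 / (radialize τ (z j) + ‖w - z j‖) ^ 4) ∂dA :=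
        setLIntegral_le_lintegral _ _
    _ = ∑ j, ENNReal.ofReal (C ^ 2 * Q * ‖c j‖ ^ 2 * radialize τ (z j) ^ 2) * ∫⁻ w, ENNReal.ofReal (1 / (radialize τ (z j) + ‖w - z j‖) ^ 4) ∂dA := by
        rw [lintegral_finsetSum _ (fun j _ => (hm j).const_mul _)]
        refine Finset.sum_congr rfl fun j _ => lintegral_const_mul _ (hm j)
    _ ≤ ∑ j, ENNReal.ofReal (C ^ 2 * Q * I * ‖c j‖ ^ 2) := by
        refine Finset.sum_le_sum fun j _ => (mul_le_mul_right (hInt _ (z j) (ht j)) _).trans (le_of_eq ?_)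
        rw [← ENNReal.ofReal_mul (by positivity)]
        congr 1
        have := ht j
        field_simp
    _ = _ := by rw [← ENNReal.ofReal_sum_of_nonneg (fun j _ => by positivity), Finset.mul_sum]

end
end

noncomputable section
section
variable {ω φ : ℂ → ℝ} {τ : ℝ → ℝ} {c₁ c₂ δ : ℝ} {τC : ℂ → ℝ}

theorem div_aux {x s y A t : ℝ} (ht : 0 < t) (htA : t ≤ A) (hy : 0 ≤ y) (h : x * A ^ 2 ≤ 2 * y + s * A ^ 2) :
    t ^ 2 * x ≤ 2 * y + t ^ 2 * s := by
  have hA : 0 < A := lt_of_lt_of_le ht htA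
  have h1 : t ^ 2 ≤ A ^ 2 := pow_le_pow_left₀ ht.le htA 2
  rcases le_or_gt x s with h2 | h2
  · have := mul_le_mul_of_nonneg_left h2 (sq_nonneg t); linarith
  · have := mul_le_mul_of_nonneg_right h1 (sub_pos.2 h2).le
    linarith [show t ^ 2 * (x - s) = t ^ 2 * x - t ^ 2 * s by ring, show A ^ 2 * (x - s) = x * A ^ 2 - s * A ^ 2 by ring]

set_option maxHeartbeats 1000000 in
theorem comb_lower (hW : IsClassW ω φ τ) (hL : IsClassL (radialize τ) c₁ c₂) (hδ0 : 0 < δ) (hδ : δ ≤ mTau c₁ c₂)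
    {g : ℂ → ℂ} (hg : MemLp g 2 (muW ω)) {C Q c M t X : ℝ} (hC : 0 < C) (hc : 0 < c) (hM : 0 < M)
    (hMQ : 52 * C * Q ≤ c * M) (ht : 0 < t) (hX : 0 ≤ X)
    {ι : Type*} [Fintype ι] {z : ι → ℂ} (hz : ∀ j, z j ∈ unitDisc)
    (hS1 : ∀ a ∈ unitDisc, ∑ j, radialize τ (z j) ^ 2 * radialize τ a ^ 2 / (radialize τ (z j) + ‖z j - a‖) ^ 4 ≤ Q)
    (hS2 : ∀ a ∈ unitDisc, ∑ j, radialize τ (z j) ^ 2 * radialize τ a ^ 2 / (radialize τ a + ‖z j - a‖) ^ 4 ≤ Q)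
    {F : ι → ℂ → ℂ} (hFd : ∀ j, Differentiable ℂ (F j))
    (hF : ∀ j, ∀ w ∈ unitDisc, ‖F j w‖ * √(ω w) ≤ C * (min (radialize τ (z j)) (radialize τ w) / (radialize τ (z j) + ‖w - z j‖)) ^ 5)
    (hFl : ∀ j, ∀ w ∈ unitDisc, ‖w - z j‖ ≤ δ * radialize τ (z j) → c ≤ ‖F j w‖ * √(ω w))
    (hsep : ∀ j k, j ≠ k → M * min (radialize τ (z j)) (radialize τ (z k)) ≤ ‖z j - z k‖)
    {A : ι → ℝ} (hA : ∀ j, t ≤ A j) (hAF : ∀ j, FdeltaSqE (radialize τ) δ g (z j) = ENNReal.ofReal (A j ^ 2))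
    (α : ι → ℂ) {v : ℂ → ℂ} (hv : DifferentiableOn ℂ v unitDisc)
    (hXb : ∑ k, ∫⁻ w in Metric.ball (z k) (δ * radialize τ (z k)),
      ENNReal.ofReal (‖g w * (∑ j, α j * (F j w / (radialize τ (z j) : ℂ))) - v w‖ ^ 2) ∂(muW ω) ≤ ENNReal.ofReal X) :
    3 / 4 * c ^ 2 * δ ^ 2 * t ^ 2 * ∑ j, ‖α j‖ ^ 2 ≤ 2 * X := by
  classical
  obtain ⟨m0, m1, m2, m3⟩ := mTau_bds hL
  have hc2 := hL.c₂_pos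
  have htp : ∀ j, 0 < radialize τ (z j) := fun j => hL.pos _ (hz j)
  set ε : ι → ι → ℝ := fun k j => 13 * C / M * (radialize τ (z k) ^ 2 * radialize τ (z j) ^ 2 / (radialize τ (z j) + ‖z j - z k‖) ^ 4) with hε
  have hε0 : ∀ k j, 0 ≤ ε k j := fun k j => by have := htp j; have := htp k; simp only [hε]; positivity
  have hBb : 13 * C / M * Q ≤ c / 4 := by
    rw [div_mul_eq_mul_div, div_le_div_iff₀ hM (by norm_num)]; linarith
  have h13 : 0 ≤ 13 * C / M := by positivity
  have hrow : ∀ k, ∑ j, ε k j ≤ c / 4 := by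
    intro k
    refine le_trans (le_trans (le_of_eq ?_) (mul_le_mul_of_nonneg_left (hS1 (z k) (hz k)) h13)) hBb
    rw [Finset.mul_sum]; exact Finset.sum_congr rfl fun j _ => by simp only [hε]; ring
  have hcol : ∀ j, ∑ k, ε k j ≤ c / 4 := by
    intro j
    refine le_trans (le_trans (le_of_eq ?_) (mul_le_mul_of_nonneg_left (hS2 (z j) (hz j)) h13)) hBb
    rw [Finset.mul_sum]; exact Finset.sum_congr rfl fun k _ => by simp only [hε]; rw [norm_sub_rev]
  have hsch := schur ε (fun j => ‖α j‖) hε0 hrow hcol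
  set S : ι → ℝ := fun k => ∑ j, ε k j * ‖α j‖ with hS
  set Y : ι → ℝ≥0∞ := fun k => ∫⁻ w in Metric.ball (z k) (δ * radialize τ (z k)),
      ENNReal.ofReal (‖g w * (∑ j, α j * (F j w / (radialize τ (z j) : ℂ))) - v w‖ ^ 2) ∂(muW ω) with hY
  have hYfin : ∀ k, Y k ≠ ⊤ := fun k => ne_top_of_le_ne_top ENNReal.ofReal_ne_top
    ((Finset.single_le_sum (f := Y) (fun _ _ => zero_le) (Finset.mem_univ k)).trans hXb)
  have hYs : ∑ k, (Y k).toReal ≤ X := by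
    rw [← ENNReal.toReal_sum (fun k _ => hYfin k)]
    exact ENNReal.toReal_le_of_le_ofReal hX hXb
  have hk : ∀ k, t ^ 2 * (‖α k‖ ^ 2 * c ^ 2 * δ ^ 2) ≤ 2 * (Y k).toReal + t ^ 2 * (4 * S k ^ 2 * δ ^ 2) := by
    intro k
    have hAk : 0 < A k := lt_of_lt_of_le ht (hA k)
    have hde := disc_est hW hL hδ0 hδ hg (hz k) (e := fun w => F k w / (radialize τ (z k) : ℂ))
      (r := fun w => ∑ j ∈ Finset.univ.erase k, α j * (F j w / (radialize τ (z j) : ℂ))) (v := v) (α := α k) (c := c) (S := S k) hc hAk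
      ((hFd k).differentiableOn.div_const _)
      (DifferentiableOn.fun_sum fun j _ => ((hFd j).differentiableOn.div_const _).const_mul _) hv ?_ ?_ (hAF k)
    · have e1 : ∀ w, α k * (F k w / (radialize τ (z k) : ℂ)) + ∑ j ∈ Finset.univ.erase k, α j * (F j w / (radialize τ (z j) : ℂ))
          = ∑ j, α j * (F j w / (radialize τ (z j) : ℂ)) := fun w =>
        Finset.add_sum_erase Finset.univ (fun j => α j * (F j w / (radialize τ (z j) : ℂ))) (Finset.mem_univ k)
      simp only [e1] at hde
      have h2 : ENNReal.ofReal (‖α k‖ ^ 2 * c ^ 2 * δ ^ 2 * A k ^ 2) ≤ ENNReal.ofReal (2 * (Y k).toReal + 4 * S k ^ 2 * δ ^ 2 * A k ^ 2) := by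
        refine hde.trans (le_of_eq ?_)
        rw [ENNReal.ofReal_add (by positivity) (by positivity), ENNReal.ofReal_mul (p := 2) (by norm_num), ENNReal.ofReal_toReal (hYfin k)]
        simp only [hY, ENNReal.ofReal_ofNat]
      rw [ENNReal.ofReal_le_ofReal_iff (by positivity)] at h2
      exact div_aux ht (hA k) ENNReal.toReal_nonneg h2
    · intro w hw
      have hwd : w ∈ unitDisc := closedBall_sub hL hδ0 hδ (hz k) (Metric.ball_subset_closedBall hw)
      have hw' := hw
      rw [Metric.mem_ball, dist_eq_norm] at hw'
      beta_reduce
      rw [norm_div, Complex.norm_real, Real.norm_of_nonneg (htp k).le, div_mul_eq_mul_div]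
      exact div_le_div_of_nonneg_right (hFl k w hwd hw'.le) (htp k).le
    · intro w hw
      have hwd : w ∈ unitDisc := closedBall_sub hL hδ0 hδ (hz k) (Metric.ball_subset_closedBall hw)
      have hw' := hw
      rw [Metric.mem_ball, dist_eq_norm] at hw'
      beta_reduce
      refine (mul_le_mul_of_nonneg_right (norm_sum_le _ _) (Real.sqrt_nonneg _)).trans ?_
      have e2 : S k / radialize τ (z k) = ∑ j, ε k j * ‖α j‖ / radialize τ (z k) := Finset.sum_div _ _ _
      rw [Finset.sum_mul, e2]
      refine le_trans (Finset.sum_le_sum fun j hj => ?_) (Finset.sum_le_sum_of_subset_of_nonneg (Finset.subset_univ (Finset.univ.erase k))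
        (fun j _ _ => div_nonneg (mul_nonneg (hε0 k j) (norm_nonneg _)) (htp k).le))
      have hjk : j ≠ k := (Finset.mem_erase.1 hj).1
      have htk := htp k
      have htj := htp j
      have htw := hL.pos w hwd
      have hcmp := (abs_le.1 (tau_cmp hL hδ0.le hδ (hz k) hwd (s := 1) (by norm_num) (by linarith))).2
      have hs : 3 / 4 * (radialize τ (z j) + ‖z j - z k‖) ≤ radialize τ (z j) + ‖w - z j‖ := by
        have h3 : ‖z j - z k‖ ≤ ‖w - z j‖ + ‖w - z k‖ := by
          calc ‖z j - z k‖ = ‖(w - z k) - (w - z j)‖ := by congr 1; ring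
            _ ≤ ‖w - z k‖ + ‖w - z j‖ := norm_sub_le _ _
            _ = _ := add_comm _ _
        have h4 := (abs_le.1 (hL.lip _ (hz j) _ (hz k))).1
        have h5 : δ * radialize τ (z k) ≤ 1 / 4 * radialize τ (z j) + 1 / 4 * ‖z j - z k‖ := by
          have h6 : δ * radialize τ (z k) ≤ δ * (radialize τ (z j) + c₂ * ‖z j - z k‖) :=
            mul_le_mul_of_nonneg_left (by linarith) hδ0.le
          have h7 : δ * radialize τ (z j) ≤ 1 / 4 * radialize τ (z j) := mul_le_mul_of_nonneg_right (by linarith) htj.le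
          have h8 : c₂ * δ ≤ 1 / 4 := (mul_le_mul_of_nonneg_left hδ hc2.le).trans m3
          have h9 := mul_le_mul_of_nonneg_right h8 (norm_nonneg (z j - z k))
          linarith [show δ * (radialize τ (z j) + c₂ * ‖z j - z k‖) = δ * radialize τ (z j) + c₂ * δ * ‖z j - z k‖ by ring]
        linarith
      have hp2 := pw2 htj htw htk (norm_nonneg (z j - z k)) hM (by linarith) hs (hsep j k hjk)
      rw [norm_mul, norm_div, Complex.norm_real, Real.norm_of_nonneg htj.le]
      calc _ = ‖α j‖ * ((‖F j w‖ * √(ω w)) / radialize τ (z j)) := by ring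
        _ ≤ ‖α j‖ * ((C * (min (radialize τ (z j)) (radialize τ w) / (radialize τ (z j) + ‖w - z j‖)) ^ 5) / radialize τ (z j)) :=
            mul_le_mul_of_nonneg_left (div_le_div_of_nonneg_right (hF j w hwd) htj.le) (norm_nonneg _)
        _ = C * (‖α j‖ * ((min (radialize τ (z j)) (radialize τ w) / (radialize τ (z j) + ‖w - z j‖)) ^ 5 / radialize τ (z j))) := by ring
        _ ≤ C * (‖α j‖ * (13 / M * (radialize τ (z k) * radialize τ (z j) ^ 2 / (radialize τ (z j) + ‖z j - z k‖) ^ 4))) := by gcongr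
        _ = _ := by simp only [hε]; field_simp
  have hsum := Finset.sum_le_sum (fun k (_ : k ∈ Finset.univ) => hk k)
  rw [Finset.sum_add_distrib, ← Finset.mul_sum, ← Finset.mul_sum, ← Finset.mul_sum] at hsum
  have e3 : ∑ k, ‖α k‖ ^ 2 * c ^ 2 * δ ^ 2 = c ^ 2 * δ ^ 2 * ∑ k, ‖α k‖ ^ 2 := by
    rw [Finset.mul_sum]; exact Finset.sum_congr rfl fun k _ => by ring
  have e4 : ∑ k, 4 * S k ^ 2 * δ ^ 2 = 4 * δ ^ 2 * ∑ k, S k ^ 2 := by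
    rw [Finset.mul_sum]; exact Finset.sum_congr rfl fun k _ => by ring
  rw [e3, e4] at hsum
  have h9 := mul_le_mul_of_nonneg_left hsch (by positivity : 0 ≤ 4 * δ ^ 2 * t ^ 2)
  linarith [show t ^ 2 * (4 * δ ^ 2 * ∑ k, S k ^ 2) = 4 * δ ^ 2 * t ^ 2 * ∑ k, S k ^ 2 by ring,
    show 4 * δ ^ 2 * t ^ 2 * ((c / 4) ^ 2 * ∑ j, ‖α j‖ ^ 2) = 1 / 4 * (t ^ 2 * (c ^ 2 * δ ^ 2 * ∑ j, ‖α j‖ ^ 2)) by ring,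
    show 3 / 4 * c ^ 2 * δ ^ 2 * t ^ 2 * ∑ j, ‖α j‖ ^ 2 = 3 / 4 * (t ^ 2 * (c ^ 2 * δ ^ 2 * ∑ j, ‖α j‖ ^ 2)) by ring]

end
end

noncomputable section
section
variable {ω φ : ℂ → ℝ} {τ : ℝ → ℝ} {c₁ c₂ δ : ℝ} {τC : ℂ → ℝ}

theorem entire_bdd {F : ℂ → ℂ} (hF : Differentiable ℂ F) : ∃ M : ℝ, ∀ z ∈ unitDisc, ‖F z‖ ≤ M := by
  obtain ⟨M, hM⟩ := (isCompact_closedBall (0:ℂ) 1).exists_bound_of_continuousOn hF.continuous.continuousOn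
  exact ⟨M, fun z hz => hM z (Metric.ball_subset_closedBall hz)⟩

theorem hank_rep (hW : IsClassW ω φ τ) {g : ℂ → ℂ} (hg : MemLp g 2 (muW ω))
    {T : bergmanH ω →L[ℂ] Lp ℂ 2 (muW ω)} (hT : IsHankelExtension ω g T) {H : ℂ → ℂ} (hH : Differentiable ℂ H)
    {f : bergmanH ω} (hf : ((f : Lp ℂ 2 (muW ω)) : ℂ → ℂ) =ᵐ[muW ω] H) :
    ∃ v : ℂ → ℂ, DifferentiableOn ℂ v unitDisc ∧ ((T f : Lp ℂ 2 (muW ω)) : ℂ → ℂ) =ᵐ[muW ω] fun z => g z * H z - v z := by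
  obtain ⟨M, hM⟩ := entire_bdd hH
  have hgF := gF_memLp hW hg hH.differentiableOn hM
  have e := hT f H M hH.differentiableOn hM hf _ hgF.coeFn_toLp
  refine ⟨hrep hW (bergmanProjA ω (hgF.toLp _)), hrep_diff hW _, ?_⟩
  rw [e]
  filter_upwards [Lp.coeFn_sub (hgF.toLp _) (bergmanProj ω (hgF.toLp _)), hgF.coeFn_toLp, hrep_ae hW (bergmanProjA ω (hgF.toLp _))] with w h1 h2 h3
  rw [h1, Pi.sub_apply, h2]
  congr 1

theorem comb_ae {ι : Type*} {e : ι → bergmanH ω} {f : ι → ℂ → ℂ}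
    (he : ∀ j, ((e j : Lp ℂ 2 (muW ω)) : ℂ → ℂ) =ᵐ[muW ω] f j) (c : ι → ℂ) (s : Finset ι) :
    (((∑ j ∈ s, c j • e j : bergmanH ω) : Lp ℂ 2 (muW ω)) : ℂ → ℂ) =ᵐ[muW ω] fun w => ∑ j ∈ s, c j * f j w := by
  classical
  induction s using Finset.induction_on with
  | empty =>
    simp only [Finset.sum_empty, ZeroMemClass.coe_zero]
    exact Lp.coeFn_zero ℂ 2 (muW ω)
  | insert a s has ih =>
    rw [Finset.sum_insert has]
    filter_upwards [ih, he a, Lp.coeFn_add ((c a • e a : bergmanH ω) : Lp ℂ 2 (muW ω)) ((∑ j ∈ s, c j • e j : bergmanH ω) : Lp ℂ 2 (muW ω)),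
      Lp.coeFn_smul (c a) (e a : Lp ℂ 2 (muW ω))] with w h1 h2 h3 h4
    rw [Submodule.coe_add, h3, Pi.add_apply, h1, Submodule.coe_smul, h4, Pi.smul_apply, h2, Finset.sum_insert has, smul_eq_mul]

set_option maxHeartbeats 1000000 in
theorem sn_lower (hW : IsClassW ω φ τ) (hL : IsClassL (radialize τ) c₁ c₂) (hδ0 : 0 < δ) (hδ : δ ≤ mTau c₁ c₂)
    {g : ℂ → ℂ} (hg : MemLp g 2 (muW ω)) {T : bergmanH ω →L[ℂ] Lp ℂ 2 (muW ω)} (hT : IsHankelExtension ω g T)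
    {z : ℕ → ℂ} (hz : IsLattice (radialize τ) δ z) {C c : ℝ} (hC : 0 < C) (hc : 0 < c) :
    ∃ M K : ℝ, 0 < M ∧ 0 < K ∧ ∀ J : Finset ℕ, ∀ F : ℕ → ℂ → ℂ, (∀ j ∈ J, Differentiable ℂ (F j)) →
    (∀ j ∈ J, ∀ w ∈ unitDisc, ‖F j w‖ * √(ω w) ≤ C * (min (radialize τ (z j)) (radialize τ w) / (radialize τ (z j) + ‖w - z j‖)) ^ 5) →
    (∀ j ∈ J, ∀ w ∈ unitDisc, ‖w - z j‖ ≤ δ * radialize τ (z j) → c ≤ ‖F j w‖ * √(ω w)) →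
    (∀ j ∈ J, ∀ k ∈ J, j ≠ k → M * min (radialize τ (z j)) (radialize τ (z k)) ≤ ‖z j - z k‖) →
    ∀ A : ℕ → ℝ, (∀ j, FdeltaSqE (radialize τ) δ g (z j) = ENNReal.ofReal (A j ^ 2)) →
    ∀ t, 0 ≤ t → (∀ j ∈ J, t ≤ A j) → ∀ n, n < J.card → t ≤ K * singularNumber T n := by
  obtain ⟨Q, hQ, hQs⟩ := fin_sums hL hδ0 hδ hz
  obtain ⟨I, hI, hInt⟩ := decay_int
  obtain ⟨N, hN⟩ := overlap_int hW hL hδ0 hδ hz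
  set b0 : ℝ := √(3 * c ^ 2 * δ ^ 2 / (8 * (N + 1))) with hb0
  set C0 : ℝ := √(C ^ 2 * Q * I) with hC0
  have hb0p : 0 < b0 := Real.sqrt_pos.2 (by positivity)
  have hC0p : 0 < C0 := Real.sqrt_pos.2 (by positivity)
  have hb0s : b0 ^ 2 = 3 * c ^ 2 * δ ^ 2 / (8 * (N + 1)) := Real.sq_sqrt (by positivity)
  have hC0s : C0 ^ 2 = C ^ 2 * Q * I := Real.sq_sqrt (by positivity)
  refine ⟨52 * C * Q / c, C0 / b0, by positivity, by positivity, ?_⟩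
  intro J F hFd hFu hFl hsep A hAF t ht htA n hn
  rcases ht.eq_or_lt with rfl | ht
  · exact mul_nonneg (by positivity) (sn_nonneg T n)
  classical
  set f : J → ℂ → ℂ := fun j w => F j w / (radialize τ (z j) : ℂ) with hf
  have hfd : ∀ j, Differentiable ℂ (f j) := fun j => (hFd j j.2).div_const _
  have hex : ∀ j : J, ∃ e : bergmanH ω, ((e : Lp ℂ 2 (muW ω)) : ℂ → ℂ) =ᵐ[muW ω] f j := by
    intro j
    obtain ⟨M, hM⟩ := entire_bdd (hfd j)
    exact berg_mk (hfd j).differentiableOn (bdd_memLp hW (hfd j).continuous.continuousOn hM)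
  choose e he using hex
  set L : EuclideanSpace ℂ J →ₗ[ℂ] bergmanH ω := Fintype.linearCombination ℂ e ∘ₗ (WithLp.linearEquiv 2 ℂ (J → ℂ)).toLinearMap with hLdef
  have hLa : ∀ x : EuclideanSpace ℂ J, L x = ∑ j, x j • e j := fun x => rfl
  have hnx : ∀ x : EuclideanSpace ℂ J, ‖x‖ ^ 2 = ∑ j, ‖x j‖ ^ 2 := fun x => EuclideanSpace.norm_sq_eq x
  have h1 : ∀ x, ‖L x‖ ≤ C0 * ‖x‖ := by
    intro x
    have h2 := comb_upper hW hL hC hQ hI hInt (z := fun j : J => z j) (fun j => hz.mem j) (fun a ha => (hQs J a ha).1)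
      (F := fun j => F j) (fun j => hFu j j.2) (fun j => x j)
    have h3 := comb_ae he (fun j => x j) Finset.univ
    have h4 := norm_sq_Lp' _ h3
    rw [← hLa] at h4
    rw [← hnx, ← hC0s, ← mul_pow] at h2
    have h5 := h4.le.trans h2
    rw [ENNReal.ofReal_le_ofReal_iff (by positivity)] at h5
    exact (abs_le_of_sq_le_sq' h5 (by positivity)).2
  have h2 : ∀ x, t * b0 * ‖x‖ ≤ ‖T (L x)‖ := by
    intro x
    have h3 := comb_ae he (fun j => x j) Finset.univ
    rw [← hLa] at h3
    have hHd : Differentiable ℂ (fun w => ∑ j, x j * f j w) := Differentiable.fun_sum fun j _ => (hfd j).const_mul _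
    obtain ⟨v, hv, hTv⟩ := hank_rep hW hg hT hHd h3
    have h4 := norm_sq_Lp' _ hTv
    have hme : AEMeasurable (fun w => ENNReal.ofReal (‖g w * (∑ j, x j * f j w) - v w‖ ^ 2)) (muW ω) := by
      refine ((AEStronglyMeasurable.norm ?_).aemeasurable.pow_const 2).ennreal_ofReal
      exact (hg.1.mul hHd.continuous.aestronglyMeasurable).sub (aesm_contOn hW hv.continuousOn)
    have h5 := hN _ hme
    rw [← h4] at h5
    have h6 : ∑ k : J, ∫⁻ w in Metric.ball (z k) (δ * radialize τ (z k)),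
      ENNReal.ofReal (‖g w * (∑ j : J, x j * (F j w / (radialize τ (z j) : ℂ))) - v w‖ ^ 2) ∂(muW ω) ≤ ENNReal.ofReal ((N + 1) * ‖T (L x)‖ ^ 2) := by
      rw [Finset.sum_coe_sort J (fun k => ∫⁻ w in Metric.ball (z k) (δ * radialize τ (z k)),
        ENNReal.ofReal (‖g w * (∑ j : J, x j * (F j w / (radialize τ (z j) : ℂ))) - v w‖ ^ 2) ∂(muW ω))]
      calc _ ≤ ∑ k ∈ J, ∫⁻ w in Metric.ball (z k) (3 * (δ * radialize τ (z k))), ENNReal.ofReal (‖g w * (∑ j, x j * f j w) - v w‖ ^ 2) ∂(muW ω) := by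
            refine Finset.sum_le_sum fun k _ => lintegral_mono_set (Metric.ball_subset_ball ?_)
            have := mul_pos hδ0 (hL.pos _ (hz.mem k)); linarith
        _ ≤ _ := ENNReal.sum_le_tsum J
        _ ≤ _ := h5
        _ ≤ ENNReal.ofReal (N + 1) * ENNReal.ofReal (‖T (L x)‖ ^ 2) := by
            gcongr
            rw [← ENNReal.ofReal_natCast]; exact ENNReal.ofReal_le_ofReal (by linarith)
        _ = _ := (ENNReal.ofReal_mul (by positivity)).symm
    have h7 := comb_lower hW hL hδ0 hδ hg (M := 52 * C * Q / c) (t := t) (Q := Q) (X := (N + 1) * ‖T (L x)‖ ^ 2) hC hc (by positivity)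
      (by rw [mul_div_cancel₀ _ hc.ne']) ht (by positivity) (z := fun j : J => z j) (fun j => hz.mem j)
      (fun a ha => (hQs J a ha).1) (fun a ha => (hQs J a ha).2) (F := fun j : J => F j) (fun j => hFd j j.2) (fun j => hFu j j.2)
      (fun j => hFl j j.2) (fun j k hjk => hsep j j.2 k k.2 (fun h => hjk (Subtype.ext h))) (A := fun j : J => A j) (fun j => htA j j.2)
      (fun j => hAF j) (fun j => x j) hv h6
    rw [← hnx] at h7
    refine (abs_le_of_sq_le_sq' ?_ (norm_nonneg _)).2
    rw [mul_pow, mul_pow, hb0s, mul_div_assoc', div_mul_eq_mul_div, div_le_iff₀ (by positivity)]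
    linarith
  have h3 := sn_ge T (by rwa [Fintype.card_coe]) L (by positivity) hC0p h1 h2
  rw [div_le_iff₀ hC0p] at h3
  rw [div_mul_eq_mul_div, le_div_iff₀ hb0p]
  linarith

end
end

noncomputable section
section
variable {ω φ : ℂ → ℝ} {τ : ℝ → ℝ} {c₁ c₂ δ : ℝ} {τC : ℂ → ℝ}

theorem fd_fin (hW : IsClassW ω φ τ) (hL : IsClassL (radialize τ) c₁ c₂) (hδ0 : 0 < δ) (hδ : δ ≤ mTau c₁ c₂)
    {g : ℂ → ℂ} (hg : MemLp g 2 (muW ω)) {a : ℂ} (ha : a ∈ unitDisc) : FdeltaSqE (radialize τ) δ g a ≠ ⊤ := by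
  have ht := hL.pos a ha
  have hR : 0 < δ * radialize τ a := mul_pos hδ0 ht
  have hcb := closedBall_sub hL hδ0 hδ ha
  have hDd : Metric.ball a (δ * radialize τ a) ⊆ unitDisc := Metric.ball_subset_closedBall.trans hcb
  obtain ⟨x, hx, hmin⟩ := (isCompact_closedBall a (δ * radialize τ a)).exists_isMinOn ⟨a, Metric.mem_closedBall_self hR.le⟩
    ((omega_contOn hW).mono hcb)
  have hm := hW.pos x (hcb hx)
  have h1 : FdeltaSqE (radialize τ) δ g a ≤ localMeanE (radialize τ) δ (fun w => g w - 0) a :=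
    iInf₂_le (f := fun (h : ℂ → ℂ) (_ : DifferentiableOn ℂ h (Metric.ball a (δ * radialize τ a))) =>
      localMeanE (radialize τ) δ (fun w => g w - h w) a) (fun _ => (0:ℂ)) (differentiableOn_const 0)
  refine ne_top_of_le_ne_top ?_ h1
  unfold localMeanE
  refine ENNReal.mul_ne_top ?_ ?_
  · rw [Ne, ENNReal.inv_eq_top, ENNReal.ofReal_eq_zero, not_le]; positivity
  simp only [sub_zero]
  have h2 : ENNReal.ofReal (ω x) * ∫⁻ w in Metric.ball a (δ * radialize τ a), ENNReal.ofReal (‖g w‖ ^ 2) ∂dA ≤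
      ∫⁻ w, ENNReal.ofReal (‖g w‖ ^ 2) ∂(muW ω) := by
    refine le_trans ?_ (setLIntegral_le_lintegral (Metric.ball a (δ * radialize τ a)) _)
    rw [lintegral_muW hW hDd measurableSet_ball, ← lintegral_const_mul' _ _ ENNReal.ofReal_ne_top]
    refine setLIntegral_mono' measurableSet_ball fun w hw => ?_
    gcongr
    exact hmin (Metric.ball_subset_closedBall hw)
  intro h3
  rw [h3, ENNReal.mul_top (by rw [Ne, ENNReal.ofReal_eq_zero, not_le]; exact hm)] at h2
  exact lint_of_memLp hg (top_le_iff.1 h2)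

theorem inner_fin (hW : IsClassW ω φ τ) (hL : IsClassL (radialize τ) c₁ c₂) (hδ0 : 0 < δ) (hδ : δ ≤ mTau c₁ c₂)
    {z : ℕ → ℂ} (hz : IsLattice (radialize τ) δ z) {r0 : ℝ} (hr0 : r0 < 1) : {j | ‖z j‖ < r0}.Finite := by
  obtain ⟨C, hC, hcnt⟩ := count_le
  have h0 : (0:ℂ) ∈ unitDisc := by simp [unitDisc]
  have ht0 := hL.pos 0 h0
  have hr1 : max r0 0 < 1 := max_lt hr0 (by norm_num)
  have htr : 0 < τ (max r0 0) := hW.tau_pos _ ⟨le_max_right _ _, hr1⟩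
  refine (finite_of_count (B := C * (1 + 1 / radialize τ 0) ^ 4 / ((τ (max r0 0) / radialize τ 0) ^ 2 * δ ^ 2)) fun J hJ => ?_).1
  refine hcnt _ c₁ c₂ δ hL hδ0 hδ z hz.mem (lat_sep hz) 0 h0 _ _ (by positivity) (by positivity) J fun j hj => ?_
  have h1 : ‖z j‖ < r0 := hJ hj
  rw [div_mul_cancel₀ _ ht0.ne', div_mul_cancel₀ _ ht0.ne', sub_zero]
  refine ⟨?_, by linarith⟩
  exact hW.tau_anti ⟨norm_nonneg _, by linarith⟩ ⟨le_max_right _ _, hr1⟩ (h1.le.trans (le_max_left _ _))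

theorem near_count (hL : IsClassL (radialize τ) c₁ c₂) (hδ0 : 0 < δ) (hδ : δ ≤ mTau c₁ c₂)
    {z : ℕ → ℂ} (hz : IsLattice (radialize τ) δ z) {M : ℝ} (hM : 0 < M) : ∃ B : ℝ, 0 < B ∧ ∀ j, ∀ J : Finset ℕ,
      (∀ k ∈ J, ‖z j - z k‖ < M * min (radialize τ (z j)) (radialize τ (z k))) → (J.card : ℝ) ≤ B := by
  obtain ⟨C, hC, hcnt⟩ := count_le
  have hc2 := hL.c₂_pos
  refine ⟨C * (1 + M) ^ 4 / ((1 / (1 + c₂ * M)) ^ 2 * δ ^ 2), by positivity, fun j J hJ => ?_⟩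
  refine hcnt _ c₁ c₂ δ hL hδ0 hδ z hz.mem (lat_sep hz) (z j) (hz.mem j) _ _ (by positivity) hM.le J fun k hk => ?_
  have h1 := (hJ k hk).le
  have h2 : ‖z j - z k‖ ≤ M * radialize τ (z j) := h1.trans (mul_le_mul_of_nonneg_left (min_le_left _ _) hM.le)
  have h3 : ‖z j - z k‖ ≤ M * radialize τ (z k) := h1.trans (mul_le_mul_of_nonneg_left (min_le_right _ _) hM.le)
  refine ⟨?_, by rw [norm_sub_rev]; exact h2⟩
  have h4 := (abs_le.1 (hL.lip _ (hz.mem j) _ (hz.mem k))).2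
  have h5 := mul_le_mul_of_nonneg_left h3 hc2.le
  rw [div_mul_eq_mul_div, one_mul, div_le_iff₀ (by positivity)]
  linarith

set_option maxHeartbeats 1000000 in
theorem one_two (hW : IsClassW ω φ τ) (hL : IsClassL (radialize τ) c₁ c₂) {g : ℂ → ℂ} (hg : MemLp g 2 (muW ω))
    {T : bergmanH ω →L[ℂ] Lp ℂ 2 (muW ω)} (hT : IsHankelExtension ω g T) {p : ℝ}
    (hp : p ∈ Set.Ioo (0:ℝ) 1) (h : MemSchatten p T) : SchattenCondTwo (radialize τ) c₁ c₂ g p := by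
  classical
  obtain ⟨C, c, δ0, r0, hC, hc, hδ00, hr0, hTF⟩ := TFn hW hL
  obtain ⟨m0, -, -, -⟩ := mTau_bds hL
  set δ := min δ0 (mTau c₁ c₂ / 2) with hδdef
  have hδ0 : 0 < δ := lt_min hδ00 (by linarith)
  have hδ1 : δ < mTau c₁ c₂ := lt_of_le_of_lt (min_le_right _ _) (by linarith)
  have hδδ0 : δ ≤ δ0 := min_le_left _ _
  refine ⟨δ, ⟨hδ0, hδ1⟩, fun z hz => ?_⟩
  have hp0 := hp.1
  obtain ⟨M, K, hM, hK, hsn⟩ := sn_lower hW hL hδ0 hδ1.le hg hT hz hC hc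
  obtain ⟨B, hB, hnear⟩ := near_count hL hδ0 hδ1.le hz hM
  have hS0 := inner_fin hW hL hδ0 hδ1.le hz hr0
  have hff : ∀ j, FdeltaSqE (radialize τ) δ g (z j) ≠ ⊤ := fun j => fd_fin hW hL hδ0 hδ1.le hg (hz.mem j)
  set A : ℕ → ℝ := fun j => √(FdeltaSqE (radialize τ) δ g (z j)).toReal with hA
  have hA0 : ∀ j, 0 ≤ A j := fun j => Real.sqrt_nonneg _
  have hAF : ∀ j, FdeltaSqE (radialize τ) δ g (z j) = ENNReal.ofReal (A j ^ 2) := by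
    intro j; simp only [hA]; rw [Real.sq_sqrt ENNReal.toReal_nonneg, ENNReal.ofReal_toReal (hff j)]
  have hAp : ∀ j, FdeltaSqE (radialize τ) δ g (z j) ^ (p / 2) = ENNReal.ofReal (A j ^ p) := by
    intro j; simp only [hA]
    rw [sqrt_rpow_aux ENNReal.toReal_nonneg, ENNReal.toReal_rpow, ENNReal.ofReal_toReal]
    exact ENNReal.rpow_ne_top_of_nonneg (by positivity) (hff j)
  -- test functions
  have hex : ∀ j, ∃ F : ℂ → ℂ, r0 ≤ ‖z j‖ → Differentiable ℂ F ∧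
      (∀ w ∈ unitDisc, ‖F w‖ * √(ω w) ≤ C * (min (radialize τ (z j)) (radialize τ w) / (radialize τ (z j) + ‖w - z j‖)) ^ 5) ∧
      (∀ w ∈ unitDisc, ‖w - z j‖ ≤ δ0 * radialize τ (z j) → c ≤ ‖F w‖ * √(ω w)) := by
    intro j
    by_cases hj : r0 ≤ ‖z j‖
    · obtain ⟨F, hF⟩ := hTF (z j) (hz.mem j) hj
      exact ⟨F, fun _ => hF⟩
    · exact ⟨0, fun h => absurd h hj⟩
  choose F hF using hex
  have houter : ∀ J : Finset ℕ, (∀ j ∈ J, r0 ≤ ‖z j‖) → ∑ j ∈ J, A j ^ p ≤ B * (K ^ p * schattenSum p T) := by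
    intro J hJ
    set near : ℕ → ℕ → Prop := fun j k => ‖z j - z k‖ < M * min (radialize τ (z j)) (radialize τ (z k)) with hnr
    obtain ⟨I, hIJ, hI, hle⟩ := greedy near (fun i j hij => by simp only [hnr] at hij ⊢; rwa [norm_sub_rev, min_comm])
      (fun i => by simp only [hnr, sub_self, norm_zero, min_self]; exact mul_pos hM (hL.pos _ (hz.mem i)))
      (fun j => A j ^ p) (fun j => Real.rpow_nonneg (hA0 j) p) (B := B) J
      (fun j _ => hnear j _ fun k hk => (Finset.mem_filter.1 hk).2)
    refine hle.trans (mul_le_mul_of_nonneg_left ?_ hB.le)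
    refine sum_le_schatten T hp0 hK hA0 h I fun J' hJ' t ht htA n hn => ?_
    have hin : ∀ j ∈ J', r0 ≤ ‖z j‖ := fun j hj => hJ j (hIJ (hJ' hj))
    refine hsn J' F (fun j hj => (hF j (hin j hj)).1) (fun j hj => (hF j (hin j hj)).2.1) ?_ ?_ A hAF t ht htA n hn
    · intro j hj w hw hwj
      exact (hF j (hin j hj)).2.2 w hw (hwj.trans (mul_le_mul_of_nonneg_right hδδ0 (hL.pos _ (hz.mem j)).le))
    · intro j hj k hk hjk
      exact not_lt.1 (hI j (hJ' hj) k (hJ' hk) hjk)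
  simp only [hAp]
  refine lt_of_le_of_lt (b := ENNReal.ofReal (∑ j ∈ hS0.toFinset, A j ^ p + B * (K ^ p * schattenSum p T))) ?_ ENNReal.ofReal_lt_top
  rw [ENNReal.tsum_eq_iSup_sum]
  refine iSup_le fun J => ?_
  rw [← ENNReal.ofReal_sum_of_nonneg (fun j _ => Real.rpow_nonneg (hA0 j) p)]
  apply ENNReal.ofReal_le_ofReal
  rw [← Finset.sum_filter_add_sum_filter_not J (fun j => ‖z j‖ < r0)]
  refine add_le_add ?_ (houter _ fun j hj => not_lt.1 (Finset.mem_filter.1 hj).2)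
  refine Finset.sum_le_sum_of_subset_of_nonneg (fun j hj => ?_) (fun j _ _ => Real.rpow_nonneg (hA0 j) p)
  rw [Set.Finite.mem_toFinset]
  exact (Finset.mem_filter.1 hj).2

end
end

theorem stmt0 (ω φ : ℂ → ℝ) (τ : ℝ → ℝ) (c₁ c₂ : ℝ)
    (hW : IsClassW ω φ τ) (hL : IsClassL (radialize τ) c₁ c₂)
    (g : ℂ → ℂ) (hg : MemLp g 2 (muW ω))
    (T : bergmanH ω →L[ℂ] Lp ℂ 2 (muW ω)) (hT : IsHankelExtension ω g T)
    (p : ℝ) (hp : p ∈ Set.Ioo (0 : ℝ) 1) :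
    (MemSchatten p T ↔ SchattenCondTwo (radialize τ) c₁ c₂ g p) ∧
    (SchattenCondTwo (radialize τ) c₁ c₂ g p ↔
      SchattenCondThree (radialize τ) φ c₁ c₂ g p) := by
  exact ⟨⟨fun h => one_two hW hL hg hT hp h, fun h => three_one hW hL hg hT hp (two_three hW hL hg hp h)⟩,
    ⟨fun h => two_three hW hL hg hp h, fun h => three_two hW hL hp h⟩⟩

end
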